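/- Let G be a finitely generated virtually solvable group and let μ be a courteous probability measure on G. If dim HF_k(G,μ) < ∞ for some k ≥ 1, then G is virtually nilpotent. -/

import Mathlib

open scoped ENNReal

/-- The word length of `x` with respect to a generating set `S`:
the least `n` such that `x` is a product of `n` elements of `S`. -/
noncomputable def wordLen {G : Type*} [Group G] (S : Set G) (x : G) : ℕ :=
  sInf {n : ℕ | ∃ l : List G, (∀ s ∈ l, s ∈ S) ∧ l.length = n ∧ l.prod = x}

/-- `f : G → ℂ` is `μ`-harmonic: `f x = ∑ₛ μ(s) f(x s⁻¹)`. -/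
def IsHarmonic {G : Type*} [Group G] (μ : G → ℝ) (f : G → ℂ) : Prop :=
  ∀ x : G, f x = ∑' s : G, (μ s : ℂ) * f (x * s⁻¹)

/-- The polynomial-`k`-seminorm `‖f‖ₖ = limsup_{r → ∞} r^{-k} · max_{|x| ≤ r} |f(x)|`,
valued in `ℝ≥0∞`. -/
noncomputable def polyNorm {G : Type*} [Group G] (S : Set G) (k : ℕ) (f : G → ℂ) : ℝ≥0∞ :=
  Filter.limsup
    (fun r : ℕ => ((r : ℝ≥0∞) ^ k)⁻¹ * ⨆ (x : G) (_ : wordLen S x ≤ r), (‖f x‖₊ : ℝ≥0∞))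
    Filter.atTop

/-- `HFk S μ k` : the set of `μ`-harmonic functions of polynomial growth of degree at most `k`. -/
noncomputable def HFk {G : Type*} [Group G] (S : Set G) (μ : G → ℝ) (k : ℕ) : Set (G → ℂ) :=
  {f | IsHarmonic μ f ∧ polyNorm S k f < ⊤}

universe u v

section WordLength

variable {G : Type*} [Group G]

/-- The hypotheses on a courteous probability measure on a group with a finite symmetric
generating set. -/
structure Courteous (S : Finset G) (μ : G → ℝ) : Prop where
  gen : Subgroup.closure (S : Set G) = ⊤
  inv_mem : ∀ s ∈ S, s⁻¹ ∈ S
  nonneg : ∀ x, 0 ≤ μ x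
  hasSum : HasSum μ 1
  symm : ∀ x, μ x⁻¹ = μ x
  adapted : Subgroup.closure {x : G | μ x ≠ 0} = ⊤
  smooth : ∃ ζ : ℝ, 0 < ζ ∧ Summable (fun x : G => μ x * Real.exp (ζ * (wordLen (S : Set G) x)))

theorem exists_list_prod_of_closure_eq_top {S : Finset G}
    (hgen : Subgroup.closure (S : Set G) = ⊤) (hinv : ∀ s ∈ S, s⁻¹ ∈ S) (x : G) :
    ∃ l : List G, (∀ s ∈ l, s ∈ S) ∧ l.prod = x := by
  have hx : x ∈ (Subgroup.closure (S : Set G)).toSubmonoid := by rw [hgen]; trivial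
  rw [Subgroup.closure_toSubmonoid] at hx
  obtain ⟨l, hl, rfl⟩ := Submonoid.exists_list_of_mem_closure hx
  refine ⟨l, fun s hs => ?_, rfl⟩
  rcases hl s hs with h | h
  · exact h
  · simpa using hinv _ h

theorem exists_list_wordLen {S : Finset G}
    (hgen : Subgroup.closure (S : Set G) = ⊤) (hinv : ∀ s ∈ S, s⁻¹ ∈ S) (x : G) :
    ∃ l : List G, (∀ s ∈ l, s ∈ S) ∧ l.length = wordLen (S : Set G) x ∧ l.prod = x := by
  have hne : {n : ℕ | ∃ l : List G, (∀ s ∈ l, s ∈ (S : Set G)) ∧ l.length = n ∧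
      l.prod = x}.Nonempty := by
    obtain ⟨l, hl, hx⟩ := exists_list_prod_of_closure_eq_top hgen hinv x
    exact ⟨l.length, l, hl, rfl, hx⟩
  exact Nat.sInf_mem hne

theorem wordLen_le_length {S : Set G} (l : List G) (hl : ∀ s ∈ l, s ∈ S) :
    wordLen S l.prod ≤ l.length :=
  Nat.sInf_le ⟨l, hl, rfl, rfl⟩

namespace Courteous

variable {S : Finset G} {μ : G → ℝ} (h : Courteous S μ)

include h

theorem summable : Summable μ := h.hasSum.summable

theorem wordLen_mul_le (x y : G) :
    wordLen (S : Set G) (x * y) ≤ wordLen (S : Set G) x + wordLen (S : Set G) y := by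
  obtain ⟨l, hl, hn, rfl⟩ := exists_list_wordLen h.gen h.inv_mem x
  obtain ⟨l', hl', hn', rfl⟩ := exists_list_wordLen h.gen h.inv_mem y
  rw [← hn, ← hn', ← List.prod_append, ← List.length_append]
  refine wordLen_le_length _ fun s hs => ?_
  rcases List.mem_append.1 hs with hs | hs
  exacts [hl s hs, hl' s hs]

/-- A subadditive function bounded on the generators grows at most linearly. -/
theorem le_mul_wordLen {q : G → ℝ} {C : ℝ} (h1 : q 1 ≤ 0) (hmul : ∀ x y, q (x * y) ≤ q x + q y)
    (hS : ∀ s ∈ S, q s ≤ C) (x : G) : q x ≤ C * wordLen (S : Set G) x := by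
  obtain ⟨l, hl, hn, rfl⟩ := exists_list_wordLen h.gen h.inv_mem x
  rw [← hn]
  clear hn
  induction l with
  | nil => simpa using h1
  | cons a l ih =>
    rw [List.prod_cons, List.length_cons]
    have h1 := ih fun s hs => hl s (List.mem_cons_of_mem _ hs)
    have h2 := hS a (hl a List.mem_cons_self)
    push_cast
    nlinarith [hmul a l.prod]

theorem summable_mul_pow (m : ℕ) :
    Summable (fun x : G => μ x * (1 + (wordLen (S : Set G) x : ℝ)) ^ m) := by
  obtain ⟨ζ, hζ, hs⟩ := h.smooth
  have hbound : ∃ C : ℝ, ∀ n : ℕ, (1 + (n : ℝ)) ^ m ≤ C * Real.exp (ζ * n) := by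
    refine ⟨m.factorial / ζ ^ m * Real.exp ζ, fun n => ?_⟩
    have h1 := Real.pow_div_factorial_le_exp (ζ * (1 + n)) (by positivity) m
    rw [div_le_iff₀ (by positivity), mul_pow] at h1
    have h2 : Real.exp ζ * Real.exp (ζ * n) = Real.exp (ζ * (1 + n)) := by
      rw [← Real.exp_add]; ring_nf
    rw [mul_assoc, h2, div_mul_eq_mul_div, le_div_iff₀ (by positivity)]
    linarith
  obtain ⟨C, hC⟩ := hbound
  refine Summable.of_nonneg_of_le (fun x => mul_nonneg (h.nonneg x) (by positivity))
    (fun x => ?_) (hs.mul_left C)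
  nlinarith [hC (wordLen (S : Set G) x), h.nonneg x]

theorem summable_of_le_pow {E : Type*} [NormedAddCommGroup E] [NormedSpace ℂ E]
    [CompleteSpace E] {f : G → E} {C : ℝ} {m : ℕ}
    (hf : ∀ x, ‖f x‖ ≤ C * (1 + (wordLen (S : Set G) x : ℝ)) ^ m) :
    Summable (fun x => (μ x : ℂ) • f x) := by
  refine Summable.of_norm_bounded ((h.summable_mul_pow m).mul_left C) fun x => ?_
  rw [norm_smul, Complex.norm_real, Real.norm_of_nonneg (h.nonneg x)]
  nlinarith [hf x, h.nonneg x]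

theorem summable_real_of_le_pow {f : G → ℝ} {C : ℝ} {m : ℕ}
    (hf : ∀ x, |f x| ≤ C * (1 + (wordLen (S : Set G) x : ℝ)) ^ m) :
    Summable (fun x => μ x * f x) := by
  refine Summable.of_norm_bounded ((h.summable_mul_pow m).mul_left C) fun x => ?_
  rw [norm_mul, Real.norm_of_nonneg (h.nonneg x), Real.norm_eq_abs]
  nlinarith [hf x, h.nonneg x]

theorem mem_HFk {f : G → ℂ} {C : ℝ} {k : ℕ} (hk : 1 ≤ k)
    (hharm : ∀ x, f x = ∑' s : G, (μ s : ℂ) * f (x * s))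
    (hf : ∀ x, ‖f x‖ ≤ C * (1 + (wordLen (S : Set G) x : ℝ))) : f ∈ HFk (S : Set G) μ k := by
  have hC : 0 ≤ C := by
    have := (norm_nonneg _).trans (hf 1)
    by_contra hC
    push Not at hC
    nlinarith [(Nat.cast_nonneg (wordLen (S : Set G) (1 : G)) : (0 : ℝ) ≤ _)]
  refine ⟨fun x => ?_, ?_⟩
  · rw [hharm x, ← (Equiv.inv G).tsum_eq]
    simp [h.symm]
  · refine lt_of_le_of_lt (b := ENNReal.ofReal (2 * C)) ?_ ENNReal.ofReal_lt_top
    refine Filter.limsup_le_of_le (by isBoundedDefault) ?_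
    filter_upwards [Filter.eventually_ge_atTop 1] with r hr
    rw [mul_comm, ← div_eq_mul_inv]
    refine ENNReal.div_le_of_le_mul ?_
    refine iSup₂_le fun x hx => ?_
    rw [← ENNReal.ofReal_coe_nnreal, coe_nnnorm, ← ENNReal.ofReal_natCast r,
      ← ENNReal.ofReal_pow (by positivity), ← ENNReal.ofReal_mul (by positivity)]
    refine ENNReal.ofReal_le_ofReal ((hf x).trans ?_)
    have h1 : (1 : ℝ) ≤ r := by exact_mod_cast hr
    have h2 : (wordLen (S : Set G) x : ℝ) ≤ r := by exact_mod_cast hx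
    have h3 : (r : ℝ) ≤ (r : ℝ) ^ k := le_self_pow₀ h1 (by omega)
    nlinarith

end Courteous

end WordLength

section Solver

open Filter Topology
open scoped InnerProductSpace

variable {G : Type*} [Group G]
variable {E : Type*} [NormedAddCommGroup E] [InnerProductSpace ℂ E]

/-- The sum of the displacements of a vector under finitely many group elements. -/
noncomputable def displacement (ρ : Representation ℂ G E) (F : Finset G) (φ : E) : ℝ :=
  ∑ g ∈ F, ‖ρ g φ - φ‖

/-- Pairing with `e` is controlled by the displacement. -/
def DispBounded (ρ : Representation ℂ G E) (F : Finset G) (K : ℝ) (e : E) : Prop :=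
  ∀ φ : E, ‖⟪e, φ⟫_ℂ‖ ≤ K * displacement ρ F φ

theorem displacement_nonneg (ρ : Representation ℂ G E) (F : Finset G) (φ : E) :
    0 ≤ displacement ρ F φ := Finset.sum_nonneg fun _ _ => norm_nonneg _

namespace DispBounded

variable {ρ : Representation ℂ G E} {F : Finset G} {K K' : ℝ} {e e' : E}

theorem mono (h : DispBounded ρ F K e) (hK : K ≤ K') : DispBounded ρ F K' e := fun φ =>
  (h φ).trans (mul_le_mul_of_nonneg_right hK (displacement_nonneg _ _ _))

theorem mono_set {F' : Finset G} (h : DispBounded ρ F K e) (hK : 0 ≤ K) (hF : F ⊆ F') :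
    DispBounded ρ F' K e := fun φ =>
  (h φ).trans (mul_le_mul_of_nonneg_left
    (Finset.sum_le_sum_of_subset_of_nonneg hF fun _ _ _ => norm_nonneg _) hK)

theorem zero : DispBounded ρ F 0 (0 : E) := fun φ => by simp

theorem add (h : DispBounded ρ F K e) (h' : DispBounded ρ F K' e') :
    DispBounded ρ F (K + K') (e + e') := fun φ => by
  rw [inner_add_left, add_mul]
  exact (norm_add_le _ _).trans (add_le_add (h φ) (h' φ))

theorem neg (h : DispBounded ρ F K e) : DispBounded ρ F K (-e) := fun φ => by
  rw [inner_neg_left, norm_neg]; exact h φ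

theorem sub (h : DispBounded ρ F K e) (h' : DispBounded ρ F K' e') :
    DispBounded ρ F (K + K') (e - e') := sub_eq_add_neg e e' ▸ h.add h'.neg

theorem smul (h : DispBounded ρ F K e) (c : ℂ) : DispBounded ρ F (‖c‖ * K) (c • e) := fun φ => by
  rw [inner_smul_left, norm_mul, RCLike.norm_conj, mul_assoc]
  exact mul_le_mul_of_nonneg_left (h φ) (norm_nonneg _)

theorem sum {ι : Type*} (s : Finset ι) {K : ι → ℝ} {e : ι → E}
    (h : ∀ i ∈ s, DispBounded ρ F (K i) (e i)) :
    DispBounded ρ F (∑ i ∈ s, K i) (∑ i ∈ s, e i) := by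
  classical
  induction s using Finset.induction_on with
  | empty => simpa using zero
  | insert a s ha ih =>
    rw [Finset.sum_insert ha, Finset.sum_insert ha]
    exact (h a (by simp)).add (ih fun i hi => h i (by simp [hi]))

theorem hasSum {ι : Type*} {K : ι → ℝ} {e : ι → E} {K₀ : ℝ} {e₀ : E}
    (h : ∀ i, DispBounded ρ F (K i) (e i)) (hK : HasSum K K₀) (he : HasSum e e₀) :
    DispBounded ρ F K₀ e₀ := fun φ => by
  have h1 : Tendsto (fun s : Finset ι => ‖⟪∑ i ∈ s, e i, φ⟫_ℂ‖) atTop (𝓝 ‖⟪e₀, φ⟫_ℂ‖) :=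
    (Filter.Tendsto.inner he tendsto_const_nhds).norm
  have h2 : Tendsto (fun s : Finset ι => (∑ i ∈ s, K i) * displacement ρ F φ) atTop
      (𝓝 (K₀ * displacement ρ F φ)) := Tendsto.mul_const _ hK
  exact le_of_tendsto_of_tendsto' h1 h2 fun s => sum s (fun i _ => h i) φ

theorem norm_le (hρ : ∀ g φ, ‖ρ g φ‖ = ‖φ‖) (hK : 0 ≤ K) (h : DispBounded ρ F K e) :
    ‖e‖ ≤ 2 * F.card * K := by
  have h1 := h e
  have h2 : displacement ρ F e ≤ F.card * (2 * ‖e‖) := by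
    rw [← nsmul_eq_mul]
    refine Finset.sum_le_card_nsmul _ _ _ fun g _ => (norm_sub_le _ _).trans ?_
    rw [hρ]; linarith
  have h3 : ‖⟪e, e⟫_ℂ‖ = ‖e‖ * ‖e‖ := by
    rw [inner_self_eq_norm_sq_to_K, norm_pow, pow_two]; simp
  rw [h3] at h1
  by_contra! hlt
  have h0 : 0 < ‖e‖ := lt_of_le_of_lt (by positivity) hlt
  nlinarith [mul_le_mul_of_nonneg_left h2 hK]

end DispBounded

section Energy

variable [CompleteSpace E]

/-- The operators of an isometric representation, as continuous linear maps. -/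
noncomputable def isomCLM (ρ : Representation ℂ G E) (hρ : ∀ g φ, ‖ρ g φ‖ = ‖φ‖) (g : G) :
    E →L[ℂ] E := (ρ g).mkContinuous 1 fun φ => by rw [hρ, one_mul]

/-- The Markov operator of `μ` in an isometric representation. -/
noncomputable def markovCLM (μ : G → ℝ) (ρ : Representation ℂ G E)
    (hρ : ∀ g φ, ‖ρ g φ‖ = ‖φ‖) : E →L[ℂ] E := ∑' s, (μ s : ℂ) • isomCLM ρ hρ s

variable {S : Finset G} {μ : G → ℝ} (h : Courteous S μ)
variable (ρ : Representation ℂ G E) (hρ : ∀ g φ, ‖ρ g φ‖ = ‖φ‖)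

include h

theorem norm_smul_isomCLM_le (s : G) : ‖(μ s : ℂ) • isomCLM ρ hρ s‖ ≤ μ s := by
  rw [norm_smul, Complex.norm_real, Real.norm_of_nonneg (h.nonneg s)]
  exact mul_le_of_le_one_right (h.nonneg s) (LinearMap.mkContinuous_norm_le _ zero_le_one _)

theorem summable_isomCLM : Summable fun s => (μ s : ℂ) • isomCLM ρ hρ s :=
  Summable.of_norm_bounded h.summable (norm_smul_isomCLM_le h ρ hρ)

theorem norm_markovCLM_le : ‖markovCLM μ ρ hρ‖ ≤ 1 :=
  tsum_of_norm_bounded h.hasSum (norm_smul_isomCLM_le h ρ hρ)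

theorem hasSum_markovCLM (φ : E) :
    HasSum (fun s => (μ s : ℂ) • ρ s φ) (markovCLM μ ρ hρ φ) := by
  have h1 : HasSum (fun s => (μ s : ℂ) • isomCLM ρ hρ s) (markovCLM μ ρ hρ) :=
    (summable_isomCLM h ρ hρ).hasSum
  have h2 := h1.mapL (ContinuousLinearMap.apply ℂ E φ)
  exact h2

theorem hasSum_energy (φ : E) :
    HasSum (fun s => μ s * ‖ρ s φ - φ‖ ^ 2) (2 * (⟪φ - markovCLM μ ρ hρ φ, φ⟫_ℂ).re) := by
  have h1 : HasSum (fun s => ((μ s : ℂ) • (φ - ρ s φ))) (φ - markovCLM μ ρ hρ φ) := by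
    have h2 : HasSum (fun s => (μ s : ℂ) • φ) ((1 : ℂ) • φ) := by
      refine HasSum.smul_const ?_ φ
      have := Complex.hasSum_ofReal.2 h.hasSum
      simpa using this
    simpa [smul_sub] using h2.sub (hasSum_markovCLM h ρ hρ φ)
  have h3 := (Complex.reCLM.hasSum ((innerSL ℂ φ).hasSum h1)).mul_left 2
  have h4 : (⟪φ - markovCLM μ ρ hρ φ, φ⟫_ℂ).re = (⟪φ, φ - markovCLM μ ρ hρ φ⟫_ℂ).re :=
    inner_re_symm (𝕜 := ℂ) _ _
  rw [h4]
  refine h3.congr_fun fun s => ?_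
  have h5 := @norm_sub_sq ℂ E _ _ _ (ρ s φ) φ
  have h6 : (⟪φ, ρ s φ⟫_ℂ).re = (⟪ρ s φ, φ⟫_ℂ).re := inner_re_symm (𝕜 := ℂ) _ _
  have h7 : (⟪φ, φ⟫_ℂ).re = ‖φ‖ ^ 2 := (@norm_sq_eq_re_inner ℂ E _ _ _ φ).symm
  simp only [innerSL_apply_apply, inner_smul_right, inner_sub_right,
    Complex.reCLM_apply, Complex.re_ofReal_mul, Complex.sub_re, h6, h7]
  rw [h5, hρ]
  simp only [RCLike.re_to_complex]
  ring

theorem exists_norm_sub_le_energy (g : G) : ∃ C : ℝ, 0 ≤ C ∧ ∀ φ : E,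
    ‖ρ g φ - φ‖ ≤ C * √((⟪φ - markovCLM μ ρ hρ φ, φ⟫_ℂ).re) := by
  have hg : g ∈ Subgroup.closure {x : G | μ x ≠ 0} := by rw [h.adapted]; trivial
  induction hg using Subgroup.closure_induction with
  | mem x hx =>
    have hpos : 0 < μ x := lt_of_le_of_ne (h.nonneg x) (Ne.symm hx)
    refine ⟨√(2 / μ x), Real.sqrt_nonneg _, fun φ => ?_⟩
    rw [← Real.sqrt_mul (by positivity)]
    refine Real.le_sqrt_of_sq_le ?_
    have h1 := le_hasSum (hasSum_energy h ρ hρ φ) x fun s _ =>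
      mul_nonneg (h.nonneg s) (sq_nonneg _)
    rw [div_mul_eq_mul_div, le_div_iff₀ hpos]
    linarith
  | one => exact ⟨0, le_rfl, fun φ => by simp⟩
  | mul x y _ _ hx hy =>
    obtain ⟨C, hC, hx⟩ := hx
    obtain ⟨D, hD, hy⟩ := hy
    refine ⟨C + D, by positivity, fun φ => ?_⟩
    have h1 : ρ (x * y) φ - φ = ρ x (ρ y φ - φ) + (ρ x φ - φ) := by
      rw [map_mul, map_sub]; simp
    rw [h1]
    refine (norm_add_le _ _).trans ?_
    rw [hρ]
    linarith [hx φ, hy φ]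
  | inv x _ hx =>
    obtain ⟨C, hC, hx⟩ := hx
    refine ⟨C, hC, fun φ => ?_⟩
    rw [← hρ x, map_sub, ← Module.End.mul_apply, ← map_mul, mul_inv_cancel, map_one,
      Module.End.one_apply, norm_sub_rev]
    exact hx φ

/-- Solutions of the resolvent equation with displacement bounded uniformly in `ε`. -/
theorem exists_resolvent {F : Finset G} {K : ℝ} {e : E} (hK : 0 ≤ K)
    (he : DispBounded ρ F K e) : ∃ B : G → ℝ, ∀ ε : ℝ, 0 < ε → ∃ u : E,
      (1 + ε : ℂ) • u - markovCLM μ ρ hρ u = e ∧ (∀ g, ‖ρ g u - u‖ ≤ B g) ∧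
      ε * ‖u‖ ^ 2 ≤ B 1 := by
  choose C hC hCle using exists_norm_sub_le_energy h ρ hρ
  set D := ∑ g ∈ F, C g with hD
  have hD0 : 0 ≤ D := Finset.sum_nonneg fun g _ => hC g
  refine ⟨fun g => C g * (K * D) + (K * D) ^ 2, fun ε hε => ?_⟩
  have hε' : (1 + ε : ℂ) ≠ 0 := by
    have : (1 + ε : ℝ) ≠ 0 := by positivity
    exact_mod_cast this
  set P := markovCLM μ ρ hρ with hP
  have hlt : ‖(1 + ε : ℂ)⁻¹ • P‖ < 1 := by
    rw [norm_smul, norm_inv]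
    have h1 : ‖(1 + ε : ℂ)‖ = 1 + ε := by
      have : ((1 + ε : ℝ) : ℂ) = 1 + ε := by push_cast; rfl
      rw [← this, Complex.norm_real, Real.norm_of_nonneg (by positivity)]
    rw [h1, inv_mul_lt_iff₀ (by positivity)]
    linarith [norm_markovCLM_le h ρ hρ]
  obtain ⟨v, hv⟩ := isUnit_one_sub_of_norm_lt_one hlt
  have hu : (1 + ε : ℂ) • ((1 + ε : ℂ)⁻¹ • (v⁻¹.val e)) - P ((1 + ε : ℂ)⁻¹ • (v⁻¹.val e)) = e := by
    rw [smul_smul, mul_inv_cancel₀ hε', one_smul, map_smul]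
    have h2 : v.val (v⁻¹.val e) = e := by
      rw [← mul_apply_eq_comp, v.mul_inv, one_apply_eq_self]
    rw [hv] at h2
    simpa using h2
  generalize (1 + ε : ℂ)⁻¹ • (v⁻¹.val e) = u at hu
  set q := (⟪u - P u, u⟫_ℂ).re with hq
  have hq0 : 0 ≤ q := by
    have := (hasSum_energy h ρ hρ u).nonneg fun s => mul_nonneg (h.nonneg s) (sq_nonneg _)
    linarith
  have hdisp : displacement ρ F u ≤ D * √q := by
    rw [hD, Finset.sum_mul]
    exact Finset.sum_le_sum fun g _ => hCle g u
  have hen : q + ε * ‖u‖ ^ 2 ≤ K * (D * √q) := by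
    have h1 : q + ε * ‖u‖ ^ 2 = (⟪e, u⟫_ℂ).re := by
      have h2 : e = (u - P u) + (ε : ℂ) • u := by rw [← hu, add_smul, one_smul]; abel
      rw [h2, inner_add_left, inner_smul_left, Complex.add_re, ← hq, Complex.conj_ofReal,
        Complex.re_ofReal_mul]
      congr 2
      exact @norm_sq_eq_re_inner ℂ E _ _ _ u
    rw [h1]
    exact ((Complex.re_le_norm _).trans (he u)).trans (mul_le_mul_of_nonneg_left hdisp hK)
  have hsq : √q * √q = q := Real.mul_self_sqrt hq0
  have hε0 : 0 ≤ ε * ‖u‖ ^ 2 := by positivity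
  have hle : √q ≤ K * D := by
    by_contra! hlt
    have : 0 < √q := lt_of_le_of_lt (by positivity) hlt
    nlinarith
  refine ⟨u, hu, fun g => ?_, ?_⟩
  · have := (hCle g u).trans (mul_le_mul_of_nonneg_left hle (hC g))
    nlinarith [sq_nonneg (K * D)]
  · have h3 : K * (D * √q) ≤ (K * D) ^ 2 := by
      nlinarith [mul_le_mul_of_nonneg_left hle (mul_nonneg hK hD0)]
    have h4 := mul_nonneg (hC 1) (mul_nonneg hK hD0)
    simp only
    linarith

end Energy

end Solver

section Corrector

open Filter Topology
open scoped InnerProductSpace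

variable {G : Type*} [Group G]
variable {E : Type*} [NormedAddCommGroup E] [InnerProductSpace ℂ E]

theorem norm_sum_sq_of_pairwise_inner_eq_zero (v : ℕ → E) {c : ℝ} (hc : ∀ i, ‖v i‖ = c)
    (hv : ∀ i j, i ≠ j → ⟪v i, v j⟫_ℂ = 0) (n : ℕ) :
    ‖∑ i ∈ Finset.range n, v i‖ = √n * c := by
  have hc0 : 0 ≤ c := hc 0 ▸ norm_nonneg _
  have h1 : ‖∑ i ∈ Finset.range n, v i‖ ^ 2 = n * c ^ 2 := by
    induction n with
    | zero => simp
    | succ n ih =>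
      have h2 : ⟪∑ i ∈ Finset.range n, v i, v n⟫_ℂ = 0 := by
        rw [sum_inner]
        exact Finset.sum_eq_zero fun i hi => hv i n (Finset.mem_range.1 hi).ne
      rw [Finset.sum_range_succ, @norm_add_sq ℂ, ih, h2, hc]
      push_cast
      simp
      ring
  rw [← Real.sqrt_sq (norm_nonneg _), h1, Real.sqrt_mul (by positivity), Real.sqrt_sq hc0]

variable (ρ : Representation ℂ G E) (hρ : ∀ g φ, ‖ρ g φ‖ = ‖φ‖)

include hρ

theorem inner_map_map_of_norm (g : G) (φ ψ : E) : ⟪ρ g φ, ρ g ψ⟫_ℂ = ⟪φ, ψ⟫_ℂ :=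
  LinearIsometry.inner_map_map (𝕜 := ℂ) ⟨ρ g, hρ g⟩ φ ψ

theorem inner_map_eq_inv (g : G) (φ ψ : E) : ⟪φ, ρ g ψ⟫_ℂ = ⟪ρ g⁻¹ φ, ψ⟫_ℂ := by
  rw [← inner_map_map_of_norm ρ hρ g⁻¹ φ, ← Module.End.mul_apply, ← map_mul]
  simp

theorem norm_inner_pow_sub_le {w u : E} {g : G} {B : ℝ} (hB : ‖ρ g u - u‖ ≤ B)
    (hw : ∀ m n : ℕ, m ≠ n → ⟪ρ ((g⁻¹) ^ m) w, ρ ((g⁻¹) ^ n) w⟫_ℂ = 0) (n : ℕ) :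
    ‖⟪w, ρ (g ^ n) u⟫_ℂ - ⟪w, u⟫_ℂ‖ ≤ √n * ‖w‖ * B := by
  have h1 : ⟪w, ρ (g ^ n) u⟫_ℂ - ⟪w, u⟫_ℂ =
      ⟪∑ i ∈ Finset.range n, ρ ((g⁻¹) ^ i) w, ρ g u - u⟫_ℂ := by
    rw [sum_inner]
    have h2 : ∀ i, ⟪ρ ((g⁻¹) ^ i) w, ρ g u - u⟫_ℂ =
        ⟪w, ρ (g ^ (i + 1)) u⟫_ℂ - ⟪w, ρ (g ^ i) u⟫_ℂ := by
      intro i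
      rw [inv_pow, ← inner_map_eq_inv ρ hρ, map_sub, inner_sub_right, pow_succ, map_mul]
      simp
    rw [Finset.sum_congr rfl fun i _ => h2 i,
      Finset.sum_range_sub (fun i => ⟪w, ρ (g ^ i) u⟫_ℂ)]
    simp
  rw [h1]
  refine (norm_inner_le_norm _ _).trans ?_
  rw [norm_sum_sq_of_pairwise_inner_eq_zero _ (fun i => hρ _ w) hw]
  exact mul_le_mul_of_nonneg_left hB (by positivity)

variable {S : Finset G} {μ : G → ℝ} (h : Courteous S μ) [CompleteSpace E]

include h

/-- The corrector: a function of linear growth whose Laplacian is a matrix coefficient. -/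
theorem exists_corrector {F : Finset G} {K : ℝ} {e w : E} (hK : 0 ≤ K)
    (he : DispBounded ρ F K e) (hw : DispBounded ρ F K w) :
    ∃ (U : G → ℂ) (C : ℝ), (∀ x, ‖U x‖ ≤ C * (1 + (wordLen (S : Set G) x : ℝ))) ∧
      (∀ x, U x - ∑' s, (μ s : ℂ) * U (x * s) = ⟪w, ρ x e⟫_ℂ) ∧
      (∀ g : G, (∀ m n : ℕ, m ≠ n → ⟪ρ ((g⁻¹) ^ m) w, ρ ((g⁻¹) ^ n) w⟫_ℂ = 0) →
        ∃ D : ℝ, ∀ n : ℕ, ‖U (g ^ n)‖ ≤ D * (1 + √n)) := by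
  classical
  obtain ⟨B, hB⟩ := exists_resolvent h ρ hρ hK he
  choose u hu hd hn using fun n : ℕ => hB (1 / ((n : ℝ) + 1)) (by positivity)
  have hB0 : ∀ g, 0 ≤ B g := fun g => (norm_nonneg _).trans (hd 0 g)
  set U' : ℕ → G → ℂ := fun n x => ⟪w, ρ x (u n)⟫_ℂ with hU'
  set M : ℝ := ∑ s ∈ S, B s with hM
  have hM0 : 0 ≤ M := Finset.sum_nonneg fun s _ => hB0 s
  have hlip : ∀ n x, ‖ρ x (u n) - u n‖ ≤ M * wordLen (S : Set G) x := by
    intro n x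
    refine h.le_mul_wordLen (q := fun x => ‖ρ x (u n) - u n‖) (by simp) (fun x y => ?_)
      (fun s hs => (hd n s).trans (Finset.single_le_sum (fun s _ => hB0 s) hs)) x
    have h1 : ρ (x * y) (u n) - u n = ρ x (ρ y (u n) - u n) + (ρ x (u n) - u n) := by
      rw [map_mul, map_sub]; simp
    rw [h1]
    refine (norm_add_le _ _).trans ?_
    rw [hρ]; linarith
  set A : ℝ := K * ∑ g ∈ F, B g with hA
  have hA0 : 0 ≤ A := mul_nonneg hK (Finset.sum_nonneg fun s _ => hB0 s)
  have hwu : ∀ n, ‖⟪w, u n⟫_ℂ‖ ≤ A := fun n => (hw (u n)).trans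
    (mul_le_mul_of_nonneg_left (Finset.sum_le_sum fun g _ => hd n g) hK)
  set C : ℝ := A + ‖w‖ * M with hC
  have hbound : ∀ n x, ‖U' n x‖ ≤ C * (1 + (wordLen (S : Set G) x : ℝ)) := by
    intro n x
    have h1 : U' n x = ⟪w, u n⟫_ℂ + ⟪w, ρ x (u n) - u n⟫_ℂ := by
      rw [← inner_add_right]; simp [hU']
    rw [h1]
    refine (norm_add_le _ _).trans ((add_le_add (hwu n) ((norm_inner_le_norm _ _).trans
      (mul_le_mul_of_nonneg_left (hlip n x) (norm_nonneg _)))).trans ?_)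
    have h2 : (0 : ℝ) ≤ wordLen (S : Set G) x := Nat.cast_nonneg _
    have h3 : 0 ≤ ‖w‖ * M := by positivity
    rw [hC]
    nlinarith [mul_nonneg hA0 h2]
  have hcomp : IsCompact (Set.univ.pi fun x : G =>
      Metric.closedBall (0 : ℂ) (C * (1 + (wordLen (S : Set G) x : ℝ)))) :=
    isCompact_univ_pi fun x => isCompact_closedBall _ _
  let 𝓤 : Ultrafilter (G → ℂ) := (hyperfilter ℕ).map U'
  obtain ⟨U, hUmem, hU⟩ := hcomp.ultrafilter_le_nhds 𝓤 (by
    rw [le_principal_iff]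
    change _ ∈ Filter.map U' (hyperfilter ℕ : Filter ℕ)
    refine Filter.mem_map.2 (Filter.univ_mem' fun n => ?_)
    simpa using hbound n)
  have hlim : ∀ x, Tendsto (fun n => U' n x) (hyperfilter ℕ : Filter ℕ) (𝓝 (U x)) := by
    have h1 : Tendsto U' (hyperfilter ℕ : Filter ℕ) (𝓝 U) := hU
    exact fun x => tendsto_pi_nhds.1 h1 x
  have hle : (hyperfilter ℕ : Filter ℕ) ≤ atTop := by
    rw [← Nat.cofinite_eq_atTop]; exact hyperfilter_le_cofinite
  refine ⟨U, C, fun x => by simpa using hUmem x (Set.mem_univ x), fun x => ?_, fun g hg => ?_⟩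
  · have heq : ∀ n : ℕ, (1 + 1 / ((n : ℂ) + 1) : ℂ) * U' n x - ∑' s, (μ s : ℂ) * U' n (x * s) =
        ⟪w, ρ x e⟫_ℂ := by
      intro n
      have h1 := ((innerSL ℂ (ρ x⁻¹ w)).hasSum (hasSum_markovCLM h ρ hρ (u n))).tsum_eq
      have h2 : ∀ s, innerSL ℂ (ρ x⁻¹ w) ((μ s : ℂ) • ρ s (u n)) = (μ s : ℂ) * U' n (x * s) := by
        intro s
        rw [innerSL_apply_apply, inner_smul_right, ← inner_map_eq_inv ρ hρ, hU']
        simp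
      rw [tsum_congr fun s => (h2 s).symm, h1, innerSL_apply_apply, ← inner_map_eq_inv ρ hρ,
        ← hu n, map_sub, map_smul, inner_sub_right, inner_smul_right]
      push_cast
      rfl
    have h1 : Tendsto (fun n : ℕ => (1 + 1 / ((n : ℂ) + 1) : ℂ) * U' n x -
        ∑' s, (μ s : ℂ) * U' n (x * s)) (hyperfilter ℕ : Filter ℕ)
        (𝓝 ((1 + 0 : ℂ) * U x - ∑' s, (μ s : ℂ) * U (x * s))) := by
      refine Tendsto.sub (Tendsto.mul ?_ (hlim x)) ?_
      · exact ((tendsto_one_div_add_atTop_nhds_zero_nat (𝕜 := ℂ)).mono_left hle).const_add 1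
      · refine tendsto_tsum_of_dominated_convergence
          (bound := fun s => (C * (1 + (wordLen (S : Set G) x : ℝ))) *
            (μ s * (1 + (wordLen (S : Set G) s : ℝ)) ^ 1))
          ((h.summable_mul_pow 1).mul_left _) (fun s => (hlim _).const_mul _)
          (Filter.univ_mem' fun n s => ?_)
        rw [norm_mul, Complex.norm_real, Real.norm_of_nonneg (h.nonneg s), pow_one]
        have h2 : (wordLen (S : Set G) (x * s) : ℝ) ≤
            wordLen (S : Set G) x + wordLen (S : Set G) s := by
          exact_mod_cast h.wordLen_mul_le x s
        have h3 := hbound n (x * s)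
        have hC0 : 0 ≤ C := by positivity
        have hx0 : (0 : ℝ) ≤ wordLen (S : Set G) x := Nat.cast_nonneg _
        have hs0 : (0 : ℝ) ≤ wordLen (S : Set G) s := Nat.cast_nonneg _
        have h4 : ‖U' n (x * s)‖ ≤ C * (1 + (wordLen (S : Set G) x : ℝ)) *
            (1 + (wordLen (S : Set G) s : ℝ)) := by
          refine h3.trans ?_
          rw [mul_assoc]
          refine mul_le_mul_of_nonneg_left ?_ hC0
          nlinarith [mul_nonneg hx0 hs0]
        nlinarith [mul_le_mul_of_nonneg_left h4 (h.nonneg s)]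
    simp_rw [heq] at h1
    have h2 := tendsto_nhds_unique h1 tendsto_const_nhds
    simpa using h2
  · refine ⟨A + ‖w‖ * B g, fun n => ?_⟩
    refine le_of_tendsto (hlim _).norm (Filter.univ_mem' fun m => ?_)
    have h1 := norm_inner_pow_sub_le ρ hρ (hd m g) hg n
    have h2 := norm_add_le (⟪w, ρ (g ^ n) (u m)⟫_ℂ - ⟪w, u m⟫_ℂ) ⟪w, u m⟫_ℂ
    rw [sub_add_cancel] at h2
    change ‖⟪w, ρ (g ^ n) (u m)⟫_ℂ‖ ≤ _
    have h3 := Real.sqrt_nonneg (n : ℝ)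
    nlinarith [hwu m, mul_nonneg hA0 h3, mul_nonneg (norm_nonneg w) (hB0 g)]

end Corrector

section Sequences

open Filter Topology Polynomial

/-- The shift operator on two-sided sequences. -/
def seqShift : (ℤ → ℂ) →ₗ[ℂ] (ℤ → ℂ) where
  toFun g n := g (n + 1)
  map_add' _ _ := rfl
  map_smul' _ _ := rfl

theorem seqShift_pow_apply (g : ℤ → ℂ) (j : ℕ) (n : ℤ) : (seqShift ^ j) g n = g (n + j) := by
  induction j generalizing n with
  | zero => simp
  | succ j ih =>
    rw [pow_succ', Module.End.mul_apply]
    change (seqShift ^ j) g (n + 1) = _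
    rw [ih]; push_cast; congr 1; ring

theorem tendsto_shift_div {g : ℤ → ℂ} {c : ℂ} (σ : ℤ) (hσ : σ = 1 ∨ σ = -1)
    (hg : Tendsto (fun n : ℕ => g (σ * n) / n) atTop (𝓝 c)) :
    Tendsto (fun n : ℕ => g (σ * n + 1) / n) atTop (𝓝 c) := by
  rcases hσ with rfl | rfl
  · have h1 := (tendsto_add_atTop_iff_nat 1).2 hg
    have h2 : Tendsto (fun n : ℕ => ((n : ℂ) + 1) / n) atTop (𝓝 (1 + 0)) := by
      have := (tendsto_inv_atTop_nhds_zero_nat (𝕜 := ℂ)).const_add 1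
      refine this.congr' ?_
      filter_upwards [eventually_gt_atTop 0] with n hn
      have : (n : ℂ) ≠ 0 := by exact_mod_cast hn.ne'
      field_simp
    have h3 := h1.mul h2
    rw [add_zero, mul_one] at h3
    refine h3.congr' ?_
    filter_upwards [eventually_gt_atTop 0] with n hn
    have h4 : (n : ℂ) ≠ 0 := by exact_mod_cast hn.ne'
    have h5 : (n : ℂ) + 1 ≠ 0 := by exact_mod_cast (Nat.succ_ne_zero n)
    push_cast
    rw [one_mul, one_mul]
    field_simp
  · rw [← tendsto_add_atTop_iff_nat 1]
    have h2 : Tendsto (fun n : ℕ => (n : ℂ) / ((n : ℂ) + 1)) atTop (𝓝 1) :=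
      tendsto_natCast_div_add_atTop 1
    have h3 := hg.mul h2
    rw [mul_one] at h3
    refine h3.congr' ?_
    filter_upwards [eventually_gt_atTop 0] with n hn
    have h4 : (n : ℂ) ≠ 0 := by exact_mod_cast hn.ne'
    have h5 : (n : ℂ) + 1 ≠ 0 := by exact_mod_cast (Nat.succ_ne_zero n)
    have h6 : (-1 * ((n + 1 : ℕ) : ℤ) + 1 : ℤ) = -1 * n := by push_cast; ring
    rw [h6]
    push_cast
    field_simp

theorem tendsto_aeval_shift_div {g : ℤ → ℂ} {c : ℂ} (σ : ℤ) (hσ : σ = 1 ∨ σ = -1)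
    (hg : Tendsto (fun n : ℕ => g (σ * n) / n) atTop (𝓝 c)) (p : ℂ[X]) :
    Tendsto (fun n : ℕ => aeval seqShift p g (σ * n) / n) atTop (𝓝 (p.eval 1 * c)) := by
  induction p using Polynomial.induction_on' with
  | add p q hp hq =>
    rw [eval_add, add_mul]
    refine (hp.add hq).congr fun n => ?_
    rw [map_add, LinearMap.add_apply, Pi.add_apply, add_div]
  | monomial j a =>
    have h1 : ∀ j : ℕ, Tendsto (fun n : ℕ => (seqShift ^ j) g (σ * n) / n) atTop (𝓝 c) := by
      intro j
      induction j with
      | zero => simpa using hg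
      | succ j ih =>
        refine (tendsto_shift_div σ hσ ih).congr fun n => ?_
        rw [pow_succ', Module.End.mul_apply]
        rfl
    have h2 := (h1 j).const_mul a
    rw [eval_monomial, one_pow, mul_one]
    refine h2.congr fun n => ?_
    rw [aeval_monomial, Module.End.mul_apply, Module.algebraMap_end_apply, Pi.smul_apply,
      smul_eq_mul, mul_div_assoc]

theorem eq_const_of_pow_sub_one_eq_zero (m : ℕ) {k : ℤ → ℂ}
    (hk : ((seqShift - 1) ^ m) k = 0)
    (h0 : Tendsto (fun n : ℕ => k (-1 * n) / n) atTop (𝓝 0)) (n : ℤ) : k n = k 0 := by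
  induction m generalizing k n with
  | zero =>
    have : k = 0 := by simpa using hk
    simp [this]
  | succ m ih =>
    rw [pow_succ, Module.End.mul_apply] at hk
    set j := (seqShift - 1) k with hj
    have hjn : ∀ n, j n = k (n + 1) - k n := fun n => rfl
    have h1 : Tendsto (fun n : ℕ => j (-1 * n) / n) atTop (𝓝 0) := by
      have := (tendsto_shift_div (-1) (Or.inr rfl) h0).sub h0
      rw [sub_zero] at this
      refine this.congr fun n => ?_
      rw [hjn, sub_div]
    have h2 := ih hk h1
    have h3 : ∀ n : ℤ, k n = k 0 + n * j 0 := by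
      intro n
      induction n using Int.induction_on with
      | zero => simp
      | succ i hi =>
        have := h2 i
        rw [hjn] at this
        rw [sub_eq_iff_eq_add.1 this, hi]; push_cast; ring
      | pred i hi =>
        have h4 := h2 (-i - 1)
        rw [hjn, sub_add_cancel, hi] at h4
        push_cast at h4 ⊢
        linear_combination -h4
    have h4 : j 0 = 0 := by
      have h5 : Tendsto (fun n : ℕ => k (-1 * n) / n) atTop (𝓝 (k 0 * 0 - j 0)) := by
        refine (((tendsto_inv_atTop_nhds_zero_nat (𝕜 := ℂ)).const_mul (k 0)).sub_const
          (j 0)).congr' ?_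
        filter_upwards [eventually_gt_atTop 0] with n hn
        have : (n : ℂ) ≠ 0 := by exact_mod_cast hn.ne'
        rw [h3 (-1 * n)]
        push_cast
        field_simp
        ring
      have h6 := tendsto_nhds_unique h5 h0
      simpa using h6
    rw [h3 n, h4]; simp

theorem eq_zero_of_shift_mem_finiteDimensional {V : Submodule ℂ (ℤ → ℂ)}
    [FiniteDimensional ℂ V] {g : ℤ → ℂ} {c : ℂ} (hV : ∀ j : ℕ, (seqShift ^ j) g ∈ V)
    (hpos : Tendsto (fun n : ℕ => g (1 * n) / n) atTop (𝓝 c))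
    (hneg : Tendsto (fun n : ℕ => g (-1 * n) / n) atTop (𝓝 0)) : c = 0 := by
  have hmem : ∀ p : ℂ[X], aeval seqShift p g ∈ V := by
    intro p
    induction p using Polynomial.induction_on' with
    | add p q hp hq => rw [map_add]; exact V.add_mem hp hq
    | monomial j a =>
      rw [aeval_monomial, Module.End.mul_apply, Module.algebraMap_end_apply]
      exact V.smul_mem _ (hV j)
  let Φ : ℂ[X] →ₗ[ℂ] V := LinearMap.codRestrict V
    ((LinearMap.applyₗ g).comp (aeval (R := ℂ) seqShift).toLinearMap) hmem
  have hΦ : ¬ Function.Injective Φ := fun hinj =>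
    Polynomial.not_finite (R := ℂ) (Module.Finite.of_injective Φ hinj)
  obtain ⟨p, hp, hp0⟩ : ∃ p, Φ p = 0 ∧ p ≠ 0 := by
    rw [injective_iff_map_eq_zero] at hΦ
    push Not at hΦ
    exact hΦ
  have hpg : aeval seqShift p g = 0 := congrArg Subtype.val hp
  obtain ⟨q, hq, hq1⟩ := Polynomial.exists_eq_pow_rootMultiplicity_mul_and_not_dvd p hp0 1
  have hq1' : q.eval 1 ≠ 0 := fun h0 => hq1 (dvd_iff_isRoot.2 h0)
  set k := aeval seqShift q g with hk
  have hk0 : ((seqShift - 1) ^ (rootMultiplicity 1 p)) k = 0 := by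
    rw [hq, map_mul, Module.End.mul_apply] at hpg
    simpa using hpg
  have hkpos := tendsto_aeval_shift_div 1 (Or.inl rfl) hpos q
  have hkneg := tendsto_aeval_shift_div (-1) (Or.inr rfl) hneg q
  rw [mul_zero] at hkneg
  have hconst := eq_const_of_pow_sub_one_eq_zero _ hk0 hkneg
  have h1 : Tendsto (fun n : ℕ => k (1 * n) / n) atTop (𝓝 (k 0 * 0)) := by
    refine ((tendsto_inv_atTop_nhds_zero_nat (𝕜 := ℂ)).const_mul (k 0)).congr fun n => ?_
    rw [hconst (1 * n), div_eq_mul_inv]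
  have h2 := tendsto_nhds_unique hkpos h1
  rw [mul_zero] at h2
  exact (mul_eq_zero.1 h2).resolve_left hq1'

theorem tendsto_div_of_norm_sub_le_sqrt {a : ℕ → ℂ} {c : ℂ} {D : ℝ}
    (ha : ∀ n : ℕ, ‖a n - n * c‖ ≤ D * (1 + √n)) : Tendsto (fun n : ℕ => a n / n) atTop (𝓝 c) := by
  rw [tendsto_iff_norm_sub_tendsto_zero]
  have h1 : Tendsto (fun n : ℕ => D * ((n : ℝ)⁻¹ + (√n)⁻¹)) atTop (𝓝 (D * (0 + 0))) := by
    refine Tendsto.const_mul D (Tendsto.add tendsto_inv_atTop_nhds_zero_nat ?_)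
    exact (tendsto_inv_atTop_zero.comp Real.tendsto_sqrt_atTop).comp tendsto_natCast_atTop_atTop
  rw [add_zero, mul_zero] at h1
  refine squeeze_zero' (Eventually.of_forall fun n => norm_nonneg _) ?_ h1
  filter_upwards [eventually_gt_atTop 0] with n hn
  have h2 : (0 : ℝ) < n := by exact_mod_cast hn
  have h3 : (n : ℂ) ≠ 0 := by exact_mod_cast hn.ne'
  have h4 : a n / n - c = (a n - n * c) / n := by field_simp
  rw [h4, norm_div, Complex.norm_natCast, div_le_iff₀ h2]
  refine (ha n).trans (le_of_eq ?_)
  have h5 : √(n : ℝ) * √n = n := Real.mul_self_sqrt h2.le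
  have h6 : √(n : ℝ) ≠ 0 := (Real.sqrt_pos.2 h2).ne'
  have h7 : (√(n : ℝ))⁻¹ * n = √n := by
    rw [inv_mul_eq_iff_eq_mul₀ h6, h5]
  rw [mul_assoc, add_mul, h7, inv_mul_cancel₀ h2.ne']

variable {G : Type*} [Group G] {S : Finset G} {μ : G → ℝ}

/-- A harmonic function growing linearly in one direction along a cyclic subgroup and
sublinearly in the other one generates an infinite-dimensional space of translates. -/
theorem Courteous.false_of_halfLinear (h : Courteous S μ) {k : ℕ} (hk : 1 ≤ k)
    {W : Submodule ℂ (G → ℂ)} [FiniteDimensional ℂ W]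
    (hW : HFk (S : Set G) μ k ⊆ (W : Set (G → ℂ))) {f : G → ℂ} {C D : ℝ} {c : ℂ}
    (hf : ∀ x, f x = ∑' s : G, (μ s : ℂ) * f (x * s))
    (hC : ∀ x, ‖f x‖ ≤ C * (1 + (wordLen (S : Set G) x : ℝ))) (hc : c ≠ 0) (t : G)
    (hpos : ∀ n : ℕ, ‖f (t ^ n) - n * c‖ ≤ D * (1 + √n))
    (hneg : ∀ n : ℕ, ‖f (t⁻¹ ^ n)‖ ≤ D * (1 + √n)) : False := by
  let R : (G → ℂ) →ₗ[ℂ] (ℤ → ℂ) := LinearMap.funLeft ℂ ℂ fun n : ℤ => t ^ n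
  have hC0 : 0 ≤ C := by
    have h1 := (norm_nonneg _).trans (hC 1)
    have h2 : (0 : ℝ) ≤ wordLen (S : Set G) (1 : G) := Nat.cast_nonneg _
    by_contra! h3
    nlinarith
  have hmem : ∀ y : G, (fun x => f (y * x)) ∈ W := by
    intro y
    refine hW (h.mem_HFk (C := C * (1 + wordLen (S : Set G) y)) hk (fun x => ?_) fun x => ?_)
    · rw [hf (y * x)]; simp only [mul_assoc]
    · refine (hC _).trans ?_
      have h1 : (wordLen (S : Set G) (y * x) : ℝ) ≤
          wordLen (S : Set G) y + wordLen (S : Set G) x := by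
        exact_mod_cast h.wordLen_mul_le y x
      have h2 : (0 : ℝ) ≤ wordLen (S : Set G) y := Nat.cast_nonneg _
      have h3 : (0 : ℝ) ≤ wordLen (S : Set G) x := Nat.cast_nonneg _
      rw [mul_assoc]
      refine mul_le_mul_of_nonneg_left ?_ hC0
      nlinarith [mul_nonneg h2 h3]
  refine hc (eq_zero_of_shift_mem_finiteDimensional (V := W.map R) (g := R f) (fun j => ?_) ?_ ?_)
  · refine ⟨_, hmem (t ^ j), ?_⟩
    funext n
    rw [seqShift_pow_apply]
    change f (t ^ j * t ^ n) = f (t ^ (n + j))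
    rw [add_comm n, zpow_add, zpow_natCast]
  · refine (tendsto_div_of_norm_sub_le_sqrt hpos).congr fun n => ?_
    change _ = f (t ^ (1 * (n : ℤ))) / n
    rw [one_mul, zpow_natCast]
  · refine (tendsto_div_of_norm_sub_le_sqrt (a := fun n => f (t⁻¹ ^ n)) (c := 0) (D := D)
      (fun n => by simpa using hneg n)).congr fun n => ?_
    change _ = f (t ^ (-1 * (n : ℤ))) / n
    rw [neg_one_mul, zpow_neg, zpow_natCast, inv_pow]

end Sequences

section DriftCorrector

variable {G : Type*} [Group G] {S : Finset G} {μ : G → ℝ} (h : Courteous S μ)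
variable {X : Type*} [Fintype X] [MulAction G X]

include h

theorem Courteous.summable_orbit (r : X → ℝ) (j : X) : Summable fun s => μ s * r (s⁻¹ • j) := by
  refine h.summable_real_of_le_pow (C := ∑ i, |r i|) (m := 0) fun s => ?_
  rw [pow_zero, mul_one]
  exact Finset.single_le_sum (f := fun i => |r i|) (fun i _ => abs_nonneg _) (Finset.mem_univ _)

theorem Courteous.hasSum_sum_orbit (r : X → ℝ) :
    ∑ j, ∑' s, μ s * r (s⁻¹ • j) = ∑ j, r j := by
  rw [← Summable.tsum_finsetSum fun j _ => h.summable_orbit r j]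
  have h1 : ∀ s, ∑ j, μ s * r (s⁻¹ • j) = μ s * ∑ j, r j := by
    intro s
    rw [← Finset.mul_sum]
    congr 1
    exact Equiv.sum_comp (MulAction.toPerm s⁻¹) r
  rw [tsum_congr h1, tsum_mul_right, h.hasSum.tsum_eq, one_mul]

theorem Courteous.orbit_const [MulAction.IsPretransitive G X] {r : X → ℝ}
    (hr : ∀ j, r j = ∑' s, μ s * r (s⁻¹ • j)) (i j : X) : r i = r j := by
  have h1 : ∀ j, HasSum (fun s => μ s * (r j * r (s⁻¹ • j))) (r j * r j) := by
    intro j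
    have := ((h.summable_orbit r j).hasSum).mul_left (r j)
    rw [← hr j] at this
    exact this.congr_fun fun s => by ring
  have h2 := hasSum_sum (s := Finset.univ) fun j _ => h1 j
  have h3 : HasSum (fun s => μ s * ∑ j, (r (s⁻¹ • j) - r j) ^ 2) 0 := by
    have h4 := ((h.hasSum.mul_right (∑ j, r j * r j)).mul_left 2).sub (h2.mul_left 2)
    rw [one_mul, sub_self] at h4
    refine h4.congr_fun fun s => ?_
    have h5 : ∑ j, r (s⁻¹ • j) ^ 2 = ∑ j, r j * r j := by
      rw [← Equiv.sum_comp (MulAction.toPerm s⁻¹) fun j => r j * r j]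
      exact Finset.sum_congr rfl fun j _ => by simp [pow_two]
    simp_rw [sub_sq, Finset.sum_add_distrib, Finset.sum_sub_distrib, h5, ← Finset.mul_sum, pow_two]
    have h6 : ∑ j, 2 * r (s⁻¹ • j) * r j = 2 * ∑ j, r j * r (s⁻¹ • j) := by
      rw [Finset.mul_sum]; exact Finset.sum_congr rfl fun j _ => by ring
    rw [h6]; ring
  have hnn : ∀ s, 0 ≤ μ s * ∑ j, (r (s⁻¹ • j) - r j) ^ 2 := fun s =>
    mul_nonneg (h.nonneg s) (Finset.sum_nonneg fun j _ => sq_nonneg _)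
  have h7 := (hasSum_zero_iff_of_nonneg hnn).1 h3
  have h8 : ∀ g ∈ Subgroup.closure {x : G | μ x ≠ 0}, ∀ j, r (g • j) = r j := by
    intro g hg
    induction hg using Subgroup.closure_induction with
    | mem s hs =>
      intro j
      have h9 := congrFun h7 s
      have h10 := (mul_eq_zero.1 h9).resolve_left hs
      rw [Finset.sum_eq_zero_iff_of_nonneg fun j _ => sq_nonneg _] at h10
      have h11 := h10 (s • j) (Finset.mem_univ _)
      rw [inv_smul_smul, sq_eq_zero_iff, sub_eq_zero] at h11
      exact h11.symm
    | one => simp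
    | mul x y _ _ hx hy => intro j; rw [mul_smul, hx, hy]
    | inv x _ hx => intro j; rw [← hx (x⁻¹ • j), smul_inv_smul]
  obtain ⟨g, rfl⟩ := MulAction.exists_smul_eq G j i
  exact h8 g (by rw [h.adapted]; trivial) j

/-- A nonnegative function on the orbit space making a cocycle centred at every point. -/
theorem Courteous.exists_drift_corrector [MulAction.IsPretransitive G X] [Nonempty X]
    {ω : G → X → ℝ} {C : ℝ} (hω : ∀ g g' i, ω (g * g') i = ω g (g' • i) + ω g' i)
    (hC : ∀ g i, |ω g i| ≤ C * (1 + (wordLen (S : Set G) g : ℝ))) :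
    ∃ r : X → ℝ, (∀ j, 0 ≤ r j) ∧
      ∀ j, HasSum (fun s => μ s * (r (s⁻¹ • j) - ω s (s⁻¹ • j) - r j)) 0 := by
  classical
  have hsω : ∀ j, Summable fun s => μ s * ω s (s⁻¹ • j) := fun j =>
    h.summable_real_of_le_pow (m := 1) fun s => by rw [pow_one]; exact hC s _
  set b : X → ℝ := fun j => ∑' s, μ s * ω s (s⁻¹ • j) with hb
  have hbsum : ∑ j, b j = 0 := by
    rw [hb, ← Summable.tsum_finsetSum fun j _ => hsω j]
    set W : G → ℝ := fun s => ∑ i, ω s i with hW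
    have h1 : ∀ s, ∑ j, μ s * ω s (s⁻¹ • j) = μ s * W s := by
      intro s
      rw [← Finset.mul_sum]
      congr 1
      exact Equiv.sum_comp (MulAction.toPerm s⁻¹) (ω s)
    have h2 : ∀ s, W s⁻¹ = - W s := by
      intro s
      have h3 : ∀ i, ω s⁻¹ (s • i) = - ω s i := by
        intro i
        have h4 := hω s⁻¹ s i
        have h5 := hω 1 1 i
        rw [inv_mul_cancel] at h4
        rw [mul_one, one_smul] at h5
        linarith
      rw [hW]
      simp only
      rw [← Finset.sum_neg_distrib, ← Equiv.sum_comp (MulAction.toPerm s)]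
      exact Finset.sum_congr rfl fun i _ => h3 i
    rw [tsum_congr h1]
    have h3 : ∑' s, μ s * W s = - ∑' s, μ s * W s := by
      rw [← tsum_neg, ← (Equiv.inv G).tsum_eq]
      exact tsum_congr fun s => by simp [h.symm, h2]
    linarith
  let A : (X → ℝ) →ₗ[ℝ] (X → ℝ) :=
    { toFun := fun r j => r j - ∑' s, μ s * r (s⁻¹ • j) + ∑ i, r i
      map_add' := fun r r' => by
        funext j
        simp only [Pi.add_apply, mul_add, Finset.sum_add_distrib]
        rw [(h.summable_orbit r j).tsum_add (h.summable_orbit r' j)]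
        ring
      map_smul' := fun c r => by
        funext j
        simp only [Pi.smul_apply, smul_eq_mul, RingHom.id_apply, ← Finset.mul_sum, mul_left_comm]
        rw [tsum_mul_left]
        ring }
  have hA : ∀ r j, A r j = r j - ∑' s, μ s * r (s⁻¹ • j) + ∑ i, r i := fun _ _ => rfl
  have hcard : (Fintype.card X : ℝ) ≠ 0 := by exact_mod_cast Fintype.card_ne_zero
  have hAsum : ∀ r, ∑ j, A r j = Fintype.card X * ∑ i, r i := by
    intro r
    simp_rw [hA, Finset.sum_add_distrib, Finset.sum_sub_distrib, h.hasSum_sum_orbit]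
    simp
  have hinj : Function.Injective A := by
    rw [injective_iff_map_eq_zero]
    intro r hr
    have h1 := hAsum r
    rw [hr] at h1
    have h2 : ∑ i, r i = 0 := by simpa [hcard] using h1
    have h3 : ∀ i j, r i = r j := h.orbit_const fun j => by
      have h4 := hA r j
      rw [hr, h2] at h4
      simp only [Pi.zero_apply] at h4
      linarith
    funext j
    have h5 : ∑ i, r i = Fintype.card X * r j := by
      rw [Finset.sum_congr rfl fun i _ => h3 i j]; simp
    rw [h2] at h5
    simpa [hcard] using h5.symm
  obtain ⟨r, hr⟩ := LinearMap.surjective_of_injective hinj (-b)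
  have hrsum : ∑ i, r i = 0 := by
    have h1 := hAsum r
    rw [hr] at h1
    simpa [hbsum, hcard] using h1
  refine ⟨fun j => r j + ∑ i, |r i|, fun j => ?_, fun j => ?_⟩
  · have h1 := Finset.single_le_sum (f := fun i => |r i|) (fun i _ => abs_nonneg _)
      (Finset.mem_univ j)
    linarith [neg_abs_le (r j)]
  · have h1 := (((h.summable_orbit r j).hasSum).sub (hsω j).hasSum).sub (h.hasSum.mul_right (r j))
    have h2 : ∑' s, μ s * r (s⁻¹ • j) - ∑' s, μ s * ω s (s⁻¹ • j) - 1 * r j = 0 := by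
      have h3 := hA r j
      rw [hr, hrsum] at h3
      simp only [Pi.neg_apply, hb] at h3
      linarith
    rw [h2] at h1
    exact h1.congr_fun fun s => by ring

end DriftCorrector

section HalfLine

open Filter Topology
open scoped InnerProductSpace

/-- Translation of a function on the line. -/
def lineShift (r : ℝ) (p : ℝ → ℝ) : ℝ → ℝ := fun y => p (y - r)

/-- Measurable functions bounded by `M` and vanishing outside `[a, b)`. -/
structure Profile (p : ℝ → ℝ) (M a b : ℝ) : Prop where
  meas : Measurable p
  bound : ∀ y, |p y| ≤ M
  supp : ∀ y, y < a ∨ b ≤ y → p y = 0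

namespace Profile

variable {p q : ℝ → ℝ} {M M' a b a' b' : ℝ}

theorem nonneg (h : Profile p M a b) : 0 ≤ M := (abs_nonneg _).trans (h.bound 0)

theorem mono (h : Profile p M a b) (hM : M ≤ M') (ha : a' ≤ a) (hb : b ≤ b') :
    Profile p M' a' b' :=
  ⟨h.meas, fun y => (h.bound y).trans hM, fun y hy => h.supp y <| by
    rcases hy with hy | hy
    exacts [Or.inl (hy.trans_le ha), Or.inr (hb.trans hy)]⟩

theorem add (h : Profile p M a b) (h' : Profile q M' a' b') :
    Profile (p + q) (M + M') (min a a') (max b b') :=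
  ⟨h.meas.add h'.meas, fun y => (abs_add_le _ _).trans (add_le_add (h.bound y) (h'.bound y)),
    fun y hy => by
      have h1 : p y = 0 := h.supp y (by
        rcases hy with hy | hy
        exacts [Or.inl (hy.trans_le (min_le_left _ _)), Or.inr ((le_max_left _ _).trans hy)])
      have h2 : q y = 0 := h'.supp y (by
        rcases hy with hy | hy
        exacts [Or.inl (hy.trans_le (min_le_right _ _)), Or.inr ((le_max_right _ _).trans hy)])
      simp [h1, h2]⟩

theorem smul (h : Profile p M a b) (c : ℝ) : Profile (c • p) (|c| * M) a b :=
  ⟨h.meas.const_smul c, fun y => by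
    rw [Pi.smul_apply, smul_eq_mul, abs_mul]
    exact mul_le_mul_of_nonneg_left (h.bound y) (abs_nonneg c),
    fun y hy => by simp [h.supp y hy]⟩

theorem lineShift (h : Profile p M a b) (r : ℝ) :
    Profile (lineShift r p) M (a + r) (b + r) :=
  ⟨h.meas.comp (measurable_id.sub_const r), fun y => h.bound _, fun y hy => h.supp _ <| by
    rcases hy with hy | hy
    exacts [Or.inl (by linarith), Or.inr (by linarith)]⟩

theorem indicator (hp : Measurable p) (hM : 0 ≤ M) (h : ∀ y, a ≤ y → y < b → |p y| ≤ M) :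
    Profile (Set.indicator (Set.Ico a b) p) M a b :=
  ⟨hp.indicator measurableSet_Ico, fun y => by
    by_cases hy : y ∈ Set.Ico a b
    · rw [Set.indicator_of_mem hy]; exact h y hy.1 hy.2
    · rw [Set.indicator_of_notMem hy, abs_zero]; exact hM,
    fun y hy => Set.indicator_of_notMem (fun h' => by
      rcases hy with hy | hy
      exacts [absurd h'.1 (not_le.2 hy), absurd h'.2 (not_lt.2 hy)]) _⟩

end Profile

/-- A function that is a profile for some parameters. -/
def IsProfile (p : ℝ → ℝ) : Prop := ∃ M a b, Profile p M a b

namespace IsProfile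

variable {p q : ℝ → ℝ}

theorem add (h : IsProfile p) (h' : IsProfile q) : IsProfile (p + q) := by
  obtain ⟨_, _, _, h⟩ := h
  obtain ⟨_, _, _, h'⟩ := h'
  exact ⟨_, _, _, h.add h'⟩

theorem smul (h : IsProfile p) (c : ℝ) : IsProfile (c • p) := by
  obtain ⟨_, _, _, h⟩ := h
  exact ⟨_, _, _, h.smul c⟩

theorem lineShift (h : IsProfile p) (r : ℝ) : IsProfile (lineShift r p) := by
  obtain ⟨_, _, _, h⟩ := h
  exact ⟨_, _, _, h.lineShift r⟩

theorem zero : IsProfile 0 := ⟨0, 0, 0, measurable_const, by simp, by simp⟩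

end IsProfile

/-- Measurable functions of at most linear growth. -/
def Tempered (p : ℝ → ℝ) : Prop := Measurable p ∧ ∃ A : ℝ, ∀ y, |p y| ≤ A * (1 + |y|)

theorem Tempered.indicator {p : ℝ → ℝ} (h : Tempered p) (a b : ℝ) :
    IsProfile (Set.indicator (Set.Ico a b) p) := by
  obtain ⟨hp, A, hA⟩ := h
  have hA0 : 0 ≤ A := by simpa using (abs_nonneg _).trans (hA 0)
  refine ⟨A * (1 + (|a| + |b|)), a, b, Profile.indicator hp (by positivity) fun y h1 h2 => ?_⟩
  refine (hA y).trans (mul_le_mul_of_nonneg_left ?_ hA0)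
  have : |y| ≤ |a| + |b| := abs_le.2
    ⟨by linarith [neg_abs_le a, abs_nonneg b], by linarith [le_abs_self b, abs_nonneg a]⟩
  linarith

theorem Tempered.add {p q : ℝ → ℝ} (h : Tempered p) (h' : Tempered q) : Tempered (p + q) := by
  obtain ⟨hp, A, hA⟩ := h
  obtain ⟨hq, B, hB⟩ := h'
  refine ⟨hp.add hq, A + B, fun y => (abs_add_le _ _).trans ?_⟩
  rw [add_mul]
  exact add_le_add (hA y) (hB y)

theorem Tempered.smul {p : ℝ → ℝ} (h : Tempered p) (c : ℝ) : Tempered (c • p) := by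
  obtain ⟨hp, A, hA⟩ := h
  refine ⟨hp.const_smul c, |c| * A, fun y => ?_⟩
  rw [Pi.smul_apply, smul_eq_mul, abs_mul, mul_assoc]
  exact mul_le_mul_of_nonneg_left (hA y) (abs_nonneg c)

theorem Tempered.lineShift {p : ℝ → ℝ} (h : Tempered p) (r : ℝ) : Tempered (lineShift r p) := by
  obtain ⟨hp, A, hA⟩ := h
  have hA0 : 0 ≤ A := by simpa using (abs_nonneg _).trans (hA 0)
  refine ⟨hp.comp (measurable_id.sub_const r), A * (1 + |r|), fun y => (hA _).trans ?_⟩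
  rw [mul_assoc]
  refine mul_le_mul_of_nonneg_left ?_ hA0
  nlinarith [abs_sub y r, abs_nonneg y, abs_nonneg r, mul_nonneg (abs_nonneg y) (abs_nonneg r)]

theorem IsProfile.tempered {p : ℝ → ℝ} (h : IsProfile p) : Tempered p := by
  obtain ⟨M, a, b, h⟩ := h
  exact ⟨h.meas, M, fun y => (h.bound y).trans
    (by nlinarith [h.nonneg, mul_nonneg h.nonneg (abs_nonneg y)])⟩

/-- An isometric representation of `G` carrying an approximately equivariant copy of
functions on `X × ℝ`, where `G` translates the line through the cocycle `ω`, such that profiles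
supported far to the left are almost exactly equivariant. -/
structure HalfLine (G X E : Type*) [Group G] [MulAction G X] [NormedAddCommGroup E]
    [InnerProductSpace ℂ E] (len : G → ℝ) where
  ρ : Representation ℂ G E
  norm_map : ∀ g φ, ‖ρ g φ‖ = ‖φ‖
  J : X → (ℝ → ℝ) → E
  ω : G → X → ℝ
  F : Finset G
  C : ℝ
  m : ℕ
  C_nonneg : 0 ≤ C
  ω_mul : ∀ g g' i, ω (g * g') i = ω g (g' • i) + ω g' i
  ω_le : ∀ g i, |ω g i| ≤ C * (1 + len g)
  J_add : ∀ i p q, IsProfile p → IsProfile q → J i (p + q) = J i p + J i q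
  J_smul : ∀ i (c : ℝ) p, IsProfile p → J i (c • p) = (c : ℂ) • J i p
  norm_J : ∀ i p M a b, a ≤ b → Profile p M a b → ‖J i p‖ ≤ C * M * (1 + (b - a))
  disp_J : ∀ i p M R, 1 ≤ R → Profile p M (-R) R → DispBounded ρ F (C * M * R ^ 3) (J i p)
  disp_sub : ∀ g i p M (k : ℕ), Profile p M (-(k : ℝ) - 1) (-(k : ℝ)) →
    DispBounded ρ F (C * M * (1 + len g) ^ m * ((1 + (k : ℝ)) ^ 3)⁻¹)
      (ρ g (J i p) - J (g • i) (lineShift (ω g i) p))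
  inner_eq_zero : ∀ g i j p q, IsProfile p → IsProfile q →
    (j ≠ g • i ∨ ∀ y, lineShift (ω g i) p y * q y = 0) → ⟪ρ g (J i p), J j q⟫_ℂ = 0
  t : G
  i₀ : X
  τ : ℝ
  τ_pos : 0 < τ
  t_smul : t • i₀ = i₀
  ω_t : ω t i₀ = τ
  ρ_t : ∀ p, IsProfile p → ρ t (J i₀ p) = J i₀ (lineShift τ p)
  J_ne_zero : J i₀ (Set.indicator (Set.Ico 0 τ) 1) ≠ 0

end HalfLine

section HalfLineHarmonic

open Filter Topology
open scoped InnerProductSpace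

namespace HalfLine

variable {G X E : Type*} [Group G] [MulAction G X] [NormedAddCommGroup E]
  [InnerProductSpace ℂ E] {len : G → ℝ} (A : HalfLine G X E len)

theorem J_zero (i : X) : A.J i 0 = 0 := by
  have := A.J_smul i 0 0 IsProfile.zero
  simpa using this

theorem J_sub {i : X} {p q : ℝ → ℝ} (hp : IsProfile p) (hq : IsProfile q) :
    A.J i (p - q) = A.J i p - A.J i q := by
  have h1 := A.J_smul i (-1) q hq
  have h2 := A.J_add i p _ hp (hq.smul (-1))
  have h3 : p + (-1 : ℝ) • q = p - q := by rw [neg_one_smul, sub_eq_add_neg]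
  rw [h3, h1] at h2
  rw [h2]; simp [sub_eq_add_neg]

theorem J_sum {i : X} {ι : Type*} (s : Finset ι) {p : ι → ℝ → ℝ} (hp : ∀ k, IsProfile (p k)) :
    A.J i (∑ k ∈ s, p k) = ∑ k ∈ s, A.J i (p k) ∧ IsProfile (∑ k ∈ s, p k) := by
  classical
  induction s using Finset.induction_on with
  | empty => simpa using ⟨A.J_zero i, IsProfile.zero⟩
  | insert a s ha ih =>
    rw [Finset.sum_insert ha, Finset.sum_insert ha]
    exact ⟨by rw [A.J_add i _ _ (hp a) ih.2, ih.1], (hp a).add ih.2⟩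

theorem ω_one (i : X) : A.ω 1 i = 0 := by
  have := A.ω_mul 1 1 i
  rw [mul_one, one_smul] at this
  linarith

/-- The reference vector: the image of the indicator function of a fundamental interval. -/
noncomputable def w : E := A.J A.i₀ (Set.indicator (Set.Ico 0 A.τ) 1)

theorem profile_w : Profile (Set.indicator (Set.Ico 0 A.τ) 1) 1 0 A.τ :=
  Profile.indicator measurable_const zero_le_one fun y _ _ => by simp

theorem inner_w_eq_zero {x : G} {i : X} {p : ℝ → ℝ} (hp : IsProfile p)
    (h : A.i₀ ≠ x • i ∨ ∀ y, -A.ω x i ≤ y → y < A.τ - A.ω x i → p y = 0) :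
    ⟪A.w, A.ρ x (A.J i p)⟫_ℂ = 0 := by
  rw [← inner_conj_symm, w, A.inner_eq_zero x i A.i₀ p _ hp ⟨_, _, _, A.profile_w⟩, map_zero]
  refine h.imp_right fun h y => ?_
  by_cases hy : y ∈ Set.Ico 0 A.τ
  · rw [lineShift, h _ (by linarith [hy.1]) (by linarith [hy.2]), zero_mul]
  · rw [Set.indicator_of_notMem hy, mul_zero]

/-- The pairing of the reference vector with the translate by `x` of the (possibly unbounded)
function `p` on the line over `i`. -/
noncomputable def pairing (x : G) (i : X) (p : ℝ → ℝ) : ℂ :=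
  ⟪A.w, A.ρ x (A.J i (Set.indicator (Set.Ico (-A.ω x i) (A.τ - A.ω x i)) p))⟫_ℂ

theorem inner_w_congr {x : G} {i : X} {p q : ℝ → ℝ} (hp : IsProfile p) (hq : IsProfile q)
    (h : ∀ y, -A.ω x i ≤ y → y < A.τ - A.ω x i → p y = q y) :
    ⟪A.w, A.ρ x (A.J i p)⟫_ℂ = ⟪A.w, A.ρ x (A.J i q)⟫_ℂ := by
  have hq' : IsProfile ((-1 : ℝ) • q) := hq.smul (-1)
  have h1 : IsProfile (p - q) := by
    have := hp.add hq'
    rwa [neg_one_smul, ← sub_eq_add_neg] at this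
  have h2 := A.inner_w_eq_zero (x := x) (i := i) h1
    (Or.inr fun y h1 h2 => by rw [Pi.sub_apply, h y h1 h2, sub_self])
  rw [A.J_sub hp hq, map_sub, inner_sub_right] at h2
  exact sub_eq_zero.1 h2

theorem pairing_eq_inner {x : G} {i : X} {p q : ℝ → ℝ} (hp : IsProfile p) (hq : Tempered q)
    (h : ∀ y, -A.ω x i ≤ y → y < A.τ - A.ω x i → p y = q y) :
    A.pairing x i q = ⟪A.w, A.ρ x (A.J i p)⟫_ℂ :=
  A.inner_w_congr (hq.indicator _ _) hp fun y h1 h2 => by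
    rw [Set.indicator_of_mem (show y ∈ Set.Ico _ _ from ⟨h1, h2⟩), h y h1 h2]

theorem pairing_add (x : G) (i : X) {p q : ℝ → ℝ} (hp : Tempered p) (hq : Tempered q) :
    A.pairing x i (p + q) = A.pairing x i p + A.pairing x i q := by
  rw [pairing, Set.indicator_add', A.J_add _ _ _ (hp.indicator _ _) (hq.indicator _ _), map_add,
    inner_add_right]
  rfl

theorem pairing_smul (x : G) (i : X) {p : ℝ → ℝ} (hp : Tempered p) (c : ℝ) :
    A.pairing x i (c • p) = c * A.pairing x i p := by
  have h1 : ∀ s : Set ℝ, s.indicator (c • p) = c • s.indicator p :=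
    fun s => by funext y; by_cases hy : y ∈ s <;> simp [hy]
  rw [pairing, h1, A.J_smul _ _ _ (hp.indicator _ _), map_smul,
    inner_smul_right]
  rfl

theorem norm_pairing_le {x : G} {i : X} {p : ℝ → ℝ} {M : ℝ} (hp : Measurable p) (hM : 0 ≤ M)
    (h : ∀ y, -A.ω x i ≤ y → y < A.τ - A.ω x i → |p y| ≤ M) :
    ‖A.pairing x i p‖ ≤ ‖A.w‖ * (A.C * M * (1 + A.τ)) := by
  refine (norm_inner_le_norm _ _).trans (mul_le_mul_of_nonneg_left ?_ (norm_nonneg _))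
  rw [A.norm_map]
  refine (A.norm_J i _ M _ _ (by linarith [A.τ_pos]) (Profile.indicator hp hM h)).trans
    (le_of_eq ?_)
  ring

/-- The truncated linear function `y ↦ (-y - r)⁺`. -/
noncomputable def ramp (r : ℝ) : ℝ → ℝ := fun y => max (-(y + r)) 0

theorem ramp_measurable (r : ℝ) : Measurable (ramp r) := by unfold ramp; fun_prop

theorem abs_ramp_le {r : ℝ} (hr : 0 ≤ r) (y : ℝ) : |ramp r y| ≤ |y| := by
  rw [ramp, abs_of_nonneg (le_max_right _ _)]
  exact max_le (by linarith [neg_abs_le y]) (abs_nonneg _)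

theorem ramp_tempered {r : ℝ} (hr : 0 ≤ r) : Tempered (ramp r) :=
  ⟨ramp_measurable r, 1, fun y => (abs_ramp_le hr y).trans (by linarith)⟩

theorem ramp_eq_zero {r : ℝ} (hr : 0 ≤ r) {y : ℝ} (hy : 0 ≤ y) : ramp r y = 0 :=
  max_eq_right (by linarith)

/-- The defect of linearity of the ramp function under a shift by `δ`. -/
noncomputable def kink (r δ : ℝ) : ℝ → ℝ :=
  fun y => ramp r y - ramp (r + δ) y - δ * Set.indicator (Set.Iio (-r)) 1 y

theorem kink_profile {r δ : ℝ} (hr : 0 ≤ r) :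
    Profile (kink r δ) (2 * |δ|) (-(1 + r + |δ|)) (1 + r + |δ|) := by
  refine ⟨?_, fun y => ?_, fun y hy => ?_⟩
  · exact ((ramp_measurable r).sub (ramp_measurable _)).sub
      ((measurable_one.indicator measurableSet_Iio).const_mul δ)
  · have h1 : |ramp r y - ramp (r + δ) y| ≤ |δ| := by
      have := abs_max_sub_max_le_abs (-(y + r)) (-(y + (r + δ))) 0
      have h2 : -(y + r) - -(y + (r + δ)) = δ := by ring
      rwa [h2] at this
    have h2 : |δ * Set.indicator (Set.Iio (-r)) 1 y| ≤ |δ| := by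
      rw [abs_mul]
      refine mul_le_of_le_one_right (abs_nonneg _) ?_
      by_cases hy : y ∈ Set.Iio (-r)
      · simp [Set.indicator_of_mem hy]
      · simp [Set.indicator_of_notMem hy]
    refine (abs_sub _ _).trans ?_
    linarith
  · simp only [kink, ramp]
    have h1 := neg_abs_le δ
    have h2 := le_abs_self δ
    rcases hy with hy | hy
    · rw [Set.indicator_of_mem (show y ∈ Set.Iio (-r) by simp only [Set.mem_Iio]; linarith),
        max_eq_left (by linarith), max_eq_left (by linarith), Pi.one_apply]
      ring
    · rw [Set.indicator_of_notMem (by simp only [Set.mem_Iio]; linarith),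
        max_eq_right (by linarith), max_eq_right (by linarith)]
      ring

theorem ramp_sub_lineShift (r r' ω : ℝ) : ramp r - lineShift ω (ramp r') =
    kink r (r' - ω - r) + (r' - ω - r) • Set.indicator (Set.Iio (-r)) 1 := by
  funext y
  have : lineShift ω (ramp r') y = ramp (r + (r' - ω - r)) y := by
    simp only [lineShift, ramp]; congr 1; ring
  simp only [Pi.sub_apply, Pi.add_apply, Pi.smul_apply, this, kink, smul_eq_mul]
  ring

theorem heaviside_tempered (r : ℝ) : Tempered (Set.indicator (Set.Iio (-r)) 1) :=
  ⟨measurable_one.indicator measurableSet_Iio, 1, fun y => by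
    by_cases hy : y ∈ Set.Iio (-r)
    · rw [Set.indicator_of_mem hy]; simp
    · rw [Set.indicator_of_notMem hy, abs_zero]; positivity⟩

/-- The defect of equivariance on the unit windows. -/
noncomputable def windowDefect (r : ℝ) (s : G) (i : X) (k : ℕ) : E :=
  A.ρ s (A.J i (Set.indicator (Set.Ico (-(k : ℝ) - 1) (-(k : ℝ))) (ramp r))) -
    A.J (s • i) (lineShift (A.ω s i)
      (Set.indicator (Set.Ico (-(k : ℝ) - 1) (-(k : ℝ))) (ramp r)))

theorem windowDefect_dispBounded {r : ℝ} (hr : 0 ≤ r) (s : G) (i : X) (k : ℕ)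
    (hlen : 0 ≤ len s) :
    DispBounded A.ρ A.F (A.C * (1 + len s) ^ A.m * ((1 + (k : ℝ)) ^ 2)⁻¹)
      (A.windowDefect r s i k) := by
  have h1 : Profile (Set.indicator (Set.Ico (-(k : ℝ) - 1) (-(k : ℝ))) (ramp r)) (1 + k)
      (-(k : ℝ) - 1) (-(k : ℝ)) := by
    refine Profile.indicator (ramp_measurable r) (by positivity) fun y h1 h2 =>
      (abs_ramp_le hr y).trans (abs_le.2 ⟨by linarith, ?_⟩)
    have : (0 : ℝ) ≤ k := Nat.cast_nonneg k
    linarith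
  refine (A.disp_sub s i _ _ k h1).mono (le_of_eq ?_)
  have : (1 + (k : ℝ)) ≠ 0 := by positivity
  field_simp

theorem indicator_eq_sum_windows (p : ℝ → ℝ) (N : ℕ) :
    Set.indicator (Set.Ico (-(N : ℝ)) 0) p =
      ∑ k ∈ Finset.range N, Set.indicator (Set.Ico (-(k : ℝ) - 1) (-(k : ℝ))) p := by
  induction N with
  | zero => funext y; simp
  | succ N ih =>
    have h1 : Disjoint (Set.Ico (-(N : ℝ)) 0) (Set.Ico (-(N : ℝ) - 1) (-(N : ℝ))) := by
      rw [Set.disjoint_left]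
      intro y h1 h2
      linarith [h1.1, h2.2]
    have h2 := Set.indicator_union_of_disjoint h1 p
    rw [Set.union_comm, Set.Ico_union_Ico_eq_Ico (by linarith) (by simp)] at h2
    rw [Finset.sum_range_succ, ← ih]
    push_cast
    rw [neg_add']
    exact h2

theorem sum_windowDefect {r : ℝ} (hr : 0 ≤ r) (s : G) (i : X) (N : ℕ) :
    ∑ k ∈ Finset.range N, A.windowDefect r s i k =
      A.ρ s (A.J i (Set.indicator (Set.Ico (-(N : ℝ)) 0) (ramp r))) -
        A.J (s • i) (lineShift (A.ω s i) (Set.indicator (Set.Ico (-(N : ℝ)) 0) (ramp r))) := by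
  have h1 : ∀ k : ℕ, IsProfile (Set.indicator (Set.Ico (-(k : ℝ) - 1) (-(k : ℝ))) (ramp r)) :=
    fun k => (ramp_tempered hr).indicator _ _
  have h2 : lineShift (A.ω s i) (∑ k ∈ Finset.range N,
      Set.indicator (Set.Ico (-(k : ℝ) - 1) (-(k : ℝ))) (ramp r)) = ∑ k ∈ Finset.range N,
      lineShift (A.ω s i) (Set.indicator (Set.Ico (-(k : ℝ) - 1) (-(k : ℝ))) (ramp r)) := by
    funext y; simp [lineShift]
  rw [indicator_eq_sum_windows, h2, (A.J_sum _ h1).1,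
    (A.J_sum _ fun k => (h1 k).lineShift _).1, map_sum, ← Finset.sum_sub_distrib]
  rfl

theorem summable_inv_sq : Summable fun k : ℕ => ((1 + (k : ℝ)) ^ 2)⁻¹ := by
  have := (summable_nat_add_iff 1).2 (Real.summable_nat_pow_inv.2 (show 1 < 2 by norm_num))
  refine this.congr fun k => ?_
  push_cast; ring_nf

end HalfLine

end HalfLineHarmonic

section HalfLineMain

open Filter Topology
open scoped InnerProductSpace

namespace HalfLine

variable {G X E : Type*} [Group G] [MulAction G X] [Fintype X] [NormedAddCommGroup E]
  [InnerProductSpace ℂ E] [CompleteSpace E] {len : G → ℝ} (A : HalfLine G X E len)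

/-- The pairing of the reference vector with the ramp functions. -/
noncomputable def rampPairing (r : X → ℝ) (x : G) : ℂ := ∑ i, A.pairing x i (ramp (r i))

theorem exists_defect {r : X → ℝ} (hr : ∀ i, 0 ≤ r i) (hlen : ∀ g, 0 ≤ len g) :
    ∃ K : ℝ, 0 ≤ K ∧ ∀ s : G, ∃ e : E, DispBounded A.ρ A.F (K * (1 + len s) ^ (A.m + 4)) e ∧
      ∀ x : G, A.rampPairing r x - A.rampPairing r (x * s) = ⟪A.w, A.ρ x e⟫_ℂ +
        ∑ j, ((r (s⁻¹ • j) - A.ω s (s⁻¹ • j) - r j : ℝ) : ℂ) *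
          A.pairing x j (Set.indicator (Set.Iio (-(r j))) 1) := by
  classical
  set Z : ℝ := ∑' k : ℕ, ((1 + (k : ℝ)) ^ 2)⁻¹ with hZ
  have hZ0 : 0 ≤ Z := tsum_nonneg fun k => by positivity
  set R : ℝ := ∑ i, r i with hR
  have hR0 : 0 ≤ R := Finset.sum_nonneg fun i _ => hr i
  have hrR : ∀ i, r i ≤ R := fun i => Finset.single_le_sum (fun i _ => hr i) (Finset.mem_univ i)
  have hC := A.C_nonneg
  set L : ℝ := 1 + 3 * R + A.C with hL
  have hL1 : 1 ≤ L := by rw [hL]; linarith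
  set K₁ : ℝ := A.C * (2 * L) * L ^ 3 with hK₁
  have hK₁0 : 0 ≤ K₁ := by positivity
  refine ⟨Fintype.card X * (K₁ + A.C * Z), by positivity, fun s => ?_⟩
  have hl := hlen s
  set δ : X → ℝ := fun j => r (s⁻¹ • j) - A.ω s (s⁻¹ • j) - r j with hδ
  have hδle : ∀ j, |δ j| + 1 + r j ≤ L * (1 + len s) := by
    intro j
    have h1 : |δ j| ≤ r (s⁻¹ • j) + |A.ω s (s⁻¹ • j)| + r j := by
      refine (abs_sub _ _).trans ?_
      refine (add_le_add_left (abs_sub _ _) _).trans ?_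
      rw [abs_of_nonneg (hr _), abs_of_nonneg (hr j)]
    have h2 := A.ω_le s (s⁻¹ • j)
    have h3 := hrR j
    have h4 := hrR (s⁻¹ • j)
    rw [hL]
    nlinarith [mul_nonneg hR0 hl]
  have hdef : ∀ i, Summable fun k => A.windowDefect (r i) s i k := by
    intro i
    refine Summable.of_norm_bounded ((summable_inv_sq.mul_left
      (2 * (A.F.card : ℝ) * (A.C * (1 + len s) ^ A.m)))) fun k => ?_
    refine ((A.windowDefect_dispBounded (hr i) s i k hl).norm_le A.norm_map
      (by positivity)).trans (le_of_eq ?_)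
    ring
  have hdefB : ∀ i, DispBounded A.ρ A.F (A.C * Z * (1 + len s) ^ (A.m + 4))
      (∑' k, A.windowDefect (r i) s i k) := by
    intro i
    refine (DispBounded.hasSum (fun k => A.windowDefect_dispBounded (hr i) s i k hl)
      (summable_inv_sq.hasSum.mul_left _) (hdef i).hasSum).mono ?_
    have h1 : (1 + len s) ^ A.m ≤ (1 + len s) ^ (A.m + 4) :=
      pow_le_pow_right₀ (by linarith) (by omega)
    have h2 : 0 ≤ A.C * Z := by positivity
    rw [← hZ]
    nlinarith [mul_le_mul_of_nonneg_left h1 h2]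
  have hkinkB : ∀ j, DispBounded A.ρ A.F (K₁ * (1 + len s) ^ (A.m + 4))
      (A.J j (kink (r j) (δ j))) := by
    intro j
    have h0 := abs_nonneg (δ j)
    have h1 := A.disp_J j _ _ _ (by linarith [hr j]) (kink_profile (δ := δ j) (hr j))
    refine h1.mono ?_
    have h2 := hδle j
    have h3 : (1 + r j + |δ j|) ^ 3 ≤ (L * (1 + len s)) ^ 3 :=
      pow_le_pow_left₀ (by linarith [hr j]) (by linarith) 3
    have h4 : 2 * |δ j| ≤ 2 * (L * (1 + len s)) := by linarith [hr j]
    have h5 : (1 + len s) ^ 4 ≤ (1 + len s) ^ (A.m + 4) :=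
      pow_le_pow_right₀ (by linarith) (by omega)
    calc A.C * (2 * |δ j|) * (1 + r j + |δ j|) ^ 3
        ≤ A.C * (2 * (L * (1 + len s))) * (L * (1 + len s)) ^ 3 := by
          have := hr j
          gcongr
      _ = K₁ * (1 + len s) ^ 4 := by rw [hK₁]; ring
      _ ≤ _ := mul_le_mul_of_nonneg_left h5 hK₁0
  refine ⟨∑ j, (A.J j (kink (r j) (δ j)) - ∑' k, A.windowDefect (r j) s j k), ?_, fun x => ?_⟩
  · refine (DispBounded.sum Finset.univ fun j _ => (hkinkB j).sub (hdefB j)).mono (le_of_eq ?_)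
    rw [Finset.sum_const, Finset.card_univ, nsmul_eq_mul]
    ring
  · have hkey : A.rampPairing r (x * s) =
        ∑ i, A.pairing x (s • i) (lineShift (A.ω s i) (ramp (r i))) +
          ⟪A.w, A.ρ x (∑ i, ∑' k, A.windowDefect (r i) s i k)⟫_ℂ := by
      have h1 : Tendsto (fun N : ℕ => ⟪A.w, A.ρ x (∑ i, ∑ k ∈ Finset.range N,
          A.windowDefect (r i) s i k)⟫_ℂ) atTop
          (𝓝 ⟪A.w, A.ρ x (∑ i, ∑' k, A.windowDefect (r i) s i k)⟫_ℂ) := by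
        have h2 : Tendsto (fun N : ℕ => ∑ i, ∑ k ∈ Finset.range N,
            A.windowDefect (r i) s i k) atTop (𝓝 (∑ i, ∑' k, A.windowDefect (r i) s i k)) :=
          tendsto_finsetSum _ fun i _ => (hdef i).hasSum.tendsto_sum_nat
        have h3 : Continuous (A.ρ x) := (isomCLM A.ρ A.norm_map x).continuous
        exact tendsto_const_nhds.inner ((h3.tendsto _).comp h2)
      have h2 : ∀ᶠ N : ℕ in atTop, ⟪A.w, A.ρ x (∑ i, ∑ k ∈ Finset.range N,
          A.windowDefect (r i) s i k)⟫_ℂ = A.rampPairing r (x * s) -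
          ∑ i, A.pairing x (s • i) (lineShift (A.ω s i) (ramp (r i))) := by
        obtain ⟨N₀, hN₀⟩ := exists_nat_ge (∑ i, |A.ω (x * s) i|)
        filter_upwards [eventually_ge_atTop N₀] with N hN
        have hN' : ∀ i, A.ω (x * s) i ≤ N := fun i => (le_abs_self _).trans
          ((Finset.single_le_sum (f := fun i => |A.ω (x * s) i|) (fun i _ => abs_nonneg _)
            (Finset.mem_univ i)).trans (hN₀.trans (by exact_mod_cast hN)))
        rw [rampPairing, ← Finset.sum_sub_distrib, map_sum, inner_sum]
        refine Finset.sum_congr rfl fun i _ => ?_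
        have hT := ramp_tempered (hr i)
        have hP := hT.indicator (-(N : ℝ)) 0
        rw [A.sum_windowDefect (hr i), map_sub, inner_sub_right]
        congr 1
        · rw [A.pairing_eq_inner hP hT, map_mul, Module.End.mul_apply]
          intro y hy1 hy2
          by_cases hy : y < 0
          · exact Set.indicator_of_mem (show y ∈ Set.Ico _ _ from ⟨by linarith [hN' i], hy⟩) _
          · rw [Set.indicator_of_notMem fun h => hy h.2, ramp_eq_zero (hr i) (not_lt.1 hy)]
        · rw [A.pairing_eq_inner (hP.lineShift _) (hT.lineShift _)]
          intro y hy1 hy2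
          have h4 := A.ω_mul x s i
          have h5 := hN' i
          simp only [lineShift]
          by_cases hy : y - A.ω s i < 0
          · exact Set.indicator_of_mem (show _ ∈ Set.Ico _ _ from ⟨by linarith, hy⟩) _
          · rw [Set.indicator_of_notMem fun h => hy h.2, ramp_eq_zero (hr i) (not_lt.1 hy)]
      have h3 := tendsto_nhds_unique (h1.congr' h2) tendsto_const_nhds
      rw [h3]; ring
    have hre : ∑ i, A.pairing x (s • i) (lineShift (A.ω s i) (ramp (r i))) =
        ∑ j, A.pairing x j (lineShift (A.ω s (s⁻¹ • j)) (ramp (r (s⁻¹ • j)))) := by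
      rw [← Equiv.sum_comp (MulAction.toPerm s) fun j =>
        A.pairing x j (lineShift (A.ω s (s⁻¹ • j)) (ramp (r (s⁻¹ • j))))]
      exact Finset.sum_congr rfl fun i _ => by simp
    have hterm : ∀ j, A.pairing x j (ramp (r j)) =
        A.pairing x j (lineShift (A.ω s (s⁻¹ • j)) (ramp (r (s⁻¹ • j)))) +
        ⟪A.w, A.ρ x (A.J j (kink (r j) (δ j)))⟫_ℂ +
        (δ j : ℂ) * A.pairing x j (Set.indicator (Set.Iio (-(r j))) 1) := by
      intro j
      have hk : IsProfile (kink (r j) (δ j)) := ⟨_, _, _, kink_profile (hr j)⟩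
      have h1 := ramp_sub_lineShift (r j) (r (s⁻¹ • j)) (A.ω s (s⁻¹ • j))
      have h2 := (ramp_tempered (hr (s⁻¹ • j))).lineShift (A.ω s (s⁻¹ • j))
      have h3 := heaviside_tempered (r j)
      rw [sub_eq_iff_eq_add'] at h1
      rw [h1, A.pairing_add x j h2 (hk.tempered.add (h3.smul _)),
        A.pairing_add x j hk.tempered (h3.smul _), A.pairing_smul x j h3,
        A.pairing_eq_inner hk hk.tempered fun _ _ _ => rfl, add_assoc]
    rw [hkey, hre, rampPairing, Finset.sum_congr rfl fun j _ => hterm j]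
    simp only [map_sum, inner_sum, map_sub, inner_sub_right, Finset.sum_sub_distrib,
      Finset.sum_add_distrib, hδ]
    ring

omit [Fintype X] [CompleteSpace E] in
theorem ω_t_pow (n : ℕ) : A.t ^ n • A.i₀ = A.i₀ ∧ A.ω (A.t ^ n) A.i₀ = n * A.τ := by
  induction n with
  | zero => simp [A.ω_one]
  | succ n ih =>
    rw [pow_succ, mul_smul, A.ω_mul, A.t_smul, A.ω_t]
    refine ⟨ih.1, ?_⟩
    rw [ih.2]; push_cast; ring

omit [Fintype X] [CompleteSpace E] in
theorem ω_t_inv_pow (n : ℕ) :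
    A.t⁻¹ ^ n • A.i₀ = A.i₀ ∧ A.ω (A.t⁻¹ ^ n) A.i₀ = -(n * A.τ) := by
  obtain ⟨h1, h2⟩ := A.ω_t_pow n
  have h3 : A.t⁻¹ ^ n • A.i₀ = A.i₀ := by rw [inv_pow, inv_smul_eq_iff, h1]
  refine ⟨h3, ?_⟩
  have h4 := A.ω_mul (A.t ^ n) (A.t⁻¹ ^ n) A.i₀
  rw [inv_pow, mul_inv_cancel, A.ω_one, ← inv_pow, h3, h2] at h4
  linarith

omit [Fintype X] [CompleteSpace E] in
theorem ρ_t_pow {p : ℝ → ℝ} (hp : IsProfile p) (n : ℕ) :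
    A.ρ (A.t ^ n) (A.J A.i₀ p) = A.J A.i₀ (lineShift (n * A.τ) p) := by
  induction n generalizing p with
  | zero =>
    have : lineShift 0 p = p := by funext y; simp [lineShift]
    simp [this]
  | succ n ih =>
    rw [pow_succ, map_mul, Module.End.mul_apply, A.ρ_t p hp, ih (hp.lineShift _)]
    congr 1
    funext y
    simp only [lineShift]
    congr 1
    push_cast; ring

omit [Fintype X] [CompleteSpace E] in
theorem inner_pow_w_eq_zero {g : G} (hg : g = A.t ∨ g = A.t⁻¹) {n : ℕ} (hn : n ≠ 0) :
    ⟪A.ρ (g ^ n) A.w, A.w⟫_ℂ = 0 := by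
  have hn' : (1 : ℝ) ≤ n := by exact_mod_cast Nat.one_le_iff_ne_zero.2 hn
  have hτ := A.τ_pos
  refine A.inner_eq_zero _ _ _ _ _ ⟨_, _, _, A.profile_w⟩ ⟨_, _, _, A.profile_w⟩
    (Or.inr fun y => ?_)
  by_cases hy : y ∈ Set.Ico 0 A.τ
  · have h1 : y - A.ω (g ^ n) A.i₀ ∉ Set.Ico 0 A.τ := by
      rcases hg with rfl | rfl
      · rw [(A.ω_t_pow n).2]
        intro h
        nlinarith [h.1, hy.2]
      · rw [(A.ω_t_inv_pow n).2]
        intro h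
        nlinarith [h.2, hy.1]
    rw [lineShift, Set.indicator_of_notMem h1, zero_mul]
  · rw [Set.indicator_of_notMem hy, mul_zero]

omit [Fintype X] [CompleteSpace E] in
theorem inner_pow_w_pow_w_eq_zero {g : G} (hg : g = A.t ∨ g = A.t⁻¹) (m n : ℕ) (hmn : m ≠ n) :
    ⟪A.ρ (g ^ m) A.w, A.ρ (g ^ n) A.w⟫_ℂ = 0 := by
  wlog hlt : n < m generalizing m n
  · rw [← inner_conj_symm, this n m hmn.symm (by omega), map_zero]
  obtain ⟨d, rfl⟩ := Nat.exists_eq_add_of_lt hlt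
  rw [show n + d + 1 = n + (d + 1) by ring, pow_add, map_mul, Module.End.mul_apply,
    inner_map_map_of_norm A.ρ A.norm_map]
  exact A.inner_pow_w_eq_zero hg (by omega)

omit [CompleteSpace E] in
theorem exists_rampPairing_t_pow {r : X → ℝ} (hr : ∀ i, 0 ≤ r i) :
    ∃ D : ℝ, ∀ n : ℕ,
      ‖A.rampPairing r (A.t ^ n) - n * ((A.τ : ℂ) * ⟪A.w, A.w⟫_ℂ)‖ ≤ D := by
  classical
  have hτ := A.τ_pos
  refine ⟨‖A.w‖ * (A.C * (A.τ + r A.i₀) * (1 + (A.τ - 0))), fun n => ?_⟩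
  obtain ⟨h1, h2⟩ := A.ω_t_pow n
  have h3 : A.rampPairing r (A.t ^ n) = A.pairing (A.t ^ n) A.i₀ (ramp (r A.i₀)) := by
    refine Finset.sum_eq_single A.i₀ (fun i _ hi => ?_) (by simp)
    refine A.inner_w_eq_zero ((ramp_tempered (hr i)).indicator _ _) (Or.inl fun h => hi ?_)
    nth_rewrite 1 [← h1] at h
    exact (smul_left_cancel _ h).symm
  have hT := ramp_tempered (hr A.i₀)
  have hP := hT.indicator (-(n * A.τ)) (A.τ - n * A.τ)
  have h4 : A.pairing (A.t ^ n) A.i₀ (ramp (r A.i₀)) = ⟪A.w, A.J A.i₀ (lineShift (n * A.τ)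
      (Set.indicator (Set.Ico (-(n * A.τ)) (A.τ - n * A.τ)) (ramp (r A.i₀))))⟫_ℂ := by
    rw [pairing, h2, A.ρ_t_pow hP]
  have h5 : (n : ℂ) * ((A.τ : ℂ) * ⟪A.w, A.w⟫_ℂ) =
      ⟪A.w, A.J A.i₀ (((n : ℝ) * A.τ) • Set.indicator (Set.Ico 0 A.τ) 1)⟫_ℂ := by
    rw [A.J_smul _ _ _ ⟨_, _, _, A.profile_w⟩, inner_smul_right, ← mul_assoc]
    push_cast
    rfl
  have hQ : IsProfile (((n : ℝ) * A.τ) • Set.indicator (Set.Ico 0 A.τ) (1 : ℝ → ℝ)) :=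
    IsProfile.smul ⟨_, _, _, A.profile_w⟩ _
  rw [h3, h4, h5, ← inner_sub_right, ← A.J_sub (hP.lineShift _) hQ]
  refine (norm_inner_le_norm _ _).trans (mul_le_mul_of_nonneg_left ?_ (norm_nonneg _))
  refine A.norm_J _ _ _ _ _ hτ.le ?_
  refine ⟨?_, fun y => ?_, fun y hy => ?_⟩
  · obtain ⟨_, _, _, hP'⟩ := hP.lineShift (n * A.τ)
    obtain ⟨_, _, _, hQ'⟩ := hQ
    exact hP'.meas.sub hQ'.meas
  · simp only [Pi.sub_apply, Pi.smul_apply, lineShift, smul_eq_mul]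
    have hr0 := hr A.i₀
    by_cases hy : y ∈ Set.Ico 0 A.τ
    · rw [Set.indicator_of_mem hy, Set.indicator_of_mem
        (show y - n * A.τ ∈ Set.Ico _ _ from ⟨by linarith [hy.1], by linarith [hy.2]⟩), ramp,
        Pi.one_apply, mul_one]
      have hn0 : 0 ≤ n * A.τ := by positivity
      have hy1 := hy.1
      have hy2 := hy.2
      rcases max_cases (-(y - n * A.τ + r A.i₀)) 0 with ⟨h, h'⟩ | ⟨h, h'⟩ <;>
        rw [h, abs_le] <;> constructor <;> linarith
    · rw [Set.indicator_of_notMem hy, Set.indicator_of_notMem]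
      · simp only [mul_zero, sub_zero, abs_zero]; positivity
      · exact fun h => hy ⟨by linarith [h.1], by linarith [h.2]⟩
  · simp only [Pi.sub_apply, Pi.smul_apply, lineShift, smul_eq_mul]
    have hy' : y ∉ Set.Ico 0 A.τ := fun h => by
      rcases hy with hy | hy
      exacts [absurd h.1 (not_le.2 hy), absurd h.2 (not_lt.2 hy)]
    rw [Set.indicator_of_notMem hy', Set.indicator_of_notMem]
    · simp
    · exact fun h => hy' ⟨by linarith [h.1], by linarith [h.2]⟩

omit [CompleteSpace E] in
theorem rampPairing_t_inv_pow {r : X → ℝ} (hr : ∀ i, 0 ≤ r i) (n : ℕ) :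
    A.rampPairing r (A.t⁻¹ ^ n) = 0 := by
  obtain ⟨h1, h2⟩ := A.ω_t_inv_pow n
  refine Finset.sum_eq_zero fun i _ => ?_
  refine A.inner_w_eq_zero ((ramp_tempered (hr i)).indicator _ _) ?_
  by_cases hi : i = A.i₀
  · subst hi
    refine Or.inr fun y hy _ => ?_
    rw [h2, neg_neg] at hy
    have : 0 ≤ n * A.τ := by have := A.τ_pos; positivity
    rw [Set.indicator_apply, ramp_eq_zero (hr _) (this.trans hy), ite_self]
  · refine Or.inl fun h => hi ?_
    nth_rewrite 1 [← h1] at h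
    exact (smul_left_cancel _ h).symm

end HalfLine

variable {G X E : Type*} [Group G] [MulAction G X] [Fintype X] [Nonempty X]
  [MulAction.IsPretransitive G X] [NormedAddCommGroup E]
  [InnerProductSpace ℂ E] [CompleteSpace E] {S : Finset G} {μ : G → ℝ}

/-- A half-line system is incompatible with finite-dimensionality of the spaces of harmonic
functions of polynomial growth. -/
theorem HalfLine.elim {ℓ : G → ℝ} (hℓ : ∀ g, ℓ g = wordLen (S : Set G) g)
    (A : HalfLine G X E ℓ)
    (h : Courteous S μ) {k : ℕ} (hk : 1 ≤ k) {W : Submodule ℂ (G → ℂ)} [FiniteDimensional ℂ W]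
    (hW : HFk (S : Set G) μ k ⊆ (W : Set (G → ℂ))) : False := by
  classical
  have hC := A.C_nonneg
  have hτ := A.τ_pos
  have hℓ0 : ∀ g, 0 ≤ ℓ g := fun g => by rw [hℓ]; exact Nat.cast_nonneg _
  obtain ⟨r, hr, hδ⟩ := h.exists_drift_corrector A.ω_mul fun g i => by
    rw [← hℓ]; exact A.ω_le g i
  obtain ⟨K, hK, he⟩ := A.exists_defect hr hℓ0
  choose e heB hee using he
  have hen : ∀ s, ‖e s‖ ≤ (2 * A.F.card * K) * (1 + ℓ s) ^ (A.m + 4) := fun s =>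
    ((heB s).norm_le A.norm_map (mul_nonneg hK (by have := hℓ0 s; positivity))).trans
      (le_of_eq (by ring))
  have hes := h.summable_of_le_pow (by simpa only [hℓ] using hen)
  set e₀ := ∑' s, (μ s : ℂ) • e s with he₀
  have hKs : Summable fun s => ‖(μ s : ℂ)‖ * (K * (1 + ℓ s) ^ (A.m + 4)) := by
    refine ((h.summable_mul_pow (A.m + 4)).mul_left K).congr fun s => ?_
    rw [hℓ, Complex.norm_real, Real.norm_of_nonneg (h.nonneg s)]
    ring
  have he₀B : DispBounded A.ρ A.F (∑' s, ‖(μ s : ℂ)‖ * (K * (1 + ℓ s) ^ (A.m + 4))) e₀ :=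
    DispBounded.hasSum (fun s => (heB s).smul _) hKs.hasSum hes.hasSum
  have hwB : DispBounded A.ρ A.F (A.C * 1 * (1 + A.τ) ^ 3) A.w :=
    A.disp_J _ _ _ _ (by linarith) (A.profile_w.mono le_rfl (by linarith) (by linarith))
  set K₀ := max (∑' s, ‖(μ s : ℂ)‖ * (K * (1 + ℓ s) ^ (A.m + 4))) (A.C * 1 * (1 + A.τ) ^ 3)
  have hK₀ : 0 ≤ K₀ := le_max_of_le_right (by positivity)
  obtain ⟨U, C, hU, hUe, hUt⟩ := exists_corrector A.ρ A.norm_map h hK₀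
    (he₀B.mono (le_max_left _ _)) (hwB.mono (le_max_right _ _))
  set f₀ := A.rampPairing r with hf₀
  obtain ⟨C', hC'0, hf₀le⟩ : ∃ C' : ℝ, 0 ≤ C' ∧ ∀ x, ‖f₀ x‖ ≤ C' * (1 + ℓ x) := by
    refine ⟨∑ _i : X, ‖A.w‖ * (A.C * (A.C + A.τ) * (1 + A.τ)), by positivity, fun x => ?_⟩
    rw [Finset.sum_mul]
    refine (norm_sum_le _ _).trans (Finset.sum_le_sum fun i _ => ?_)
    have h1 := hℓ0 x
    have h2 := A.ω_le x i
    refine (A.norm_pairing_le (M := (A.C + A.τ) * (1 + ℓ x)) (ramp_measurable _) (by positivity)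
      fun y hy1 hy2 => (abs_ramp_le (hr i) y).trans ?_).trans (le_of_eq (by ring))
    rw [abs_le] at h2 ⊢
    have h3 := mul_nonneg hτ.le h1
    constructor <;> nlinarith [h2.1, h2.2]
  have hgrow : ∀ {g : G → ℂ} {B : ℝ}, (∀ x, ‖g x‖ ≤ B * (1 + ℓ x)) → ∀ x,
      Summable fun s => (μ s : ℂ) * g (x * s) := by
    intro g B hg x
    have hB : 0 ≤ B := by
      have h1 := (norm_nonneg _).trans (hg 1)
      have h2 := hℓ0 1
      by_contra! h3
      nlinarith
    refine h.summable_of_le_pow (C := B * (1 + ℓ x)) (m := 1) fun s => ?_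
    refine (hg _).trans ?_
    have h1 : ℓ (x * s) ≤ ℓ x + ℓ s := by
      simp only [hℓ]; exact_mod_cast h.wordLen_mul_le x s
    rw [pow_one, mul_assoc]
    refine mul_le_mul_of_nonneg_left ?_ hB
    have h2 := mul_nonneg (hℓ0 x) (hℓ0 s)
    simp only [hℓ] at h1 h2 ⊢
    nlinarith
  have hf₀e : ∀ x, f₀ x - ∑' s, (μ s : ℂ) * f₀ (x * s) = ⟪A.w, A.ρ x e₀⟫_ℂ := by
    intro x
    have h1 : HasSum (fun s => (μ s : ℂ) * f₀ x) (1 * f₀ x) := by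
      refine HasSum.mul_right _ ?_
      have := Complex.hasSum_ofReal.2 h.hasSum
      simpa using this
    have h2 := h1.sub (hgrow hf₀le x).hasSum
    rw [one_mul] at h2
    have h3 : HasSum (fun s => (μ s : ℂ) * ⟪A.w, A.ρ x (e s)⟫_ℂ) ⟪A.w, A.ρ x e₀⟫_ℂ := by
      rw [inner_map_eq_inv A.ρ A.norm_map]
      have h4 := (innerSL ℂ (A.ρ x⁻¹ A.w)).hasSum hes.hasSum
      refine h4.congr_fun fun s => ?_
      rw [innerSL_apply_apply, inner_smul_right, inner_map_eq_inv A.ρ A.norm_map]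
    have h4 : HasSum (fun s => ∑ j, ((μ s * (r (s⁻¹ • j) - A.ω s (s⁻¹ • j) - r j) : ℝ) : ℂ) *
        A.pairing x j (Set.indicator (Set.Iio (-(r j))) 1)) (∑ _j : X, 0) := by
      refine hasSum_sum fun j _ => ?_
      have := (Complex.hasSum_ofReal.2 (hδ j)).mul_right
        (A.pairing x j (Set.indicator (Set.Iio (-(r j))) 1))
      simpa using this
    have h5 := h3.add h4
    rw [Finset.sum_const_zero, add_zero] at h5
    refine h2.unique (h5.congr_fun fun s => ?_)
    rw [← mul_sub, hee s x, mul_add, Finset.mul_sum]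
    congr 1
    refine Finset.sum_congr rfl fun j _ => ?_
    push_cast; ring
  obtain ⟨D₁, hD₁⟩ := A.exists_rampPairing_t_pow hr
  obtain ⟨D₂, hD₂⟩ := hUt A.t (A.inner_pow_w_pow_w_eq_zero (Or.inr rfl))
  obtain ⟨D₃, hD₃⟩ := hUt A.t⁻¹ (by
    rw [inv_inv]; exact A.inner_pow_w_pow_w_eq_zero (Or.inl rfl))
  have hD₁0 : 0 ≤ D₁ := (norm_nonneg _).trans (hD₁ 0)
  have hpos : ∀ {D : ℝ} {z : ℂ} {n : ℕ}, ‖z‖ ≤ D * (1 + √n) → 0 ≤ D := by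
    intro D z n hz
    have h1 := (norm_nonneg _).trans hz
    have h2 := Real.sqrt_nonneg (n : ℝ)
    by_contra! h3
    nlinarith
  have hD₂0 := hpos (hD₂ 0)
  have hD₃0 := hpos (hD₃ 0)
  have hw0 : ⟪A.w, A.w⟫_ℂ ≠ 0 := inner_self_ne_zero.2 A.J_ne_zero
  have hf₀le' := hf₀le
  simp only [hℓ] at hf₀le'
  refine h.false_of_halfLinear hk hW (f := fun x => f₀ x - U x) (C := C' + C)
    (D := D₁ + D₂ + D₃) (c := A.τ * ⟪A.w, A.w⟫_ℂ) (fun x => ?_) (fun x => ?_)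
    (mul_ne_zero (by exact_mod_cast hτ.ne') hw0) A.t (fun n => ?_) fun n => ?_
  · simp only [mul_sub]
    rw [(hgrow hf₀le x).tsum_sub (hgrow (fun x => by rw [hℓ]; exact hU x) x)]
    linear_combination hf₀e x - hUe x
  · refine (norm_sub_le _ _).trans ?_
    rw [add_mul]
    exact add_le_add (hf₀le' x) (hU x)
  · have h1 := Real.sqrt_nonneg (n : ℝ)
    rw [sub_right_comm]
    refine (norm_sub_le _ _).trans ((add_le_add (hD₁ n) (hD₂ n)).trans ?_)
    nlinarith [mul_nonneg hD₁0 h1, mul_nonneg hD₃0 h1]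
  · have h1 := Real.sqrt_nonneg (n : ℝ)
    rw [hf₀, A.rampPairing_t_inv_pow hr, zero_sub, norm_neg]
    refine (hD₃ n).trans (mul_le_mul_of_nonneg_right (by linarith) (by linarith))

end HalfLineMain

section Induction

open scoped InnerProductSpace

variable {G : Type*} [Group G] (H : Subgroup G)

/-- The Schreier cocycle of a subgroup, with respect to a choice of coset representatives. -/
noncomputable def schreierCocycle (g : G) (j : G ⧸ H) : H :=
  ⟨(g • j).out⁻¹ * g * j.out, by
    rw [mul_assoc, ← QuotientGroup.eq, QuotientGroup.out_eq', ← smul_eq_mul,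
      ← MulAction.Quotient.smul_mk, QuotientGroup.out_eq']⟩

theorem coe_schreierCocycle (g : G) (j : G ⧸ H) :
    (schreierCocycle H g j : G) = (g • j).out⁻¹ * g * j.out := rfl

theorem schreierCocycle_mul (g g' : G) (j : G ⧸ H) :
    schreierCocycle H (g * g') j = schreierCocycle H g (g' • j) * schreierCocycle H g' j := by
  ext
  simp only [Subgroup.coe_mul, coe_schreierCocycle, mul_smul]
  group

theorem schreierCocycle_one (j : G ⧸ H) : schreierCocycle H 1 j = 1 := by
  ext
  simp [coe_schreierCocycle]

theorem out_conj_smul (j : G ⧸ H) (h : H) : (j.out * h * j.out⁻¹) • j = j := by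
  conv_lhs => rw [← QuotientGroup.out_eq' j, MulAction.Quotient.smul_mk, smul_eq_mul]
  conv_rhs => rw [← QuotientGroup.out_eq' j]
  rw [QuotientGroup.eq]
  simp

theorem schreierCocycle_conj (j : G ⧸ H) (h : H) :
    schreierCocycle H (j.out * h * j.out⁻¹) j = h := by
  ext
  rw [coe_schreierCocycle, out_conj_smul]
  group

variable {E : Type*} [NormedAddCommGroup E] [InnerProductSpace ℂ E]
  (π : Representation ℂ H E)

/-- The representation induced from a subgroup. -/
noncomputable def inducedRep : Representation ℂ G (PiLp 2 fun _ : G ⧸ H => E) where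
  toFun g :=
    { toFun := fun Φ => WithLp.toLp 2 fun j => π (schreierCocycle H g (g⁻¹ • j)) (Φ (g⁻¹ • j))
      map_add' := fun Φ Ψ => by ext j; simp
      map_smul' := fun c Φ => by ext j; simp }
  map_one' := by
    ext Φ j
    simp [schreierCocycle_one]
  map_mul' g g' := by
    ext Φ j
    simp [schreierCocycle_mul, mul_smul]

theorem inducedRep_apply (g : G) (Φ : PiLp 2 fun _ : G ⧸ H => E) (j : G ⧸ H) :
    inducedRep H π g Φ j = π (schreierCocycle H g (g⁻¹ • j)) (Φ (g⁻¹ • j)) := rfl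

variable [Fintype (G ⧸ H)] [DecidableEq (G ⧸ H)]

omit [Fintype (G ⧸ H)] in
theorem inducedRep_single (g : G) (j : G ⧸ H) (v : E) :
    inducedRep H π g (PiLp.single 2 j v) =
      PiLp.single 2 (g • j) (π (schreierCocycle H g j) v) := by
  ext i
  rw [inducedRep_apply]
  by_cases hi : i = g • j
  · subst hi
    rw [inv_smul_smul, PiLp.single_eq_same, PiLp.single_eq_same]
  · rw [PiLp.single_eq_of_ne _ hi, PiLp.single_eq_of_ne, map_zero]
    rwa [Ne, inv_smul_eq_iff]

variable {π} (hπ : ∀ g φ, ‖π g φ‖ = ‖φ‖)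

omit [DecidableEq (G ⧸ H)] in
include hπ in
theorem norm_inducedRep (g : G) (Φ : PiLp 2 fun _ : G ⧸ H => E) : ‖inducedRep H π g Φ‖ = ‖Φ‖ := by
  rw [← sq_eq_sq₀ (norm_nonneg _) (norm_nonneg _), PiLp.norm_sq_eq_of_L2, PiLp.norm_sq_eq_of_L2]
  simp only [inducedRep_apply, hπ]
  exact Equiv.sum_comp (MulAction.toPerm g⁻¹) fun j => ‖Φ j‖ ^ 2

theorem inner_piLp_single (j : G ⧸ H) (v : E) (Φ : PiLp 2 fun _ : G ⧸ H => E) :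
    ⟪PiLp.single 2 j v, Φ⟫_ℂ = ⟪v, Φ j⟫_ℂ := by
  rw [PiLp.inner_apply, Finset.sum_eq_single j]
  · rw [PiLp.single_eq_same]
  · intro i _ hi
    rw [PiLp.single_eq_of_ne _ hi, inner_zero_left]
  · simp

open Classical in
/-- The conjugates of a finite subset of `H` by the coset representatives. -/
noncomputable def conjFinset (F : Finset H) : Finset G :=
  Finset.univ.biUnion fun j : G ⧸ H => F.image fun h : H => j.out * (h : G) * j.out⁻¹

theorem DispBounded.single {F : Finset H} {K : ℝ} {v : E} (h : DispBounded π F K v) (hK : 0 ≤ K)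
    (j : G ⧸ H) : DispBounded (inducedRep H π) (conjFinset H F) K (PiLp.single 2 j v) := by
  classical
  intro Φ
  rw [inner_piLp_single]
  refine (h _).trans (mul_le_mul_of_nonneg_left ?_ hK)
  have hinj : Function.Injective fun h : H => j.out * (h : G) * j.out⁻¹ := fun a b hab => by
    ext; simpa using hab
  have h1 : displacement (inducedRep H π) (F.image fun h : H => j.out * (h : G) * j.out⁻¹) Φ ≤
      displacement (inducedRep H π) (conjFinset H F) Φ := by
    refine Finset.sum_le_sum_of_subset_of_nonneg ?_ fun _ _ _ => norm_nonneg _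
    exact Finset.subset_biUnion_of_mem (fun j : G ⧸ H => F.image fun h : H => j.out * (h : G) * j.out⁻¹)
      (Finset.mem_univ j)
  refine le_trans ?_ h1
  rw [displacement, displacement, Finset.sum_image hinj.injOn]
  refine Finset.sum_le_sum fun h _ => ?_
  have h2 := PiLp.norm_apply_le (inducedRep H π (j.out * h * j.out⁻¹) Φ - Φ) j
  rw [PiLp.sub_apply, inducedRep_apply] at h2
  rwa [show (j.out * (h : G) * j.out⁻¹)⁻¹ • j = j by rw [inv_smul_eq_iff, out_conj_smul],
    schreierCocycle_conj] at h2

variable {lenH : H → ℝ} {len : G → ℝ}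

/-- Induction of half-line systems from a subgroup of finite index. -/
noncomputable def HalfLine.induce (A : HalfLine H Unit E lenH) {D : ℝ} (hD : 0 ≤ D)
    (hlen : ∀ g j, lenH (schreierCocycle H g j) ≤ D * (1 + len g)) (hlenH : ∀ h, 0 ≤ lenH h)
    (hlen0 : ∀ g, 0 ≤ len g) :
    HalfLine G (G ⧸ H) (PiLp 2 fun _ : G ⧸ H => E) len :=
  have hC := A.C_nonneg
  have hone : (1 : ℝ) ≤ (1 + D) ^ (A.m + 1) := one_le_pow₀ (by linarith)
  have hCle : A.C ≤ A.C * (1 + D) ^ (A.m + 1) := le_mul_of_one_le_right hC hone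
  have hlen1 : ∀ g j, 1 + lenH (schreierCocycle H g j) ≤ (1 + D) * (1 + len g) := fun g j => by
    have := hlen g j
    have := hlen0 g
    linarith
  { ρ := inducedRep H A.ρ
    norm_map := norm_inducedRep H A.norm_map
    J := fun j p => PiLp.single 2 j (A.J () p)
    ω := fun g j => A.ω (schreierCocycle H g j) ()
    F := conjFinset H A.F
    C := A.C * (1 + D) ^ (A.m + 1)
    m := A.m
    C_nonneg := by positivity
    ω_mul := fun g g' j => by rw [schreierCocycle_mul, A.ω_mul]
    ω_le := fun g j => by
      refine (A.ω_le _ _).trans ?_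
      have h1 := mul_le_mul_of_nonneg_left (hlen1 g j) hC
      have h2 : A.C * (1 + D) ≤ A.C * (1 + D) ^ (A.m + 1) :=
        mul_le_mul_of_nonneg_left (le_self_pow₀ (by linarith) (by omega)) hC
      have h3 := mul_le_mul_of_nonneg_right h2 (show 0 ≤ 1 + len g by linarith [hlen0 g])
      linarith
    J_add := fun j p q hp hq => by rw [A.J_add _ _ _ hp hq, PiLp.single_add]
    J_smul := fun j c p hp => by
      rw [A.J_smul _ _ _ hp]
      ext i
      by_cases hi : i = j
      · subst hi
        rw [PiLp.smul_apply, PiLp.single_eq_same, PiLp.single_eq_same]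
      · rw [PiLp.smul_apply, PiLp.single_eq_of_ne _ hi, PiLp.single_eq_of_ne _ hi, smul_zero]
    norm_J := fun j p M a b hab hp => by
      rw [PiLp.norm_single]
      refine (A.norm_J _ _ _ _ _ hab hp).trans ?_
      have := hp.nonneg
      have : 0 ≤ b - a := by linarith
      gcongr
    disp_J := fun j p M R hR hp => by
      have := hp.nonneg
      refine ((A.disp_J () p M R hR hp).single H (by positivity) j).mono ?_
      gcongr
    disp_sub := fun g j p M k hp => by
      have hM := hp.nonneg
      have h1 := A.disp_sub (schreierCocycle H g j) () p M k hp
      have h0 := hlen0 g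
      have h00 := hlenH (schreierCocycle H g j)
      have h2 := (h1.single H (by positivity) (g • j))
      rw [inducedRep_single, ← PiLp.single_sub]
      refine h2.mono ?_
      have h3 : A.C * (1 + lenH (schreierCocycle H g j)) ^ A.m ≤
          A.C * (1 + D) ^ (A.m + 1) * (1 + len g) ^ A.m := by
        rw [mul_assoc]
        refine mul_le_mul_of_nonneg_left ?_ hC
        calc (1 + lenH (schreierCocycle H g j)) ^ A.m ≤ ((1 + D) * (1 + len g)) ^ A.m :=
              pow_le_pow_left₀ (by linarith) (hlen1 g j) _
          _ = (1 + D) ^ A.m * (1 + len g) ^ A.m := mul_pow _ _ _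
          _ ≤ _ := by
            gcongr
            · linarith
            · omega
      have h4 : 0 ≤ M * ((1 + (k : ℝ)) ^ 3)⁻¹ := by positivity
      nlinarith [mul_le_mul_of_nonneg_right h3 h4]
    inner_eq_zero := fun g i j p q hp hq h => by
      rw [inducedRep_single, inner_piLp_single]
      by_cases hj : j = g • i
      · subst hj
        rw [PiLp.single_eq_same]
        exact A.inner_eq_zero _ () () p q hp hq (Or.inr (h.resolve_left fun h => h rfl))
      · rw [PiLp.single_eq_of_ne _ fun h => hj h.symm, inner_zero_right]
    t := ((1 : G) : G ⧸ H).out * A.t * ((1 : G) : G ⧸ H).out⁻¹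
    i₀ := ((1 : G) : G ⧸ H)
    τ := A.τ
    τ_pos := A.τ_pos
    t_smul := out_conj_smul H _ _
    ω_t := by rw [schreierCocycle_conj]; exact A.ω_t
    ρ_t := fun p hp => by
      rw [inducedRep_single, schreierCocycle_conj, out_conj_smul]
      congr 1
      exact A.ρ_t p hp
    J_ne_zero := fun h => A.J_ne_zero (by rwa [PiLp.single_eq_zero_iff] at h) }

variable {S : Finset G} {μ : G → ℝ}

omit [DecidableEq (G ⧸ H)] in
/-- The word length of the Schreier cocycle is controlled by the word length of the group. -/
theorem Courteous.exists_schreierCocycle_le (h : Courteous S μ) {T : Finset H}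
    (hT : Subgroup.closure (T : Set H) = ⊤) (hTinv : ∀ s ∈ T, s⁻¹ ∈ T) :
    ∃ D : ℝ, 0 ≤ D ∧ ∀ g j, (wordLen (T : Set H) (schreierCocycle H g j) : ℝ) ≤
      D * (1 + (wordLen (S : Set G) g : ℝ)) := by
  set q : G → ℝ := fun g => ∑ j, (wordLen (T : Set H) (schreierCocycle H g j) : ℝ) with hq
  have hq0 : ∀ g, 0 ≤ q g := fun g => Finset.sum_nonneg fun _ _ => Nat.cast_nonneg _
  have hTmul : ∀ x y : H, wordLen (T : Set H) (x * y) ≤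
      wordLen (T : Set H) x + wordLen (T : Set H) y := by
    intro x y
    obtain ⟨l, hl, hn, hx⟩ := exists_list_wordLen hT hTinv x
    obtain ⟨l', hl', hn', hy⟩ := exists_list_wordLen hT hTinv y
    rw [← hn, ← hn', ← List.length_append]
    refine (wordLen_le_length (l := l ++ l') ?_).trans' (by rw [List.prod_append, hx, hy])
    intro s hs
    exact (List.mem_append.1 hs).elim (hl s) (hl' s)
  have hone : wordLen (T : Set H) 1 = 0 := by
    have := wordLen_le_length (S := (T : Set H)) (l := []) (by simp)
    simpa using this
  refine ⟨∑ s ∈ S, q s, Finset.sum_nonneg fun s _ => hq0 s, fun g j => ?_⟩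
  have h1 := h.le_mul_wordLen (q := q) (C := ∑ s ∈ S, q s) (by
      simp [hq, schreierCocycle_one, hone]) (fun x y => by
      have h2 : q x = ∑ j, (wordLen (T : Set H) (schreierCocycle H x (y • j)) : ℝ) :=
        (Equiv.sum_comp (MulAction.toPerm y) fun j =>
          (wordLen (T : Set H) (schreierCocycle H x j) : ℝ)).symm
      rw [h2, hq, ← Finset.sum_add_distrib]
      refine Finset.sum_le_sum fun j _ => ?_
      rw [schreierCocycle_mul]
      exact_mod_cast hTmul _ _) (fun s hs => Finset.single_le_sum (fun s _ => hq0 s) hs) g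
  have h2 : (wordLen (T : Set H) (schreierCocycle H g j) : ℝ) ≤ q g :=
    Finset.single_le_sum (f := fun j => (wordLen (T : Set H) (schreierCocycle H g j) : ℝ))
      (fun _ _ => Nat.cast_nonneg _) (Finset.mem_univ j)
  have h3 : 0 ≤ ∑ s ∈ S, q s := Finset.sum_nonneg fun s _ => hq0 s
  nlinarith

end Induction

/-- A half-line system on a subgroup of finite index is incompatible with finite-dimensionality
of the spaces of harmonic functions of polynomial growth. -/
theorem Courteous.false_of_halfLine {G : Type*} [Group G] {S : Finset G} {μ : G → ℝ}
    (h : Courteous S μ) {k : ℕ} (hk : 1 ≤ k) {W : Submodule ℂ (G → ℂ)} [FiniteDimensional ℂ W]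
    (hW : HFk (S : Set G) μ k ⊆ (W : Set (G → ℂ))) (H : Subgroup G) [H.FiniteIndex]
    {T : Finset H} (hT : Subgroup.closure (T : Set H) = ⊤) (hTinv : ∀ s ∈ T, s⁻¹ ∈ T)
    {E : Type*} [NormedAddCommGroup E] [InnerProductSpace ℂ E] [CompleteSpace E]
    (A : HalfLine H Unit E fun x => (wordLen (T : Set H) x : ℝ)) : False := by
  classical
  have : Fintype (G ⧸ H) := Subgroup.fintypeQuotientOfFiniteIndex
  obtain ⟨D, hD, hDle⟩ := h.exists_schreierCocycle_le H hT hTinv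
  exact HalfLine.elim (ℓ := fun g => (wordLen (S : Set G) g : ℝ)) (fun _ => rfl)
    (A.induce H hD hDle (fun _ => Nat.cast_nonneg _) fun _ => Nat.cast_nonneg _) h hk hW

section WordLengthDisplacement

open scoped InnerProductSpace

/-- `T` is a finite symmetric generating set. -/
structure SymmGen {H : Type*} [Group H] (T : Finset H) : Prop where
  gen : Subgroup.closure (T : Set H) = ⊤
  inv_mem : ∀ s ∈ T, s⁻¹ ∈ T

variable {H : Type*} [Group H] {T : Finset H}

theorem wordLen_one : wordLen (T : Set H) 1 = 0 := by
  have := wordLen_le_length (S := (T : Set H)) [] (by simp)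
  simpa using this

variable {E : Type*} [NormedAddCommGroup E] [InnerProductSpace ℂ E]
  {ρ : Representation ℂ H E} (hρ : ∀ g φ, ‖ρ g φ‖ = ‖φ‖)

include hρ in
/-- A coboundary is controlled by the displacement. -/
theorem DispBounded.sub_map {F : Finset H} {a : H} (ha : a⁻¹ ∈ F) (v : E) :
    DispBounded ρ F ‖v‖ (v - ρ a v) := by
  intro φ
  have h1 : ⟪v - ρ a v, φ⟫_ℂ = -⟪v, ρ a⁻¹ φ - φ⟫_ℂ := by
    rw [inner_sub_left, inner_sub_right, ← inner_conj_symm (ρ a v), inner_map_eq_inv ρ hρ,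
      inner_conj_symm, neg_sub]
  rw [h1, norm_neg]
  exact (norm_inner_le_norm _ _).trans (mul_le_mul_of_nonneg_left
    (Finset.single_le_sum (f := fun g => ‖ρ g φ - φ‖) (fun _ _ => norm_nonneg _) ha)
    (norm_nonneg _))

variable (hT : SymmGen T)

include hT

/-- A subadditive function bounded on the generators grows at most linearly. -/
theorem SymmGen.le_mul_wordLen {q : H → ℝ} {C : ℝ} (h1 : q 1 ≤ 0)
    (hmul : ∀ x y, q (x * y) ≤ q x + q y)
    (hS : ∀ s ∈ T, q s ≤ C) (x : H) : q x ≤ C * wordLen (T : Set H) x := by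
  obtain ⟨l, hl, hn, rfl⟩ := exists_list_wordLen hT.gen hT.inv_mem x
  rw [← hn]
  clear hn
  induction l with
  | nil => simpa using h1
  | cons a l ih =>
    rw [List.prod_cons, List.length_cons]
    have h1 := ih fun s hs => hl s (List.mem_cons_of_mem _ hs)
    have h2 := hS a (hl a List.mem_cons_self)
    push_cast
    nlinarith [hmul a l.prod]

theorem SymmGen.wordLen_mul_le (x y : H) :
    (wordLen (T : Set H) (x * y) : ℝ) ≤ wordLen (T : Set H) x + wordLen (T : Set H) y := by
  obtain ⟨l, hl, hn, rfl⟩ := exists_list_wordLen hT.gen hT.inv_mem x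
  obtain ⟨l', hl', hn', rfl⟩ := exists_list_wordLen hT.gen hT.inv_mem y
  rw [← hn, ← hn', ← List.prod_append, ← Nat.cast_add, ← List.length_append]
  refine Nat.cast_le.2 (wordLen_le_length _ fun s hs => ?_)
  rcases List.mem_append.1 hs with hs | hs
  exacts [hl s hs, hl' s hs]

theorem SymmGen.wordLen_inv_le (x : H) :
    (wordLen (T : Set H) x⁻¹ : ℝ) ≤ wordLen (T : Set H) x := by
  obtain ⟨l, hl, hn, rfl⟩ := exists_list_wordLen hT.gen hT.inv_mem x
  rw [← hn, List.prod_inv_reverse, Nat.cast_le]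
  refine (wordLen_le_length _ fun s hs => ?_).trans (by simp)
  rw [List.mem_reverse, List.mem_map] at hs
  obtain ⟨a, ha, rfl⟩ := hs
  exact hT.inv_mem a (hl a ha)

theorem SymmGen.wordLen_zpow_le (x : H) (n : ℤ) :
    (wordLen (T : Set H) (x ^ n) : ℝ) ≤ |(n : ℝ)| * wordLen (T : Set H) x := by
  have h1 : ∀ n : ℕ, (wordLen (T : Set H) (x ^ n) : ℝ) ≤ n * wordLen (T : Set H) x := by
    intro n
    induction n with
    | zero => simp [wordLen_one]
    | succ n ih =>
      rw [pow_succ]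
      have := hT.wordLen_mul_le (x ^ n) x
      push_cast
      linarith
  obtain ⟨n, rfl | rfl⟩ := n.eq_nat_or_neg
  · simpa using h1 n
  · rw [zpow_neg, zpow_natCast]
    refine (hT.wordLen_inv_le _).trans ?_
    simpa using h1 n

include hρ

theorem SymmGen.norm_map_sub_le {F : Finset H} (hF : T ⊆ F) (g : H) (φ : E) :
    ‖ρ g φ - φ‖ ≤ displacement ρ F φ * wordLen (T : Set H) g := by
  refine hT.le_mul_wordLen (q := fun g => ‖ρ g φ - φ‖) (by simp) (fun x y => ?_)
    (fun s hs => Finset.single_le_sum (f := fun g => ‖ρ g φ - φ‖) (fun _ _ => norm_nonneg _)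
      (hF hs)) g
  have h1 : ρ (x * y) φ - φ = ρ x (ρ y φ - φ) + (ρ x φ - φ) := by
    rw [map_mul, Module.End.mul_apply, map_sub]; abel
  change ‖ρ (x * y) φ - φ‖ ≤ _
  rw [h1, add_comm]
  exact (norm_add_le _ _).trans (by rw [hρ])

/-- The displacement bound is preserved by translation, up to a linear factor. -/
theorem DispBounded.map {F : Finset H} (hF : T ⊆ F) {K : ℝ} (hK : 0 ≤ K) {e : E}
    (h : DispBounded ρ F K e) (g : H) :
    DispBounded ρ F (K * (1 + 2 * F.card * wordLen (T : Set H) g)) (ρ g e) := by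
  intro φ
  have h1 : ⟪ρ g e, φ⟫_ℂ = ⟪e, ρ g⁻¹ φ⟫_ℂ := by
    rw [← inner_conj_symm, inner_map_eq_inv ρ hρ, inner_conj_symm]
  rw [h1, mul_assoc]
  refine (h _).trans (mul_le_mul_of_nonneg_left ?_ hK)
  have h2 : ∀ a : H, ‖ρ a (ρ g⁻¹ φ) - ρ g⁻¹ φ‖ ≤
      ‖ρ a φ - φ‖ + 2 * (displacement ρ F φ * wordLen (T : Set H) g) := by
    intro a
    have h3 : ρ a (ρ g⁻¹ φ) - ρ g⁻¹ φ =
        ρ a (ρ g⁻¹ φ - φ) + ((ρ a φ - φ) - (ρ g⁻¹ φ - φ)) := by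
      rw [map_sub]; abel
    have h4 := hT.norm_map_sub_le hρ hF g⁻¹ φ
    have h5 : displacement ρ F φ * wordLen (T : Set H) g⁻¹ ≤
        displacement ρ F φ * wordLen (T : Set H) g :=
      mul_le_mul_of_nonneg_left (hT.wordLen_inv_le g) (displacement_nonneg _ _ _)
    rw [h3]
    refine (norm_add_le _ _).trans ?_
    rw [hρ]
    linarith [norm_sub_le (ρ a φ - φ) (ρ g⁻¹ φ - φ)]
  refine (Finset.sum_le_sum fun a _ => h2 a).trans (le_of_eq ?_)
  rw [Finset.sum_add_distrib, Finset.sum_const, nsmul_eq_mul, displacement]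
  ring

end WordLengthDisplacement

section DiscreteHalfLine

open scoped InnerProductSpace

variable {H : Type*} [Group H] {E : Type*} [NormedAddCommGroup E] [InnerProductSpace ℂ E]

/-- The vector `∑ₖ p(k) ρ(tᵏ)ξ`. -/
noncomputable def zpowSum (ρ : Representation ℂ H E) (t : H) (ξ : E) (p : ℝ → ℝ) : E :=
  ∑ᶠ k : ℤ, (p k : ℂ) • ρ (t ^ k) ξ

variable {ρ : Representation ℂ H E} {t : H} {ξ : E} {p q : ℝ → ℝ}

theorem Profile.zpowSum_eq {M a b : ℝ} (hp : Profile p M a b) :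
    zpowSum ρ t ξ p = ∑ k ∈ Finset.Ico ⌈a⌉ ⌈b⌉, (p k : ℂ) • ρ (t ^ k) ξ := by
  refine finsum_eq_sum_of_support_subset _ fun k hk => ?_
  by_contra h
  refine hk ?_
  have : p k = 0 := hp.supp k (by
    rw [Finset.coe_Ico, Set.mem_Ico, not_and_or, not_le, not_lt] at h
    exact h.imp (fun h => Int.lt_ceil.1 h) fun h => Int.ceil_le.1 h)
  simp [this]

theorem IsProfile.finite_support (hp : IsProfile p) :
    Function.HasFiniteSupport fun k : ℤ => (p k : ℂ) • ρ (t ^ k) ξ := by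
  obtain ⟨M, a, b, hp⟩ := hp
  refine (Finset.Ico ⌈a⌉ ⌈b⌉).finite_toSet.subset fun k hk => ?_
  by_contra h
  refine hk ?_
  have : p k = 0 := hp.supp k (by
    rw [Finset.coe_Ico, Set.mem_Ico, not_and_or, not_le, not_lt] at h
    exact h.imp (fun h => Int.lt_ceil.1 h) fun h => Int.ceil_le.1 h)
  simp [this]

theorem zpowSum_lineShift (hp : IsProfile p) (n : ℤ) :
    zpowSum ρ t ξ (lineShift n p) = ρ (t ^ n) (zpowSum ρ t ξ p) := by
  rw [zpowSum, zpowSum, map_finsum (ρ (t ^ n)) hp.finite_support]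
  rw [← finsum_comp_equiv (Equiv.addRight n)]
  refine finsum_congr fun k => ?_
  rw [Equiv.coe_addRight, map_smul, ← Module.End.mul_apply, ← map_mul, ← zpow_add, add_comm n k,
    lineShift]
  push_cast
  rw [add_sub_cancel_right]

theorem card_Ico_ceil_le {a b : ℝ} (h : a ≤ b) :
    ((Finset.Ico ⌈a⌉ ⌈b⌉).card : ℝ) ≤ 1 + (b - a) := by
  rw [Int.card_Ico]
  have h1 := Int.ceil_lt_add_one b
  have h2 := Int.le_ceil a
  have h3 : ((⌈b⌉ - ⌈a⌉).toNat : ℝ) = ((⌈b⌉ - ⌈a⌉ : ℤ) : ℝ) := by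
    exact_mod_cast Int.toNat_of_nonneg (sub_nonneg.2 (Int.ceil_mono h))
  rw [h3]
  push_cast
  linarith

variable {T : Finset H}

set_option maxHeartbeats 1000000 in
/-- A half-line system built from a single vector and its translates. -/
theorem SymmGen.exists_halfLine_of_vector (hT : SymmGen T) (hρ : ∀ g φ, ‖ρ g φ‖ = ‖φ‖)
    (η : H → ℤ) (hη : ∀ g g', η (g * g') = η g + η g') (ht : η t = 1)
    (horth : ∀ g, η g ≠ 0 → ⟪ρ g ξ, ξ⟫_ℂ = 0) (hξ : ξ ≠ 0) {F : Finset H} {K : ℝ}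
    (hF : DispBounded ρ F K ξ) {L : ℝ}
    (hfar : ∀ (g : H) (n : ℤ), n ≤ -(L * (1 + (wordLen (T : Set H) g : ℝ))) →
      ρ (g * t ^ n) ξ = ρ (t ^ (n + η g)) ξ) :
    Nonempty (HalfLine H Unit E fun x => (wordLen (T : Set H) x : ℝ)) := by
  classical
  wlog hTF : T ⊆ F generalizing F K
  · exact this (F := T ∪ F) ((hF.mono (le_abs_self K)).mono_set (abs_nonneg K)
      Finset.subset_union_right) Finset.subset_union_left
  wlog hK : 0 ≤ K generalizing K
  · exact this (hF.mono (le_abs_self K)) (abs_nonneg K)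
  wlog hL : 0 ≤ L generalizing L
  · refine this (L := |L|) (fun g n hn => hfar g n (hn.trans ?_)) (abs_nonneg L)
    have := mul_le_mul_of_nonneg_right (le_abs_self L)
      (show 0 ≤ 1 + (wordLen (T : Set H) g : ℝ) by positivity)
    linarith
  have hη1 : η 1 = 0 := by have := hη 1 1; rw [mul_one] at this; linarith
  have hηinv : ∀ g, η g⁻¹ = -η g := fun g => by
    have := hη g g⁻¹; rw [mul_inv_cancel, hη1] at this; linarith
  have hηpow : ∀ n : ℕ, η (t ^ n) = n := fun n => by
    induction n with
    | zero => simpa using hη1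
    | succ n ih => rw [pow_succ, hη, ih, ht]; push_cast; ring
  have hηz : ∀ n : ℤ, η (t ^ n) = n := fun n => by
    obtain ⟨n, rfl | rfl⟩ := n.eq_nat_or_neg
    · rw [zpow_natCast, hηpow]
    · rw [zpow_neg, zpow_natCast, hηinv, hηpow]
  obtain ⟨B, hB0, hB⟩ : ∃ B : ℝ, 0 ≤ B ∧ ∀ g, |(η g : ℝ)| ≤ B * wordLen (T : Set H) g := by
    refine ⟨∑ s ∈ T, |(η s : ℝ)|, Finset.sum_nonneg fun _ _ => abs_nonneg _, fun g => ?_⟩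
    refine hT.le_mul_wordLen (q := fun g => |(η g : ℝ)|) (by simp [hη1]) (fun x y => ?_)
      (fun s hs => Finset.single_le_sum (f := fun s => |(η s : ℝ)|)
        (fun _ _ => abs_nonneg _) hs) g
    rw [hη]; push_cast; exact abs_add_le _ _
  set J := zpowSum ρ t ξ with hJ
  set N : ℝ := 2 * F.card with hN
  have hN0 : 0 ≤ N := by positivity
  have hmap : ∀ g, DispBounded ρ F (K * (1 + N * wordLen (T : Set H) g)) (ρ g ξ) := fun g =>
    hF.map hρ hT hTF hK g
  set l : ℝ := (wordLen (T : Set H) t : ℝ) with hl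
  have hl0 : 0 ≤ l := by positivity
  have hnorm : ∀ p M a b, a ≤ b → Profile p M a b → ‖J p‖ ≤ ‖ξ‖ * M * (1 + (b - a)) := by
    intro p M a b hab hp
    rw [hJ, hp.zpowSum_eq]
    refine (norm_sum_le _ _).trans ((Finset.sum_le_card_nsmul _ _ (M * ‖ξ‖) fun k _ => ?_).trans ?_)
    · rw [norm_smul, hρ, Complex.norm_real]
      exact mul_le_mul_of_nonneg_right (hp.bound _) (norm_nonneg _)
    · rw [nsmul_eq_mul]
      have := mul_le_mul_of_nonneg_right (card_Ico_ceil_le hab)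
        (mul_nonneg hp.nonneg (norm_nonneg ξ))
      linarith
  have hdisp : ∀ p M R, 1 ≤ R → Profile p M (-R) R →
      DispBounded ρ F ((3 * K * (1 + N * (2 * l))) * M * R ^ 3) (J p) := by
    intro p M R hR hp
    rw [hJ, hp.zpowSum_eq]
    have h1 : ∀ k ∈ Finset.Ico ⌈-R⌉ ⌈R⌉, DispBounded ρ F (M * (K * (1 + N * (2 * l)) * R))
        ((p k : ℂ) • ρ (t ^ k) ξ) := by
      intro k hk
      rw [Finset.mem_Ico] at hk
      have h2 : |(k : ℝ)| ≤ R := by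
        rw [abs_le]
        have h3 := Int.ceil_le.1 hk.1
        have h4 := Int.lt_ceil.1 hk.2
        exact ⟨by linarith, h4.le⟩
      refine ((hmap (t ^ k)).smul (p k : ℂ)).mono ?_
      rw [Complex.norm_real]
      have h3 := hT.wordLen_zpow_le t k
      have h4 := mul_le_mul_of_nonneg_right h2 hl0
      refine mul_le_mul (hp.bound _) ?_ (by positivity) hp.nonneg
      have h5 : 1 + N * (wordLen (T : Set H) (t ^ k) : ℝ) ≤ (1 + N * (2 * l)) * R := by
        have h6 := mul_le_mul_of_nonneg_left (h3.trans h4) hN0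
        nlinarith [mul_nonneg hN0 (mul_nonneg (by linarith : 0 ≤ R) hl0)]
      have h6 := mul_le_mul_of_nonneg_left h5 hK
      linarith
    refine (DispBounded.sum _ h1).mono ?_
    rw [Finset.sum_const, nsmul_eq_mul]
    have h2 := card_Ico_ceil_le (show -R ≤ R by linarith)
    have h3 : 0 ≤ M * (K * (1 + N * (2 * l)) * R) := by
      have := hp.nonneg; positivity
    have h4 : 1 + (R - -R) ≤ 3 * R ^ 2 := by nlinarith
    calc _ ≤ (3 * R ^ 2) * (M * (K * (1 + N * (2 * l)) * R)) :=
          mul_le_mul_of_nonneg_right (h2.trans h4) h3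
      _ = _ := by ring
  set Q : ℝ := K * (2 + N * (1 + B * l + 2 * (L * l))) with hQ
  have hBl : 0 ≤ B * l := mul_nonneg hB0 hl0
  have hLl : 0 ≤ L * l := mul_nonneg hL hl0
  have hQ0 : 0 ≤ Q := by positivity
  have hsub : ∀ g p M (k : ℕ), Profile p M (-(k : ℝ) - 1) (-(k : ℝ)) →
      DispBounded ρ F ((Q * L ^ 3) * M * (1 + (wordLen (T : Set H) g : ℝ)) ^ 4 *
        ((1 + (k : ℝ)) ^ 3)⁻¹) (ρ g (J p) - J (lineShift (η g) p)) := by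
    intro g p M k hp
    set w : ℝ := (wordLen (T : Set H) g : ℝ) with hw
    have hw0 : 0 ≤ w := by positivity
    have hM := hp.nonneg
    have h1 : J p = (p (-(k : ℝ) - 1) : ℂ) • ρ (t ^ (-(k : ℤ) - 1)) ξ := by
      have h2 : (⌈-(k : ℝ) - 1⌉ : ℤ) = -(k : ℤ) - 1 := by
        have : (-(k : ℝ) - 1) = ((-(k : ℤ) - 1 : ℤ) : ℝ) := by push_cast; ring
        rw [this, Int.ceil_intCast]
      have h3 : (⌈-(k : ℝ)⌉ : ℤ) = -(k : ℤ) := by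
        have : (-(k : ℝ)) = ((-(k : ℤ) : ℤ) : ℝ) := by push_cast; ring
        rw [this, Int.ceil_intCast]
      have h4 : Finset.Ico (-(k : ℤ) - 1) (-(k : ℤ)) = {-(k : ℤ) - 1} := by
        ext x; simp only [Finset.mem_Ico, Finset.mem_singleton]; omega
      rw [hJ, hp.zpowSum_eq, h2, h3, h4, Finset.sum_singleton]
      push_cast; rfl
    rw [hJ, zpowSum_lineShift ⟨_, _, _, hp⟩, ← hJ, h1, map_smul, map_smul, ← smul_sub,
      ← Module.End.mul_apply, ← map_mul, ← Module.End.mul_apply, ← map_mul, ← zpow_add]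
    have hcoef := hp.bound (-(k : ℝ) - 1)
    by_cases hk : ((-(k : ℤ) - 1 : ℤ) : ℝ) ≤ -(L * (1 + w))
    · rw [hfar g _ hk, add_comm (-(k : ℤ) - 1) (η g), sub_self, smul_zero]
      exact DispBounded.zero.mono (by positivity)
    · push Not at hk
      push_cast at hk
      have hk' : 1 + (k : ℝ) ≤ L * (1 + w) := by linarith
      have hz1 := hT.wordLen_zpow_le t (-(k : ℤ) - 1)
      have hz2 := hT.wordLen_zpow_le t (η g + (-(k : ℤ) - 1))
      have hz3 := hT.wordLen_mul_le g (t ^ (-(k : ℤ) - 1))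
      have habs : |((-(k : ℤ) - 1 : ℤ) : ℝ)| = 1 + k := by
        push_cast
        rw [abs_of_nonpos (by linarith [(Nat.cast_nonneg k : (0 : ℝ) ≤ k)])]
        ring
      have habs2 : |((η g + (-(k : ℤ) - 1) : ℤ) : ℝ)| ≤ B * w + (1 + k) := by
        rw [Int.cast_add]
        refine (abs_add_le _ _).trans ?_
        rw [habs]
        linarith [hB g]
      rw [habs] at hz1
      have hb1 : (1 + (k : ℝ)) * l ≤ L * l * (1 + w) := by nlinarith
      have hz4 : (wordLen (T : Set H) (t ^ (η g + (-(k : ℤ) - 1))) : ℝ) ≤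
          (B * l + L * l) * (1 + w) := by
        have := mul_le_mul_of_nonneg_right habs2 hl0
        nlinarith
      have hz5 : (wordLen (T : Set H) (g * t ^ (-(k : ℤ) - 1)) : ℝ) ≤
          (1 + L * l) * (1 + w) := by linarith
      have hd := (((hmap (g * t ^ (-(k : ℤ) - 1))).sub
        (hmap (t ^ (η g + (-(k : ℤ) - 1))))).smul (p (-(k : ℝ) - 1) : ℂ))
      refine hd.mono ?_
      rw [Complex.norm_real]
      have h5 : K * (1 + N * (wordLen (T : Set H) (g * t ^ (-(k : ℤ) - 1)) : ℝ)) +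
          K * (1 + N * (wordLen (T : Set H) (t ^ (η g + (-(k : ℤ) - 1))) : ℝ)) ≤ Q * (1 + w) := by
        rw [← mul_add, hQ, mul_assoc K]
        refine mul_le_mul_of_nonneg_left ?_ hK
        have h6 := mul_le_mul_of_nonneg_left hz4 hN0
        have h7 := mul_le_mul_of_nonneg_left hz5 hN0
        nlinarith
      have h6 : 1 ≤ L ^ 3 * (1 + w) ^ 3 * ((1 + (k : ℝ)) ^ 3)⁻¹ := by
        rw [← mul_pow, ← div_eq_mul_inv, one_le_div (by positivity)]
        exact pow_le_pow_left₀ (by positivity) hk' 3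
      calc _ ≤ M * (Q * (1 + w)) := mul_le_mul hcoef h5 (by positivity) hM
        _ ≤ M * (Q * (1 + w)) * (L ^ 3 * (1 + w) ^ 3 * ((1 + (k : ℝ)) ^ 3)⁻¹) :=
          le_mul_of_one_le_right (by positivity) h6
        _ = _ := by ring
  have hinner : ∀ g p q, IsProfile p → IsProfile q →
      (∀ y, lineShift (η g) p y * q y = 0) → ⟪ρ g (J p), J q⟫_ℂ = 0 := by
    intro g p q hp hq h
    obtain ⟨M, a, b, hp⟩ := hp
    obtain ⟨M', a', b', hq⟩ := hq
    rw [hJ, hp.zpowSum_eq, hq.zpowSum_eq, map_sum, sum_inner]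
    refine Finset.sum_eq_zero fun i _ => ?_
    rw [inner_sum]
    refine Finset.sum_eq_zero fun j _ => ?_
    rw [map_smul, inner_smul_left, inner_smul_right]
    by_cases hij : j = i + η g
    · subst hij
      have h1 := h ((i + η g : ℤ) : ℝ)
      rw [lineShift, Int.cast_add, add_sub_cancel_right] at h1
      rw [Complex.conj_ofReal, ← mul_assoc, ← Complex.ofReal_mul, Int.cast_add, h1]
      simp
    · have h1 : ⟪ρ g (ρ (t ^ i) ξ), ρ (t ^ j) ξ⟫_ℂ = 0 := by
        rw [inner_map_eq_inv ρ hρ, ← Module.End.mul_apply, ← Module.End.mul_apply, ← map_mul,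
          ← map_mul]
        refine horth _ ?_
        rw [hη, hη, hηinv, hηz, hηz]
        omega
      rw [h1, mul_zero, mul_zero]
  set C : ℝ := ‖ξ‖ + 3 * K * (1 + N * (2 * l)) + Q * L ^ 3 + B with hC
  have hC1 : 0 ≤ 3 * K * (1 + N * (2 * l)) := by positivity
  have hC2 : 0 ≤ Q * L ^ 3 := by positivity
  have hC3 := norm_nonneg ξ
  exact ⟨{
    ρ := ρ
    norm_map := hρ
    J := fun _ => J
    ω := fun g _ => η g
    F := F
    C := C
    m := 4
    C_nonneg := by positivity
    ω_mul := fun g g' _ => by rw [hη]; push_cast; rfl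
    ω_le := fun g _ => by
      refine (hB g).trans ?_
      have : (0 : ℝ) ≤ wordLen (T : Set H) g := by positivity
      nlinarith
    J_add := fun _ p q hp hq => by
      rw [hJ, zpowSum, zpowSum, zpowSum, ← finsum_add_distrib hp.finite_support hq.finite_support]
      exact finsum_congr fun k => by rw [Pi.add_apply, Complex.ofReal_add, add_smul]
    J_smul := fun _ c p hp => by
      rw [hJ, zpowSum, zpowSum, smul_finsum' _ hp.finite_support]
      exact finsum_congr fun k => by
        rw [Pi.smul_apply, smul_eq_mul, Complex.ofReal_mul, mul_smul]
    norm_J := fun _ p M a b hab hp => by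
      refine (hnorm p M a b hab hp).trans ?_
      have := hp.nonneg
      have : 0 ≤ b - a := by linarith
      gcongr
      linarith
    disp_J := fun _ p M R hR hp => by
      refine (hdisp p M R hR hp).mono ?_
      have := hp.nonneg
      gcongr
      linarith
    disp_sub := fun g _ p M k hp => by
      refine (hsub g p M k hp).mono ?_
      have := hp.nonneg
      gcongr
      linarith
    inner_eq_zero := fun g _ _ p q hp hq h =>
      hinner g p q hp hq (h.resolve_left fun h => h (Subsingleton.elim _ _))
    t := t
    i₀ := ()
    τ := 1
    τ_pos := one_pos
    t_smul := rfl
    ω_t := by rw [ht]; simp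
    ρ_t := fun p hp => by
      have := zpowSum_lineShift (ρ := ρ) (t := t) (ξ := ξ) hp 1
      rw [zpow_one, Int.cast_one] at this
      exact this.symm
    J_ne_zero := by
      have h1 : Profile (Set.indicator (Set.Ico (0 : ℝ) 1) 1) 1 0 1 :=
        Profile.indicator measurable_const zero_le_one fun y _ _ => by simp
      have h2 : Finset.Ico (0 : ℤ) 1 = {0} := rfl
      change J _ ≠ 0
      rw [hJ, h1.zpowSum_eq, Int.ceil_zero, Int.ceil_one, h2, Finset.sum_singleton]
      simpa using hξ }⟩

end DiscreteHalfLine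

section PermutationModel

open scoped InnerProductSpace Pointwise ENNReal

/-- Composition with a permutation, on `ℓ²(Y)`. -/
noncomputable def lpComp {Y : Type*} (σ : Equiv.Perm Y) :
    lp (fun _ : Y => ℂ) 2 →ₗ[ℂ] lp (fun _ : Y => ℂ) 2 where
  toFun f := ⟨fun y => f (σ y), by
    have h := lp.memℓp f
    refine (memℓp_gen_iff (by norm_num)).2 ?_
    rw [memℓp_gen_iff (by norm_num)] at h
    exact (Equiv.summable_iff σ).2 h⟩
  map_add' f f' := rfl
  map_smul' c f := rfl

theorem lpComp_apply {Y : Type*} (σ : Equiv.Perm Y) (f : lp (fun _ : Y => ℂ) 2) (y : Y) :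
    lpComp σ f y = f (σ y) := rfl

variable (H : Type*) [Group H] (Y : Type*) [MulAction H Y]

/-- The unitary representation on `ℓ²(Y)` of a group acting on `Y`. -/
noncomputable def permRep : Representation ℂ H (lp (fun _ : Y => ℂ) 2) where
  toFun g := lpComp (MulAction.toPerm g⁻¹)
  map_one' := by
    ext f y
    simp [lpComp_apply]
  map_mul' g g' := by
    ext f y
    simp [mul_smul, lpComp_apply]

variable {H Y}

theorem permRep_apply (g : H) (f : lp (fun _ : Y => ℂ) 2) (y : Y) :
    permRep H Y g f y = f (g⁻¹ • y) := rfl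

theorem norm_permRep (g : H) (f : lp (fun _ : Y => ℂ) 2) : ‖permRep H Y g f‖ = ‖f‖ := by
  rw [lp.norm_eq_tsum_rpow (by norm_num), lp.norm_eq_tsum_rpow (by norm_num)]
  congr 1
  exact Equiv.tsum_eq (MulAction.toPerm g⁻¹) fun y => ‖f y‖ ^ (2 : ℝ≥0∞).toReal

variable [DecidableEq Y]

theorem permRep_single (g : H) (y : Y) (c : ℂ) :
    permRep H Y g (lp.single 2 y c) = lp.single 2 (g • y) c := by
  ext z
  rw [permRep_apply, lp.single_apply, lp.single_apply, Pi.single_apply, Pi.single_apply]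
  simp only [inv_smul_eq_iff]

variable {T : Finset H} {t : H}

set_option maxHeartbeats 800000 in
/-- A half-line system from a permutation action. -/
theorem SymmGen.exists_halfLine_of_action (hT : SymmGen T) (η : H → ℤ)
    (hη : ∀ g g', η (g * g') = η g + η g') (ht : η t = 1) (y₀ : Y) (X : Finset Y)
    (hX : X.Nontrivial) (hy₀ : y₀ ∈ X) (htrans : ∀ x ∈ X, ∃ a : H, a • y₀ = x)
    (hlevel : ∀ g, η g ≠ 0 → ∀ x ∈ X, g • x ∉ X) {L : ℝ}
    (hfar : ∀ (g : H) (n : ℤ), n ≤ -(L * (1 + (wordLen (T : Set H) g : ℝ))) →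
      ((t ^ (n + η g))⁻¹ * (g * t ^ n)) • y₀ = y₀ ∧
        ∀ x ∈ X, ((t ^ (n + η g))⁻¹ * (g * t ^ n)) • x ∈ X) :
    Nonempty (HalfLine H Unit (lp (fun _ : Y => ℂ) 2)
      fun x => (wordLen (T : Set H) x : ℝ)) := by
  classical
  set N : ℂ := (X.card : ℂ) with hN
  have hN1 : N ≠ 1 := by
    have := Finset.one_lt_card_iff_nontrivial.2 hX
    rw [hN]; exact_mod_cast this.ne'
  have hN0 : N ≠ 0 := by
    rw [hN]; exact_mod_cast (Finset.card_pos.2 ⟨y₀, hy₀⟩).ne'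
  set δ : Y → lp (fun _ : Y => ℂ) 2 := fun y => lp.single 2 y 1 with hδ
  set ξ : lp (fun _ : Y => ℂ) 2 := N⁻¹ • ∑ x ∈ X, (δ y₀ - δ x) with hξ
  have hξ' : ξ = δ y₀ - N⁻¹ • ∑ x ∈ X, δ x := by
    rw [hξ, Finset.sum_sub_distrib, Finset.sum_const, smul_sub, ← Nat.cast_smul_eq_nsmul ℂ,
      smul_smul, inv_mul_cancel₀ hN0, one_smul]
  have hsum : ∀ y, (∑ x ∈ X, δ x : lp (fun _ : Y => ℂ) 2) y = if y ∈ X then 1 else 0 := by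
    intro y
    rw [lp.coeFn_sum, Finset.sum_apply]
    simp [hδ, Pi.single_apply]
  have hval : ∀ y, ξ y = (if y = y₀ then 1 else 0) - N⁻¹ * if y ∈ X then 1 else 0 := by
    intro y
    rw [hξ', lp.coeFn_sub, Pi.sub_apply, lp.coeFn_smul, Pi.smul_apply, hsum, smul_eq_mul]
    congr 1
    simp [hδ, Pi.single_apply]
  have hsupp : ∀ y, y ∉ X → ξ y = 0 := by
    intro y hy
    rw [hval, if_neg hy, if_neg (fun h : y = y₀ => hy (h ▸ hy₀))]
    simp
  choose! a ha using htrans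
  set F : Finset H := X.image fun x => (a x)⁻¹ with hF
  have hdisp : ∀ x ∈ X, DispBounded (permRep H Y) F ‖δ y₀‖ (δ y₀ - δ x) := by
    intro x hx
    have h1 : permRep H Y (a x) (δ y₀) = δ x := by rw [hδ, permRep_single, ha x hx]
    have h2 : (a x)⁻¹ ∈ F := Finset.mem_image_of_mem (fun x => (a x)⁻¹) hx
    have h3 := DispBounded.sub_map norm_permRep h2 (δ y₀)
    rwa [h1] at h3
  refine hT.exists_halfLine_of_vector (ρ := permRep H Y) (t := t) (ξ := ξ) norm_permRep η hη ht
    (fun g hg => ?_) (fun h0 => ?_) 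
    (DispBounded.smul (DispBounded.sum _ hdisp) _) (L := L) (fun g n hn => ?_)
  · rw [lp.inner_eq_tsum]
    refine (tsum_congr fun y => ?_).trans tsum_zero
    rw [permRep_apply]
    by_cases hy : y ∈ X
    · rw [hsupp (g⁻¹ • y) fun h => hlevel g hg _ h (by rwa [smul_inv_smul]), inner_zero_left]
    · rw [hsupp y hy, inner_zero_right]
  · have h1 := hval y₀
    rw [h0, if_pos rfl, if_pos hy₀, lp.coeFn_zero, Pi.zero_apply, mul_one] at h1
    exact hN1 (by rw [← inv_inj, inv_one]; linear_combination h1)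
  · obtain ⟨h1, h2⟩ := hfar g n hn
    set b := (t ^ (n + η g))⁻¹ * (g * t ^ n) with hb
    have h3 : g * t ^ n = t ^ (n + η g) * b := by rw [hb, mul_inv_cancel_left]
    have h4 : X.image (b • ·) = X :=
      Finset.eq_of_subset_of_card_le (fun y hy => by
        obtain ⟨x, hx, rfl⟩ := Finset.mem_image.1 hy
        exact h2 x hx) (Finset.card_image_of_injective _ (MulAction.injective b)).ge
    have h5 : permRep H Y b ξ = ξ := by
      have h6 : ∀ y, permRep H Y b (δ y) = δ (b • y) := fun y => permRep_single _ _ _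
      have h7 : ∑ x ∈ X, δ (b • x) = ∑ x ∈ X, δ x := by
        conv_rhs => rw [← h4]
        exact (Finset.sum_image fun x _ y _ h => MulAction.injective b h).symm
      rw [hξ', map_sub, map_smul, map_sum, h6, h1, Finset.sum_congr rfl fun x _ => h6 x, h7]
    rw [h3, map_mul, Module.End.mul_apply, h5]

/-- A half-line system from an affine action preserving a filtration by subgroups. -/
theorem SymmGen.exists_halfLine_of_filtration (hT : SymmGen T) {A : Type*} [AddCommGroup A]
    (l : H → A →+ A) (hl : ∀ g g' x, l (g * g') x = l g (l g' x)) (hl1 : ∀ x, l 1 x = x)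
    (c : H → A) (hc : ∀ g g', c (g * g') = c g + l g (c g')) (hct : c t = 0) (η : H → ℤ)
    (hη : ∀ g g', η (g * g') = η g + η g') (ht : η t = 1) (B : ℤ → AddSubgroup A)
    (hB : ∀ n, B (n + 1) ≤ B n) (hlB : ∀ g n x, x ∈ B n → l g x ∈ B (n + η g))
    (hex : ∀ x, ∃ n, x ∈ B n)
    (hfin : ∀ n, ((fun u : A => u +ᵥ (B (n + 1) : Set A)) '' (B n : Set A)).Finite)
    (a₀ : H) (ha₀ : ∀ x, l a₀ x = x) {n₀ : ℤ} (hn₀ : c a₀ ∉ B n₀) :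
    Nonempty (HalfLine H Unit (lp (fun _ : Set A => ℂ) 2)
      fun x => (wordLen (T : Set H) x : ℝ)) := by
  classical
  have hanti : Antitone B := antitone_int_of_succ_le hB
  have hc1 : c 1 = 0 := by have := hc 1 1; rw [hl1, mul_one] at this; simpa using this
  have hη1 : η 1 = 0 := by have := hη 1 1; rw [mul_one] at this; linarith
  have hηinv : ∀ g, η g⁻¹ = -η g := fun g => by
    have := hη g g⁻¹; rw [mul_inv_cancel, hη1] at this; linarith
  have hcinv : ∀ g, c g + l g (c g⁻¹) = 0 := fun g => by rw [← hc, mul_inv_cancel, hc1]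
  have htpow : ∀ n : ℕ, η (t ^ n) = n ∧ c (t ^ n) = 0 := fun n => by
    induction n with
    | zero => simpa using ⟨hη1, hc1⟩
    | succ n ih =>
      rw [pow_succ, hη, hc, ih.1, ih.2, ht, hct, map_zero, add_zero]; push_cast; simp
  have htz : ∀ n : ℤ, η (t ^ n) = n ∧ c (t ^ n) = 0 := fun n => by
    obtain ⟨n, rfl | rfl⟩ := n.eq_nat_or_neg
    · rw [zpow_natCast]; exact htpow n
    · rw [zpow_neg, zpow_natCast]
      refine ⟨by rw [hηinv, (htpow n).1], ?_⟩
      have h1 := hcinv (t ^ n)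
      rw [(htpow n).2, zero_add] at h1
      have h2 := hl (t ^ n)⁻¹ (t ^ n) (c (t ^ n)⁻¹)
      rwa [inv_mul_cancel, hl1, h1, map_zero] at h2
  let _ : MulAction H A :=
    { smul := fun g x => c g + l g x
      one_smul := fun x => by change c 1 + l 1 x = x; rw [hc1, hl1, zero_add]
      mul_smul := fun g g' x => by
        change c (g * g') + l (g * g') x = c g + l g (c g' + l g' x)
        rw [hc, hl, map_add, add_assoc] }
  have hsmul : ∀ (g : H) (x : A), g • x = c g + l g x := fun _ _ => rfl
  have hsmulB : ∀ (g : H) (u : A) n, g • (u +ᵥ (B n : Set A)) =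
      (c g + l g u) +ᵥ (B (n + η g) : Set A) := by
    intro g u n
    ext y
    rw [Set.mem_smul_set, Set.mem_vadd_set]
    constructor
    · rintro ⟨_, ⟨x, hx, rfl⟩, rfl⟩
      exact ⟨l g x, hlB g n x hx, by simp only [hsmul, vadd_eq_add, map_add, add_assoc]⟩
    · rintro ⟨x, hx, rfl⟩
      refine ⟨_, ⟨l g⁻¹ x, ?_, rfl⟩, ?_⟩
      · have := hlB g⁻¹ _ x hx
        rwa [hηinv, add_neg_cancel_right] at this
      · simp only [hsmul, vadd_eq_add, map_add, add_assoc]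
        rw [← hl, mul_inv_cancel, hl1]
  have hcoset : ∀ (u u' : A) m n, u +ᵥ (B m : Set A) = u' +ᵥ (B n : Set A) → B m ≤ B n := by
    intro u u' m n h x hx
    have h0 : ∀ x ∈ B m, -u' + (u + x) ∈ B n := by
      intro x hx
      have h1 : u + x ∈ u' +ᵥ (B n : Set A) := h ▸ ⟨x, hx, rfl⟩
      obtain ⟨y, hy, hyx⟩ := h1
      have hyx : u' + y = u + x := hyx
      rw [← hyx, neg_add_cancel_left]
      exact hy
    have := (B n).sub_mem (h0 x hx) (h0 0 (zero_mem _))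
    have h2 : -u' + (u + x) - (-u' + (u + 0)) = x := by abel
    rwa [h2] at this
  obtain ⟨n₁, hn₁, hmax⟩ : ∃ n₁, c a₀ ∈ B n₁ ∧ ∀ z, c a₀ ∈ B z → z ≤ n₁ :=
    Int.exists_greatest_of_bdd ⟨n₀, fun z hz => le_of_not_ge fun h => hn₀ (hanti h hz)⟩
      (hex (c a₀))
  have hn₁' : c a₀ ∉ B (n₁ + 1) := fun h => absurd (hmax _ h) (by omega)
  set C : Set A := {u | u ∈ B n₁ ∧ ∃ a, (∀ x, l a x = x) ∧ c a = u} with hC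
  have hXfin : ((fun u : A => u +ᵥ (B (n₁ + 1) : Set A)) '' C).Finite :=
    (hfin n₁).subset (Set.image_mono fun u hu => hu.1)
  obtain ⟨D, hD0, hDc, hDη⟩ : ∃ D : ℤ, 0 ≤ D ∧
      (∀ g, c g ∈ B (-(D * (wordLen (T : Set H) g : ℤ)))) ∧
      ∀ g, |η g| ≤ D * (wordLen (T : Set H) g : ℤ) := by
    choose ν hν using fun g => hex (c g)
    refine ⟨∑ s ∈ T, (|ν s| + |η s|), Finset.sum_nonneg fun _ _ => by positivity, ?_⟩
    rw [← forall_and]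
    intro g
    have hle : ∀ s ∈ T, |ν s| + |η s| ≤ ∑ s ∈ T, (|ν s| + |η s|) := fun s hs =>
      Finset.single_le_sum (f := fun s => |ν s| + |η s|) (fun _ _ => by positivity) hs
    generalize ∑ s ∈ T, (|ν s| + |η s|) = D at hle
    obtain ⟨w, hw, hn, rfl⟩ := exists_list_wordLen hT.gen hT.inv_mem g
    rw [← hn]
    clear hn
    induction w with
    | nil => simp [hc1, hη1]
    | cons s w ih =>
      have ih := ih fun s hs => hw s (List.mem_cons_of_mem _ hs)
      have hs := hle s (hw s List.mem_cons_self)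
      have h1 := abs_nonneg (ν s)
      have h2 := abs_nonneg (η s)
      have h3 := neg_abs_le (ν s)
      have h4 := neg_abs_le (η s)
      have h5 : 0 ≤ D * (w.length : ℤ) := (abs_nonneg _).trans ih.2
      rw [List.prod_cons, List.length_cons, hc, hη]
      push_cast
      refine ⟨add_mem (hanti ?_ (hν s)) (hanti ?_ (hlB s _ _ ih.1)), ?_⟩
      · rw [mul_add]; linarith
      · rw [mul_add]; linarith
      · refine (abs_add_le _ _).trans ?_
        rw [mul_add]; linarith [ih.2]
  refine hT.exists_halfLine_of_action η hη ht (B (n₁ + 1) : Set A) hXfin.toFinset ?_ ?_ ?_ ?_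
    (L := ((2 * D + |n₁ + 1| : ℤ) : ℝ)) ?_
  · refine ⟨(0 : A) +ᵥ (B (n₁ + 1) : Set A), ?_, c a₀ +ᵥ (B (n₁ + 1) : Set A), ?_, fun h => hn₁' ?_⟩
    · exact hXfin.mem_toFinset.2 ⟨0, ⟨zero_mem _, 1, hl1, hc1⟩, rfl⟩
    · exact hXfin.mem_toFinset.2 ⟨c a₀, ⟨hn₁, a₀, ha₀, rfl⟩, rfl⟩
    · rw [zero_vadd] at h
      have : c a₀ ∈ (B (n₁ + 1) : Set A) := h ▸ ⟨0, zero_mem _, add_zero _⟩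
      exact this
  · exact hXfin.mem_toFinset.2 ⟨0, ⟨zero_mem _, 1, hl1, hc1⟩, zero_vadd _ _⟩
  · intro x hx
    obtain ⟨u, ⟨-, a, ha, rfl⟩, rfl⟩ := hXfin.mem_toFinset.1 hx
    refine ⟨a, ?_⟩
    ext y
    rw [Set.mem_smul_set, Set.mem_vadd_set]
    simp only [hsmul, ha, vadd_eq_add]
  · intro g hg x hx hgx
    obtain ⟨u, -, rfl⟩ := hXfin.mem_toFinset.1 hx
    obtain ⟨u', -, hu'⟩ := hXfin.mem_toFinset.1 hgx
    dsimp only at hu'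
    rw [hsmulB] at hu'
    rcases lt_or_gt_of_ne hg with h | h
    · exact hn₁' (hcoset _ _ _ _ hu'.symm (hanti (by omega) hn₁))
    · have h1 := hlB t⁻¹ n₁ (c a₀)
      have h2 := hlB t _ _ hn₁
      rw [ht] at h2
      have h3 := hlB t⁻¹ _ _ (hcoset _ _ _ _ hu' h2)
      rw [← hl, inv_mul_cancel, hl1, hηinv, ht] at h3
      exact hn₁' (hanti (by omega) h3)
  · intro g n hn
    set b := (t ^ (n + η g))⁻¹ * (g * t ^ n) with hb
    have hηb : η b = 0 := by rw [hb, hη, hη, hηinv, (htz _).1, (htz _).1]; ring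
    have hcb : c b ∈ B (n₁ + 1) := by
      have h1 : c b = l (t ^ (-(n + η g))) (c g) := by
        rw [hb, ← zpow_neg, hc, (htz _).2, hc, (htz _).2, map_zero, add_zero, zero_add]
      have hn' : n ≤ -((2 * D + |n₁ + 1|) * (1 + (wordLen (T : Set H) g : ℤ))) := by
        exact_mod_cast hn
      have h2 := hlB (t ^ (-(n + η g))) _ _ (hDc g)
      rw [h1]
      refine hanti ?_ h2
      rw [(htz _).1]
      have h3 := abs_le.1 (hDη g)
      have h4 := le_abs_self (n₁ + 1)
      have h5 : 0 ≤ |n₁ + 1| * (wordLen (T : Set H) g : ℤ) := by positivity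
      nlinarith
    have hX : ∀ u : A, b • (u +ᵥ (B (n₁ + 1) : Set A)) = l b u +ᵥ (B (n₁ + 1) : Set A) := by
      intro u
      rw [hsmulB, hηb, add_zero, add_comm, add_vadd]
      congr 1
      ext y
      rw [Set.mem_vadd_set]
      constructor
      · rintro ⟨x, hx, rfl⟩
        exact add_mem hcb hx
      · exact fun hy => ⟨-c b + y, add_mem (neg_mem hcb) hy, add_neg_cancel_left _ _⟩
    refine ⟨?_, fun x hx => ?_⟩
    · have := hX 0
      rwa [map_zero, zero_vadd] at this
    · obtain ⟨u, ⟨hu, a, ha, rfl⟩, rfl⟩ := hXfin.mem_toFinset.1 hx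
      dsimp only
      rw [hX]
      refine hXfin.mem_toFinset.2 ⟨l b (c a), ⟨?_, b * a * b⁻¹, fun x => ?_, ?_⟩, rfl⟩
      · have := hlB b _ _ hu
        rwa [hηb, add_zero] at this
      · rw [hl, hl, ha, ← hl, mul_inv_cancel, hl1]
      · rw [hc, hl, ha, hc, add_right_comm, hcinv, zero_add]

end PermutationModel

section TwistedKoopman

open MeasureTheory
open scoped ENNReal InnerProductSpace

/-- A measure-preserving action together with a unimodular cocycle. -/
structure Twist (H : Type*) [Group H] {X : Type*} [MeasurableSpace X] (ν : Measure X) where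
  σ : H → X → X
  mp : ∀ g, MeasurePreserving (σ g) ν ν
  u : H → X → ℂ
  meas_u : ∀ g, Measurable (u g)
  norm_u : ∀ g x, ‖u g x‖ = 1
  σ_one : ∀ x, σ 1 x = x
  σ_mul : ∀ g g' x, σ (g * g') x = σ g' (σ g x)
  u_one : ∀ x, u 1 x = 1
  u_mul : ∀ g g' x, u (g * g') x = u g x * u g' (σ g x)

variable {H : Type*} [Group H] {X : Type*} [MeasurableSpace X] {ν : Measure X}

namespace Twist

variable (A : Twist H ν)

theorem memLp (g : H) {f : X → ℂ} (hf : MemLp f 2 ν) :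
    MemLp (fun x => A.u g x * f (A.σ g x)) 2 ν := by
  have h := hf.comp_measurePreserving (A.mp g)
  refine h.of_le ((A.meas_u g).aestronglyMeasurable.mul h.aestronglyMeasurable)
    (Filter.Eventually.of_forall fun x => ?_)
  rw [norm_mul, A.norm_u, one_mul, Function.comp_apply]

/-- The operator of a single group element. -/
noncomputable def op (g : H) : Lp ℂ 2 ν →ₗ[ℂ] Lp ℂ 2 ν where
  toFun φ := (A.memLp g (Lp.memLp φ)).toLp _
  map_add' φ ψ := by
    rw [← MemLp.toLp_add]
    refine MemLp.toLp_congr _ _ ?_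
    filter_upwards [(A.mp g).quasiMeasurePreserving.ae_eq_comp (Lp.coeFn_add φ ψ)] with x hx
    simp only [Function.comp_apply, Pi.add_apply] at hx
    rw [Pi.add_apply, hx, mul_add]
  map_smul' c φ := by
    rw [RingHom.id_apply, ← MemLp.toLp_const_smul]
    refine MemLp.toLp_congr _ _ ?_
    filter_upwards [(A.mp g).quasiMeasurePreserving.ae_eq_comp (Lp.coeFn_smul c φ)] with x hx
    simp only [Function.comp_apply, Pi.smul_apply, smul_eq_mul] at hx
    rw [Pi.smul_apply, hx, smul_eq_mul, mul_left_comm]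

theorem op_toLp (g : H) {f : X → ℂ} (hf : MemLp f 2 ν) :
    A.op g (hf.toLp f) = (A.memLp g hf).toLp _ := by
  refine MemLp.toLp_congr (A.memLp g (Lp.memLp (hf.toLp f))) (A.memLp g hf) ?_
  filter_upwards [(A.mp g).quasiMeasurePreserving.ae_eq_comp hf.coeFn_toLp] with x hx
  simp only [Function.comp_apply] at hx
  rw [hx]

theorem exists_toLp (φ : Lp ℂ 2 ν) : ∃ (f : X → ℂ) (hf : MemLp f 2 ν), hf.toLp f = φ :=
  ⟨φ, Lp.memLp φ, Lp.toLp_coeFn φ (Lp.memLp φ)⟩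

/-- The unitary representation on `L²`. -/
noncomputable def rep : Representation ℂ H (Lp ℂ 2 ν) where
  toFun := A.op
  map_one' := by
    refine LinearMap.ext fun φ => ?_
    obtain ⟨f, hf, rfl⟩ := exists_toLp φ
    rw [op_toLp, Module.End.one_apply]
    refine MemLp.toLp_congr _ _ (Filter.Eventually.of_forall fun x => ?_)
    dsimp only
    rw [A.u_one, A.σ_one, one_mul]
  map_mul' g g' := by
    refine LinearMap.ext fun φ => ?_
    obtain ⟨f, hf, rfl⟩ := exists_toLp φ
    rw [Module.End.mul_apply, op_toLp, op_toLp, op_toLp]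
    refine MemLp.toLp_congr _ _ (Filter.Eventually.of_forall fun x => ?_)
    dsimp only
    rw [A.u_mul, A.σ_mul, mul_assoc]

theorem rep_toLp (g : H) {f : X → ℂ} (hf : MemLp f 2 ν) :
    A.rep g (hf.toLp f) = (A.memLp g hf).toLp _ := A.op_toLp g hf

theorem norm_rep (g : H) (φ : Lp ℂ 2 ν) : ‖A.rep g φ‖ = ‖φ‖ := by
  obtain ⟨f, hf, rfl⟩ := exists_toLp φ
  rw [rep_toLp, Lp.norm_toLp, Lp.norm_toLp, ← eLpNorm_comp_measurePreserving
    hf.aestronglyMeasurable (A.mp g)]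
  congr 1
  refine eLpNorm_congr_norm_ae (Filter.Eventually.of_forall fun x => ?_)
  rw [norm_mul, A.norm_u, one_mul, Function.comp_apply]

end Twist

theorem inner_toLp_eq_zero {f g : X → ℂ} (hf : MemLp f 2 ν) (hg : MemLp g 2 ν)
    (h : ∀ x, f x * g x = 0) : ⟪hf.toLp f, hg.toLp g⟫_ℂ = 0 := by
  rw [L2.inner_def]
  refine integral_eq_zero_of_ae ?_
  filter_upwards [hf.coeFn_toLp, hg.coeFn_toLp] with x hx hx'
  rw [hx, hx', Pi.zero_apply]
  rcases mul_eq_zero.1 (h x) with h | h <;> simp [h]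

/-- Bounded functions supported on a strip are square integrable. -/
theorem memLp_of_strip {Ω : Type*} [MeasurableSpace Ω] {κ : Measure Ω} [IsProbabilityMeasure κ]
    {f : ℝ × Ω → ℂ} (hf : Measurable f) {M a b : ℝ} (hM : ∀ x, ‖f x‖ ≤ M)
    (hsupp : ∀ x, x.1 < a ∨ b ≤ x.1 → f x = 0) :
    ∃ h : MemLp f 2 ((volume : Measure ℝ).prod κ), (a ≤ b → ‖h.toLp f‖ ≤ M * (1 + (b - a))) := by
  set s : Set (ℝ × Ω) := Set.Ico a b ×ˢ Set.univ with hs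
  have hms : MeasurableSet s := measurableSet_Ico.prod MeasurableSet.univ
  have hν : ((volume : Measure ℝ).prod κ) s = ENNReal.ofReal (b - a) := by
    rw [hs, Measure.prod_prod, measure_univ, mul_one, Real.volume_Ico]
  have hνt : ((volume : Measure ℝ).prod κ) s ≠ ⊤ := by rw [hν]; exact ENNReal.ofReal_ne_top
  have h1 : MemLp (s.indicator fun _ => M) 2 ((volume : Measure ℝ).prod κ) :=
    memLp_indicator_const 2 hms M (Or.inr hνt)
  have hle : ∀ x, ‖f x‖ ≤ ‖s.indicator (fun _ => M) x‖ := by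
    intro x
    by_cases hx : x ∈ s
    · rw [Set.indicator_of_mem hx]
      exact (hM x).trans (le_abs_self M)
    · rw [hsupp x]
      · simp
      · rw [hs] at hx
        simp only [Set.mem_prod, Set.mem_Ico, Set.mem_univ, and_true, not_and_or, not_le,
          not_lt] at hx
        exact hx
  have h2 := h1.of_le hf.aestronglyMeasurable (Filter.Eventually.of_forall hle)
  refine ⟨h2, fun hab => ?_⟩
  rw [Lp.norm_toLp]
  have h3 : eLpNorm f 2 ((volume : Measure ℝ).prod κ) ≤
      eLpNorm (s.indicator fun _ => M) 2 ((volume : Measure ℝ).prod κ) :=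
    eLpNorm_mono hle
  refine (ENNReal.toReal_mono h1.eLpNorm_ne_top h3).trans ?_
  rw [eLpNorm_indicator_const hms (by norm_num) (by norm_num), hν, ENNReal.toReal_mul,
    ← ENNReal.toReal_rpow, ENNReal.toReal_ofReal (sub_nonneg.2 hab), toReal_enorm]
  by_cases hX : Nonempty (ℝ × Ω)
  · have hM0 : 0 ≤ M := (norm_nonneg _).trans (hM hX.some)
    rw [Real.norm_of_nonneg hM0]
    refine mul_le_mul_of_nonneg_left ?_ hM0
    have h0 := sub_nonneg.2 hab
    norm_num
    rw [← Real.sqrt_eq_rpow, Real.sqrt_le_left (by linarith)]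
    nlinarith
  · have : IsEmpty Ω := ⟨fun x => hX ⟨(0, x)⟩⟩
    have h4 := measure_univ (μ := κ)
    rw [Set.univ_eq_empty_iff.2 this, measure_empty] at h4
    exact absurd h4 zero_ne_one

end TwistedKoopman

section PhaseModel

open MeasureTheory
open scoped ENNReal InnerProductSpace

/-- An affine action on a plane in polar coordinates, seen on the dual side. -/
structure PhaseData (H : Type*) [Group H] {Ω : Type*} [MeasurableSpace Ω] (κ : Measure Ω) where
  θ : H → ℝ
  θ_mul : ∀ g g', θ (g * g') = θ g + θ g'
  s : H → Ω → Ω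
  mp : ∀ g, MeasurePreserving (s g) κ κ
  s_one : ∀ α, s 1 α = α
  s_mul : ∀ g g' α, s (g * g') α = s g' (s g α)
  q : H → Ω → ℝ
  meas_q : ∀ g, Measurable (q g)
  q_mul : ∀ g g' α, q (g * g') α = q g α + Real.exp (θ g) * q g' (s g α)
  Q : H → ℝ
  q_le : ∀ g α, |q g α| ≤ Q g
  w : Ω → ℝ
  meas_w : Measurable w
  w_nonneg : ∀ α, 0 ≤ w α
  w_le_one : ∀ α, w α ≤ 1
  w_s : ∀ g α, w (s g α) = w α
  Fa : Finset H
  θ_Fa : ∀ h ∈ Fa, θ h = 0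
  s_Fa : ∀ h ∈ Fa, ∀ α, s h α = α
  w_le : ∀ α, w α ≤ ∑ h ∈ Fa, |q h α|
  w_ne : κ {α | w α ≠ 0} ≠ 0
  t : H
  τ : ℝ
  τ_pos : 0 < τ
  θ_t : θ t = -τ
  q_t : ∀ α, q t α = 0

theorem abs_le_two_mul_norm_exp_sub_one {x : ℝ} (hx : |x| ≤ 1) :
    |x| ≤ 2 * ‖Complex.exp (Complex.I * x) - 1‖ := by
  rw [Complex.norm_exp_I_mul_ofReal_sub_one, norm_mul, Real.norm_eq_abs, Real.norm_eq_abs]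
  have h1 : |x / 2| ≤ Real.pi / 2 := by
    rw [abs_div, abs_two]
    linarith [Real.pi_gt_three]
  have h2 := Real.mul_abs_le_abs_sin h1
  rw [abs_div, abs_two] at h2
  have h3 : (1 / 2 : ℝ) ≤ 2 / Real.pi := by
    rw [div_le_div_iff₀ two_pos Real.pi_pos]
    linarith [Real.pi_le_four]
  have h4 := mul_le_mul_of_nonneg_right h3 (show 0 ≤ |x| / 2 by positivity)
  rw [abs_two]
  linarith

theorem toLp_eq_sum {X : Type*} [MeasurableSpace X] {ν : Measure X} {ι : Type*} (s : Finset ι)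
    {f : ι → X → ℂ} (hf : ∀ i, MemLp (f i) 2 ν) {F : X → ℂ} (hF : MemLp F 2 ν)
    (h : ∀ x, F x = ∑ i ∈ s, f i x) : hF.toLp F = ∑ i ∈ s, (hf i).toLp (f i) := by
  classical
  induction s using Finset.induction_on generalizing F with
  | empty =>
    obtain rfl : F = 0 := funext fun x => by simpa using h x
    rw [MemLp.toLp_zero, Finset.sum_empty]
  | insert a s ha ih =>
    have hF' : MemLp (fun x => F x - f a x) 2 ν := hF.sub (hf a)
    rw [Finset.sum_insert ha, ← ih hF' fun x => by rw [h, Finset.sum_insert ha]; ring,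
      ← MemLp.toLp_add]
    refine MemLp.toLp_congr _ _ (Filter.Eventually.of_forall fun x => ?_)
    simp

variable {H : Type*} [Group H] {Ω : Type*} [MeasurableSpace Ω] {κ : Measure Ω}

namespace PhaseData

variable [IsProbabilityMeasure κ] (P : PhaseData H κ)

omit [IsProbabilityMeasure κ] in
theorem θ_one : P.θ 1 = 0 := by
  have := P.θ_mul 1 1
  rw [mul_one] at this
  linarith

omit [IsProbabilityMeasure κ] in
theorem q_one (α : Ω) : P.q 1 α = 0 := by
  have := P.q_mul 1 1 α
  rw [mul_one, P.s_one, P.θ_one, Real.exp_zero] at this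
  linarith

omit [IsProbabilityMeasure κ] in
theorem θ_inv (g : H) : P.θ g⁻¹ = -P.θ g := by
  have := P.θ_mul g g⁻¹
  rw [mul_inv_cancel, P.θ_one] at this
  linarith

omit [IsProbabilityMeasure κ] in
theorem θ_q_pow (n : ℕ) : P.θ (P.t ^ n) = -(n * P.τ) ∧ ∀ α, P.q (P.t ^ n) α = 0 := by
  induction n with
  | zero => simpa using ⟨P.θ_one, P.q_one⟩
  | succ n ih =>
    rw [pow_succ]
    refine ⟨?_, fun α => ?_⟩
    · rw [P.θ_mul, ih.1, P.θ_t]; push_cast; ring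
    · rw [P.q_mul, ih.2, P.q_t]; ring

omit [IsProbabilityMeasure κ] in
theorem θ_zpow (n : ℤ) : P.θ (P.t ^ n) = -(n * P.τ) := by
  obtain ⟨n, rfl | rfl⟩ := n.eq_nat_or_neg
  · simpa using (P.θ_q_pow n).1
  · rw [zpow_neg, zpow_natCast, P.θ_inv, (P.θ_q_pow n).1]; push_cast; ring

omit [IsProbabilityMeasure κ] in
theorem q_zpow (n : ℤ) (α : Ω) : P.q (P.t ^ n) α = 0 := by
  obtain ⟨n, rfl | rfl⟩ := n.eq_nat_or_neg
  · simpa using (P.θ_q_pow n).2 α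
  · rw [zpow_neg, zpow_natCast]
    have h1 := P.q_mul (P.t ^ n)⁻¹ (P.t ^ n) α
    rwa [inv_mul_cancel, P.q_one, (P.θ_q_pow n).2, mul_zero, add_zero, eq_comm] at h1

/-- The associated twisted action on `ℝ × Ω`. -/
noncomputable def twist : Twist H ((volume : Measure ℝ).prod κ) where
  σ g x := (x.1 + P.θ g, P.s g x.2)
  mp g := (measurePreserving_add_right volume (P.θ g)).prod (P.mp g)
  u g x := Complex.exp (Complex.I * ((Real.exp x.1 * P.q g x.2 : ℝ) : ℂ))
  meas_u g := by
    have h2 : Measurable fun x : ℝ × Ω => Real.exp x.1 * P.q g x.2 :=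
      (Real.measurable_exp.comp measurable_fst).mul ((P.meas_q g).comp measurable_snd)
    exact Complex.measurable_exp.comp ((Complex.measurable_ofReal.comp h2).const_mul _)
  norm_u g x := by rw [mul_comm, Complex.norm_exp_ofReal_mul_I]
  σ_one x := by simp [P.θ_one, P.s_one]
  σ_mul g g' x := by simp [P.θ_mul, P.s_mul, add_assoc]
  u_one x := by simp [P.q_one]
  u_mul g g' x := by
    rw [← Complex.exp_add, ← mul_add, ← Complex.ofReal_add, P.q_mul, mul_add, Real.exp_add,
      mul_assoc]

theorem twist_u (g : H) (x : ℝ × Ω) :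
    P.twist.u g x = Complex.exp (Complex.I * ((Real.exp x.1 * P.q g x.2 : ℝ) : ℂ)) := rfl

theorem twist_σ (g : H) (x : ℝ × Ω) : P.twist.σ g x = (x.1 + P.θ g, P.s g x.2) := rfl

/-- Measurable functions supported in a strip and dominated by a multiple of the weight. -/
structure Strip (ψ : ℝ × Ω → ℂ) (M a b : ℝ) : Prop where
  meas : Measurable ψ
  bound : ∀ x, ‖ψ x‖ ≤ M * P.w x.2
  supp : ∀ x, x.1 < a ∨ b ≤ x.1 → ψ x = 0

variable {P}

omit [IsProbabilityMeasure κ] in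
theorem nonempty : ∃ α, P.w α ≠ 0 := by
  by_contra! h
  refine P.w_ne ?_
  simp [h]

omit [IsProbabilityMeasure κ] in
theorem Strip.nonneg {ψ : ℝ × Ω → ℂ} {M a b : ℝ} (h : P.Strip ψ M a b) : 0 ≤ M := by
  obtain ⟨α, hα⟩ := P.nonempty
  have h1 := (norm_nonneg _).trans (h.bound (0, α))
  exact nonneg_of_mul_nonneg_left h1 ((P.w_nonneg α).lt_of_ne' hα)

omit [IsProbabilityMeasure κ] in
theorem Strip.bound' {ψ : ℝ × Ω → ℂ} {M a b : ℝ} (h : P.Strip ψ M a b) (x : ℝ × Ω) :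
    ‖ψ x‖ ≤ M :=
  (h.bound x).trans (mul_le_of_le_one_right h.nonneg (P.w_le_one _))

theorem Strip.memLp {ψ : ℝ × Ω → ℂ} {M a b : ℝ} (h : P.Strip ψ M a b) :
    MemLp ψ 2 ((volume : Measure ℝ).prod κ) :=
  (memLp_of_strip h.meas h.bound' h.supp).1

variable (P)

/-- Coercivity on a single strip. -/
theorem exists_base (T : Finset H) : ∃ (b K : ℝ) (F : Finset H), T ⊆ F ∧ 0 ≤ K ∧
    ∀ (ψ : ℝ × Ω → ℂ) (M : ℝ) (h : P.Strip ψ M (b - P.τ) b),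
      DispBounded P.twist.rep F (K * M) (h.memLp.toLp ψ) := by
  classical
  obtain ⟨b, hb⟩ : ∃ b : ℝ, ∀ h ∈ P.Fa, Real.exp b * |P.Q h| ≤ 1 := by
    refine ⟨-Real.log (1 + ∑ h ∈ P.Fa, |P.Q h|), fun h hh => ?_⟩
    have h1 : |P.Q h| ≤ ∑ h ∈ P.Fa, |P.Q h| :=
      Finset.single_le_sum (f := fun h => |P.Q h|) (fun _ _ => abs_nonneg _) hh
    have h2 := abs_nonneg (P.Q h)
    rw [Real.exp_neg, Real.exp_log (by linarith), inv_mul_le_iff₀ (by linarith)]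
    linarith
  set c : ℝ := 2 * Real.exp (-(b - P.τ)) with hc
  have hc0 : 0 ≤ c := by positivity
  set n : ℝ := (P.Fa.card : ℝ) with hn
  have hn0 : 0 ≤ n := by positivity
  refine ⟨b, ∑ h ∈ P.Fa, c * n * (1 + P.τ), T ∪ P.Fa.image (·⁻¹), Finset.subset_union_left,
    Finset.sum_nonneg fun _ _ => by have := P.τ_pos; positivity, fun ψ M hψ => ?_⟩
  set d : H → ℝ × Ω → ℂ := fun h x => 1 - P.twist.u h x with hd
  set D : ℝ × Ω → ℝ := fun x => ∑ h ∈ P.Fa, ‖d h x‖ ^ 2 with hD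
  have hdm : ∀ h, Measurable (d h) := fun h => measurable_const.sub (P.twist.meas_u h)
  have hDm : Measurable D := Finset.measurable_fun_sum _ fun h _ => (hdm h).norm.pow_const 2
  have hdD : ∀ h ∈ P.Fa, ∀ x, ‖d h x‖ ^ 2 ≤ D x := fun h hh x =>
    Finset.single_le_sum (f := fun h => ‖d h x‖ ^ 2) (fun _ _ => by positivity) hh
  set χ : H → ℝ × Ω → ℂ := fun h x => ψ x * (starRingEnd ℂ (d h x) / (D x : ℂ)) with hχ
  have hkey : ∀ x, ‖ψ x‖ ≤ M * (c * ∑ h ∈ P.Fa, ‖d h x‖) := by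
    intro x
    have hs0 : 0 ≤ c * ∑ h ∈ P.Fa, ‖d h x‖ :=
      mul_nonneg hc0 (Finset.sum_nonneg fun _ _ => norm_nonneg _)
    by_cases hx : x.1 < b - P.τ ∨ b ≤ x.1
    · rw [hψ.supp x hx, norm_zero]
      exact mul_nonneg hψ.nonneg hs0
    · push Not at hx
      refine (hψ.bound x).trans (mul_le_mul_of_nonneg_left ((P.w_le _).trans ?_) hψ.nonneg)
      rw [Finset.mul_sum]
      refine Finset.sum_le_sum fun h hh => ?_
      have h1 : |Real.exp x.1 * P.q h x.2| ≤ 1 := by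
        rw [abs_mul, Real.abs_exp]
        exact (mul_le_mul (Real.exp_le_exp.2 hx.2.le) ((P.q_le h x.2).trans (le_abs_self _))
          (abs_nonneg _) (Real.exp_pos _).le).trans (hb h hh)
      have h2 := abs_le_two_mul_norm_exp_sub_one h1
      rw [← P.twist_u, norm_sub_rev, abs_mul, Real.abs_exp] at h2
      have h3 : 1 ≤ Real.exp (-(b - P.τ)) * Real.exp x.1 := by
        rw [← Real.exp_add]
        exact Real.one_le_exp (by linarith)
      calc |P.q h x.2| ≤ (Real.exp (-(b - P.τ)) * Real.exp x.1) * |P.q h x.2| :=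
            le_mul_of_one_le_left (abs_nonneg _) h3
        _ = Real.exp (-(b - P.τ)) * (Real.exp x.1 * |P.q h x.2|) := by ring
        _ ≤ Real.exp (-(b - P.τ)) * (2 * ‖d h x‖) :=
            mul_le_mul_of_nonneg_left h2 (Real.exp_pos _).le
        _ = _ := by ring
  have hχm : ∀ h, Measurable (χ h) := fun h => hψ.meas.mul
    ((Complex.continuous_conj.measurable.comp (hdm h)).div (Complex.measurable_ofReal.comp hDm))
  have hχb : ∀ h ∈ P.Fa, ∀ x, ‖χ h x‖ ≤ M * (c * n) := by
    intro h hh x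
    have hM := hψ.nonneg
    have hD0 : 0 ≤ D x := Finset.sum_nonneg fun _ _ => by positivity
    rw [hχ]
    dsimp only
    rw [norm_mul, norm_div, RCLike.norm_conj, Complex.norm_real, Real.norm_of_nonneg hD0,
      ← mul_div_assoc]
    refine div_le_of_le_mul₀ hD0 (by positivity) ?_
    have h1 : (∑ h' ∈ P.Fa, ‖d h' x‖) * ‖d h x‖ ≤ n * D x := by
      rw [Finset.sum_mul]
      refine (Finset.sum_le_card_nsmul _ _ (D x) fun h' hh' => ?_).trans (by rw [nsmul_eq_mul])
      have h2 := hdD h hh x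
      have h3 := hdD h' hh' x
      nlinarith [sq_nonneg (‖d h' x‖ - ‖d h x‖)]
    calc ‖ψ x‖ * ‖d h x‖ ≤ M * (c * ∑ h ∈ P.Fa, ‖d h x‖) * ‖d h x‖ :=
          mul_le_mul_of_nonneg_right (hkey x) (norm_nonneg _)
      _ = M * c * ((∑ h ∈ P.Fa, ‖d h x‖) * ‖d h x‖) := by ring
      _ ≤ M * c * (n * D x) := mul_le_mul_of_nonneg_left h1 (by positivity)
      _ = _ := by ring
  have hχs : ∀ h x, x.1 < b - P.τ ∨ b ≤ x.1 → χ h x = 0 := by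
    intro h x hx
    rw [hχ]; dsimp only
    rw [hψ.supp x hx, zero_mul]
  have hχL : ∀ h ∈ P.Fa, ∃ m : MemLp (χ h) 2 ((volume : Measure ℝ).prod κ),
      ‖m.toLp (χ h)‖ ≤ M * (c * n) * (1 + P.τ) := by
    intro h hh
    obtain ⟨m, hm⟩ := memLp_of_strip (κ := κ) (hχm h) (hχb h hh) (hχs h)
    refine ⟨m, ?_⟩
    have := hm (by linarith [P.τ_pos])
    rwa [sub_sub_cancel] at this
  choose m hm using hχL
  have hsum : hψ.memLp.toLp ψ =
      ∑ h ∈ P.Fa.attach, ((m h h.2).toLp (χ h) - P.twist.rep h ((m h h.2).toLp (χ h))) := by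
    have hfix : ∀ h ∈ P.Fa, ∀ x : ℝ × Ω, P.twist.σ h x = x := fun h hh x => by
      rw [P.twist_σ, P.θ_Fa h hh, P.s_Fa h hh, add_zero]
    have hmem : ∀ i : {h // h ∈ P.Fa}, MemLp (fun x => χ i x - P.twist.u i x * χ i x) 2
        ((volume : Measure ℝ).prod κ) := fun i => by
      have h1 := (m i i.2).sub (P.twist.memLp i (m i i.2))
      simp only [hfix i i.2] at h1
      exact h1
    have hterm : ∀ i : {h // h ∈ P.Fa}, (m i i.2).toLp (χ i) - P.twist.rep i ((m i i.2).toLp (χ i))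
        = (hmem i).toLp _ := fun i => by
      rw [P.twist.rep_toLp, ← MemLp.toLp_sub]
      refine MemLp.toLp_congr _ _ (Filter.Eventually.of_forall fun x => ?_)
      simp only [Pi.sub_apply, hfix i i.2]
    rw [Finset.sum_congr rfl fun i _ => hterm i]
    refine toLp_eq_sum _ hmem hψ.memLp fun x => ?_
    have h1 : ∑ i ∈ P.Fa.attach, (χ i x - P.twist.u i x * χ i x) =
        ψ x * ((∑ h ∈ P.Fa, (d h x * starRingEnd ℂ (d h x))) / (D x : ℂ)) := by
      rw [Finset.sum_attach P.Fa fun h => χ h x - P.twist.u h x * χ h x, Finset.sum_div,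
        Finset.mul_sum]
      refine Finset.sum_congr rfl fun h _ => ?_
      rw [hχ, hd]
      ring
    have h2 : ∑ h ∈ P.Fa, (d h x * starRingEnd ℂ (d h x)) = (D x : ℂ) := by
      rw [hD, Complex.ofReal_sum]
      refine Finset.sum_congr rfl fun h _ => ?_
      rw [Complex.mul_conj, Complex.normSq_eq_norm_sq]
    rw [h1, h2]
    by_cases hx : D x = 0
    · have h3 : ∀ h ∈ P.Fa, ‖d h x‖ = 0 := fun h hh => by
        have := hdD h hh x
        rw [hx] at this
        exact pow_eq_zero_iff two_ne_zero |>.1 (le_antisymm this (by positivity))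
      have h4 := hkey x
      rw [Finset.sum_eq_zero h3, mul_zero, mul_zero] at h4
      rw [norm_le_zero_iff.1 h4, zero_mul]
    · rw [div_self (Complex.ofReal_ne_zero.2 hx), mul_one]
  rw [hsum]
  have hdb : ∀ i ∈ P.Fa.attach, DispBounded P.twist.rep (T ∪ P.Fa.image (·⁻¹))
      (M * (c * n) * (1 + P.τ))
      ((m i i.2).toLp (χ i) - P.twist.rep i ((m i i.2).toLp (χ i))) := fun i _ =>
    (DispBounded.sub_map P.twist.norm_rep
      (Finset.mem_union_right _ (Finset.mem_image_of_mem _ i.2)) _).mono (hm i i.2)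
  refine (DispBounded.sum P.Fa.attach hdb).mono (le_of_eq ?_)
  rw [Finset.sum_const, Finset.sum_const, Finset.card_attach, nsmul_eq_mul, nsmul_eq_mul]
  ring

end PhaseData

end PhaseModel

section PhaseHalfLine

open MeasureTheory
open scoped ENNReal InnerProductSpace

variable {H : Type*} [Group H] {Ω : Type*} [MeasurableSpace Ω] {κ : Measure Ω}
  [IsProbabilityMeasure κ] {T : Finset H}

namespace PhaseData

variable (P : PhaseData H κ)

theorem exists_window (hT : SymmGen T) : ∃ (C : ℝ) (F : Finset H), 0 ≤ C ∧
    ∀ (ψ : ℝ × Ω → ℂ) (M R : ℝ) (h : P.Strip ψ M (-R) R), 1 ≤ R →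
      DispBounded P.twist.rep F (C * M * R ^ 2) (h.memLp.toLp ψ) := by
  obtain ⟨b, K, F, hTF, hK, hbase⟩ := P.exists_base T
  have hτ := P.τ_pos
  set ℓ : ℝ := (wordLen (T : Set H) P.t : ℝ) with hℓ
  have hℓ0 : 0 ≤ ℓ := Nat.cast_nonneg _
  set f : ℝ := (F.card : ℝ) with hf
  have hf0 : 0 ≤ f := Nat.cast_nonneg _
  set c : ℝ := (1 + |b|) / P.τ + 3 with hc
  have hc0 : 0 ≤ c := by positivity
  refine ⟨(2 * c + 1) * (K * (1 + 2 * f * ℓ * c)), F, by positivity, fun ψ M R hψ hR => ?_⟩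
  have hM := hψ.nonneg
  obtain ⟨N, hN1, hN2⟩ : ∃ N : ℕ, (R + |b|) / P.τ + 1 ≤ N ∧ (N : ℝ) ≤ c * R := by
    refine ⟨⌈(R + |b|) / P.τ + 1⌉₊, Nat.le_ceil _, (Nat.ceil_lt_add_one (by positivity)).le.trans ?_⟩
    have h1 : (R + |b|) / P.τ ≤ (1 + |b|) / P.τ * R := by
      rw [div_mul_eq_mul_div]
      exact div_le_div_of_nonneg_right (by nlinarith [abs_nonneg b]) hτ.le
    rw [hc]
    nlinarith
  set I : Finset ℤ := Finset.Icc (-(N : ℤ)) N with hI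
  set s : ℤ → Set (ℝ × Ω) := fun j => {x | b + (j - 1) * P.τ ≤ x.1 ∧ x.1 < b + j * P.τ} with hs
  have hsm : ∀ j, MeasurableSet (s j) := fun j =>
    (measurableSet_le measurable_const measurable_fst).inter
      (measurableSet_lt measurable_fst measurable_const)
  have hsI : ∀ x j, x ∈ s j → ⌊(x.1 - b) / P.τ⌋ + 1 = j := by
    rintro x j ⟨h1, h2⟩
    have : ⌊(x.1 - b) / P.τ⌋ = j - 1 := by
      rw [Int.floor_eq_iff, le_div_iff₀ hτ, div_lt_iff₀ hτ]
      push_cast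
      constructor <;> linarith
    omega
  have hself : ∀ x : ℝ × Ω, x ∈ s (⌊(x.1 - b) / P.τ⌋ + 1) := by
    intro x
    have h1 := Int.floor_le ((x.1 - b) / P.τ)
    have h2 := Int.lt_floor_add_one ((x.1 - b) / P.τ)
    rw [le_div_iff₀ hτ] at h1
    rw [div_lt_iff₀ hτ] at h2
    rw [hs]
    simp only [Set.mem_ofPred_eq]
    push_cast
    constructor <;> linarith
  set χ : ℤ → ℝ × Ω → ℂ := fun j x =>
    (s j).indicator ψ (x.1 + j * P.τ, P.s (P.t ^ (-j)) x.2) with hχ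
  have hχS : ∀ j, P.Strip (χ j) M (b - P.τ) b := by
    intro j
    refine ⟨?_, fun x => ?_, fun x hx => ?_⟩
    · exact (hψ.meas.indicator (hsm j)).comp ((measurable_fst.add_const _).prodMk
        ((P.mp (P.t ^ (-j))).measurable.comp measurable_snd))
    · refine (norm_indicator_le_norm_self _ _).trans ((hψ.bound _).trans ?_)
      rw [P.w_s]
    · refine Set.indicator_of_notMem (fun h => ?_) _
      obtain ⟨h1, h2⟩ := h
      dsimp only at h1 h2
      rcases hx with hx | hx <;> nlinarith
  have hχr : ∀ j, P.twist.rep (P.t ^ j) ((hχS j).memLp.toLp (χ j)) =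
      (P.twist.memLp (P.t ^ j) (hχS j).memLp).toLp _ := fun j => P.twist.rep_toLp _ _
  have hpt : ∀ j x, P.twist.u (P.t ^ j) x * χ j (P.twist.σ (P.t ^ j) x) = (s j).indicator ψ x := by
    intro j x
    rw [P.twist_u, P.q_zpow, mul_zero, Complex.ofReal_zero, mul_zero, Complex.exp_zero, one_mul,
      hχ]
    dsimp only
    rw [P.twist_σ, P.θ_zpow, ← P.s_mul, ← zpow_add, add_neg_cancel, zpow_zero, P.s_one]
    congr 1
    exact Prod.ext (by dsimp only; ring) rfl
  have hsum : hψ.memLp.toLp ψ = ∑ j ∈ I, P.twist.rep (P.t ^ j) ((hχS j).memLp.toLp (χ j)) := by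
    rw [Finset.sum_congr rfl fun j _ => hχr j]
    refine toLp_eq_sum I (fun j => P.twist.memLp (P.t ^ j) (hχS j).memLp) hψ.memLp fun x => ?_
    rw [Finset.sum_congr rfl fun j _ => hpt j x,
      Finset.sum_eq_single (⌊(x.1 - b) / P.τ⌋ + 1)]
    · rw [Set.indicator_of_mem (hself x)]
    · intro j _ hj
      exact Set.indicator_of_notMem (fun h => hj (hsI x j h).symm) _
    · intro h
      rw [Set.indicator_of_mem (hself x)]
      refine hψ.supp x ?_
      by_contra! hx
      refine h (Finset.mem_Icc.2 ?_)
      have h3 : (x.1 - b) / P.τ ≤ N - 1 := by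
        refine le_trans ?_ (le_sub_iff_add_le.2 hN1)
        exact div_le_div_of_nonneg_right (by linarith [neg_abs_le b]) hτ.le
      have h4 : -((N : ℝ) - 1) ≤ (x.1 - b) / P.τ := by
        refine (neg_le_neg (le_sub_iff_add_le.2 hN1)).trans ?_
        rw [← neg_div]
        exact div_le_div_of_nonneg_right (by linarith [le_abs_self b]) hτ.le
      have h5 : -((N : ℤ) - 1) ≤ ⌊(x.1 - b) / P.τ⌋ := Int.le_floor.2 (by push_cast; exact h4)
      have h6 : ⌊(x.1 - b) / P.τ⌋ ≤ (N : ℤ) - 1 := by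
        have := Int.floor_le_floor h3
        rwa [show (N : ℝ) - 1 = (((N : ℤ) - 1 : ℤ) : ℝ) by push_cast; ring, Int.floor_intCast]
          at this
      omega
  rw [hsum]
  have hdb : ∀ j ∈ I, DispBounded P.twist.rep F (K * M * (1 + 2 * f * ℓ * c) * R)
      (P.twist.rep (P.t ^ j) ((hχS j).memLp.toLp (χ j))) := by
    intro j hj
    refine (DispBounded.map P.twist.norm_rep hT hTF (by positivity) (hbase _ _ (hχS j))
      (P.t ^ j)).mono ?_
    rw [mul_assoc (K * M)]
    refine mul_le_mul_of_nonneg_left ?_ (by positivity)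
    have h1 := hT.wordLen_zpow_le P.t j
    have h2 : |(j : ℝ)| ≤ N := by
      rw [hI, Finset.mem_Icc] at hj
      exact abs_le.2 ⟨by exact_mod_cast hj.1, by exact_mod_cast hj.2⟩
    have h3 : (wordLen (T : Set H) (P.t ^ j) : ℝ) ≤ c * R * ℓ :=
      h1.trans (mul_le_mul_of_nonneg_right (h2.trans hN2) hℓ0)
    have h4 := mul_le_mul_of_nonneg_left h3 (show 0 ≤ 2 * f by positivity)
    linarith
  refine (DispBounded.sum I hdb).mono ?_
  rw [Finset.sum_const, nsmul_eq_mul]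
  have hcard : (I.card : ℝ) ≤ (2 * c + 1) * R := by
    rw [hI, Int.card_Icc]
    have : ((N : ℤ) + 1 - -(N : ℤ)).toNat = 2 * N + 1 := by omega
    rw [this]
    push_cast
    linarith
  refine (mul_le_mul_of_nonneg_right hcard (by positivity)).trans (le_of_eq (by ring))

end PhaseData

end PhaseHalfLine

section PhaseHalfLine

open MeasureTheory
open scoped ENNReal InnerProductSpace

variable {H : Type*} [Group H] {Ω : Type*} [MeasurableSpace Ω] {κ : Measure Ω}
  [IsProbabilityMeasure κ] {T : Finset H}

namespace PhaseData

variable (P : PhaseData H κ)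

omit [IsProbabilityMeasure κ] in
theorem exists_growth (hT : SymmGen T) : ∃ D : ℝ, 0 ≤ D ∧
    (∀ g, |P.θ g| ≤ D * wordLen (T : Set H) g) ∧
    ∀ g α, |P.q g α| ≤ Real.exp (D * wordLen (T : Set H) g) := by
  set D : ℝ := ∑ s ∈ T, |P.θ s| with hD
  set A : ℝ := ∑ s ∈ T, |P.Q s| with hA
  have hD0 : 0 ≤ D := Finset.sum_nonneg fun _ _ => abs_nonneg _
  have hA0 : 0 ≤ A := Finset.sum_nonneg fun _ _ => abs_nonneg _
  have hθs : ∀ s ∈ T, |P.θ s| ≤ D := fun s hs =>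
    Finset.single_le_sum (f := fun s => |P.θ s|) (fun _ _ => abs_nonneg _) hs
  have hqs : ∀ s ∈ T, ∀ α, |P.q s α| ≤ A := fun s hs α => (P.q_le s α).trans <|
    (le_abs_self _).trans
      (Finset.single_le_sum (f := fun s => |P.Q s|) (fun _ _ => abs_nonneg _) hs)
  have hθ : ∀ g, |P.θ g| ≤ D * wordLen (T : Set H) g := fun g =>
    hT.le_mul_wordLen (q := fun g => |P.θ g|) (by simp [P.θ_one])
      (fun x y => by rw [P.θ_mul]; exact abs_add_le _ _) hθs g
  have hq : ∀ l : List H, (∀ s ∈ l, s ∈ T) → ∀ α,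
      |P.q l.prod α| ≤ A * l.length * Real.exp (D * l.length) := by
    intro l
    induction l with
    | nil => intro _ α; simp [P.q_one]
    | cons s l ih =>
      intro hl α
      have h1 := hqs s (hl s (by simp)) α
      have h2 := ih (fun s hs => hl s (by simp [hs])) (P.s s α)
      rw [List.prod_cons, P.q_mul, List.length_cons]
      push_cast
      have h3 : |Real.exp (P.θ s) * P.q l.prod (P.s s α)| ≤
          Real.exp D * (A * l.length * Real.exp (D * l.length)) := by
        rw [abs_mul, Real.abs_exp]
        exact mul_le_mul (Real.exp_le_exp.2 ((le_abs_self _).trans (hθs s (hl s (by simp))))) h2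
          (abs_nonneg _) (Real.exp_pos _).le
      have h4 : A ≤ A * Real.exp (D * (l.length + 1)) :=
        le_mul_of_one_le_right hA0 (Real.one_le_exp (by positivity))
      calc _ ≤ A + Real.exp D * (A * l.length * Real.exp (D * l.length)) :=
            (abs_add_le _ _).trans (add_le_add h1 h3)
        _ = A + A * l.length * Real.exp (D * (l.length + 1)) := by
            rw [mul_add, mul_one, Real.exp_add]; ring
        _ ≤ A * Real.exp (D * (l.length + 1)) + A * l.length * Real.exp (D * (l.length + 1)) :=
            add_le_add_left h4 _
        _ = _ := by ring
  refine ⟨D + A, by positivity, fun g => (hθ g).trans ?_, fun g α => ?_⟩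
  · exact mul_le_mul_of_nonneg_right (by linarith) (Nat.cast_nonneg _)
  · obtain ⟨l, hl, hn, rfl⟩ := exists_list_wordLen hT.gen hT.inv_mem g
    rw [← hn]
    refine (hq l hl α).trans ?_
    rw [add_mul, Real.exp_add, mul_comm (Real.exp _)]
    refine mul_le_mul_of_nonneg_right ?_ (Real.exp_pos _).le
    linarith [Real.add_one_le_exp (A * l.length)]

theorem min_exp_le {K L k x : ℝ} (hK : 0 ≤ K) (hL : 1 ≤ L) (hk : 0 ≤ k) (h2 : x ≤ 2)
    (hx : x ≤ Real.exp (K * L - k)) :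
    x ≤ 360 * (1 + K) ^ 5 * L ^ 5 * ((1 + k) ^ 5)⁻¹ := by
  rw [← div_eq_mul_inv, le_div_iff₀ (by positivity)]
  have hKL : 0 ≤ K * L := by positivity
  have h0 : 0 ≤ (1 + K) ^ 5 * L ^ 5 := by positivity
  rcases le_total k (K * L) with h | h
  · have h1 : (1 + k) ^ 5 ≤ (1 + K) ^ 5 * L ^ 5 := by
      rw [← mul_pow]
      exact pow_le_pow_left₀ (by positivity) (by nlinarith) 5
    have h3 : x * (1 + k) ^ 5 ≤ 2 * (1 + k) ^ 5 := mul_le_mul_of_nonneg_right h2 (by positivity)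
    nlinarith
  · obtain ⟨z, hz0, rfl⟩ : ∃ z, 0 ≤ z ∧ k = K * L + z := ⟨k - K * L, by linarith, by ring⟩
    have h1 : (1 + (K * L + z)) ^ 5 ≤ ((1 + K) * L * (1 + z)) ^ 5 := by
      refine pow_le_pow_left₀ (by positivity) ?_ 5
      nlinarith [mul_nonneg hz0 (show 0 ≤ (1 + K) * L - 1 by nlinarith)]
    have h3 := Real.pow_div_factorial_le_exp (1 + z) (show 0 ≤ 1 + z by linarith) 5
    have h4 : ((5 : ℕ).factorial : ℝ) = 120 := by norm_num [Nat.factorial]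
    rw [h4, div_le_iff₀ (by norm_num), Real.exp_add] at h3
    have h5 : (1 + z) ^ 5 * Real.exp (-z) ≤ 360 := by
      have h6 : Real.exp z * Real.exp (-z) = 1 := by rw [← Real.exp_add]; simp
      calc (1 + z) ^ 5 * Real.exp (-z) ≤ Real.exp 1 * Real.exp z * 120 * Real.exp (-z) :=
            mul_le_mul_of_nonneg_right h3 (Real.exp_pos _).le
        _ = Real.exp 1 * 120 * (Real.exp z * Real.exp (-z)) := by ring
        _ ≤ 360 := by rw [h6]; linarith [Real.exp_one_lt_three]
    rw [show K * L - (K * L + z) = -z by ring] at hx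
    calc x * (1 + (K * L + z)) ^ 5 ≤ Real.exp (-z) * ((1 + K) * L * (1 + z)) ^ 5 :=
          mul_le_mul hx h1 (by positivity) (Real.exp_pos _).le
      _ = (1 + K) ^ 5 * L ^ 5 * ((1 + z) ^ 5 * Real.exp (-z)) := by ring
      _ ≤ (1 + K) ^ 5 * L ^ 5 * 360 := mul_le_mul_of_nonneg_left h5 h0
      _ = _ := by ring

/-- The function on the strip attached to a profile. -/
noncomputable def prof (p : ℝ → ℝ) (x : ℝ × Ω) : ℂ := (p x.1 : ℂ) * (P.w x.2 : ℂ)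

omit [IsProbabilityMeasure κ] in
theorem strip_prof {p : ℝ → ℝ} {M a b : ℝ} (h : Profile p M a b) : P.Strip (P.prof p) M a b where
  meas := (Complex.measurable_ofReal.comp (h.meas.comp measurable_fst)).mul
    (Complex.measurable_ofReal.comp (P.meas_w.comp measurable_snd))
  bound x := by
    rw [prof, norm_mul, Complex.norm_real, Complex.norm_real, Real.norm_of_nonneg (P.w_nonneg _)]
    exact mul_le_mul_of_nonneg_right (h.bound _) (P.w_nonneg _)
  supp x hx := by rw [prof, h.supp _ hx, Complex.ofReal_zero, zero_mul]

open Classical in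
/-- The vector attached to a profile. -/
noncomputable def vec (p : ℝ → ℝ) : Lp ℂ 2 ((volume : Measure ℝ).prod κ) :=
  if h : MemLp (P.prof p) 2 ((volume : Measure ℝ).prod κ) then h.toLp _ else 0

variable {P} in
theorem memLp_prof {p : ℝ → ℝ} (h : IsProfile p) :
    MemLp (P.prof p) 2 ((volume : Measure ℝ).prod κ) := by
  obtain ⟨M, a, b, h⟩ := h
  exact (P.strip_prof h).memLp

omit [IsProbabilityMeasure κ] in
theorem vec_eq {p : ℝ → ℝ} (h : MemLp (P.prof p) 2 ((volume : Measure ℝ).prod κ)) :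
    P.vec p = h.toLp _ := dif_pos h

theorem twist_rep_vec (g : H) {p : ℝ → ℝ} (h : IsProfile p) :
    P.twist.rep g (P.vec p) = (P.twist.memLp g (memLp_prof (P := P) h)).toLp _ := by
  rw [P.vec_eq (memLp_prof h), P.twist.rep_toLp]

theorem prof_σ (g : H) (p : ℝ → ℝ) (x : ℝ × Ω) :
    P.prof p (P.twist.σ g x) = P.prof (lineShift (-P.θ g) p) x := by
  rw [P.twist_σ, prof, prof, lineShift, P.w_s, sub_neg_eq_add]

theorem vec_ne_zero : P.vec (Set.indicator (Set.Ico 0 P.τ) 1) ≠ 0 := by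
  have hp : IsProfile (Set.indicator (Set.Ico 0 P.τ) (1 : ℝ → ℝ)) :=
    ⟨1, 0, P.τ, Profile.indicator measurable_const zero_le_one fun _ _ _ => by simp⟩
  rw [P.vec_eq (memLp_prof hp)]
  intro h0
  have h1 := (memLp_prof (P := P) hp).coeFn_toLp
  rw [h0] at h1
  have h2 : P.prof (Set.indicator (Set.Ico 0 P.τ) 1) =ᵐ[(volume : Measure ℝ).prod κ] 0 :=
    h1.symm.trans (Lp.coeFn_zero _ _ _)
  have h3 : ((volume : Measure ℝ).prod κ) (Set.Ico 0 P.τ ×ˢ {α | P.w α ≠ 0}) = 0 := by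
    refine measure_mono_null ?_ (ae_iff.1 h2)
    rintro ⟨y, α⟩ ⟨hy, hα⟩
    simp only [Set.mem_ofPred_eq, prof, Pi.zero_apply]
    rw [Set.indicator_of_mem hy]
    simpa using hα
  rw [Measure.prod_prod, Real.volume_Ico, mul_eq_zero, ENNReal.ofReal_eq_zero] at h3
  rcases h3 with h3 | h3
  · linarith [P.τ_pos]
  · exact P.w_ne h3

theorem exists_halfLine (P : PhaseData H κ) (hT : SymmGen T) :
    Nonempty (HalfLine H Unit (Lp ℂ 2 ((volume : Measure ℝ).prod κ))
      fun x => (wordLen (T : Set H) x : ℝ)) := by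
  obtain ⟨D, hD, hθ, hq⟩ := P.exists_growth hT
  obtain ⟨C, F, hC, hwin⟩ := P.exists_window hT
  have h360 : 0 ≤ 360 * (1 + 2 * D) ^ 5 * (1 + D) ^ 2 := by positivity
  refine ⟨{
    ρ := P.twist.rep
    norm_map := P.twist.norm_rep
    J := fun _ p => P.vec p
    ω := fun g _ => -P.θ g
    F := F
    C := 1 + D + C * (1 + 360 * (1 + 2 * D) ^ 5 * (1 + D) ^ 2)
    m := 7
    C_nonneg := by positivity
    ω_mul := fun g g' _ => by rw [P.θ_mul]; ring
    ω_le := fun g _ => ?_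
    J_add := fun _ p q hp hq => ?_
    J_smul := fun _ c p hp => ?_
    norm_J := fun _ p M a b hab hp => ?_
    disp_J := fun _ p M R hR hp => ?_
    disp_sub := fun g _ p M k hp => ?_
    inner_eq_zero := fun g i j p q hp hq h => ?_
    t := P.t
    i₀ := ()
    τ := P.τ
    τ_pos := P.τ_pos
    t_smul := rfl
    ω_t := by rw [P.θ_t, neg_neg]
    ρ_t := fun p hp => ?_
    J_ne_zero := P.vec_ne_zero }⟩
  · rw [abs_neg]
    refine (hθ g).trans ?_
    have : (0 : ℝ) ≤ wordLen (T : Set H) g := Nat.cast_nonneg _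
    nlinarith [mul_nonneg hC (add_nonneg zero_le_one h360)]
  · rw [P.vec_eq (memLp_prof hp), P.vec_eq (memLp_prof hq), P.vec_eq (memLp_prof (hp.add hq)),
      ← MemLp.toLp_add]
    refine MemLp.toLp_congr _ _ (Filter.Eventually.of_forall fun x => ?_)
    simp only [prof, Pi.add_apply, Complex.ofReal_add]
    ring
  · rw [P.vec_eq (memLp_prof hp), P.vec_eq (memLp_prof (hp.smul c)), ← MemLp.toLp_const_smul]
    refine MemLp.toLp_congr _ _ (Filter.Eventually.of_forall fun x => ?_)
    simp only [prof, Pi.smul_apply, smul_eq_mul, Complex.ofReal_mul]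
    ring
  · have hS := P.strip_prof hp
    obtain ⟨h1, h2⟩ := memLp_of_strip (κ := κ) hS.meas hS.bound' hS.supp
    rw [P.vec_eq h1]
    refine (h2 hab).trans ?_
    rw [mul_assoc]
    refine le_mul_of_one_le_left (mul_nonneg hp.nonneg (by linarith)) ?_
    nlinarith [mul_nonneg hC (add_nonneg zero_le_one h360)]
  · have hS := P.strip_prof hp
    have hM := hp.nonneg
    rw [P.vec_eq hS.memLp]
    refine (hwin _ M R hS hR).mono ?_
    refine mul_le_mul (mul_le_mul_of_nonneg_right ?_ hM) ?_ (by positivity) (by positivity)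
    · nlinarith [mul_nonneg hC h360]
    · exact pow_le_pow_right₀ hR (by norm_num)
  · have hM := hp.nonneg
    have hP : IsProfile p := ⟨_, _, _, hp⟩
    set L : ℝ := 1 + (wordLen (T : Set H) g : ℝ) with hL
    have hw0 : (0 : ℝ) ≤ wordLen (T : Set H) g := Nat.cast_nonneg _
    have hL1 : 1 ≤ L := by linarith
    have hk0 : (0 : ℝ) ≤ k := Nat.cast_nonneg k
    have hθL : |P.θ g| ≤ D * L := (hθ g).trans (mul_le_mul_of_nonneg_left (by linarith) hD)
    obtain ⟨hθ1, hθ2⟩ := abs_le.1 hθL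
    set δ : ℝ := 360 * (1 + 2 * D) ^ 5 * L ^ 5 * ((1 + (k : ℝ)) ^ 5)⁻¹ with hδ
    set ψ : ℝ × Ω → ℂ := fun x => P.twist.u g x * P.prof p (P.twist.σ g x) -
      P.prof (lineShift (-P.θ g) p) x with hψ
    have hS := P.strip_prof (hp.lineShift (-P.θ g))
    have hψ' : ∀ x, ψ x = (P.twist.u g x - 1) * P.prof (lineShift (-P.θ g) p) x := fun x => by
      rw [hψ]
      dsimp only
      rw [P.prof_σ]
      ring
    have hψ0 : ∀ x : ℝ × Ω, (x.1 < -(k : ℝ) - 1 + -P.θ g ∨ -(k : ℝ) + -P.θ g ≤ x.1) → ψ x = 0 :=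
      fun x hx => by rw [hψ', hS.supp x hx, mul_zero]
    have hu : ∀ x : ℝ × Ω, x.1 < -(k : ℝ) + -P.θ g → ‖P.twist.u g x - 1‖ ≤ δ := by
      intro x hx
      refine min_exp_le (by positivity) hL1 hk0 ?_ ?_
      · refine (norm_sub_le _ _).trans ?_
        rw [P.twist.norm_u, norm_one]
        norm_num
      · rw [P.twist_u]
        refine Real.norm_exp_I_mul_ofReal_sub_one_le.trans ?_
        rw [Real.norm_eq_abs, abs_mul, Real.abs_exp]
        refine (mul_le_mul_of_nonneg_left (hq g x.2) (Real.exp_pos _).le).trans ?_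
        rw [← Real.exp_add]
        refine Real.exp_le_exp.2 ?_
        have : D * (wordLen (T : Set H) g : ℝ) ≤ D * L :=
          mul_le_mul_of_nonneg_left (by linarith) hD
        linarith
    have hψS : P.Strip ψ (δ * M) (-((1 + k) * (1 + D) * L)) ((1 + k) * (1 + D) * L) := by
      have hb : 1 + (k : ℝ) + D * L ≤ (1 + k) * (1 + D) * L := by
        nlinarith [mul_nonneg hk0 hD, mul_nonneg (mul_nonneg hk0 hD) (zero_le_one.trans hL1),
          mul_nonneg hk0 (sub_nonneg.2 hL1)]
      refine ⟨?_, fun x => ?_, fun x hx => hψ0 x ?_⟩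
      · have : ψ = fun x => (P.twist.u g x - 1) * P.prof (lineShift (-P.θ g) p) x := funext hψ'
        rw [this]
        exact ((P.twist.meas_u g).sub_const 1).mul hS.meas
      · by_cases hx : x.1 < -(k : ℝ) + -P.θ g
        · rw [hψ', norm_mul, mul_assoc]
          exact mul_le_mul (hu x hx) (hS.bound x) (norm_nonneg _) (by positivity)
        · rw [hψ0 x (Or.inr (not_lt.1 hx)), norm_zero]
          exact mul_nonneg (by positivity) (P.w_nonneg _)
      · rcases hx with hx | hx
        · left; linarith
        · right; linarith
    have hR : 1 ≤ (1 + (k : ℝ)) * (1 + D) * L := by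
      have h1 : 1 ≤ (1 + (k : ℝ)) * (1 + D) := by nlinarith
      nlinarith
    have heq : P.twist.rep g (P.vec p) - P.vec (lineShift (-P.θ g) p) = hψS.memLp.toLp ψ := by
      rw [P.twist_rep_vec g hP, P.vec_eq (memLp_prof (hP.lineShift _)), ← MemLp.toLp_sub]
      exact MemLp.toLp_congr _ _ (Filter.Eventually.of_forall fun x => rfl)
    rw [heq]
    refine (hwin _ _ _ hψS hR).mono ?_
    have hk1 : (1 + (k : ℝ)) ≠ 0 := by positivity
    have : C * (δ * M) * ((1 + (k : ℝ)) * (1 + D) * L) ^ 2 =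
        C * (360 * (1 + 2 * D) ^ 5 * (1 + D) ^ 2) * M * L ^ 7 * ((1 + (k : ℝ)) ^ 3)⁻¹ := by
      rw [hδ]
      field_simp
    rw [this]
    refine mul_le_mul_of_nonneg_right (mul_le_mul_of_nonneg_right
      (mul_le_mul_of_nonneg_right ?_ hM) (by positivity)) (by positivity)
    nlinarith
  · rw [P.twist_rep_vec g hp, P.vec_eq (memLp_prof hq)]
    refine inner_toLp_eq_zero _ _ fun x => ?_
    rcases h with h | h
    · exact absurd rfl h
    · rw [P.prof_σ, prof, prof]
      have h1 : ((lineShift (-P.θ g) p x.1 : ℝ) : ℂ) * (q x.1 : ℂ) = 0 := by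
        rw [← Complex.ofReal_mul, h x.1, Complex.ofReal_zero]
      linear_combination (P.twist.u g x * (P.w x.2 : ℂ) * (P.w x.2 : ℂ)) * h1
  · rw [P.twist_rep_vec P.t hp, P.vec_eq (memLp_prof (hp.lineShift _))]
    refine MemLp.toLp_congr _ _ (Filter.Eventually.of_forall fun x => ?_)
    dsimp only
    rw [P.prof_σ, P.θ_t, neg_neg, P.twist_u, P.q_t]
    simp

end PhaseData

end PhaseHalfLine

section ComplexAffine

open MeasureTheory
open scoped ENNReal InnerProductSpace

noncomputable instance : MeasurableSpace Circle := borel Circle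

instance : BorelSpace Circle := ⟨rfl⟩

/-- The normalised Haar measure of the circle. -/
noncomputable def circleHaar : Measure Circle := Measure.haarMeasure ⊤

instance : IsProbabilityMeasure circleHaar := ⟨by
  have := Measure.haarMeasure_self (K₀ := (⊤ : TopologicalSpace.PositiveCompacts Circle))
  simpa [circleHaar] using this⟩

theorem circleHaar_ne_zero {U : Set Circle} (h : IsOpen U) (h' : U.Nonempty) :
    circleHaar U ≠ 0 := by
  unfold circleHaar
  exact h.measure_ne_zero _ h'

theorem measurePreserving_mul_circle (a : Circle) :
    MeasurePreserving (· * a) circleHaar circleHaar := by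
  unfold circleHaar
  exact measurePreserving_mul_right _ a

theorem continuous_circle_coe : Continuous fun α : Circle => (α : ℂ) := continuous_subtype_val

/-- The unit complex number in the direction of `z`. -/
noncomputable def unitPart (z : ℂ) (hz : z ≠ 0) : Circle :=
  ⟨z / (‖z‖ : ℂ), mem_sphere_zero_iff_norm.2 (by
    rw [norm_div, Complex.norm_real, norm_norm, div_self (norm_ne_zero_iff.2 hz)])⟩

theorem coe_unitPart (z : ℂ) (hz : z ≠ 0) : (unitPart z hz : ℂ) = z / (‖z‖ : ℂ) := rfl

theorem abs_im_conj_mul_le (α : Circle) (c₁ c₂ : ℂ) : |(starRingEnd ℂ c₁ * c₂).im| ≤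
    (|(α * c₁).re| + |(α * c₂).re|) * (‖c₁‖ + ‖c₂‖) := by
  set u : ℂ := α * c₁ with hu
  set v : ℂ := α * c₂ with hv
  have hun : ‖u‖ = ‖c₁‖ := by rw [hu, norm_mul, α.norm_coe, one_mul]
  have hvn : ‖v‖ = ‖c₂‖ := by rw [hv, norm_mul, α.norm_coe, one_mul]
  have h1 : starRingEnd ℂ c₁ * c₂ = starRingEnd ℂ u * v := by
    have h2 : starRingEnd ℂ (α : ℂ) * α = 1 := by
      rw [mul_comm, Complex.mul_conj, α.normSq_coe, Complex.ofReal_one]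
    rw [hu, hv, map_mul]
    linear_combination (-(starRingEnd ℂ c₁ * c₂)) * h2
  have h3 : (starRingEnd ℂ u * v).im = u.re * v.im - u.im * v.re := by
    rw [Complex.mul_im, Complex.conj_re, Complex.conj_im]; ring
  rw [h1, h3, ← hun, ← hvn]
  have h4 : |u.re * v.im| ≤ |u.re| * ‖v‖ := by
    rw [abs_mul]; exact mul_le_mul_of_nonneg_left (Complex.abs_im_le_norm v) (abs_nonneg _)
  have h5 : |u.im * v.re| ≤ ‖u‖ * |v.re| := by
    rw [abs_mul]; exact mul_le_mul_of_nonneg_right (Complex.abs_im_le_norm u) (abs_nonneg _)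
  refine (abs_sub _ _).trans ?_
  nlinarith [mul_nonneg (abs_nonneg u.re) (norm_nonneg u), mul_nonneg (abs_nonneg v.re)
    (norm_nonneg v)]

variable {H : Type*} [Group H] (l : H →* ℂ) (c : H → ℂ) (hc : ∀ g g', c (g * g') = c g + l g * c g')

theorem charHom_ne_zero (g : H) : l g ≠ 0 := fun h => by
  have := l.map_one
  rw [← mul_inv_cancel g, l.map_mul, h, zero_mul] at this
  exact zero_ne_one this

include hc

theorem crossed_conj {a : H} (ha : l a = 1) (g : H) : c (g * a * g⁻¹) = l g * c a := by
  have h1 : c 1 = 0 := by have := hc 1 1; simpa using this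
  have h2 := hc g g⁻¹
  rw [mul_inv_cancel, h1] at h2
  rw [hc, hc, l.map_mul, ha]
  linear_combination -h2

theorem exists_weight {a : H} (ha : l a = 1) (hca : c a ≠ 0) :
    ∃ (w : Circle → ℝ) (F : Finset H), Measurable w ∧ (∀ α, 0 ≤ w α) ∧ (∀ α, w α ≤ 1) ∧
      (∀ (g : H) (α α' : Circle), (α' : ℂ) * (‖l g‖ : ℂ) = α * l g → w α' = w α) ∧
      (∀ h ∈ F, l h = 1) ∧ (∀ α : Circle, w α ≤ ∑ h ∈ F, |((α : ℂ) * c h).re|) ∧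
      circleHaar {α | w α ≠ 0} ≠ 0 := by
  classical
  by_cases hind : ∃ a', l a' = 1 ∧ (starRingEnd ℂ (c a) * c a').im ≠ 0
  · obtain ⟨a', ha', hne⟩ := hind
    have hΔ : 0 < |(starRingEnd ℂ (c a) * c a').im| := abs_pos.2 hne
    set Δ : ℝ := |(starRingEnd ℂ (c a) * c a').im| with hΔdef
    set m : ℝ := ‖c a‖ + ‖c a'‖ + Δ with hm
    have hm0 : 0 < m := by positivity
    have haa : a ≠ a' := by
      rintro rfl
      rw [mul_comm, Complex.mul_conj, Complex.ofReal_im] at hne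
      exact hne rfl
    refine ⟨fun _ => Δ / m, {a, a'}, measurable_const, fun _ => by positivity, fun _ => ?_,
      fun _ _ _ _ => rfl, fun h hh => ?_, fun α => ?_, ?_⟩
    · rw [div_le_one hm0, hm]
      linarith [norm_nonneg (c a), norm_nonneg (c a')]
    · rcases Finset.mem_insert.1 hh with rfl | hh
      · exact ha
      · rw [Finset.mem_singleton.1 hh]; exact ha'
    · rw [Finset.sum_pair haa, div_le_iff₀ hm0]
      refine (abs_im_conj_mul_le α (c a) (c a')).trans (mul_le_mul_of_nonneg_left ?_ (by positivity))
      linarith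
    · have : {α : Circle | Δ / m ≠ 0} = Set.univ := Set.eq_univ_of_forall fun _ =>
        (div_pos hΔ hm0).ne'
      rw [this]
      exact circleHaar_ne_zero isOpen_univ ⟨1, trivial⟩
  · push Not at hind
    have hreal : ∀ g, (l g).im = 0 := by
      intro g
      have h1 := hind (g * a * g⁻¹) (by
        rw [l.map_mul, l.map_mul, ha, mul_one, ← l.map_mul, mul_inv_cancel, l.map_one])
      rw [crossed_conj l c hc ha, mul_left_comm, mul_comm (starRingEnd ℂ (c a)), Complex.mul_conj,
        Complex.mul_im, Complex.ofReal_im, Complex.ofReal_re, mul_zero, zero_add] at h1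
      exact (mul_eq_zero.1 h1).resolve_right (Complex.normSq_pos.2 hca).ne'
    set m : ℝ := 1 + ‖c a‖ with hm
    have hm1 : 1 ≤ m := by linarith [norm_nonneg (c a)]
    have hm0 : 0 < m := by linarith
    have hcont : Continuous fun α : Circle => |((α : ℂ) * c a).re| / m :=
      ((Complex.continuous_re.comp (continuous_circle_coe.mul_const (c a))).abs).div_const m
    refine ⟨fun α => |((α : ℂ) * c a).re| / m, {a}, hcont.measurable, fun _ => by positivity,
      fun α => ?_, fun g α α' hα => ?_, fun h hh => ?_, fun α => ?_, ?_⟩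
    · rw [div_le_one hm0]
      refine (Complex.abs_re_le_norm _).trans ?_
      rw [norm_mul, α.norm_coe, one_mul]
      linarith
    · have hl : l g = ((l g).re : ℂ) := Complex.ext rfl (by simp [hreal g])
      have hn : ‖l g‖ = |(l g).re| := by rw [hl, Complex.norm_real]; simp
      have hpos : 0 < |(l g).re| := by rw [← hn]; exact norm_pos_iff.2 (charHom_ne_zero l g)
      have h2 : ((α' : ℂ) * c a).re * |(l g).re| = ((α : ℂ) * c a).re * (l g).re := by
        have h3 := congrArg (fun z => (z * c a).re) hα
        rw [hn, hl] at h3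
        simp only [Complex.ofReal_re] at h3
        rw [mul_right_comm, mul_right_comm (α : ℂ), Complex.re_mul_ofReal,
          Complex.re_mul_ofReal] at h3
        exact h3
      have h4 := congrArg abs h2
      rw [abs_mul, abs_mul, abs_abs] at h4
      dsimp only
      rw [mul_right_cancel₀ hpos.ne' h4]
    · rw [Finset.mem_singleton.1 hh]; exact ha
    · rw [Finset.sum_singleton]
      exact div_le_self (abs_nonneg _) hm1
    · refine circleHaar_ne_zero (isOpen_ne_fun hcont continuous_const) ⟨(unitPart (c a) hca)⁻¹, ?_⟩
      simp only [Set.mem_ofPred_eq]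
      rw [Circle.coe_inv, coe_unitPart, inv_div, div_mul_cancel₀ _ hca, Complex.ofReal_re,
        abs_norm]
      exact (div_pos (norm_pos_iff.2 hca) hm0).ne'

/-- A complex affine action with a contracting element gives a half-line. -/
theorem SymmGen.exists_halfLine_of_complex {T : Finset H} (hT : SymmGen T) {t : H}
    (ht : ‖l t‖ < 1) (hct : c t = 0) {a : H} (ha : l a = 1) (hca : c a ≠ 0) :
    Nonempty (HalfLine H Unit (Lp ℂ 2 ((volume : Measure ℝ).prod circleHaar))
      fun x => (wordLen (T : Set H) x : ℝ)) := by
  obtain ⟨w, F, hw, hw0, hw1, hws, hF, hwF, hwne⟩ := exists_weight l c hc ha hca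
  have hl0 := charHom_ne_zero l
  have hln : ∀ g, ((‖l g‖ : ℝ) : ℂ) ≠ 0 := fun g =>
    Complex.ofReal_ne_zero.2 (norm_ne_zero_iff.2 (hl0 g))
  have hexp : ∀ g, Real.exp (Real.log ‖l g‖) = ‖l g‖ := fun g =>
    Real.exp_log (norm_pos_iff.2 (hl0 g))
  refine PhaseData.exists_halfLine (κ := circleHaar)
    { θ := fun g => Real.log ‖l g‖
      θ_mul := fun g g' => ?_
      s := fun g α => α * unitPart (l g) (hl0 g)
      mp := fun g => measurePreserving_mul_circle _
      s_one := fun α => ?_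
      s_mul := fun g g' α => ?_
      q := fun g α => ((α : ℂ) * c g).re
      meas_q := fun g => (Complex.continuous_re.comp
        (continuous_circle_coe.mul_const (c g))).measurable
      q_mul := fun g g' α => ?_
      Q := fun g => ‖c g‖
      q_le := fun g α => ?_
      w := w
      meas_w := hw
      w_nonneg := hw0
      w_le_one := hw1
      w_s := fun g α => hws g _ _ ?_
      Fa := F
      θ_Fa := fun h hh => ?_
      s_Fa := fun h hh α => ?_
      w_le := hwF
      w_ne := hwne
      t := t
      τ := -Real.log ‖l t‖
      τ_pos := neg_pos.2 (Real.log_neg (norm_pos_iff.2 (hl0 t)) ht)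
      θ_t := (neg_neg _).symm
      q_t := fun α => by rw [hct, mul_zero, Complex.zero_re] } hT
  · rw [l.map_mul, norm_mul, Real.log_mul (norm_ne_zero_iff.2 (hl0 g))
      (norm_ne_zero_iff.2 (hl0 g'))]
  · ext
    rw [Circle.coe_mul, coe_unitPart, l.map_one, norm_one, Complex.ofReal_one, div_one, mul_one]
  · ext
    rw [Circle.coe_mul, Circle.coe_mul, Circle.coe_mul, coe_unitPart, coe_unitPart, coe_unitPart,
      l.map_mul, norm_mul, Complex.ofReal_mul, mul_div_mul_comm, mul_assoc]
  · rw [hexp, Circle.coe_mul, coe_unitPart, hc, mul_add, Complex.add_re, ← Complex.re_ofReal_mul]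
    congr 2
    field_simp [hln g]
  · refine (Complex.abs_re_le_norm _).trans ?_
    rw [norm_mul, α.norm_coe, one_mul]
  · rw [Circle.coe_mul, coe_unitPart, mul_assoc, div_mul_cancel₀ _ (hln g)]
  · rw [hF h hh, norm_one, Real.log_one]
  · ext
    rw [Circle.coe_mul, coe_unitPart, hF h hh, norm_one, Complex.ofReal_one, div_one, mul_one]

end ComplexAffine

section Valued

open WithZero Pointwise

variable {K : Type*} [Field K]

/-- The subgroups of a filtration given by a discrete valuation. -/
def valBall (v : Valuation K (WithZero (Multiplicative ℤ))) (n : ℤ) : AddSubgroup K where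
  carrier := {x | v x ≤ exp (-n)}
  zero_mem' := by simp
  add_mem' hx hy := (v.map_add _ _).trans (max_le hx hy)
  neg_mem' {x} hx := by
    simp only [Set.mem_ofPred_eq] at hx ⊢
    rwa [v.map_neg]

theorem mem_valBall {v : Valuation K (WithZero (Multiplicative ℤ))} {n : ℤ} {x : K} :
    x ∈ valBall v n ↔ v x ≤ exp (-n) := Iff.rfl

theorem valBall_anti (v : Valuation K (WithZero (Multiplicative ℤ))) {m n : ℤ} (h : m ≤ n) :
    valBall v n ≤ valBall v m := fun _ hx => (mem_valBall.1 hx).trans (exp_le_exp.2 (neg_le_neg h))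

/-- A discrete valuation with uniformizer and finite residue field. -/
structure LocalVal (v : Valuation K (WithZero (Multiplicative ℤ))) : Prop where
  unif : ∃ π, v π = exp (-1)
  residue : ∃ R : Finset K, ∀ x, v x ≤ 1 → ∃ r ∈ R, v (x - r) ≤ exp (-1)

theorem LocalVal.finite_cosets {v : Valuation K (WithZero (Multiplicative ℤ))} (hv : LocalVal v)
    (n : ℤ) (m : ℕ) : ∃ R : Finset K, ∀ x ∈ valBall v n, ∃ r ∈ R, x - r ∈ valBall v (n + m) := by
  classical
  obtain ⟨π, hπ⟩ := hv.unif
  obtain ⟨R, hR⟩ := hv.residue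
  have hπz : ∀ k : ℤ, v (π ^ k) = exp (-k) := fun k => by
    rw [map_zpow₀, hπ, ← exp_zsmul, smul_eq_mul, mul_neg_one]
  have hπ0 : π ≠ 0 := fun h => by rw [h, map_zero] at hπ; exact exp_ne_zero hπ.symm
  induction m with
  | zero => exact ⟨{0}, fun x hx => ⟨0, by simp, by simpa using hx⟩⟩
  | succ m ih =>
    obtain ⟨R', hR'⟩ := ih
    refine ⟨(R' ×ˢ R).image fun p => p.1 + π ^ (n + m) * p.2, fun x hx => ?_⟩
    obtain ⟨r', hr', h1⟩ := hR' x hx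
    obtain ⟨r, hr, h2⟩ := hR (π ^ (-(n + m)) * (x - r')) (by
      rw [map_mul, hπz]
      refine (mul_le_mul_right (mem_valBall.1 h1) _).trans ?_
      rw [← exp_add]
      simp)
    refine ⟨_, Finset.mem_image_of_mem _ (Finset.mk_mem_product hr' hr), ?_⟩
    have h3 : x - (r' + π ^ (n + m) * r) = π ^ (n + m) * (π ^ (-(n + m)) * (x - r') - r) := by
      rw [mul_sub, ← mul_assoc, ← zpow_add₀ hπ0, add_neg_cancel, zpow_zero]
      ring
    dsimp only
    rw [h3, mem_valBall, map_mul, hπz]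
    refine (mul_le_mul_right h2 _).trans ?_
    rw [← exp_add, exp_le_exp]
    push_cast
    linarith

theorem localVal_of_heightOneSpectrum {R : Type*} [CommRing R] [IsDedekindDomain R] [Algebra R K]
    [IsFractionRing R K] (p : IsDedekindDomain.HeightOneSpectrum R) [Finite (R ⧸ p.asIdeal)] :
    LocalVal (p.valuation K) := by
  classical
  refine ⟨p.valuation_exists_uniformizer K, ?_⟩
  obtain ⟨π, hπ⟩ := p.valuation_exists_uniformizer K
  have := Fintype.ofFinite (R ⧸ p.asIdeal)
  refine ⟨Finset.univ.image fun q : R ⧸ p.asIdeal => algebraMap R K q.out, fun x hx => ?_⟩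
  obtain ⟨a, ha⟩ := p.exists_valuation_sub_lt_of_integer (γ := Units.mk0 1 one_ne_zero) hx
  have hlt : ∀ y : K, p.valuation K y < 1 → p.valuation K y ≤ exp (-1) := by
    intro y hy
    by_cases h0 : p.valuation K y = 0
    · rw [h0]; exact zero_le
    · rw [← log_le_iff_le_exp h0]
      have h1 := (log_lt_log h0 one_ne_zero).2 hy
      rw [log_one] at h1
      omega
  refine ⟨_, Finset.mem_image_of_mem _ (Finset.mem_univ (Ideal.Quotient.mk p.asIdeal a)), hlt _ ?_⟩
  have h1 : a - (Ideal.Quotient.mk p.asIdeal a).out ∈ p.asIdeal := by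
    rw [← Ideal.Quotient.eq]
    exact (Quotient.out_eq _).symm
  have h2 := (p.valuation_lt_one_iff_mem (K := K) _).2 h1
  have h3 : x - algebraMap R K (Ideal.Quotient.mk p.asIdeal a).out
      = algebraMap R K (a - (Ideal.Quotient.mk p.asIdeal a).out) - (algebraMap R K a - x) := by
    rw [map_sub]
    ring
  rw [h3]
  exact Valuation.map_sub_lt _ h2 ha

/-- A nonarchimedean affine action with a contracting element gives a half-line. -/
theorem SymmGen.exists_halfLine_of_localVal {H : Type*} [Group H] {T : Finset H} (hT : SymmGen T)
    {v : Valuation K (WithZero (Multiplicative ℤ))} (hv : LocalVal v)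
    (l : H →* Kˣ) (c : H → K) (hc : ∀ g g', c (g * g') = c g + l g * c g')
    {t : H} (ht : v (l t) ≠ 1) {a : H} (ha : l a = 1) (hca : c a ≠ 0) :
    Nonempty (HalfLine H Unit (lp (fun _ : Set K => ℂ) 2) fun x => (wordLen (T : Set H) x : ℝ)) := by
  have hv0 : ∀ g, v (l g) ≠ 0 := fun g => v.ne_zero_iff.2 (l g).ne_zero
  set e : H → ℤ := fun g => -log (v (l g)) with he
  have hemul : ∀ g g', e (g * g') = e g + e g' := fun g g' => by
    rw [he]
    dsimp only
    rw [map_mul, Units.val_mul, map_mul, log_mul (hv0 g) (hv0 g')]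
    ring
  have het : e t ≠ 0 := fun h => ht <| by
    rw [← exp_log (hv0 t), neg_eq_zero.1 h, exp_zero]
  obtain ⟨m, t', hm, ht', η, hη⟩ : ∃ (m : ℕ) (t' : H), 0 < m ∧ e t' = m ∧
      ∃ η : H → ℤ, ∀ g, e g = m * η g := by
    have he1 : e 1 = 0 := by
      have := hemul 1 1
      rw [mul_one] at this
      linarith
    let f : Additive H →+ ℤ := ⟨⟨fun g => e g.toMul, he1⟩, fun g g' => hemul g.toMul g'.toMul⟩
    obtain ⟨d, hd⟩ := Int.subgroup_cyclic f.range
    rw [← AddSubgroup.zmultiples_eq_closure] at hd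
    have hdvd : ∀ g, d ∣ e g := fun g => by
      have h1 : e g ∈ f.range := ⟨Additive.ofMul g, rfl⟩
      rw [hd, Int.mem_zmultiples_iff] at h1
      exact h1
    have hd0 : d ≠ 0 := fun h => het (by simpa [h] using hdvd t)
    have hmem : (d.natAbs : ℤ) ∈ f.range := by
      rw [hd, Int.mem_zmultiples_iff]
      exact Int.dvd_natAbs.2 dvd_rfl
    obtain ⟨t', ht'⟩ := hmem
    choose η hη using fun g => Int.natAbs_dvd.2 (hdvd g)
    exact ⟨d.natAbs, t'.toMul, Int.natAbs_pos.2 hd0, ht', η, hη⟩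
  have hηmul : ∀ g g', η (g * g') = η g + η g' := fun g g' => by
    have h1 := hemul g g'
    rw [hη, hη, hη, ← mul_add] at h1
    exact mul_left_cancel₀ (by positivity) h1
  have hη1 : η t' = 1 := by
    have := hη t'
    rw [ht'] at this
    exact (mul_left_cancel₀ (by positivity) (this.symm.trans (mul_one _).symm))
  have hlt : (1 : K) - l t' ≠ 0 := fun h => by
    have h1 : e t' = 0 := by
      rw [he]
      dsimp only
      rw [← sub_eq_zero.1 h, map_one, log_one, neg_zero]
    omega
  set x₀ : K := c t' / (1 - l t') with hx₀
  have hlB : ∀ g, ∀ n x, x ∈ valBall v n → (l g : K) * x ∈ valBall v (n + e g) := by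
    intro g n x hx
    rw [mem_valBall, map_mul, neg_add, add_comm, exp_add]
    refine mul_le_mul' (le_of_eq ?_) hx
    rw [he, neg_neg, exp_log (hv0 g)]
  refine hT.exists_halfLine_of_filtration (t := t')
    (fun g => AddMonoidHom.mulLeft (l g : K)) (fun g g' x => ?_) (fun x => ?_)
    (fun g => c g - (x₀ - l g * x₀)) (fun g g' => ?_) ?_ η hηmul hη1
    (fun n => valBall v (m * n)) (fun n => valBall_anti v (by nlinarith)) (fun g n x hx => ?_)
    (fun x => ?_) (fun n => ?_) a (fun x => ?_) (n₀ := |log (v (c a))| + 1) ?_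
  · simp [mul_assoc]
  · simp
  · simp only [AddMonoidHom.coe_mulLeft, map_mul, Units.val_mul, hc]
    ring
  · rw [hx₀]
    field_simp
    ring
  · have := hlB g _ x hx
    rwa [hη, ← mul_add] at this
  · by_cases h0 : v x = 0
    · exact ⟨0, by rw [mem_valBall, h0]; exact zero_le⟩
    · refine ⟨-|log (v x)|, ?_⟩
      rw [mem_valBall, ← log_le_iff_le_exp h0]
      have := le_abs_self (log (v x))
      nlinarith [abs_nonneg (log (v x))]
  · obtain ⟨R, hR⟩ := hv.finite_cosets (m * n) m
    refine (R.finite_toSet.image fun u : K => u +ᵥ (valBall v (m * (n + 1)) : Set K)).subset ?_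
    rintro _ ⟨x, hx, rfl⟩
    obtain ⟨r, hr, hxr⟩ := hR x hx
    refine ⟨r, hr, ?_⟩
    rw [← mul_add_one] at hxr
    refine (leftAddCoset_eq_iff _).2 ?_
    rwa [neg_add_eq_sub]
  · simp [ha]
  · have h0 : v (c a) ≠ 0 := v.ne_zero_iff.2 hca
    rw [ha, Units.val_one, one_mul, sub_self, sub_zero, mem_valBall, ← log_le_iff_le_exp h0]
    have := neg_abs_le (log (v (c a)))
    have := abs_nonneg (log (v (c a)))
    nlinarith

end Valued

section AffineAction

/-- An affine action of a group on a field, given by its linear part and its translation part. -/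
structure AffineRep (H L : Type*) [Group H] [Field L] where
  l : H →* L
  c : H → L
  c_mul : ∀ g g', c (g * g') = c g + l g * c g'

namespace AffineRep

variable {H L L' : Type*} [Group H] [Field L] [Field L']

theorem l_ne_zero (A : AffineRep H L) (g : H) : A.l g ≠ 0 := fun h => by
  have h1 : A.l (g * g⁻¹) = 1 := by rw [mul_inv_cancel, map_one]
  rw [map_mul, h, zero_mul] at h1
  exact zero_ne_one h1

theorem l_inv (A : AffineRep H L) (g : H) : A.l g⁻¹ = (A.l g)⁻¹ := by
  refine eq_inv_of_mul_eq_one_left ?_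
  rw [← map_mul, inv_mul_cancel, map_one]

theorem c_one (A : AffineRep H L) : A.c 1 = 0 := by
  have := A.c_mul 1 1
  rw [map_one, mul_one, one_mul] at this
  simpa using this

theorem c_inv (A : AffineRep H L) (g : H) : A.c g⁻¹ = -(A.l g)⁻¹ * A.c g := by
  have := A.c_mul g⁻¹ g
  rw [inv_mul_cancel, c_one, l_inv] at this
  linear_combination -this

/-- Transport of an affine action along a field homomorphism. -/
def map (A : AffineRep H L) (f : L →+* L') : AffineRep H L' where
  l := f.toMonoidHom.comp A.l
  c g := f (A.c g)
  c_mul g g' := by simp [A.c_mul]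

theorem mem_of_closure (A : AffineRep H L) (K : Subfield L) {T : Set H}
    (hT : Subgroup.closure T = ⊤) (h : ∀ s ∈ T, A.l s ∈ K ∧ A.c s ∈ K) (g : H) :
    A.l g ∈ K ∧ A.c g ∈ K := by
  have hg : g ∈ Subgroup.closure T := hT ▸ Subgroup.mem_top g
  induction hg using Subgroup.closure_induction with
  | mem x hx => exact h x hx
  | one => simp [A.c_one, K.one_mem, K.zero_mem]
  | mul x y _ _ hx hy =>
    rw [map_mul, A.c_mul]
    exact ⟨K.mul_mem hx.1 hy.1, K.add_mem hx.2 (K.mul_mem hx.1 hy.2)⟩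
  | inv x _ hx =>
    rw [l_inv, c_inv]
    exact ⟨K.inv_mem hx.1, K.mul_mem (K.neg_mem (K.inv_mem hx.1)) hx.2⟩

/-- Restriction of the field of definition. -/
def restrict (A : AffineRep H L) (K : Subfield L) (h : ∀ g, A.l g ∈ K ∧ A.c g ∈ K) :
    AffineRep H K where
  l := ⟨⟨fun g => ⟨A.l g, (h g).1⟩, Subtype.ext A.l.map_one⟩, fun g g' => Subtype.ext (A.l.map_mul g g')⟩
  c g := ⟨A.c g, (h g).2⟩
  c_mul g g' := Subtype.ext (A.c_mul g g')

/-- A finitely generated affine action over a field of algebraic elements is, after a Frobenius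
twist, defined over a finite separable extension. -/
theorem exists_finite_separable (A : AffineRep H L) (K : Type*) [Field K] [Algebra K L]
    [Algebra.IsAlgebraic K L] {T : Set H} (hTf : T.Finite) (hT : Subgroup.closure T = ⊤) :
    ∃ (q : ℕ) (F : IntermediateField K L) (B : AffineRep H F), 0 < q ∧ FiniteDimensional K F ∧
      Algebra.IsSeparable K F ∧ ∀ g, (B.l g : L) = A.l g ^ q ∧ (B.c g : L) = A.c g ^ q := by
  classical
  obtain ⟨p, hp⟩ := ExpChar.exists K
  have hpL : ExpChar L p := expChar_of_injective_algebraMap (algebraMap K L).injective p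
  have h1 : ∀ x : L, ∃ n, ∀ m, n ≤ m → x ^ p ^ m ∈ separableClosure K L := fun x => by
    have := separableClosure.isPurelyInseparable K L
    have : ExpChar (separableClosure K L) p :=
      expChar_of_injective_algebraMap (algebraMap K (separableClosure K L)).injective p
    obtain ⟨n, y, hy⟩ := IsPurelyInseparable.pow_mem (separableClosure K L) p x
    refine ⟨n, fun m hm => ?_⟩
    obtain ⟨d, rfl⟩ := Nat.exists_eq_add_of_le hm
    rw [pow_add, pow_mul, ← hy]
    exact pow_mem y.2 _
  choose N hN using h1
  obtain ⟨M, hM⟩ := (hTf.image fun g => N (A.l g) ⊔ N (A.c g)).bddAbove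
  have hM' : ∀ g ∈ T, N (A.l g) ≤ M ∧ N (A.c g) ≤ M := fun g hg =>
    sup_le_iff.1 (hM (Set.mem_image_of_mem _ hg))
  set B₀ : AffineRep H L := A.map (iterateFrobenius L p M) with hB₀
  have hl : ∀ g, B₀.l g = A.l g ^ p ^ M := fun g => iterateFrobenius_def p M _
  have hc : ∀ g, B₀.c g = A.c g ^ p ^ M := fun g => iterateFrobenius_def p M _
  set X : Set L := B₀.l '' T ∪ B₀.c '' T with hX
  have hXf : X.Finite := (hTf.image _).union (hTf.image _)
  have hXs : ∀ x ∈ X, x ∈ separableClosure K L := by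
    rintro _ (⟨g, hg, rfl⟩ | ⟨g, hg, rfl⟩)
    · rw [hl]
      exact hN _ _ (hM' g hg).1
    · rw [hc]
      exact hN _ _ (hM' g hg).2
  set F := IntermediateField.adjoin K X with hF
  have hmem := B₀.mem_of_closure F.toSubfield hT fun s hs =>
    ⟨IntermediateField.subset_adjoin K X (Or.inl (Set.mem_image_of_mem _ hs)),
      IntermediateField.subset_adjoin K X (Or.inr (Set.mem_image_of_mem _ hs))⟩
  refine ⟨p ^ M, F, B₀.restrict F.toSubfield hmem, pow_pos (expChar_pos K p) _, ?_, ?_,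
    fun g => ⟨hl g, hc g⟩⟩
  · have := hXf.to_subtype
    exact IntermediateField.finiteDimensional_adjoin fun x _ => Algebra.IsIntegral.isIntegral x
  · rw [hF, IntermediateField.isSeparable_adjoin_iff_isSeparable]
    exact fun x hx => mem_separableClosure_iff.1 (hXs x hx)

end AffineRep

/-- Existence of a half-line system in some complex Hilbert space. -/
def HasHalfLine {H : Type*} [Group H] (T : Finset H) : Prop :=
  ∃ (E : Type) (_ : NormedAddCommGroup E) (_ : InnerProductSpace ℂ E) (_ : CompleteSpace E),
    Nonempty (HalfLine H Unit E fun x => (wordLen (T : Set H) x : ℝ))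

instance {k : Type*} [Field k] [Finite k] : Ring.HasFiniteQuotients (Polynomial k) where
  finiteQuotient {I} hI := by
    obtain ⟨f, hf, hf0⟩ := Submodule.exists_mem_ne_zero_of_ne_bot hI
    have : Module.Finite k (AdjoinRoot f) := (AdjoinRoot.powerBasis hf0).finite
    have h1 : Finite (AdjoinRoot f) := Module.finite_of_finite k
    have h2 : Finite (Polynomial k ⧸ Ideal.span {f}) := h1
    exact Finite.of_surjective _
      (Ideal.Quotient.factor_surjective ((Ideal.span_singleton_le_iff_mem I).2 hf))

namespace AffineRep

variable {H : Type*} [Group H] {L : Type} [Field L]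

theorem hasHalfLine_of_localVal (B : AffineRep H L) {T : Finset H} (hT : SymmGen T)
    {v : Valuation L (WithZero (Multiplicative ℤ))} (hv : LocalVal v)
    {t : H} (ht : v (B.l t) ≠ 1) {a : H} (ha : B.l a = 1) (hca : B.c a ≠ 0) : HasHalfLine T := by
  let l : H →* Lˣ := MonoidHom.mk' (fun g => Units.mk0 (B.l g) (B.l_ne_zero g))
    fun g g' => Units.ext (B.l.map_mul g g')
  exact ⟨_, _, _, inferInstance, hT.exists_halfLine_of_localVal hv l B.c B.c_mul (t := t) ht
    (a := a) (Units.ext ha) hca⟩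

theorem hasHalfLine_of_complex (B : AffineRep H ℂ) {T : Finset H} (hT : SymmGen T)
    {t : H} (ht : ‖B.l t‖ ≠ 1) {a : H} (ha : B.l a = 1) (hca : B.c a ≠ 0) : HasHalfLine T := by
  obtain ⟨t, ht⟩ : ∃ t, ‖B.l t‖ < 1 := by
    rcases ht.lt_or_gt with h | h
    · exact ⟨t, h⟩
    · refine ⟨t⁻¹, ?_⟩
      rw [l_inv, norm_inv]
      exact inv_lt_one_of_one_lt₀ h
  have h1 : (1 : ℂ) - B.l t ≠ 0 := fun h => by
    rw [← sub_eq_zero.1 h, norm_one] at ht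
    exact lt_irrefl _ ht
  set x₀ := B.c t / (1 - B.l t) with hx₀
  refine ⟨_, _, _, inferInstance, SymmGen.exists_halfLine_of_complex B.l
    (fun g => B.c g - (x₀ - B.l g * x₀)) (fun g g' => ?_) hT ht ?_ ha ?_⟩
  · rw [B.c_mul, map_mul]
    ring
  · rw [hx₀]
    field_simp
    ring
  · simpa [ha] using hca

theorem hasHalfLine_of_not_isIntegral (A : AffineRep H L) (R K : Type) [CommRing R] [IsDedekindDomain R]
    [Field K] [Algebra R K] [IsFractionRing R K] [Algebra K L] [Algebra R L] [IsScalarTower R K L]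
    [FiniteDimensional K L] [Algebra.IsSeparable K L]
    [Ring.HasFiniteQuotients R]
    {T : Finset H} (hT : SymmGen T) {t : H} (ht : ¬ (IsIntegral R (A.l t) ∧ IsIntegral R (A.l t)⁻¹))
    {a : H} (ha : A.l a = 1) (hca : A.c a ≠ 0) : HasHalfLine T := by
  have : IsDedekindDomain (integralClosure R L) := integralClosure.isDedekindDomain R K L
  have : IsFractionRing (integralClosure R L) L :=
    integralClosure.isFractionRing_of_finite_extension K L
  have hfin : Module.Finite R (integralClosure R L) := IsIntegralClosure.finite R K L _
  by_cases h : ∃ v : IsDedekindDomain.HeightOneSpectrum (integralClosure R L),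
      v.valuation L (A.l t) ≠ 1
  · obtain ⟨v, hv⟩ := h
    have := Ring.HasFiniteQuotients.of_module_finite R (integralClosure R L)
    have : Finite (integralClosure R L ⧸ v.asIdeal) :=
      Ring.HasFiniteQuotients.finiteQuotient v.ne_bot
    exact A.hasHalfLine_of_localVal hT (localVal_of_heightOneSpectrum v) hv ha hca
  · push Not at h
    have h1 : ∀ x : L, (∀ v : IsDedekindDomain.HeightOneSpectrum (integralClosure R L),
        v.valuation L x = 1) → IsIntegral R x := fun x hx => by
      obtain ⟨y, hy⟩ := IsDedekindDomain.HeightOneSpectrum.mem_integers_of_valuation_le_one L x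
        fun v => (hx v).le
      rw [← hy]
      exact y.2
    exact (ht ⟨h1 _ h, h1 _ fun v => by rw [map_inv₀, h v, inv_one]⟩).elim

theorem hasHalfLine_of_rat [CharZero L] [Algebra.IsAlgebraic ℚ L] (A : AffineRep H L)
    {T : Finset H} (hT : SymmGen T) {t : H} (ht : ∀ n : ℕ, 0 < n → A.l t ^ n ≠ 1)
    {a : H} (ha : A.l a = 1) (hca : A.c a ≠ 0) : HasHalfLine T := by
  obtain ⟨q, F, B, hq, hF, -, hB⟩ := A.exists_finite_separable ℚ T.finite_toSet hT.gen
  have hBa : B.l a = 1 := Subtype.ext (by rw [(hB a).1, ha, one_pow]; rfl)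
  have hBca : B.c a ≠ 0 := fun h => hca <| by
    have := (hB a).2
    rw [h] at this
    exact pow_eq_zero_iff hq.ne' |>.1 this.symm
  have hBt : ∀ n : ℕ, 0 < n → B.l t ^ n ≠ 1 := fun n hn h => ht (q * n) (by positivity) <| by
    rw [pow_mul, ← (hB t).1]
    exact congrArg Subtype.val h
  have hNF : NumberField F := ⟨⟩
  by_cases hi : IsIntegral ℤ (B.l t) ∧ IsIntegral ℤ (B.l t)⁻¹
  · by_cases h : ∀ φ : F →+* ℂ, ‖φ (B.l t)‖ = 1
    · obtain ⟨n, hn, h1⟩ := NumberField.Embeddings.pow_eq_one_of_norm_eq_one F ℂ hi.1 h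
      exact (hBt n hn h1).elim
    · push Not at h
      obtain ⟨φ, hφ⟩ := h
      exact (B.map φ).hasHalfLine_of_complex hT hφ (a := a) (by simp [map, hBa]) (by simp [map, hBca])
  · exact B.hasHalfLine_of_not_isIntegral ℤ ℚ hT hi hBa hBca

theorem hasHalfLine_of_transcendental {k K : Type} [Field k] [Finite k] [Field K]
    [Algebra (Polynomial k) K] [IsFractionRing (Polynomial k) K] [Algebra K L]
    [Algebra.IsAlgebraic K L] (A : AffineRep H L)
    {T : Finset H} (hT : SymmGen T) {t : H} {j : ℕ} (hj : 0 < j)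
    (ht : A.l t = algebraMap K L (algebraMap (Polynomial k) K Polynomial.X) ^ j)
    {a : H} (ha : A.l a = 1) (hca : A.c a ≠ 0) : HasHalfLine T := by
  obtain ⟨q, F, B, hq, hF, hs, hB⟩ := A.exists_finite_separable K T.finite_toSet hT.gen
  have hBa : B.l a = 1 := Subtype.ext (by rw [(hB a).1, ha, one_pow]; rfl)
  have hBca : B.c a ≠ 0 := fun h => hca <| by
    have := (hB a).2
    rw [h] at this
    exact pow_eq_zero_iff hq.ne' |>.1 this.symm
  let _ : Algebra (Polynomial k) F := ((algebraMap K F).comp (algebraMap (Polynomial k) K)).toAlgebra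
  have : IsScalarTower (Polynomial k) K F := IsScalarTower.of_algebraMap_eq fun _ => rfl
  refine B.hasHalfLine_of_not_isIntegral (Polynomial k) K hT (t := t) (fun hi => ?_) hBa hBca
  · have h1 : B.l t = algebraMap K F (algebraMap (Polynomial k) K (Polynomial.X ^ (j * q))) := by
      refine Subtype.ext ?_
      rw [(hB t).1, ht, ← pow_mul, map_pow, map_pow]
      rfl
    have h2 := hi.2
    rw [h1, ← map_inv₀, isIntegral_algebraMap_iff (algebraMap K F).injective] at h2
    obtain ⟨y, hy⟩ := IsIntegrallyClosed.isIntegral_iff.1 h2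
    have hX : (Polynomial.X : Polynomial k) ≠ 0 := Polynomial.X_ne_zero
    have h3 : algebraMap (Polynomial k) K (Polynomial.X ^ (j * q) * y) = 1 := by
      rw [map_mul, hy]
      refine mul_inv_cancel₀ ?_
      rw [Ne, FaithfulSMul.algebraMap_eq_zero_iff]
      exact pow_ne_zero _ hX
    rw [FaithfulSMul.algebraMap_eq_one_iff] at h3
    have h4 : IsUnit (Polynomial.X : Polynomial k) :=
      (isUnit_pow_iff (by positivity)).1 (IsUnit.of_mul_eq_one _ h3)
    exact Polynomial.not_isUnit_X h4

end AffineRep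

end AffineAction

section NoAffine

theorem finiteIndex_comap {G G' : Type*} [Group G] [Group G'] (f : G →* G') (H : Subgroup G')
    [H.FiniteIndex] : (H.comap f).FiniteIndex := by
  rw [Subgroup.finiteIndex_iff, Subgroup.index_comap]
  exact (Subgroup.isFiniteRelIndex_of_finiteIndex (H := H) (K := f.range)).relIndex_ne_zero

theorem finiteIndex_map_subtype {G : Type*} [Group G] {K : Subgroup G} [K.FiniteIndex]
    (H : Subgroup K) [H.FiniteIndex] : (H.map K.subtype).FiniteIndex := by
  rw [Subgroup.finiteIndex_iff, Subgroup.index_map_subtype]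
  exact mul_ne_zero Subgroup.FiniteIndex.index_ne_zero Subgroup.FiniteIndex.index_ne_zero

/-- An element of a field is hyperbolic if affine actions in which a power of it occurs as a
multiplier have half-line systems. -/
def Hyperbolic (L : Type) [Field L] (x : L) : Prop :=
  ∀ (H : Type u) [Group H] (A : AffineRep H L) (T : Finset H), SymmGen T → ∀ (t a : H) (j : ℕ),
    0 < j → A.l t = x ^ j → A.l a = 1 → A.c a ≠ 0 → HasHalfLine T

theorem hyperbolic_of_rat {L : Type} [Field L] [CharZero L] [Algebra.IsAlgebraic ℚ L] {x : L}
    (hx : ∀ n : ℕ, 0 < n → x ^ n ≠ 1) : Hyperbolic.{u} L x :=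
  fun _ _ A _ hT t _ j hj ht ha hca => A.hasHalfLine_of_rat hT (t := t) (fun n hn h =>
    hx (j * n) (by positivity) (by rw [pow_mul, ← ht, h])) ha hca

theorem hyperbolic_X {k K L : Type} [Field k] [Finite k] [Field K] [Field L]
    [Algebra (Polynomial k) K] [IsFractionRing (Polynomial k) K] [Algebra K L]
    [Algebra.IsAlgebraic K L] :
    Hyperbolic.{u} L (algebraMap K L (algebraMap (Polynomial k) K Polynomial.X)) :=
  fun _ _ A _ hT _ _ _ hj ht ha hca => A.hasHalfLine_of_transcendental hT hj ht ha hca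

/-- A group has a hyperbolic affine action. -/
def HasAff (H : Type u) [Group H] : Prop :=
  ∃ (L : Type) (_ : Field L) (x : L) (A : AffineRep H L) (t a : H) (j : ℕ),
    Hyperbolic.{u} L x ∧ 0 < j ∧ A.l t = x ^ j ∧ A.l a = 1 ∧ A.c a ≠ 0

theorem HasAff.of_surjective {H H' : Type u} [Group H] [Group H'] (f : H' →* H)
    (hf : Function.Surjective f) (h : HasAff H) : HasAff H' := by
  obtain ⟨L, _, x, A, t, a, j, hx, hj, ht, ha, hca⟩ := h
  obtain ⟨t, rfl⟩ := hf t
  obtain ⟨a, rfl⟩ := hf a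
  exact ⟨L, _, x, ⟨A.l.comp f, fun g => A.c (f g), fun g g' => by simp [A.c_mul]⟩, t, a, j,
    hx, hj, ht, ha, hca⟩

/-- No subgroup of finite index has a hyperbolic affine action. -/
def NoAff (G : Type u) [Group G] : Prop :=
  ∀ H : Subgroup G, H.FiniteIndex → ¬ HasAff H

theorem NoAff.of_surjective {G G' : Type u} [Group G] [Group G'] (h : NoAff G) (f : G →* G')
    (hf : Function.Surjective f) : NoAff G' := by
  intro H hH hA
  refine h (H.comap f) (finiteIndex_comap f H) (hA.of_surjective ((f.comp (H.comap f).subtype).codRestrict H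
    fun x => x.2) ?_)
  rintro ⟨y, hy⟩
  obtain ⟨x, rfl⟩ := hf y
  exact ⟨⟨x, hy⟩, rfl⟩

theorem NoAff.subgroup {G : Type u} [Group G] (h : NoAff G) (K : Subgroup G) [K.FiniteIndex] :
    NoAff K := by
  intro H hH hA
  refine h (H.map K.subtype) (finiteIndex_map_subtype H) (hA.of_surjective
    (H.equivMapOfInjective K.subtype K.subtype_injective).symm.toMonoidHom ?_)
  exact (H.equivMapOfInjective K.subtype K.subtype_injective).symm.surjective

theorem Courteous.noAff {G : Type u} [Group G] {S : Finset G} {μ : G → ℝ}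
    (h : Courteous S μ) {k : ℕ} (hk : 1 ≤ k) {W : Submodule ℂ (G → ℂ)} [FiniteDimensional ℂ W]
    (hW : HFk (S : Set G) μ k ⊆ (W : Set (G → ℂ))) : NoAff G := by
  classical
  rintro H hH ⟨L, _, x, A, t, a, j, hx, hj, ht, ha, hca⟩
  have : Group.FG G := Group.fg_iff.2 ⟨S, h.gen, S.finite_toSet⟩
  obtain ⟨T₀, hT₀, hfin⟩ := Group.fg_iff.1 (inferInstance : Group.FG H)
  set T : Finset H := hfin.toFinset ∪ hfin.toFinset.image (·⁻¹) with hT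
  have hsymm : SymmGen T := by
    refine ⟨?_, fun s hs => ?_⟩
    · rw [eq_top_iff, ← hT₀]
      exact Subgroup.closure_mono fun y hy => by simp [hT, hy]
    · simp only [hT, Finset.mem_union, Finset.mem_image, Set.Finite.mem_toFinset] at hs ⊢
      rcases hs with hs | ⟨y, hy, rfl⟩
      · exact Or.inr ⟨s, hs, rfl⟩
      · exact Or.inl (by rwa [inv_inv])
  obtain ⟨E, _, _, _, ⟨hl⟩⟩ := hx H A T hsymm t a j hj ht ha hca
  exact h.false_of_halfLine hk hW H hsymm.gen hsymm.inv_mem hl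

end NoAffine

section CentralTower

/-- Groups built from a finite group by `m` central extensions with cyclic kernel, up to finite
index at each stage. -/
def CentralTower : ℕ → ∀ (G : Type u) [Group G], Prop
  | 0, G, _ => Finite G
  | m + 1, G, _ => ∃ (H : Subgroup G) (K : Type u) (_ : Group K) (f : H →* K) (w : H),
      H.FiniteIndex ∧ Function.Surjective f ∧ w ∈ Subgroup.center H ∧
        f.ker = Subgroup.zpowers w ∧ CentralTower m K

namespace CentralTower

theorem of_injective {m : ℕ} {G S : Type u} [Group G] [Group S] (h : CentralTower m G)
    (j : S →* G) (hj : Function.Injective j) : CentralTower m S := by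
  induction m generalizing G S with
  | zero =>
    have : Finite G := h
    exact Finite.of_injective j hj
  | succ m ih =>
    obtain ⟨H, K, _, f, w, hH, hf, hw, hker, hK⟩ := h
    have hj' : Function.Injective (j.subgroupComap H) := fun x y hxy =>
      Subtype.ext (hj (congrArg Subtype.val hxy))
    set g := f.comp (j.subgroupComap H) with hg
    have hmem : ∀ x : H.comap j, x ∈ g.rangeRestrict.ker →
        j.subgroupComap H x ∈ Subgroup.zpowers w := fun x hx => by
      rw [MonoidHom.ker_rangeRestrict] at hx
      rw [← hker]
      exact hx
    let i : g.rangeRestrict.ker →* Subgroup.zpowers w :=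
      ((j.subgroupComap H).comp g.rangeRestrict.ker.subtype).codRestrict _ fun x => hmem x x.2
    have hi : Function.Injective i := fun x y hxy =>
      Subtype.ext (hj' (congrArg Subtype.val hxy))
    have hcyc : IsCyclic g.rangeRestrict.ker := isCyclic_of_injective i hi
    obtain ⟨w', hw'⟩ := (Subgroup.isCyclic_iff_exists_zpowers_eq_top _).1 hcyc
    refine ⟨H.comap j, g.range, inferInstance, g.rangeRestrict, w', finiteIndex_comap j H,
      g.rangeRestrict_surjective, ?_, hw'.symm, ih hK g.range.subtype Subtype.val_injective⟩
    rw [Subgroup.mem_center_iff]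
    intro x
    have h1 : j.subgroupComap H w' ∈ Subgroup.center H :=
      (Subgroup.zpowers_le.2 hw) (hmem w' (hw' ▸ Subgroup.mem_zpowers w'))
    refine hj' ?_
    rw [map_mul, map_mul]
    exact Subgroup.mem_center_iff.1 h1 _

theorem succ {m : ℕ} {G K : Type u} [Group G] [Group K] (f : G →* K) (hf : Function.Surjective f)
    {w : G} (hw : w ∈ Subgroup.center G) (hker : f.ker = Subgroup.zpowers w)
    (hK : CentralTower m K) : CentralTower (m + 1) G := by
  refine ⟨⊤, K, inferInstance, f.comp (⊤ : Subgroup G).subtype, ⟨w, trivial⟩, inferInstance,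
    fun k => ?_, ?_, ?_, hK⟩
  · obtain ⟨x, hx⟩ := hf k
    exact ⟨⟨x, trivial⟩, hx⟩
  · rw [Subgroup.mem_center_iff] at hw ⊢
    exact fun x => Subtype.ext (hw x)
  · ext ⟨x, hx⟩
    have h1 : x ∈ f.ker ↔ x ∈ Subgroup.zpowers w := by rw [hker]
    rw [MonoidHom.mem_ker, Subgroup.mem_zpowers_iff] at h1
    rw [MonoidHom.mem_ker, Subgroup.mem_zpowers_iff]
    refine h1.trans (exists_congr fun k => ?_)
    rw [Subtype.ext_iff]
    rfl

theorem of_finiteIndex {m : ℕ} {G : Type u} [Group G] (S : Subgroup G) [S.FiniteIndex]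
    (h : CentralTower m S) : CentralTower m G := by
  cases m with
  | zero => exact (Subgroup.finite_iff_finite_and_finiteIndex S).2 ⟨h, inferInstance⟩
  | succ m =>
    obtain ⟨H, K, _, f, w, hH, hf, hw, hker, hK⟩ := h
    let e := H.equivMapOfInjective S.subtype S.subtype_injective
    refine ⟨H.map S.subtype, K, inferInstance, f.comp e.symm.toMonoidHom, e w,
      finiteIndex_map_subtype H, hf.comp e.symm.surjective, ?_, ?_, hK⟩
    · rw [Subgroup.mem_center_iff] at hw ⊢
      intro x
      obtain ⟨x, rfl⟩ := e.surjective x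
      rw [← map_mul, ← map_mul, hw]
    · ext x
      obtain ⟨x, rfl⟩ := e.surjective x
      have h1 : x ∈ f.ker ↔ x ∈ Subgroup.zpowers w := by rw [hker]
      rw [MonoidHom.mem_ker, Subgroup.mem_zpowers_iff] at h1
      rw [MonoidHom.mem_ker, Subgroup.mem_zpowers_iff]
      simp only [MonoidHom.comp_apply, MulEquiv.coe_toMonoidHom, MulEquiv.symm_apply_apply,
        ← map_zpow, e.injective.eq_iff]
      exact h1

/-- A central extension with finite kernel of a tower is a tower of the same height. -/
theorem of_finite_central_ker {m : ℕ} {E P : Type u} [Group E] [Group P] (hP : CentralTower m P)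
    (f : E →* P) (hc : f.ker ≤ Subgroup.center E) (hfin : Finite f.ker) : CentralTower m E := by
  induction m generalizing E P with
  | zero =>
    have : Finite P := hP
    have : f.ker.FiniteIndex := inferInstance
    exact (Subgroup.finite_iff_finite_and_finiteIndex _).2 ⟨hfin, this⟩
  | succ m ih =>
    wlog hf : Function.Surjective f generalizing P
    · exact this (hP.of_injective f.range.subtype Subtype.val_injective) f.rangeRestrict
        (by rwa [MonoidHom.ker_rangeRestrict]) (by rwa [MonoidHom.ker_rangeRestrict])
        f.rangeRestrict_surjective
    obtain ⟨H, K, _, q, w, hH, hq, hw, hker, hK⟩ := hP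
    have := finiteIndex_comap f H
    refine of_finiteIndex (H.comap f) ?_
    set E' := H.comap f with hE'
    set f' : E' →* H := f.subgroupComap H with hf'
    obtain ⟨w', hw'⟩ : ∃ w', f' w' = w := by
      obtain ⟨y, hy⟩ := hf w
      exact ⟨⟨y, by rw [hE', Subgroup.mem_comap, hy]; exact w.2⟩, Subtype.ext hy⟩
    have hZ : ∀ x : E', f' x = 1 → (x : E) ∈ f.ker := fun x hx => congrArg Subtype.val hx
    have hZc : ∀ x : E', f' x = 1 → ∀ y : E', x * y = y * x := fun x hx y =>
      Subtype.ext (Subgroup.mem_center_iff.1 (hc (hZ x hx)) y).symm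
    have hcomm : ∀ g : E', f' (g * w' * g⁻¹ * w'⁻¹) = 1 := fun g => by
      rw [map_mul, map_mul, map_mul, map_inv, map_inv, hw', Subgroup.mem_center_iff.1 hw]
      group
    have hfin' : Finite f'.ker :=
      Finite.of_injective (fun x : f'.ker => (⟨(x : E'), hZ x x.2⟩ : f.ker)) fun x y hxy =>
        Subtype.ext (Subtype.ext (congrArg (fun z : f.ker => (z : E)) hxy))
    let κ : E' →* f'.ker := MonoidHom.mk' (fun g => ⟨g * w' * g⁻¹ * w'⁻¹, hcomm g⟩) fun g h => by
      refine Subtype.ext ?_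
      change g * h * w' * (g * h)⁻¹ * w'⁻¹ = (g * w' * g⁻¹ * w'⁻¹) * (h * w' * h⁻¹ * w'⁻¹)
      rw [← hZc _ (hcomm h)]
      have h1 := hZc _ (hcomm h) g
      calc g * h * w' * (g * h)⁻¹ * w'⁻¹
          = g * (h * w' * h⁻¹ * w'⁻¹) * (w' * g⁻¹ * w'⁻¹) := by group
        _ = (h * w' * h⁻¹ * w'⁻¹) * (g * w' * g⁻¹ * w'⁻¹) := by rw [← h1]; group
    refine of_finiteIndex κ.ker ?_
    have hκ : ∀ g : κ.ker, (g : E') * w' = w' * g := fun g => by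
      have h1 : (g : E') * w' * (g : E')⁻¹ * w'⁻¹ = 1 := congrArg Subtype.val g.2
      rw [mul_inv_eq_one, mul_inv_eq_iff_eq_mul] at h1
      exact h1
    let w'' : κ.ker := ⟨w', Subtype.ext (by change w' * w' * w'⁻¹ * w'⁻¹ = 1; group)⟩
    have hw'' : w'' ∈ Subgroup.center κ.ker := by
      rw [Subgroup.mem_center_iff]
      exact fun g => Subtype.ext (hκ g)
    have hnorm : (Subgroup.zpowers w'').Normal :=
      ⟨fun n hn g => by
        rwa [Subgroup.mem_center_iff.1 (Subgroup.zpowers_le.2 hw'' hn) g, mul_inv_cancel_right]⟩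
    let F : κ.ker →* K := (q.comp f').comp κ.ker.subtype
    have hF : Subgroup.zpowers w'' ≤ F.ker := by
      rw [Subgroup.zpowers_le]
      change q (f' w') = 1
      rw [hw', ← MonoidHom.mem_ker, hker]
      exact Subgroup.mem_zpowers w
    have hrep : ∀ x : (QuotientGroup.lift _ F hF).ker, ∃ y : κ.ker, f' y = 1 ∧
        (QuotientGroup.mk y : κ.ker ⧸ Subgroup.zpowers w'') = x := by
      rintro ⟨x, hx⟩
      obtain ⟨x, rfl⟩ := QuotientGroup.mk_surjective x
      have h1 : f' x ∈ q.ker := hx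
      rw [hker, Subgroup.mem_zpowers_iff] at h1
      obtain ⟨n, hn⟩ := h1
      refine ⟨x * (w'' ^ n)⁻¹, ?_, ?_⟩
      · change f' ((x : E') * ((w'' ^ n : κ.ker) : E')⁻¹) = 1
        rw [Subgroup.coe_zpow, map_mul, map_inv, map_zpow]
        change f' x * (f' w' ^ n)⁻¹ = 1
        rw [hw', hn, mul_inv_cancel]
      · refine QuotientGroup.eq.2 ?_
        rw [mul_inv_rev, inv_inv, mul_assoc, inv_mul_cancel, mul_one]
        exact Subgroup.zpow_mem_zpowers _ _
    choose r hr1 hr2 using hrep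
    refine succ (QuotientGroup.mk' (Subgroup.zpowers w'')) (QuotientGroup.mk'_surjective _) hw''
      (QuotientGroup.ker_mk' _) (ih hK (QuotientGroup.lift _ F hF) (fun x hx => ?_) ?_)
    · obtain ⟨y, hy, rfl⟩ : ∃ y : κ.ker, f' y = 1 ∧
        (QuotientGroup.mk y : κ.ker ⧸ Subgroup.zpowers w'') = x := ⟨r ⟨x, hx⟩, hr1 _, hr2 _⟩
      rw [Subgroup.mem_center_iff]
      intro z
      obtain ⟨z, rfl⟩ := QuotientGroup.mk_surjective z
      rw [← QuotientGroup.mk_mul, ← QuotientGroup.mk_mul]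
      exact congrArg _ (Subtype.ext (hZc y hy z).symm)
    · exact Finite.of_injective (fun x => (⟨(r x : E'), hr1 x⟩ : f'.ker)) fun x y hxy =>
        Subtype.ext (by
          have h1 : r x = r y := Subtype.ext (congrArg (fun z : f'.ker => (z : E')) hxy)
          rw [← hr2 x, ← hr2 y, h1])

end CentralTower

end CentralTower

section VirtuallyNilpotent

/-- Virtually nilpotent groups. -/
def VN (G : Type*) [Group G] : Prop :=
  ∃ H : Subgroup G, H.FiniteIndex ∧ Group.IsNilpotent H

namespace VN

theorem of_finiteIndex {G : Type*} [Group G] (S : Subgroup G) [S.FiniteIndex] (h : VN S) :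
    VN G := by
  obtain ⟨H, _, _⟩ := h
  exact ⟨H.map S.subtype, finiteIndex_map_subtype H,
    Group.nilpotent_of_mulEquiv (H.equivMapOfInjective S.subtype S.subtype_injective)⟩

theorem of_ker_le_center {H K : Type*} [Group H] [Group K] (h : VN K) (f : H →* K)
    (hc : f.ker ≤ Subgroup.center H) : VN H := by
  obtain ⟨S, _, _⟩ := h
  refine ⟨S.comap f, finiteIndex_comap f S,
    Subgroup.isNilpotent_of_ker_le_center (f.subgroupComap S) fun x hx => ?_⟩
  have h1 : (x : H) ∈ f.ker := congrArg Subtype.val hx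
  rw [Subgroup.mem_center_iff]
  exact fun y => Subtype.ext (Subgroup.mem_center_iff.1 (hc h1) y)

theorem of_finite {G : Type*} [Group G] [Finite G] : VN G := ⟨⊥, inferInstance, inferInstance⟩

end VN

theorem Group.fg_of_ker_fg {G K : Type*} [Group G] [Group K] (f : G →* K)
    (hf : Function.Surjective f) (hK : Group.FG K) (hker : f.ker.FG) : Group.FG G := by
  obtain ⟨S, hS, hSf⟩ := Group.fg_iff.1 hK
  obtain ⟨T, hT, hTf⟩ := (Subgroup.fg_iff _).1 hker
  refine Group.fg_iff.2 ⟨Function.surjInv hf '' S ∪ T, ?_, (hSf.image _).union hTf⟩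
  have h1 : f.ker ≤ Subgroup.closure (Function.surjInv hf '' S ∪ T) :=
    hT ▸ Subgroup.closure_mono Set.subset_union_right
  rw [← Subgroup.comap_map_eq_self h1, MonoidHom.map_closure, eq_top_iff]
  refine le_trans (Subgroup.comap_top f).ge (Subgroup.comap_mono ?_)
  rw [← hS]
  refine Subgroup.closure_mono fun s hs => ⟨_, Or.inl ⟨s, hs, rfl⟩, Function.surjInv_eq hf s⟩

theorem Group.fg_of_finiteIndex {G : Type*} [Group G] (H : Subgroup G) [H.FiniteIndex]
    (hH : Group.FG H) : Group.FG G := by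
  obtain ⟨T, hT, hTf⟩ := (Subgroup.fg_iff _).1 ((Group.fg_iff_subgroup_fg H).1 hH)
  refine Group.fg_iff.2 ⟨Set.range (Quotient.out : G ⧸ H → G) ∪ T, ?_,
    (@Set.finite_range _ _ _ (inferInstance : Finite (G ⧸ H))).union hTf⟩
  rw [eq_top_iff]
  intro g _
  obtain ⟨h, hh⟩ := QuotientGroup.mk_out_eq_mul H g
  have h1 : g = (QuotientGroup.mk g : G ⧸ H).out * ((h : G))⁻¹ := by rw [hh]; group
  rw [h1]
  refine mul_mem (Subgroup.subset_closure (Or.inl ⟨_, rfl⟩)) (inv_mem ?_)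
  exact (hT ▸ Subgroup.closure_mono Set.subset_union_right :
    H ≤ Subgroup.closure (Set.range (Quotient.out : G ⧸ H → G) ∪ T)) h.2

namespace CentralTower

theorem vn {m : ℕ} {G : Type u} [Group G] (h : CentralTower m G) : VN G := by
  induction m generalizing G with
  | zero =>
    have : Finite G := h
    exact VN.of_finite
  | succ m ih =>
    obtain ⟨H, K, _, f, w, hH, hf, hw, hker, hK⟩ := h
    exact VN.of_finiteIndex H ((ih hK).of_ker_le_center f (hker ▸ Subgroup.zpowers_le.2 hw))

theorem fg {m : ℕ} {G : Type u} [Group G] (h : CentralTower m G) : Group.FG G := by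
  induction m generalizing G with
  | zero =>
    have : Finite G := h
    infer_instance
  | succ m ih =>
    obtain ⟨H, K, _, f, w, hH, hf, hw, hker, hK⟩ := h
    refine Group.fg_of_finiteIndex H (Group.fg_of_ker_fg f hf (ih hK) ?_)
    rw [hker, Subgroup.fg_iff]
    exact ⟨{w}, (Subgroup.zpowers_eq_closure w).symm, Set.finite_singleton w⟩

/-- Towers are finitely presented: the kernel of a surjection from a finitely generated group is
the normal closure of a finite set. -/
theorem exists_normalClosure {m : ℕ} {G P : Type u} [Group G] [Group P] [Group.FG G] (f : G →* P)
    (hf : Function.Surjective f) (hP : CentralTower m P) :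
    ∃ X : Set G, X.Finite ∧ f.ker = Subgroup.normalClosure X := by
  induction m generalizing G P with
  | zero =>
    have : Finite P := hP
    have : f.ker.FiniteIndex := inferInstance
    obtain ⟨X, hX, hXf⟩ := (Subgroup.fg_iff _).1
      ((Group.fg_iff_subgroup_fg f.ker).1 inferInstance)
    exact ⟨X, hXf, le_antisymm (hX ▸ Subgroup.closure_le_normalClosure)
      (Subgroup.normalClosure_le_normal (hX ▸ Subgroup.subset_closure))⟩
  | succ m ih =>
    obtain ⟨H, K, _, q, w, hH, hq, hw, hker, hK⟩ := hP
    have := finiteIndex_comap f H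
    set G' := H.comap f with hG'
    set f' : G' →* H := f.subgroupComap H with hf'
    have hf's : Function.Surjective f' := fun h => by
      obtain ⟨y, hy⟩ := hf h
      exact ⟨⟨y, by rw [hG', Subgroup.mem_comap, hy]; exact h.2⟩, Subtype.ext hy⟩
    obtain ⟨X, hXf, hX⟩ := ih (q.comp f') (hq.comp hf's) hK
    obtain ⟨w', hw'⟩ := hf's w
    have hn : ∀ x : G', ∃ n : ℤ, x ∈ X → w ^ n = f' x := fun x => by
      by_cases hx : x ∈ X
      · have h1 : f' x ∈ q.ker := by
          have h2 : x ∈ (q.comp f').ker := hX ▸ Subgroup.subset_normalClosure hx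
          exact h2
        rw [hker, Subgroup.mem_zpowers_iff] at h1
        exact h1.imp fun _ h _ => h
      · exact ⟨0, fun h => absurd h hx⟩
    choose n hn using hn
    obtain ⟨S, hS, hSf⟩ := Group.fg_iff.1 (inferInstance : Group.FG G')
    obtain ⟨u, hu⟩ := (Subgroup.isCyclic_iff_exists_zpowers_eq_top
      (f'.ker.subgroupOf (Subgroup.zpowers w'))).1 inferInstance
    set Y : Set G' := (fun s => s * w' * s⁻¹ * w'⁻¹) '' S ∪ (fun x => x * (w' ^ n x)⁻¹) '' X ∪
      {(u : G')} with hY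
    have hYf : Y.Finite := ((hSf.image _).union (hXf.image _)).union (Set.finite_singleton _)
    have hYker : Y ⊆ f'.ker := by
      rintro y ((⟨s, hs, rfl⟩ | ⟨x, hx, rfl⟩) | rfl)
      · rw [SetLike.mem_coe, MonoidHom.mem_ker, map_mul, map_mul, map_mul, map_inv, map_inv, hw',
          Subgroup.mem_center_iff.1 hw]
        group
      · rw [SetLike.mem_coe, MonoidHom.mem_ker, map_mul, map_inv, map_zpow, hw', hn x hx,
          mul_inv_cancel]
      · have h1 : u ∈ f'.ker.subgroupOf (Subgroup.zpowers w') := hu ▸ Subgroup.mem_zpowers u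
        exact Subgroup.mem_subgroupOf.1 h1
    have hle : f'.ker ≤ Subgroup.normalClosure Y := by
      set N := Subgroup.normalClosure Y with hN
      set π := QuotientGroup.mk' N with hπ
      have hYN : ∀ y ∈ Y, π y = 1 := fun y hy =>
        (QuotientGroup.eq_one_iff y).2 (Subgroup.subset_normalClosure hy)
      have hcent : π w' ∈ Subgroup.center (G' ⧸ N) := by
        have h1 : Subgroup.closure S ≤ (Subgroup.centralizer {π w'}).comap π := by
          rw [Subgroup.closure_le]
          intro s hs
          rw [SetLike.mem_coe, Subgroup.mem_comap, Subgroup.mem_centralizer_singleton_iff]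
          have h2 := hYN _ (Or.inl (Or.inl ⟨s, hs, rfl⟩))
          rw [map_mul, map_mul, map_mul, map_inv, map_inv, mul_inv_eq_one,
            mul_inv_eq_iff_eq_mul] at h2
          exact h2
        rw [Subgroup.mem_center_iff]
        intro g
        obtain ⟨g, rfl⟩ := QuotientGroup.mk'_surjective N g
        have h2 : g ∈ Subgroup.closure S := hS ▸ Subgroup.mem_top g
        exact Subgroup.mem_centralizer_singleton_iff.1 (h1 h2)
      have hnorm : (Subgroup.zpowers (π w')).Normal :=
        ⟨fun x hx g => by
          rwa [Subgroup.mem_center_iff.1 (Subgroup.zpowers_le.2 hcent hx) g,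
            mul_inv_cancel_right]⟩
      have hR : (q.comp f').ker ≤ (Subgroup.zpowers (π w')).comap π := by
        rw [hX]
        refine Subgroup.normalClosure_le_normal fun x hx => ?_
        rw [SetLike.mem_coe, Subgroup.mem_comap, Subgroup.mem_zpowers_iff]
        have h2 : π (x * (w' ^ n x)⁻¹) = 1 := hYN _ (Or.inl (Or.inr ⟨x, hx, rfl⟩))
        rw [map_mul, map_inv, map_zpow, mul_inv_eq_one] at h2
        exact ⟨n x, h2.symm⟩
      intro y hy
      have h1 : y ∈ (q.comp f').ker := by
        rw [MonoidHom.mem_ker] at hy ⊢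
        rw [MonoidHom.comp_apply, hy, map_one]
      obtain ⟨k, hk⟩ := Subgroup.mem_zpowers_iff.1 (hR h1)
      have h2 : π (w' ^ k) = π y := by rw [map_zpow, hk]
      have h3 : (w' ^ k)⁻¹ * y ∈ N := QuotientGroup.eq.1 h2
      have h4 : w' ^ k ∈ f'.ker := by
        have h5 : (w' ^ k)⁻¹ * y ∈ f'.ker := Subgroup.normalClosure_le_normal hYker h3
        have h6 := mul_mem hy (inv_mem h5)
        rwa [mul_inv_rev, inv_inv, mul_inv_cancel_left] at h6
      have h5 : (⟨w' ^ k, Subgroup.zpow_mem_zpowers _ _⟩ : Subgroup.zpowers w') ∈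
          Subgroup.zpowers u := hu ▸ Subgroup.mem_subgroupOf.2 h4
      obtain ⟨i, hi⟩ := Subgroup.mem_zpowers_iff.1 h5
      have h6 : w' ^ k ∈ N := by
        have h7 : (u : G') ^ i = w' ^ k := congrArg Subtype.val hi
        rw [← h7]
        have h8 : (u : G') ∈ Y := Or.inr rfl
        have h9 : (u : G') ∈ N := Subgroup.subset_normalClosure h8
        exact zpow_mem h9 i
      have h7 := mul_mem h6 h3
      rwa [mul_inv_cancel_left] at h7
    refine ⟨G'.subtype '' Y, hYf.image _, le_antisymm (fun x hx => ?_)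
      (Subgroup.normalClosure_le_normal ?_)⟩
    · have hxG : x ∈ G' := by
        rw [hG', Subgroup.mem_comap, MonoidHom.mem_ker.1 hx]
        exact one_mem H
      have h1 : (⟨x, hxG⟩ : G') ∈ f'.ker := MonoidHom.mem_ker.2 (Subtype.ext (MonoidHom.mem_ker.1 hx))
      exact Subgroup.comap_normalClosure_image_ge Y G'.subtype (hle h1)
    · rintro _ ⟨y, hy, rfl⟩
      exact congrArg Subtype.val (hYker hy)

theorem exists_of_central_closure {m : ℕ} {G K : Type u} [Group G] [Group K] (l : List G)
    (hl : ∀ x ∈ l, x ∈ Subgroup.center G) (f : G →* K) (hf : Function.Surjective f)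
    (hker : f.ker = Subgroup.closure {x | x ∈ l}) (hK : CentralTower m K) :
    ∃ m, CentralTower m G := by
  induction h : l.length generalizing G with
  | zero =>
    obtain rfl := List.length_eq_zero_iff.1 h
    refine ⟨m, hK.of_injective f ((MonoidHom.ker_eq_bot_iff f).1 ?_)⟩
    rw [hker, Subgroup.closure_eq_bot_iff]
    intro x hx
    simp at hx
  | succ n ih =>
    obtain ⟨w, l, rfl⟩ := List.exists_cons_of_length_eq_add_one h
    have hw : w ∈ Subgroup.center G := hl w (by simp)
    have hnorm : (Subgroup.zpowers w).Normal :=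
      ⟨fun x hx g => by
        rwa [Subgroup.mem_center_iff.1 (Subgroup.zpowers_le.2 hw hx) g, mul_inv_cancel_right]⟩
    set π := QuotientGroup.mk' (Subgroup.zpowers w) with hπ
    have hπw : π w = 1 := (QuotientGroup.eq_one_iff w).2 (Subgroup.mem_zpowers w)
    have hle : Subgroup.zpowers w ≤ f.ker := by
      rw [hker, Subgroup.zpowers_le]
      exact Subgroup.subset_closure (by simp)
    obtain ⟨m', hm'⟩ := ih (l.map π) (fun x hx => by
        obtain ⟨y, hy, rfl⟩ := List.mem_map.1 hx
        have h1 := hl y (by simp [hy])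
        rw [Subgroup.mem_center_iff] at h1 ⊢
        intro z
        obtain ⟨z, rfl⟩ := QuotientGroup.mk'_surjective _ z
        rw [← map_mul, ← map_mul, h1]) (QuotientGroup.lift _ f hle)
      (QuotientGroup.lift_surjective_of_surjective _ f hf hle) (by
        rw [QuotientGroup.ker_lift, hker, MonoidHom.map_closure]
        refine le_antisymm ((Subgroup.closure_le _).2 ?_) (Subgroup.closure_mono ?_)
        · rintro _ ⟨y, hy, rfl⟩
          rcases List.mem_cons.1 hy with rfl | hy
          · rw [← hπ, hπw]
            exact one_mem _
          · exact Subgroup.subset_closure (List.mem_map.2 ⟨y, hy, rfl⟩)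
        · intro x hx
          obtain ⟨y, hy, rfl⟩ := List.mem_map.1 hx
          exact ⟨y, List.mem_cons_of_mem w hy, rfl⟩) (by simpa using h)
    exact ⟨m' + 1, succ π (QuotientGroup.mk'_surjective _) hw (QuotientGroup.ker_mk' _) hm'⟩

theorem exists_of_isNilpotent (N : Type u) [Group N] [Group.IsNilpotent N] :
    Group.FG N → ∃ m, CentralTower m N := by
  refine Group.nilpotent_center_quotient_ind
    (P := fun N [Group N] [Group.IsNilpotent N] => Group.FG N → ∃ m, CentralTower m N) N ?_ ?_
  · intro N _ _ _
    exact ⟨0, (inferInstance : Finite N)⟩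
  · intro N _ _ ih _
    obtain ⟨m, hm⟩ := ih inferInstance
    obtain ⟨X, hXf, hX⟩ := hm.exists_normalClosure (QuotientGroup.mk' (Subgroup.center N))
      (QuotientGroup.mk'_surjective _)
    rw [QuotientGroup.ker_mk'] at hX
    have hXc : X ⊆ Subgroup.center N := hX ▸ Subgroup.subset_normalClosure
    have hnorm : (Subgroup.closure X).Normal :=
      ⟨fun x hx g => by
        rwa [Subgroup.mem_center_iff.1 ((Subgroup.closure_le _).2 hXc hx) g,
          mul_inv_cancel_right]⟩
    have hX' : Subgroup.center N = Subgroup.closure X :=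
      le_antisymm (hX ▸ Subgroup.normalClosure_le_normal Subgroup.subset_closure)
        ((Subgroup.closure_le _).2 hXc)
    refine exists_of_central_closure hXf.toFinset.toList (fun x hx => hXc (by simpa using hx))
      (QuotientGroup.mk' (Subgroup.center N)) (QuotientGroup.mk'_surjective _) ?_ hm
    rw [QuotientGroup.ker_mk', hX']
    congr 1
    ext x
    simp

end CentralTower

theorem VN.exists_centralTower {G : Type u} [Group G] [Group.FG G] (h : VN G) :
    ∃ m, CentralTower m G := by
  obtain ⟨H, _, _⟩ := h
  obtain ⟨m, hm⟩ := CentralTower.exists_of_isNilpotent H inferInstance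
  exact ⟨m, hm.of_finiteIndex⟩

theorem VN.fg_subgroup {G : Type u} [Group G] [Group.FG G] (h : VN G) (S : Subgroup G) :
    Group.FG S := by
  obtain ⟨m, hm⟩ := h.exists_centralTower
  exact (hm.of_injective S.subtype S.subtype_injective).fg

end VirtuallyNilpotent

section PolyCyclic

/-- Subgroups obtained from the trivial one by extensions with cyclic quotient and by finite
extensions. -/
inductive PolyZ {Q : Type u} [Group Q] : Subgroup Q → Prop
  | bot : PolyZ ⊥
  | cyc (N H : Subgroup Q) (x : Q) (hNH : N ≤ H) (hx : x ∈ H)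
      (hconj : ∀ n, n ∈ N ↔ x * n * x⁻¹ ∈ N) (hH : ∀ h ∈ H, ∃ n ∈ N, ∃ i : ℤ, h = n * x ^ i)
      (hN : PolyZ N) : PolyZ H
  | fin (N H : Subgroup Q) (F : Set Q) (hF : F.Finite) (hNH : N ≤ H) (hFH : F ⊆ H)
      (hH : ∀ h ∈ H, ∃ n ∈ N, ∃ c ∈ F, h = n * c) (hN : PolyZ N) : PolyZ H

theorem PolyZ.map_comap {H K Q : Type u} [Group H] [Group K] [Group Q] {f : H →* K}
    (hf : Function.Surjective f) {w : H} (hker : f.ker = Subgroup.zpowers w) {j : H →* Q}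
    {K₁ : Subgroup K} (hK : PolyZ K₁) :
    PolyZ ((K₁.comap f).map j) := by
  induction hK with
  | bot =>
    have h1 : (⊥ : Subgroup K).comap f = Subgroup.zpowers w := by
      rw [← hker, MonoidHom.comap_bot]
    rw [h1]
    refine PolyZ.cyc ⊥ _ (j w) bot_le ⟨w, Subgroup.mem_zpowers w, rfl⟩ (fun n => ?_) ?_ PolyZ.bot
    · rw [Subgroup.mem_bot, Subgroup.mem_bot, mul_inv_eq_one, mul_eq_left]
    · rintro _ ⟨_, ⟨i, rfl⟩, rfl⟩
      exact ⟨1, one_mem _, i, by rw [one_mul]; exact map_zpow j w i⟩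
  | cyc N H' x hNH hx hconj hH _ ih =>
    obtain ⟨y, rfl⟩ := hf x
    refine PolyZ.cyc _ _ (j y) (Subgroup.map_mono (Subgroup.comap_mono hNH))
      ⟨y, hx, rfl⟩ (fun n => ⟨?_, ?_⟩) ?_ ih
    · rintro ⟨n, hn, rfl⟩
      exact ⟨y * n * y⁻¹, by simpa using (hconj _).1 hn, by simp⟩
    · rintro ⟨n', hn', h⟩
      have h1 : n = j (y⁻¹ * n' * y) := by
        rw [map_mul, map_mul, h, map_inv]
        group
      refine ⟨y⁻¹ * n' * y, ?_, h1.symm⟩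
      have h2 : f n' ∈ N := hn'
      refine (hconj _).2 ?_
      rw [map_mul, map_mul, map_inv]
      convert h2 using 1
      group
    · rintro _ ⟨h, hh, rfl⟩
      obtain ⟨n, hn, i, hi⟩ := hH (f h) hh
      refine ⟨j (h * y ^ (-i)), ⟨_, ?_, rfl⟩, i, ?_⟩
      · change f (h * y ^ (-i)) ∈ N
        rw [map_mul, hi, map_zpow, mul_assoc, ← zpow_add]
        simpa using hn
      · rw [← map_zpow, ← map_mul, mul_assoc, ← zpow_add]
        simp
  | fin N H' F hF hNH hFH hH _ ih =>
    refine PolyZ.fin _ _ (j '' (Function.surjInv hf '' F)) ((hF.image _).image _)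
      (Subgroup.map_mono (Subgroup.comap_mono hNH)) ?_ ?_ ih
    · rintro _ ⟨_, ⟨c, hc, rfl⟩, rfl⟩
      refine ⟨_, ?_, rfl⟩
      change f _ ∈ H'
      rw [Function.surjInv_eq hf]
      exact hFH hc
    · rintro _ ⟨h, hh, rfl⟩
      obtain ⟨n, hn, c, hc, hi⟩ := hH (f h) hh
      refine ⟨j (h * (Function.surjInv hf c)⁻¹), ⟨_, ?_, rfl⟩, _, ⟨_, ⟨c, hc, rfl⟩, rfl⟩, ?_⟩
      · change f _ ∈ N
        rw [map_mul, map_inv, Function.surjInv_eq hf, hi, mul_inv_cancel_right]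
        exact hn
      · rw [← map_mul, inv_mul_cancel_right]

theorem CentralTower.polyZ {m : ℕ} {G : Type u} [Group G] (h : CentralTower m G) :
    PolyZ (⊤ : Subgroup G) := by
  induction m generalizing G with
  | zero =>
    have : Finite G := h
    exact PolyZ.fin ⊥ ⊤ Set.univ Set.finite_univ le_top (fun _ _ => trivial)
      (fun h _ => ⟨1, one_mem _, h, trivial, (one_mul h).symm⟩) PolyZ.bot
  | succ m ih =>
    obtain ⟨H, K, _, f, w, hH, hf, hw, hker, hK⟩ := h
    have h1 := (ih hK).map_comap hf hker (j := H.subtype)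
    rw [Subgroup.comap_top, ← MonoidHom.range_eq_map, H.range_subtype] at h1
    refine PolyZ.fin H ⊤ (Set.range fun q : G ⧸ H => (q.out)⁻¹)
      (@Set.finite_range _ _ _ (inferInstance : Finite (G ⧸ H))) le_top (fun _ _ => trivial)
      (fun g _ => ?_) h1
    obtain ⟨h, hh⟩ := QuotientGroup.mk_out_eq_mul H g⁻¹
    refine ⟨h, h.2, _, ⟨QuotientGroup.mk g⁻¹, rfl⟩, ?_⟩
    change g = h * (QuotientGroup.mk g⁻¹ : G ⧸ H).out⁻¹
    rw [hh]
    group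

end PolyCyclic

section GenericFreeness

variable {D : Type} [CommRing D] {M : Type u} [AddCommGroup M] [Module D M]

/-- Up to powers of `f`, the module `V` is freely generated modulo `U`. -/
def GenFree (f : D) (U V : Submodule D M) : Prop :=
  ∃ (ι : Type u) (b : ι → M), (∀ i, b i ∈ V) ∧
    (∀ l : ι →₀ D, Finsupp.linearCombination D b l ∈ U → l = 0) ∧
    ∀ m ∈ V, ∃ k : ℕ, f ^ k • m ∈ U ⊔ Submodule.span D (Set.range b)

namespace GenFree

theorem mul_right {f : D} {U V : Submodule D M} (h : GenFree f U V) (g : D) :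
    GenFree (f * g) U V := by
  obtain ⟨ι, b, hb, hl, hs⟩ := h
  refine ⟨ι, b, hb, hl, fun m hm => ?_⟩
  obtain ⟨k, hk⟩ := hs m hm
  refine ⟨k, ?_⟩
  rw [mul_pow, mul_comm, mul_smul]
  exact Submodule.smul_mem _ _ hk

theorem of_dvd {f g : D} {U V : Submodule D M} (h : GenFree f U V) (hfg : f ∣ g) :
    GenFree g U V := by
  obtain ⟨c, rfl⟩ := hfg
  exact h.mul_right c

theorem refl (f : D) (U : Submodule D M) : GenFree f U U :=
  ⟨PEmpty, PEmpty.elim, fun i => i.elim, fun l _ => Subsingleton.elim _ _,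
    fun m hm => ⟨0, by simpa using Submodule.mem_sup_left hm⟩⟩

theorem map {f : D} {U V U' V' : Submodule D M} (h : GenFree f U V) (e : M →ₗ[D] M)
    (hU : U ≤ U'.comap e) (hV : V ≤ V'.comap e) (hinj : ∀ v ∈ V, e v ∈ U' → v ∈ U)
    (hsurj : V' ≤ U' ⊔ V.map e) : GenFree f U' V' := by
  obtain ⟨ι, b, hb, hl, hs⟩ := h
  refine ⟨ι, e ∘ b, fun i => hV (hb i), fun l hmem => hl l (hinj _ ?_ ?_), fun m hm => ?_⟩
  · rw [Finsupp.linearCombination_apply]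
    exact Submodule.sum_mem _ fun i _ => Submodule.smul_mem _ _ (hb i)
  · rwa [← LinearMap.map_finsupp_linearCombination] at hmem
  · obtain ⟨u, hu, _, ⟨v, hv, rfl⟩, rfl⟩ := Submodule.mem_sup.1 (hsurj hm)
    obtain ⟨k, hk⟩ := hs v hv
    refine ⟨k, ?_⟩
    rw [smul_add]
    refine add_mem (Submodule.smul_mem _ _ (Submodule.mem_sup_left hu)) ?_
    have h1 : e (f ^ k • v) ∈ (U ⊔ Submodule.span D (Set.range b)).map e := ⟨_, hk, rfl⟩
    rw [Submodule.map_sup, Submodule.map_span, ← Set.range_comp, map_smul] at h1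
    exact sup_le_sup_right (Submodule.map_le_iff_le_comap.2 hU) _ h1

theorem chain {f : D} {V : ℕ → Submodule D M} (hV : ∀ n, V n ≤ V (n + 1))
    (h : ∀ n, GenFree f (V n) (V (n + 1))) {T : Submodule D M} (hle : ∀ n, V n ≤ T)
    (hT : ∀ t ∈ T, ∃ n, t ∈ V n) : GenFree f (V 0) T := by
  have hmono : Monotone V := monotone_nat_of_le_succ hV
  choose ι b hb hl hs using h
  refine ⟨Σ n, ι n, fun i => b i.1 i.2, fun i => hle _ (hb _ _), fun l hmem => ?_, ?_⟩
  · by_contra hne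
    have hne' : l.splitSupport.Nonempty := by
      rw [Finset.nonempty_iff_ne_empty]
      intro h0
      refine hne (Finsupp.ext fun i => ?_)
      by_contra hi
      have h1 : i.1 ∈ l.splitSupport := by
        rw [Finsupp.mem_splitSupport_iff_nonzero]
        intro h2
        exact hi (by rw [← Finsupp.split_apply, h2]; rfl)
      rw [h0] at h1
      simp at h1
    set n := l.splitSupport.max' hne' with hn
    have hsum : Finsupp.linearCombination D (fun i : Σ n, ι n => b i.1 i.2) l =
        ∑ i ∈ l.splitSupport, Finsupp.linearCombination D (b i) (l.split i) := by
      rw [Finsupp.linearCombination_apply, Finsupp.sigma_sum]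
      rfl
    rw [hsum, ← Finset.add_sum_erase _ _ (Finset.max'_mem _ hne')] at hmem
    have h1 : ∑ i ∈ l.splitSupport.erase n, Finsupp.linearCombination D (b i) (l.split i) ∈
        V n := by
      refine Submodule.sum_mem _ fun i hi => ?_
      obtain ⟨hi1, hi2⟩ := Finset.mem_erase.1 hi
      have h3 : i + 1 ≤ n := lt_of_le_of_ne (Finset.le_max' _ _ hi2) hi1
      rw [Finsupp.linearCombination_apply]
      exact Submodule.sum_mem _ fun j _ => Submodule.smul_mem _ _ (hmono h3 (hb i j))
    have h2 := hl n _ ((Submodule.add_mem_iff_left _ h1).1 (hmono (Nat.zero_le n) hmem))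
    exact Finsupp.mem_splitSupport_iff_nonzero _ _ |>.1 (Finset.max'_mem _ hne') h2
  · have key : ∀ n, ∀ m ∈ V n, ∃ k : ℕ, f ^ k • m ∈
        V 0 ⊔ Submodule.span D (Set.range fun i : Σ n, ι n => b i.1 i.2) := by
      intro n
      induction n with
      | zero => exact fun m hm => ⟨0, by simpa using Submodule.mem_sup_left hm⟩
      | succ n ih =>
        intro m hm
        obtain ⟨k, hk⟩ := hs n m hm
        obtain ⟨v, hv, s, hs', hvs⟩ := Submodule.mem_sup.1 hk
        obtain ⟨k', hk'⟩ := ih v hv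
        refine ⟨k' + k, ?_⟩
        rw [pow_add, mul_smul, ← hvs, smul_add]
        refine add_mem hk' (Submodule.smul_mem _ _ (Submodule.mem_sup_right ?_))
        refine Submodule.span_mono ?_ hs'
        rintro _ ⟨i, rfl⟩
        exact ⟨⟨n, i⟩, rfl⟩
    intro m hm
    obtain ⟨n, hn⟩ := hT m hm
    exact key n m hn

theorem trans {f : D} {U V W : Submodule D M} (hUV : U ≤ V) (hVW : V ≤ W) (h : GenFree f U V)
    (h' : GenFree f V W) : GenFree f U W := by
  let A : ℕ → Submodule D M := fun n => if n = 0 then U else if n = 1 then V else W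
  refine chain (V := A) (fun n => ?_) (fun n => ?_) (fun n => ?_) fun t ht => ⟨2, ht⟩
  · match n with
    | 0 => exact hUV
    | 1 => exact hVW
    | n + 2 => exact le_rfl
  · match n with
    | 0 => exact h
    | 1 => exact h'
    | n + 2 => exact refl f W
  · match n with
    | 0 => exact hUV.trans hVW
    | 1 => exact hVW
    | n + 2 => exact le_rfl

theorem exists_of_finite [IsDomain D] {X : Set M} (hX : X.Finite) (U : Submodule D M) :
    ∃ f : D, f ≠ 0 ∧ GenFree f U (Submodule.span D X) := by
  set V := Submodule.span D X with hV
  obtain ⟨s, hs, hs'⟩ := exists_maximal_linearIndepOn D (fun v : V => U.mkQ v)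
  have h1 : ∀ v : V, ∃ a : D, a ≠ 0 ∧
      a • (v : M) ∈ U ⊔ Submodule.span D (Set.range fun i : s => ((i : V) : M)) := by
    intro v
    by_cases hv : v ∈ s
    · exact ⟨1, one_ne_zero, Submodule.smul_mem _ _
        (Submodule.mem_sup_right (Submodule.subset_span ⟨⟨v, hv⟩, rfl⟩))⟩
    · obtain ⟨a, ha, h⟩ := hs' v hv
      refine ⟨a, ha, ?_⟩
      have h2 : (fun v : V => U.mkQ v) '' s = U.mkQ '' (Set.range fun i : s => ((i : V) : M)) := by
        ext y
        constructor
        · rintro ⟨v, hv, rfl⟩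
          exact ⟨v, ⟨⟨v, hv⟩, rfl⟩, rfl⟩
        · rintro ⟨_, ⟨⟨v, hv⟩, rfl⟩, rfl⟩
          exact ⟨v, hv, rfl⟩
      rw [h2, ← Submodule.map_span, ← map_smul] at h
      obtain ⟨y, hy, hyv⟩ := h
      have h3 : a • (v : M) - y ∈ U := by
        rw [← Submodule.ker_mkQ U, LinearMap.mem_ker, map_sub, hyv, sub_self]
      rw [← sub_add_cancel (a • (v : M)) y]
      exact add_mem (Submodule.mem_sup_left h3) (Submodule.mem_sup_right hy)
  choose a ha ha' using h1
  have hXV : ∀ x : X, (x : M) ∈ V := fun x => Submodule.subset_span x.2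
  have := hX.fintype
  refine ⟨∏ x : X, a ⟨x, hXV x⟩, Finset.prod_ne_zero_iff.2 fun x _ => ha _, s,
    fun i => ((i : V) : M), fun i => (i : V).2, fun l hl => ?_, fun m hm => ⟨1, ?_⟩⟩
  · refine (linearIndependent_iff.1 hs) l ?_
    have h2 : Finsupp.linearCombination D (fun x : s => U.mkQ ((x : V) : M)) l =
        U.mkQ (Finsupp.linearCombination D (fun i : s => ((i : V) : M)) l) := by
      rw [LinearMap.map_finsupp_linearCombination]
      rfl
    refine Eq.trans ?_ (h2.trans ?_)
    · rfl
    · rw [← LinearMap.mem_ker, Submodule.ker_mkQ]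
      exact hl
  · rw [pow_one]
    induction hm using Submodule.span_induction with
    | mem x hx =>
      obtain ⟨c, hc⟩ := Finset.dvd_prod_of_mem (fun x : X => a ⟨x, hXV x⟩)
        (Finset.mem_univ (⟨x, hx⟩ : X))
      rw [hc, mul_comm, mul_smul]
      exact Submodule.smul_mem _ _ (ha' ⟨x, hXV ⟨x, hx⟩⟩)
    | zero => rw [smul_zero]; exact zero_mem _
    | add x y _ _ hx hy => rw [smul_add]; exact add_mem hx hy
    | smul c x _ hx => rw [smul_comm]; exact Submodule.smul_mem _ _ hx

end GenFree

end GenericFreeness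

section Hall

variable {D : Type} [CommRing D] {M : Type u} [AddCommGroup M] [Module D M]
  {Q : Type u} [Group Q] (ρ : Q →* Module.End D M)

namespace HallModule

theorem rho_mul (g h : Q) (m : M) : ρ (g * h) m = ρ g (ρ h m) := by
  rw [map_mul, Module.End.mul_apply]

theorem rho_one (m : M) : ρ 1 m = m := by
  rw [map_one, Module.End.one_apply]

theorem rho_inv_rho (g : Q) (m : M) : ρ g⁻¹ (ρ g m) = m := by
  rw [← rho_mul, inv_mul_cancel, rho_one]

theorem rho_rho_inv (g : Q) (m : M) : ρ g (ρ g⁻¹ m) = m := by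
  rw [← rho_mul, mul_inv_cancel, rho_one]

/-- Stability of a submodule under a subgroup. -/
def Stable (N : Subgroup Q) (U : Submodule D M) : Prop := ∀ h ∈ N, ∀ u ∈ U, ρ h u ∈ U

/-- The submodule generated by a set under the action of a subgroup. -/
def orbitSpan (N : Subgroup Q) (X : Set M) : Submodule D M :=
  Submodule.span D {y | ∃ h ∈ N, ∃ x ∈ X, y = ρ h x}

theorem stable_orbitSpan (N : Subgroup Q) (X : Set M) : Stable ρ N (orbitSpan ρ N X) := by
  intro h hh u hu
  induction hu using Submodule.span_induction with
  | mem y hy =>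
    obtain ⟨g, hg, x, hx, rfl⟩ := hy
    exact Submodule.subset_span ⟨h * g, mul_mem hh hg, x, hx, (rho_mul ρ h g x).symm⟩
  | zero => rw [map_zero]; exact zero_mem _
  | add x y _ _ hx hy => rw [map_add]; exact add_mem hx hy
  | smul c x _ hx => rw [map_smul]; exact Submodule.smul_mem _ _ hx

variable {ρ} in
theorem Stable.mono {N H : Subgroup Q} (hNH : N ≤ H) {U : Submodule D M} (hU : Stable ρ H U) :
    Stable ρ N U := fun h hh => hU h (hNH hh)

/-- The ascending chain condition for stable submodules of finitely generated stable submodules. -/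
def Acc (N : Subgroup Q) : Prop :=
  ∀ X : Set M, X.Finite → ∀ W : ℕ →o Submodule D M, (∀ n, W n ≤ orbitSpan ρ N X) →
    (∀ n, Stable ρ N (W n)) → ∃ n, ∀ m, n ≤ m → W m = W n

/-- Generic freeness of finitely generated stable submodules. -/
def Generic (N : Subgroup Q) : Prop :=
  ∀ X : Set M, X.Finite → ∀ U : Submodule D M, U ≤ orbitSpan ρ N X → Stable ρ N U →
    ∃ f : D, f ≠ 0 ∧ GenFree f U (orbitSpan ρ N X)

theorem orbitSpan_bot (X : Set M) : orbitSpan ρ ⊥ X = Submodule.span D X := by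
  rw [orbitSpan]
  congr 1
  ext y
  constructor
  · rintro ⟨h, hh, x, hx, rfl⟩
    rw [Subgroup.mem_bot.1 hh, rho_one]
    exact hx
  · exact fun hy => ⟨1, one_mem _, y, hy, (rho_one ρ y).symm⟩

theorem acc_bot [IsNoetherianRing D] : Acc ρ (⊥ : Subgroup Q) := by
  intro X hX W hW _
  rw [orbitSpan_bot] at hW
  have := isNoetherian_span_of_finite D hX
  obtain ⟨n, hn⟩ := monotone_stabilizes_iff_noetherian.2 this
    ⟨fun n => (W n).comap (Submodule.span D X).subtype,
      fun i j hij => Submodule.comap_mono (W.monotone hij)⟩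
  refine ⟨n, fun m hm => le_antisymm (fun x hx => ?_) (W.monotone hm)⟩
  have h1 : (⟨x, hW m hx⟩ : Submodule.span D X) ∈
      (W n).comap (Submodule.span D X).subtype := (hn m hm).ge hx
  exact h1

theorem generic_bot [IsDomain D] : Generic ρ (⊥ : Subgroup Q) := by
  intro X hX U _ _
  rw [orbitSpan_bot]
  exact GenFree.exists_of_finite hX U

theorem orbitSpan_fin {N H : Subgroup Q} {F : Set Q} (hNH : N ≤ H) (hFH : F ⊆ H)
    (hH : ∀ h ∈ H, ∃ n ∈ N, ∃ c ∈ F, h = n * c) (X : Set M) :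
    orbitSpan ρ H X = orbitSpan ρ N (Set.image2 (fun c x => ρ c x) F X) := by
  rw [orbitSpan, orbitSpan]
  congr 1
  ext y
  constructor
  · rintro ⟨h, hh, x, hx, rfl⟩
    obtain ⟨n, hn, c, hc, rfl⟩ := hH h hh
    exact ⟨n, hn, _, ⟨c, hc, x, hx, rfl⟩, rho_mul ρ n c x⟩
  · rintro ⟨n, hn, _, ⟨c, hc, x, hx, rfl⟩, rfl⟩
    exact ⟨n * c, mul_mem (hNH hn) (hFH hc), x, hx, (rho_mul ρ n c x).symm⟩

/-- The sum of the first `n` translates of `M₀` under `x`. -/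
def translates (x : Q) (M₀ : Submodule D M) : ℕ → Submodule D M
  | 0 => ⊥
  | n + 1 => translates x M₀ n ⊔ M₀.map (ρ (x ^ n))

section Cyclic

variable {N H : Subgroup Q} {x : Q}

theorem translates_mono (M₀ : Submodule D M) : Monotone (translates ρ x M₀) :=
  monotone_nat_of_le_succ fun _ => le_sup_left

theorem rho_pow_mem_translates {M₀ : Submodule D M} {m : M} (hm : m ∈ M₀) (n : ℕ) :
    ρ (x ^ n) m ∈ translates ρ x M₀ (n + 1) := Submodule.mem_sup_right ⟨m, hm, rfl⟩

theorem rho_mem_translates_succ {M₀ : Submodule D M} {n : ℕ} {m : M}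
    (hm : m ∈ translates ρ x M₀ n) : ρ x m ∈ translates ρ x M₀ (n + 1) := by
  induction n generalizing m with
  | zero =>
    rw [(Submodule.mem_bot D).1 hm, map_zero]
    exact zero_mem _
  | succ n ih =>
    obtain ⟨a, ha, _, ⟨b, hb, rfl⟩, rfl⟩ := Submodule.mem_sup.1 hm
    rw [map_add, ← rho_mul, ← pow_succ']
    exact add_mem (translates_mono ρ M₀ (Nat.le_succ _) (ih ha)) (rho_pow_mem_translates ρ hb _)

theorem rho_pow_mem_translates_add {M₀ : Submodule D M} {n : ℕ} {m : M}
    (hm : m ∈ translates ρ x M₀ n) (d : ℕ) : ρ (x ^ d) m ∈ translates ρ x M₀ (n + d) := by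
  induction d with
  | zero => rwa [pow_zero, rho_one]
  | succ d ih =>
    rw [pow_succ', rho_mul]
    exact rho_mem_translates_succ ρ ih

theorem translates_le {M₀ V : Submodule D M} (hV : Stable ρ H V) (hx : x ∈ H) (h : M₀ ≤ V)
    (n : ℕ) : translates ρ x M₀ n ≤ V := by
  induction n with
  | zero => exact bot_le
  | succ n ih =>
    refine sup_le ih ?_
    rintro _ ⟨m, hm, rfl⟩
    exact hV _ (pow_mem hx n) _ (h hm)

theorem conj_pow_mem (hconj : ∀ n, n ∈ N ↔ x * n * x⁻¹ ∈ N) (i : ℕ) :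
    ∀ n, n ∈ N ↔ x ^ i * n * (x ^ i)⁻¹ ∈ N := by
  induction i with
  | zero => intro n; simp
  | succ i ih =>
    intro n
    rw [ih n, hconj, pow_succ']
    have h1 : x * x ^ i * n * (x * x ^ i)⁻¹ = x * (x ^ i * n * (x ^ i)⁻¹) * x⁻¹ := by group
    rw [h1]

theorem stable_translates (hconj : ∀ n, n ∈ N ↔ x * n * x⁻¹ ∈ N) {M₀ : Submodule D M}
    (hM : Stable ρ N M₀) (i : ℕ) : Stable ρ N (translates ρ x M₀ i) := by
  induction i with
  | zero =>
    intro h _ u hu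
    rw [(Submodule.mem_bot D).1 hu, map_zero]
    exact zero_mem _
  | succ i ih =>
    intro h hh u hu
    obtain ⟨a, ha, _, ⟨b, hb, rfl⟩, rfl⟩ := Submodule.mem_sup.1 hu
    rw [map_add]
    refine add_mem (Submodule.mem_sup_left (ih h hh a ha)) (Submodule.mem_sup_right ?_)
    refine ⟨ρ ((x ^ i)⁻¹ * h * x ^ i) b, hM _ ?_ b hb, ?_⟩
    · rw [conj_pow_mem hconj i]
      convert hh using 1
      group
    · rw [← rho_mul, ← rho_mul]
      congr 2
      group

/-- The elements of `M₀` whose `i`-th translate is congruent modulo `W` to earlier translates. -/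
def leading (x : Q) (M₀ W : Submodule D M) (i : ℕ) : Submodule D M :=
  M₀ ⊓ (W ⊔ translates ρ x M₀ i).comap (ρ (x ^ i))

theorem leading_succ {M₀ W : Submodule D M} (hW : ∀ w ∈ W, ρ x w ∈ W) (i : ℕ) :
    leading ρ x M₀ W i ≤ leading ρ x M₀ W (i + 1) := by
  rintro m ⟨hm, hm'⟩
  refine ⟨hm, ?_⟩
  obtain ⟨w, hw, g, hg, h⟩ := Submodule.mem_sup.1 (Submodule.mem_comap.1 hm')
  rw [SetLike.mem_coe, Submodule.mem_comap, pow_succ', rho_mul, ← h, map_add]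
  exact add_mem (Submodule.mem_sup_left (hW w hw))
    (Submodule.mem_sup_right (rho_mem_translates_succ ρ hg))

theorem leading_mono {M₀ W W' : Submodule D M} (h : W ≤ W') (i : ℕ) :
    leading ρ x M₀ W i ≤ leading ρ x M₀ W' i :=
  inf_le_inf_left _ (Submodule.comap_mono (sup_le_sup_right h _))

theorem stable_leading (hconj : ∀ n, n ∈ N ↔ x * n * x⁻¹ ∈ N) {M₀ W : Submodule D M}
    (hM : Stable ρ N M₀) (hW : Stable ρ N W) (i : ℕ) : Stable ρ N (leading ρ x M₀ W i) := by
  rintro h hh m ⟨hm, hm'⟩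
  refine ⟨hM h hh m hm, ?_⟩
  obtain ⟨w, hw, g, hg, h'⟩ := Submodule.mem_sup.1 (Submodule.mem_comap.1 hm')
  have h1 : ρ (x ^ i) (ρ h m) = ρ (x ^ i * h * (x ^ i)⁻¹) (ρ (x ^ i) m) := by
    rw [← rho_mul, ← rho_mul]
    congr 2
    group
  rw [SetLike.mem_coe, Submodule.mem_comap, h1, ← h', map_add]
  have h2 := (conj_pow_mem hconj i h).1 hh
  exact add_mem (Submodule.mem_sup_left (hW _ h2 w hw))
    (Submodule.mem_sup_right (stable_translates ρ hconj hM i _ h2 g hg))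

theorem exists_translates (hH : ∀ h ∈ H, ∃ n ∈ N, ∃ i : ℤ, h = n * x ^ i)
    (hconj : ∀ n, n ∈ N ↔ x * n * x⁻¹ ∈ N) (X : Set M) {v : M} (hv : v ∈ orbitSpan ρ H X) :
    ∃ i k : ℕ, ρ (x ^ i) v ∈ translates ρ x (orbitSpan ρ N X) k := by
  have hgen : ∀ n ∈ N, ∀ y ∈ X, ρ n y ∈ orbitSpan ρ N X := fun n hn y hy =>
    Submodule.subset_span ⟨n, hn, y, hy, rfl⟩
  induction hv using Submodule.span_induction with
  | mem y hy =>
    obtain ⟨h, hh, y, hy, rfl⟩ := hy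
    obtain ⟨n, hn, i, rfl⟩ := hH h hh
    obtain ⟨j, rfl | rfl⟩ := i.eq_nat_or_neg
    · refine ⟨0, j + 1, ?_⟩
      have h1 : ρ (x ^ 0) (ρ (n * x ^ (j : ℤ)) y) = ρ (x ^ j) (ρ ((x ^ j)⁻¹ * n * x ^ j) y) := by
        rw [← rho_mul, ← rho_mul, zpow_natCast]
        congr 2
        group
      rw [h1]
      refine rho_pow_mem_translates ρ (hgen _ ?_ y hy) j
      rw [conj_pow_mem hconj j]
      convert hn using 1
      group
    · refine ⟨j, 0 + 1, ?_⟩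
      have h1 : ρ (x ^ j) (ρ (n * x ^ (-(j : ℤ))) y) =
          ρ (x ^ 0) (ρ (x ^ j * n * (x ^ j)⁻¹) y) := by
        rw [← rho_mul, ← rho_mul, zpow_neg, zpow_natCast]
        congr 2
        group
      rw [h1]
      exact rho_pow_mem_translates ρ (hgen _ ((conj_pow_mem hconj j n).1 hn) y hy) 0
  | zero => exact ⟨0, 0, by rw [map_zero]; exact zero_mem _⟩
  | add v w _ _ hv hw =>
    obtain ⟨i, k, hik⟩ := hv
    obtain ⟨i', k', hik'⟩ := hw
    refine ⟨i' + i, max (k + i') (k' + i), ?_⟩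
    rw [map_add]
    refine add_mem (translates_mono ρ _ (le_max_left _ _) ?_)
      (translates_mono ρ _ (le_max_right _ _) ?_)
    · rw [pow_add, rho_mul]
      exact rho_pow_mem_translates_add ρ hik i'
    · rw [add_comm i' i, pow_add, rho_mul]
      exact rho_pow_mem_translates_add ρ hik' i
  | smul c v _ hv =>
    obtain ⟨i, k, hik⟩ := hv
    exact ⟨i, k, by rw [map_smul]; exact Submodule.smul_mem _ _ hik⟩

theorem orbitSpan_mono (hNH : N ≤ H) (X : Set M) : orbitSpan ρ N X ≤ orbitSpan ρ H X :=
  Submodule.span_mono fun _ ⟨h, hh, x, hx, e⟩ => ⟨h, hNH hh, x, hx, e⟩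

theorem acc_cyc (hNH : N ≤ H) (hx : x ∈ H) (hconj : ∀ n, n ∈ N ↔ x * n * x⁻¹ ∈ N)
    (hH : ∀ h ∈ H, ∃ n ∈ N, ∃ i : ℤ, h = n * x ^ i) (hN : Acc ρ N) : Acc ρ H := by
  intro X hX W hW hst
  set M₀ := orbitSpan ρ N X with hM₀
  have hM₀s : Stable ρ N M₀ := stable_orbitSpan ρ N X
  have hWx : ∀ n, ∀ w ∈ W n, ρ x w ∈ W n := fun n w hw => hst n x hx w hw
  have hmono : ∀ {i j n m : ℕ}, i ≤ j → n ≤ m →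
      leading ρ x M₀ (W n) i ≤ leading ρ x M₀ (W m) j := fun {i j n m} hij hnm =>
    (monotone_nat_of_le_succ (leading_succ ρ (M₀ := M₀) (hWx n)) hij).trans
      (leading_mono ρ (W.monotone hnm) j)
  have hls : ∀ n i, Stable ρ N (leading ρ x M₀ (W n) i) := fun n i =>
    stable_leading ρ hconj hM₀s ((hst n).mono hNH) i
  obtain ⟨d, hd⟩ := hN X hX ⟨fun n => leading ρ x M₀ (W n) n, fun i j hij => hmono hij hij⟩
    (fun n => inf_le_left) (fun n => hls n n)
  have hcol : ∀ i, ∃ n, ∀ m, n ≤ m → leading ρ x M₀ (W m) i = leading ρ x M₀ (W n) i := fun i =>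
    hN X hX ⟨fun n => leading ρ x M₀ (W n) i, fun n m hnm => hmono le_rfl hnm⟩
      (fun n => inf_le_left) (fun n => hls n i)
  choose c hc using hcol
  obtain ⟨n₀, hn₀d, hn₀⟩ : ∃ n₀, d ≤ n₀ ∧ ∀ i < d, c i ≤ n₀ :=
    ⟨max d ((Finset.range d).sup c), le_max_left _ _, fun i hi =>
      (Finset.le_sup (Finset.mem_range.2 hi)).trans (le_max_right _ _)⟩
  have hL : ∀ i m, n₀ ≤ m → leading ρ x M₀ (W m) i ≤ leading ρ x M₀ (W n₀) i := by
    intro i m hm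
    rcases lt_or_ge i d with hi | hi
    · rw [hc i m ((hn₀ i hi).trans hm), hc i n₀ (hn₀ i hi)]
    · refine (hmono (le_max_left i m) (le_max_right i m)).trans ?_
      have h1 : leading ρ x M₀ (W (max i m)) (max i m) = leading ρ x M₀ (W d) d :=
        hd (max i m) (hi.trans (le_max_left _ _))
      rw [h1]
      exact hmono hi hn₀d
  refine ⟨n₀, fun m hm => le_antisymm ?_ (W.monotone hm)⟩
  have key : ∀ i, W m ⊓ translates ρ x M₀ i ≤ W n₀ := by
    intro i
    induction i with
    | zero => exact inf_le_right.trans bot_le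
    | succ i ih =>
      rintro w ⟨hw, hw'⟩
      obtain ⟨g, hg, _, ⟨b, hb, rfl⟩, h⟩ := Submodule.mem_sup.1 hw'
      have h1 : b ∈ leading ρ x M₀ (W m) i := by
        refine ⟨hb, Submodule.mem_comap.2 ?_⟩
        rw [← sub_eq_iff_eq_add'.2 h.symm]
        exact sub_mem (Submodule.mem_sup_left hw) (Submodule.mem_sup_right hg)
      obtain ⟨w', hw', g', hg', h'⟩ :=
        Submodule.mem_sup.1 (Submodule.mem_comap.1 (hL i m hm h1).2)
      have h2 : g + g' ∈ W n₀ := by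
        refine ih ⟨?_, add_mem hg hg'⟩
        have h3 : g + g' = w - w' := by
          rw [← h, ← h']
          abel
        rw [SetLike.mem_coe, h3]
        exact sub_mem hw (W.monotone hm hw')
      have h3 : w = (g + g') + w' := by
        rw [← h, ← h']
        abel
      rw [h3]
      exact add_mem h2 hw'
  intro w hw
  obtain ⟨i, k, hik⟩ := exists_translates ρ hH hconj X (hW m hw)
  have h1 : ρ (x ^ i) w ∈ W n₀ := key k ⟨hst m _ (pow_mem hx i) w hw, hik⟩
  rw [← rho_inv_rho ρ (x ^ i) w]
  exact hst n₀ _ (inv_mem (pow_mem hx i)) _ h1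

theorem generic_cyc [IsDomain D] (hNH : N ≤ H) (hx : x ∈ H)
    (hconj : ∀ n, n ∈ N ↔ x * n * x⁻¹ ∈ N)
    (hH : ∀ h ∈ H, ∃ n ∈ N, ∃ i : ℤ, h = n * x ^ i) (hacc : Acc ρ N) (hN : Generic ρ N) :
    Generic ρ H := by
  intro X hX U hU hUs
  set M₀ := orbitSpan ρ N X with hM₀
  have hM₀s : Stable ρ N M₀ := stable_orbitSpan ρ N X
  have hVs := stable_orbitSpan ρ H X
  have hM₀V : M₀ ≤ orbitSpan ρ H X := orbitSpan_mono ρ hNH X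
  set A : ℕ → Submodule D M := fun i => U ⊔ translates ρ x M₀ i with hA
  have hAmono : Monotone A := fun i j hij => sup_le_sup_left (translates_mono ρ M₀ hij) U
  set P : Submodule D M := ⨆ i, A i with hP
  have hmemP : ∀ {v}, v ∈ P ↔ ∃ i, v ∈ A i := fun {v} =>
    Submodule.mem_iSup_of_directed A hAmono.directed_le
  have hAx : ∀ i, ∀ v ∈ A i, ρ x v ∈ A (i + 1) := fun i v hv => by
    obtain ⟨u, hu, g, hg, rfl⟩ := Submodule.mem_sup.1 hv
    rw [map_add]
    exact add_mem (Submodule.mem_sup_left (hUs x hx u hu))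
      (Submodule.mem_sup_right (rho_mem_translates_succ ρ hg))
  have hPx : ∀ v ∈ P, ρ x v ∈ P := fun v hv => by
    obtain ⟨i, hi⟩ := hmemP.1 hv
    exact hmemP.2 ⟨i + 1, hAx i v hi⟩
  have hPs : Stable ρ N P := fun n hn v hv => by
    obtain ⟨i, hi⟩ := hmemP.1 hv
    obtain ⟨u, hu, g, hg, rfl⟩ := Submodule.mem_sup.1 hi
    rw [map_add]
    exact hmemP.2 ⟨i, add_mem (Submodule.mem_sup_left (hUs n (hNH hn) u hu))
      (Submodule.mem_sup_right (stable_translates ρ hconj hM₀s i n hn g hg))⟩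
  have hPV : P ≤ orbitSpan ρ H X :=
    iSup_le fun i => sup_le hU (translates_le ρ hVs hx hM₀V i)
  have hM₀P : M₀ ≤ P := fun m hm => hmemP.2 ⟨1, Submodule.mem_sup_right (by
    simpa [rho_one] using rho_pow_mem_translates ρ (x := x) hm 0)⟩
  -- the increasing filtration
  obtain ⟨d, hd⟩ := hacc X hX ⟨fun i => leading ρ x M₀ U i,
    monotone_nat_of_le_succ (leading_succ ρ fun w hw => hUs x hx w hw)⟩
    (fun n => inf_le_left) (fun i => stable_leading ρ hconj hM₀s (hUs.mono hNH) i)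
  have hlead : ∀ i, ∃ f : D, f ≠ 0 ∧ GenFree f (leading ρ x M₀ U i) M₀ := fun i =>
    hN X hX _ inf_le_left (stable_leading ρ hconj hM₀s (hUs.mono hNH) i)
  choose f hf hfG using hlead
  set f₁ : D := ∏ i ∈ Finset.range (d + 1), f i with hf₁
  have hf₁0 : f₁ ≠ 0 := Finset.prod_ne_zero_iff.2 fun i _ => hf i
  have hlead₁ : ∀ i, GenFree f₁ (leading ρ x M₀ U i) M₀ := by
    intro i
    rcases le_total i d with hi | hi
    · exact (hfG i).of_dvd (Finset.dvd_prod_of_mem f (Finset.mem_range.2 (by omega)))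
    · have h1 : leading ρ x M₀ U i = leading ρ x M₀ U d := hd i hi
      rw [h1]
      exact (hfG d).of_dvd (Finset.dvd_prod_of_mem f (Finset.mem_range.2 (by omega)))
  have hGP : GenFree f₁ U P := by
    have h0 : A 0 = U := sup_bot_eq U
    rw [← h0]
    refine GenFree.chain (fun n => hAmono (Nat.le_succ n)) (fun i => ?_) (fun n => le_iSup A n)
      fun t ht => hmemP.1 ht
    refine (hlead₁ i).map (ρ (x ^ i)) inf_le_right (fun m hm => ?_) (fun m hm h => ⟨hm, h⟩) ?_
    · exact Submodule.mem_sup_right (rho_pow_mem_translates ρ hm i)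
    · exact sup_le (le_sup_left.trans le_sup_left)
        (sup_le (le_sup_right.trans le_sup_left) le_sup_right)
  -- the filtration by negative translates
  obtain ⟨f₂, hf₂0, hf₂⟩ := hN X hX (M₀ ⊓ P.comap (ρ x⁻¹)) inf_le_left (by
    rintro n hn m ⟨hm, hm'⟩
    refine ⟨hM₀s n hn m hm, ?_⟩
    have h1 : ρ x⁻¹ (ρ n m) = ρ (x⁻¹ * n * x) (ρ x⁻¹ m) := by
      rw [← rho_mul, ← rho_mul]
      congr 2
      group
    rw [SetLike.mem_coe, Submodule.mem_comap, h1]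
    refine hPs _ ?_ _ hm'
    rw [hconj]
    convert hn using 1
    group)
  have hPdec : ∀ v ∈ P, ∃ m ∈ M₀, ∃ g ∈ P, v = m + ρ x g := by
    have h1 : P ≤ M₀ ⊔ P.map (ρ x) := by
      refine iSup_le fun i => sup_le (fun u hu => ?_) ?_
      · refine Submodule.mem_sup_right ⟨ρ x⁻¹ u, ?_, rho_rho_inv ρ x u⟩
        exact hmemP.2 ⟨0, Submodule.mem_sup_left (hUs _ (inv_mem hx) u hu)⟩
      · induction i with
        | zero => exact bot_le
        | succ i ih =>
          refine sup_le ih ?_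
          rintro _ ⟨m, hm, rfl⟩
          cases i with
          | zero =>
            rw [pow_zero, rho_one]
            exact Submodule.mem_sup_left hm
          | succ i =>
            rw [pow_succ', rho_mul]
            exact Submodule.mem_sup_right ⟨_, hmemP.2 ⟨i + 1,
              Submodule.mem_sup_right (rho_pow_mem_translates ρ hm i)⟩, rfl⟩
    intro v hv
    obtain ⟨m, hm, _, ⟨g, hg, rfl⟩, rfl⟩ := Submodule.mem_sup.1 (h1 hv)
    exact ⟨m, hm, g, hg, rfl⟩
  have hGV : GenFree f₂ P (orbitSpan ρ H X) := by
    have h0 : P.comap (ρ (x ^ 0)) = P := by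
      ext v
      rw [Submodule.mem_comap, pow_zero, rho_one]
    have hstep : ∀ i, P.comap (ρ (x ^ i)) ≤ P.comap (ρ (x ^ (i + 1))) := fun i v hv => by
      rw [Submodule.mem_comap, pow_succ', rho_mul]
      exact hPx _ hv
    have hGV' := GenFree.chain (f := f₂) (V := fun i => P.comap (ρ (x ^ i)))
      (T := orbitSpan ρ H X) hstep (fun i => ?_) (fun i v hv => ?_) (fun v hv => ?_)
    · simpa only [h0] using hGV'
    · refine hf₂.map (ρ (x ^ (i + 1))⁻¹) ?_ (fun m hm => ?_) (fun m hm h => ⟨hm, ?_⟩)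
        (fun v hv => ?_)
      · rintro m ⟨hm, hm'⟩
        rw [Submodule.mem_comap, Submodule.mem_comap, ← rho_mul]
        have h1 : x ^ i * (x ^ (i + 1))⁻¹ = x⁻¹ := by rw [pow_succ']; group
        rw [h1]
        exact hm'
      · rw [Submodule.mem_comap, Submodule.mem_comap, rho_rho_inv]
        exact hM₀P hm
      · rw [Submodule.mem_comap, ← rho_mul] at h
        have h1 : x ^ i * (x ^ (i + 1))⁻¹ = x⁻¹ := by rw [pow_succ']; group
        rw [h1] at h
        exact h
      · obtain ⟨m, hm, g, hg, h⟩ := hPdec _ hv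
        have h1 : v = ρ (x ^ i)⁻¹ g + ρ (x ^ (i + 1))⁻¹ m := by
          rw [← rho_inv_rho ρ (x ^ (i + 1)) v, h, map_add, ← rho_mul, add_comm]
          congr 3
          rw [pow_succ']
          group
        rw [h1]
        refine Submodule.add_mem_sup ?_ ⟨m, hm, rfl⟩
        rw [Submodule.mem_comap, rho_rho_inv]
        exact hg
    · rw [← rho_inv_rho ρ (x ^ i) v]
      exact hVs _ (inv_mem (pow_mem hx i)) _ (hPV hv)
    · obtain ⟨i, k, hik⟩ := exists_translates ρ hH hconj X hv
      exact ⟨i, hmemP.2 ⟨k, Submodule.mem_sup_right hik⟩⟩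
  have hUP : U ≤ P := fun u hu => hmemP.2 ⟨0, Submodule.mem_sup_left hu⟩
  exact ⟨f₁ * f₂, mul_ne_zero hf₁0 hf₂0, GenFree.trans hUP hPV (hGP.of_dvd (dvd_mul_right _ _))
    (hGV.of_dvd (dvd_mul_left _ _))⟩

end Cyclic

theorem acc_and_generic [IsDomain D] [IsNoetherianRing D] {N : Subgroup Q} (h : PolyZ N) :
    Acc ρ N ∧ Generic ρ N := by
  induction h with
  | bot => exact ⟨acc_bot ρ, generic_bot ρ⟩
  | cyc N H x hNH hx hconj hH _ ih =>
    exact ⟨acc_cyc ρ hNH hx hconj hH ih.1, generic_cyc ρ hNH hx hconj hH ih.1 ih.2⟩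
  | fin N H F hF hNH hFH hH _ ih =>
    refine ⟨fun X hX W hW hst => ?_, fun X hX U hU hUs => ?_⟩
    · rw [orbitSpan_fin ρ hNH hFH hH] at hW
      exact ih.1 _ (hF.image2 _ hX) W hW fun n => (hst n).mono hNH
    · rw [orbitSpan_fin ρ hNH hFH hH] at hU ⊢
      exact ih.2 _ (hF.image2 _ hX) U hU (hUs.mono hNH)

end HallModule

end Hall

section Eigenvector

theorem exists_common_eigenvector_of_isNilpotent {L : Type} [Field L] [IsAlgClosed L] (n : ℕ)
    {N : Type u} [Group N] [Group.IsNilpotent N] {V : Type v} [AddCommGroup V] [Module L V]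
    [FiniteDimensional L V] [Nontrivial V] (ρ : N →* Module.End L V)
    (hn : Module.finrank L V = n) :
    ∃ S : Subgroup N, S.FiniteIndex ∧ ∃ v : V, v ≠ 0 ∧ ∀ s ∈ S, ∃ c : L, ρ s v = c • v := by
  induction n using Nat.strong_induction_on generalizing N V with
  | _ n ih =>
  have hone : ∀ v, ρ 1 v = v := fun v => by rw [map_one]; rfl
  have hmul : ∀ g h v, ρ (g * h) v = ρ g (ρ h v) := fun g h v => by rw [map_mul]; rfl
  obtain ⟨v₀, hv₀⟩ := exists_ne (0 : V)
  by_cases hall : ∀ g : N, ∃ c : L, ∀ v, ρ g v = c • v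
  · exact ⟨⊤, inferInstance, v₀, hv₀, fun s _ => (hall s).imp fun c hc => hc v₀⟩
  have hex : ∃ i, ∃ g ∈ Subgroup.upperCentralSeries N i, ¬ ∃ c : L, ∀ v, ρ g v = c • v := by
    push Not at hall
    obtain ⟨g, hg⟩ := hall
    obtain ⟨i, hi⟩ := Group.IsNilpotent.nilpotent N
    refine ⟨i, g, hi ▸ Subgroup.mem_top g, ?_⟩
    push Not
    exact hg
  classical
  obtain ⟨g, hg, hgs⟩ := Nat.find_spec hex
  have hmin := fun j (hj : j < Nat.find hex) => Nat.find_min hex hj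
  cases hi : Nat.find hex with
  | zero =>
    rw [hi, Subgroup.upperCentralSeries_zero, Subgroup.mem_bot] at hg
    exact absurd ⟨1, fun v => by rw [hg, hone, one_smul]⟩ hgs
  | succ i =>
  rw [hi, Subgroup.mem_upperCentralSeries_succ_iff] at hg
  have hsc : ∀ h : N, ∃ c : L, ∀ v, ρ (g * h * g⁻¹ * h⁻¹) v = c • v := by
    intro h
    by_contra hne
    exact hmin i (by omega) ⟨_, hg h, hne⟩
  choose ω hω using hsc
  have hrel : ∀ h v, ρ g (ρ h v) = ω h • ρ h (ρ g v) := fun h v => by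
    rw [← hmul h g, ← hω, ← hmul, ← hmul]
    congr 2
    group
  have hinj : ∀ h v, ρ h v = 0 → v = 0 := fun h v hv => by
    rw [← hone v, ← inv_mul_cancel h, hmul, hv, map_zero]
  have huniq : ∀ (h : N) (c : L), (∀ v, ρ g (ρ h v) = c • ρ h (ρ g v)) → c = ω h := by
    intro h c hc
    have h1 := (hc v₀).symm.trans (hrel h v₀)
    have h2 : ρ h (ρ g v₀) ≠ 0 := fun h0 => hv₀ (hinj _ _ (hinj _ _ h0))
    exact smul_left_injective L h2 h1
  let ωh : N →* L :=
    { toFun := ω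
      map_one' := (huniq 1 1 fun v => by rw [hone, hone, one_smul]).symm
      map_mul' := fun a b => (huniq _ _ fun v => by
        rw [hmul, hrel, hrel, hmul, map_smul, smul_smul]).symm }
  have hpow : ∀ h, ω h ^ n = 1 := by
    intro h
    have h1 : ρ g * ρ h = ω h • (ρ h * ρ g) := LinearMap.ext fun v => hrel h v
    have h2 := congrArg LinearMap.det h1
    rw [LinearMap.det_smul, map_mul, map_mul, hn, mul_comm (LinearMap.det (ρ h))] at h2
    have hd : ∀ a : N, LinearMap.det (ρ a) ≠ 0 := fun a h0 => by
      have h3 : LinearMap.det (ρ a) * LinearMap.det (ρ a⁻¹) = 1 := by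
        rw [← map_mul, ← map_mul, mul_inv_cancel, map_one, map_one]
      rw [h0, zero_mul] at h3
      exact zero_ne_one h3
    exact (mul_right_cancel₀ (mul_ne_zero (hd g) (hd h)) ((one_mul _).trans h2)).symm
  have hnpos : 0 < n := hn ▸ Module.finrank_pos
  have : NeZero n := ⟨hnpos.ne'⟩
  let ωu : N →* rootsOfUnity n L := ωh.toHomUnits.codRestrict _ fun h => by
    rw [mem_rootsOfUnity]
    exact Units.ext (hpow h)
  have hfin : ωu.ker.FiniteIndex := inferInstance
  have hker : ∀ s : ωu.ker, ∀ v, ρ g (ρ s v) = ρ s (ρ g v) := by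
    intro s v
    have h1 : ω s = 1 := congrArg (fun z : rootsOfUnity n L => ((z : Lˣ) : L)) s.2
    rw [hrel, h1, one_smul]
  obtain ⟨c, hc⟩ := Module.End.exists_eigenvalue (ρ g)
  set E := Module.End.eigenspace (ρ g) c with hE
  have hEs : ∀ s : ωu.ker, ∀ v ∈ E, ρ s v ∈ E := by
    intro s v hv
    rw [hE, Module.End.mem_eigenspace_iff] at hv ⊢
    rw [hker, hv, map_smul]
  have hEtop : E < ⊤ := by
    refine lt_top_iff_ne_top.2 fun h0 => hgs ⟨c, fun v => ?_⟩
    exact Module.End.mem_eigenspace_iff.1 (h0 ▸ Submodule.mem_top : v ∈ E)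
  have : Nontrivial E := (Submodule.nontrivial_iff_ne_bot).2 hc
  let σ : ωu.ker →* Module.End L E :=
    { toFun := fun s => (ρ s).restrict (hEs s)
      map_one' := LinearMap.ext fun v => Subtype.ext (hone v)
      map_mul' := fun a b => LinearMap.ext fun v => Subtype.ext (hmul a b v) }
  obtain ⟨S, hS, v, hv, hSv⟩ := ih (Module.finrank L E)
    (hn ▸ Submodule.finrank_lt hEtop.ne) σ rfl
  refine ⟨S.map ωu.ker.subtype, finiteIndex_map_subtype S, v, fun h0 => hv (Subtype.ext h0), ?_⟩
  rintro _ ⟨s, hs, rfl⟩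
  obtain ⟨d, hd⟩ := hSv s hs
  exact ⟨d, congrArg Subtype.val hd⟩

theorem VN.exists_common_eigenvector {L : Type} [Field L] [IsAlgClosed L] {Q : Type u} [Group Q]
    (h : VN Q) {V : Type v} [AddCommGroup V] [Module L V] [FiniteDimensional L V] [Nontrivial V]
    (ρ : Q →* Module.End L V) :
    ∃ S : Subgroup Q, S.FiniteIndex ∧ ∃ v : V, v ≠ 0 ∧ ∀ s ∈ S, ∃ c : L, ρ s v = c • v := by
  obtain ⟨H, _, _⟩ := h
  obtain ⟨S, hS, v, hv, hSv⟩ :=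
    exists_common_eigenvector_of_isNilpotent _ (ρ.comp H.subtype) rfl
  refine ⟨S.map H.subtype, finiteIndex_map_subtype S, v, hv, ?_⟩
  rintro _ ⟨s, hs, rfl⟩
  exact hSv s hs

end Eigenvector

section AbelianExtension

/-- A group extension of `P` with abelian kernel `M`, together with the conjugation action. -/
structure AbExt (G P M : Type u) [Group G] [Group P] [AddCommGroup M] where
  f : G →* P
  surj : Function.Surjective f
  i : M → G
  i_add : ∀ a b, i (a + b) = i a * i b
  inj : Function.Injective i
  mem_ker : ∀ g, f g = 1 ↔ ∃ m, i m = g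
  ρ : P →* AddMonoid.End M
  i_ρ : ∀ g m, i (ρ (f g) m) = g * i m * g⁻¹

theorem AbExt.exists_of_comm {G P : Type u} [Group G] [Group P] (f : G →* P)
    (hf : Function.Surjective f) (hc : ∀ a ∈ f.ker, ∀ b ∈ f.ker, a * b = b * a) :
    ∃ (M : Type u) (_ : AddCommGroup M) (E : AbExt G P M), E.f = f := by
  let _ : CommGroup f.ker := { (inferInstance : Group f.ker) with
    mul_comm := fun a b => Subtype.ext (hc a a.2 b b.2) }
  have hext : ∀ a b : AddMonoid.End (Additive f.ker), (∀ m, a m = b m) → a = b :=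
    fun a b h => AddMonoidHom.ext h
  have hs : ∀ p, f (Function.surjInv hf p) = p := Function.surjInv_eq hf
  let c : G → AddMonoid.End (Additive f.ker) := fun g =>
    { toFun := fun m => Additive.ofMul ⟨g * (m.toMul : G) * g⁻¹,
        (inferInstance : f.ker.Normal).conj_mem _ m.toMul.2 g⟩
      map_zero' := congrArg Additive.ofMul (Subtype.ext (by simp))
      map_add' := fun a b => congrArg Additive.ofMul (Subtype.ext (by simp)) }
  have hc' : ∀ g h, f g = f h → c g = c h := fun g h hgh => by
    refine hext _ _ fun m => congrArg Additive.ofMul (Subtype.ext ?_)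
    have h1 : h⁻¹ * g ∈ f.ker := by
      rw [MonoidHom.mem_ker, map_mul, map_inv, hgh, inv_mul_cancel]
    have h2 := hc _ h1 _ m.toMul.2
    change g * (m.toMul : G) * g⁻¹ = h * (m.toMul : G) * h⁻¹
    have h3 : g * (m.toMul : G) * g⁻¹ = h * (h⁻¹ * g * (m.toMul : G)) * g⁻¹ := by group
    rw [h3, h2]
    group
  let r : P →* AddMonoid.End (Additive f.ker) :=
    { toFun := fun p => c (Function.surjInv hf p)
      map_one' := by
        refine (hc' _ 1 (by rw [hs, map_one])).trans ?_
        refine hext _ _ fun m => congrArg Additive.ofMul (Subtype.ext ?_)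
        change 1 * (m.toMul : G) * 1⁻¹ = (m.toMul : G)
        simp
      map_mul' := fun p q => by
        refine (hc' _ (Function.surjInv hf p * Function.surjInv hf q) (by
          rw [map_mul, hs, hs, hs])).trans ?_
        refine hext _ _ fun m => congrArg Additive.ofMul (Subtype.ext ?_)
        set a := Function.surjInv hf p
        set b := Function.surjInv hf q
        change a * b * (m.toMul : G) * (a * b)⁻¹ = a * (b * (m.toMul : G) * b⁻¹) * a⁻¹
        group }
  refine ⟨Additive f.ker, inferInstance, ⟨f, hf, fun m => (m.toMul : G), fun a b => rfl,
    fun a b h => Additive.toMul.injective (Subtype.ext h), fun g => ⟨fun h =>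
      ⟨Additive.ofMul ⟨g, h⟩, rfl⟩, ?_⟩, r, ?_⟩, rfl⟩
  · rintro ⟨m, rfl⟩
    exact m.toMul.2
  · intro g m
    change ((c (Function.surjInv hf (f g)) m).toMul : G) = g * (m.toMul : G) * g⁻¹
    rw [hc' _ g (hs _)]
    rfl

namespace AbExt

variable {G P M : Type u} [Group G] [Group P] [AddCommGroup M] (E : AbExt G P M)

theorem i_zero : E.i 0 = 1 := by
  have h := E.i_add 0 0
  rw [add_zero] at h
  exact left_eq_mul.1 h

theorem i_neg (m : M) : E.i (-m) = (E.i m)⁻¹ := by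
  rw [eq_inv_iff_mul_eq_one, ← E.i_add, neg_add_cancel, E.i_zero]

theorem i_sub (a b : M) : E.i (a - b) = E.i a * (E.i b)⁻¹ := by
  rw [sub_eq_add_neg, E.i_add, E.i_neg]

theorem i_comm (a b : M) : E.i a * E.i b = E.i b * E.i a := by
  rw [← E.i_add, ← E.i_add, add_comm]

theorem f_i (m : M) : E.f (E.i m) = 1 := (E.mem_ker _).2 ⟨m, rfl⟩

theorem ρ_mul (p q : P) (m : M) : E.ρ (p * q) m = E.ρ p (E.ρ q m) := by
  rw [map_mul]
  rfl

theorem ρ_one (m : M) : E.ρ 1 m = m := by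
  rw [map_one]
  rfl

/-- The subgroup of the extension corresponding to a subgroup of the kernel. -/
def sub (W : AddSubgroup M) : Subgroup G where
  carrier := {g | ∃ m ∈ W, E.i m = g}
  one_mem' := ⟨0, zero_mem W, E.i_zero⟩
  mul_mem' := by
    rintro _ _ ⟨a, ha, rfl⟩ ⟨b, hb, rfl⟩
    exact ⟨a + b, add_mem ha hb, E.i_add a b⟩
  inv_mem' := by
    rintro _ ⟨a, ha, rfl⟩
    exact ⟨-a, neg_mem ha, E.i_neg a⟩

theorem i_mem_sub {W : AddSubgroup M} {m : M} : E.i m ∈ E.sub W ↔ m ∈ W :=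
  ⟨fun ⟨_, ha, h⟩ => E.inj h ▸ ha, fun h => ⟨m, h, rfl⟩⟩

theorem sub_mono {W W' : AddSubgroup M} (h : W ≤ W') : E.sub W ≤ E.sub W' :=
  fun _ ⟨m, hm, e⟩ => ⟨m, h hm, e⟩

theorem normal_sub {W : AddSubgroup M} (hW : ∀ p, ∀ m ∈ W, E.ρ p m ∈ W) : (E.sub W).Normal := by
  refine ⟨?_⟩
  rintro _ ⟨m, hm, rfl⟩ g
  exact ⟨E.ρ (E.f g) m, hW _ m hm, E.i_ρ g m⟩

theorem exists_orbitSpan [Group.FG G] {m : ℕ} (hP : CentralTower m P) :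
    ∃ X : Set M, X.Finite ∧ ∀ W : AddSubgroup M, X ⊆ W → (∀ p, ∀ m ∈ W, E.ρ p m ∈ W) →
      W = ⊤ := by
  obtain ⟨X, hX, hXk⟩ := hP.exists_normalClosure E.f E.surj
  refine ⟨E.i ⁻¹' X, hX.preimage E.inj.injOn, fun W hXW hW => ?_⟩
  have := E.normal_sub hW
  have h1 : E.f.ker ≤ E.sub W := by
    rw [hXk]
    refine Subgroup.normalClosure_le_normal fun g hg => ?_
    have h2 : g ∈ E.f.ker := hXk ▸ Subgroup.subset_normalClosure hg
    obtain ⟨m, rfl⟩ := (E.mem_ker g).1 h2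
    exact ⟨m, hXW hg, rfl⟩
  exact eq_top_iff.2 fun m _ => E.i_mem_sub.1 (h1 (E.f_i m))

section Functional

variable {D : Type} [CommRing D] [Module D M] (ρD : P →* Module.End D M)
  (hρD : ∀ p m, ρD p m = E.ρ p m)

include hρD in
theorem orbitSpan_eq_top [Group.FG G] {m : ℕ} (hP : CentralTower m P) :
    ∃ X : Set M, X.Finite ∧ HallModule.orbitSpan ρD ⊤ X = ⊤ := by
  obtain ⟨X, hX, h⟩ := E.exists_orbitSpan hP
  refine ⟨X, hX, ?_⟩
  have h1 := h (HallModule.orbitSpan ρD ⊤ X).toAddSubgroup (fun x hx =>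
    Submodule.subset_span ⟨1, trivial, x, hx, (HallModule.rho_one ρD x).symm⟩) (fun p m hm => by
      rw [← hρD]
      exact HallModule.stable_orbitSpan ρD ⊤ X p trivial m hm)
  exact Submodule.toAddSubgroup_injective h1

include hρD in
theorem exists_genFree [Group.FG G] [IsDomain D] [IsNoetherianRing D] {m : ℕ}
    (hP : CentralTower m P) : ∃ f : D, f ≠ 0 ∧ GenFree f (⊥ : Submodule D M) ⊤ := by
  obtain ⟨X, hX, h⟩ := E.orbitSpan_eq_top ρD hρD hP
  rw [← h]
  refine (HallModule.acc_and_generic ρD hP.polyZ).2 X hX ⊥ bot_le ?_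
  intro h _ u hu
  rw [(Submodule.mem_bot D).1 hu, map_zero]
  exact zero_mem _

include hρD in
theorem not_noAff_of_functional {L : Type} [Field L] [IsAlgClosed L] [Algebra D L]
    [FiniteDimensional L (M →ₗ[D] L)] (hP : VN P) {w : P} (hw : ∀ p, w * p = p * w) {x : L}
    (hx : Hyperbolic.{u} L x) (hx1 : ∀ n : ℕ, 0 < n → x ^ n ≠ 1) {φ₀ : M →ₗ[D] L} (hφ₀ : φ₀ ≠ 0)
    (hφ₀w : ∀ m, φ₀ (E.ρ w m) = x * φ₀ m) : ¬ NoAff G := by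
  intro hno
  let σ : P →* Module.End L (M →ₗ[D] L) :=
    { toFun := fun p =>
        { toFun := fun φ => φ ∘ₗ ρD p⁻¹
          map_add' := fun _ _ => rfl
          map_smul' := fun _ _ => rfl }
      map_one' := by
        ext φ m
        change φ (ρD 1⁻¹ m) = φ m
        rw [inv_one, map_one]
        rfl
      map_mul' := fun p q => by
        ext φ m
        change φ (ρD (p * q)⁻¹ m) = φ (ρD q⁻¹ (ρD p⁻¹ m))
        rw [mul_inv_rev, map_mul]
        rfl }
  let V : Submodule L (M →ₗ[D] L) :=
    { carrier := {φ | ∀ m, φ (ρD w m) = x * φ m}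
      zero_mem' := fun m => by simp
      add_mem' := fun {a b} ha hb m => by
        rw [LinearMap.add_apply, LinearMap.add_apply, ha, hb, mul_add]
      smul_mem' := fun c a ha m => by
        rw [LinearMap.smul_apply, LinearMap.smul_apply, ha, smul_eq_mul, smul_eq_mul]
        ring }
  have hVσ : ∀ p, ∀ φ ∈ V, σ p φ ∈ V := fun p φ hφ m => by
    change φ (ρD p⁻¹ (ρD w m)) = x * φ (ρD p⁻¹ m)
    rw [← HallModule.rho_mul, ← hw, HallModule.rho_mul]
    exact hφ _
  have : Nontrivial V := ⟨⟨⟨φ₀, fun m => by rw [hρD]; exact hφ₀w m⟩, 0, fun h =>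
    hφ₀ (congrArg Subtype.val h)⟩⟩
  let τ : P →* Module.End L V :=
    { toFun := fun p => (σ p).restrict (hVσ p)
      map_one' := LinearMap.ext fun φ => Subtype.ext (by
        change σ 1 φ = φ
        rw [map_one]
        rfl)
      map_mul' := fun p q => LinearMap.ext fun φ => Subtype.ext (by
        change σ (p * q) φ = σ p (σ q φ)
        rw [map_mul]
        rfl) }
  obtain ⟨S, hS, φ, hφ, hSφ⟩ := hP.exists_common_eigenvector (V := V) τ
  have hφw : ∀ m, φ.1 (E.ρ w m) = x * φ.1 m := fun m => by
    rw [← hρD]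
    exact φ.2 m
  obtain ⟨m₀, hm₀⟩ : ∃ m, φ.1 m ≠ 0 := by
    by_contra! h
    exact hφ (Subtype.ext (LinearMap.ext h))
  have hl : ∀ g : S.comap E.f, ∃ c : L, ∀ m, φ.1 (E.ρ (E.f g) m) = c * φ.1 m := by
    intro g
    obtain ⟨c, hc⟩ := hSφ (E.f g)⁻¹ (inv_mem g.2)
    refine ⟨c, fun m => ?_⟩
    have h1 : φ.1 (ρD (E.f g)⁻¹⁻¹ m) = c * φ.1 m :=
      congrArg (fun ψ : V => ψ.1 m) hc
    rwa [inv_inv, hρD] at h1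
  choose l hl using hl
  have huniq : ∀ g : S.comap E.f, ∀ c : L, φ.1 (E.ρ (E.f g) m₀) = c * φ.1 m₀ → c = l g :=
    fun g c hc => mul_right_cancel₀ hm₀ (hc.symm.trans (hl g m₀))
  let lh : S.comap E.f →* L :=
    { toFun := l
      map_one' := (huniq 1 1 (by
        change φ.1 (E.ρ (E.f 1) m₀) = _
        rw [map_one, E.ρ_one, one_mul])).symm
      map_mul' := fun a b => (huniq _ _ (by
        change φ.1 (E.ρ (E.f (a * b)) m₀) = _
        rw [map_mul, E.ρ_mul, hl, hl, mul_assoc])).symm }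
  have hfi := finiteIndex_comap E.f S
  obtain ⟨z, hz⟩ := E.surj w
  obtain ⟨j, hj, hzj⟩ : ∃ j : ℕ, 0 < j ∧ z ^ j ∈ S.comap E.f := by
    obtain ⟨j, hj, _, h⟩ := Subgroup.exists_pow_mem_of_index_ne_zero
      (H := S.comap E.f) Subgroup.FiniteIndex.index_ne_zero z
    exact ⟨j, hj, h⟩
  have hcm : ∀ g : G, ∃ m, E.i m = g * z ^ j * g⁻¹ * (z ^ j)⁻¹ := fun g => by
    rw [← E.mem_ker]
    have h1 : Commute (E.f g) (w ^ j) := Commute.pow_right (hw _).symm j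
    rw [map_mul, map_mul, map_mul, map_inv, map_inv, map_pow, hz, h1.eq]
    group
  choose κ hκ using hcm
  have hκmul : ∀ g h, κ (g * h) = κ g + E.ρ (E.f g) (κ h) := fun g h => E.inj (by
    rw [add_comm, E.i_add, E.i_ρ, hκ, hκ, hκ]
    group)
  let A : AffineRep (S.comap E.f) L :=
    ⟨lh, fun g => φ.1 (κ g), fun g g' => by
      rw [Subgroup.coe_mul, hκmul, map_add, hl]
      rfl⟩
  have hfi₀ : E.f (E.i m₀) ∈ S := by rw [E.f_i]; exact one_mem S
  have hlz : l ⟨z ^ j, hzj⟩ = x ^ j := by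
    refine (huniq _ _ ?_).symm
    change φ.1 (E.ρ (E.f (z ^ j)) m₀) = _
    rw [map_pow, hz]
    have h2 : ∀ n : ℕ, φ.1 (E.ρ (w ^ n) m₀) = x ^ n * φ.1 m₀ := by
      intro n
      induction n with
      | zero => rw [pow_zero, pow_zero, E.ρ_one, one_mul]
      | succ n ih => rw [pow_succ', E.ρ_mul, hφw, ih, pow_succ', mul_assoc]
    exact h2 j
  refine hno (S.comap E.f) hfi ⟨L, _, x, A, ⟨z ^ j, hzj⟩, ⟨E.i m₀, hfi₀⟩, j, hx, hj, hlz, ?_, ?_⟩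
  · refine (huniq _ _ ?_).symm
    change φ.1 (E.ρ (E.f (E.i m₀)) m₀) = _
    rw [E.f_i, E.ρ_one, one_mul]
  · change φ.1 (κ (E.i m₀)) ≠ 0
    have h1 : κ (E.i m₀) = m₀ - E.ρ (E.f (z ^ j)) m₀ := E.inj (by
      rw [hκ, E.i_sub, E.i_ρ]
      group)
    have h2 := hl ⟨z ^ j, hzj⟩ m₀
    rw [hlz] at h2
    rw [h1, map_sub, h2, ← one_sub_mul]
    exact mul_ne_zero (sub_ne_zero.2 (hx1 j hj).symm) hm₀

end Functional

end AbExt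

end AbelianExtension

section AbelianByTower

/-- `w` is central in `P` and `P` modulo `w` is a central tower of height `m`. -/
def CentralStep (m : ℕ) {P : Type u} [Group P] (w : P) : Prop :=
  w ∈ Subgroup.center P ∧ ∃ (K : Type u) (_ : Group K) (q : P →* K),
    Function.Surjective q ∧ q.ker = Subgroup.zpowers w ∧ CentralTower m K

/-- Extensions of towers of height `m` by abelian groups are virtually nilpotent as soon as they
have no hyperbolic affine representation. -/
def AbelianByTowerVN (m : ℕ) : Prop :=
  ∀ (G P : Type u) [Group G] [Group P] [Group.FG G] (f : G →* P), Function.Surjective f →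
    CentralTower m P → (∀ a ∈ f.ker, ∀ b ∈ f.ker, a * b = b * a) → NoAff G → VN G

theorem CentralStep.tower {m : ℕ} {P : Type u} [Group P] {w : P} (h : CentralStep m w) :
    CentralTower (m + 1) P := by
  obtain ⟨hw, K, _, q, hq, hker, hK⟩ := h
  exact hK.succ q hq hw hker

theorem CentralStep.comm {m : ℕ} {P : Type u} [Group P] {w : P} (h : CentralStep m w) (p : P) :
    w * p = p * w := (Subgroup.mem_center_iff.1 h.1 p).symm

theorem CentralStep.exists_quotient {m : ℕ} {P : Type u} [Group P] {w : P} (h : CentralStep m w)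
    {r : ℕ} (hr : 0 < r) : ∃ (P' : Type u) (_ : Group P') (π : P →* P'), Function.Surjective π ∧
      π.ker = Subgroup.zpowers (w ^ r) ∧ CentralTower m P' := by
  obtain ⟨hw, K, _, q, hq, hker, hK⟩ := h
  have hn : (Subgroup.zpowers (w ^ r)).Normal := by
    refine ⟨fun n hn g => ?_⟩
    have h1 : n ∈ Subgroup.center P :=
      (Subgroup.zpowers_le.2 (pow_mem hw r)) hn
    rw [Subgroup.mem_center_iff.1 h1 g, mul_inv_cancel_right]
    exact hn
  refine ⟨P ⧸ Subgroup.zpowers (w ^ r), inferInstance, QuotientGroup.mk' _,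
    QuotientGroup.mk'_surjective _, QuotientGroup.ker_mk' _, ?_⟩
  have hle : Subgroup.zpowers (w ^ r) ≤ q.ker := by
    rw [hker, Subgroup.zpowers_le]
    exact pow_mem (Subgroup.mem_zpowers w) r
  have hk : (QuotientGroup.lift _ q hle).ker ≤
      Subgroup.zpowers (w : P ⧸ Subgroup.zpowers (w ^ r)) := by
    intro x hx
    obtain ⟨p, rfl⟩ := QuotientGroup.mk_surjective x
    have h1 : p ∈ q.ker := hx
    rw [hker] at h1
    obtain ⟨i, rfl⟩ := h1
    exact ⟨i, rfl⟩
  refine hK.of_finite_central_ker (QuotientGroup.lift _ q hle) (hk.trans ?_) ?_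
  · rw [Subgroup.zpowers_le, Subgroup.mem_center_iff]
    intro x
    obtain ⟨p, rfl⟩ := QuotientGroup.mk_surjective x
    exact congrArg _ (Subgroup.mem_center_iff.1 hw p)
  · have h1 : IsOfFinOrder (w : P ⧸ Subgroup.zpowers (w ^ r)) := by
      rw [isOfFinOrder_iff_pow_eq_one]
      exact ⟨r, hr, (QuotientGroup.eq_one_iff (w ^ r)).2 (Subgroup.mem_zpowers _)⟩
    have h2 : Finite (Subgroup.zpowers (w : P ⧸ Subgroup.zpowers (w ^ r))) :=
      finite_zpowers.2 h1
    exact Finite.of_injective _ (Subgroup.inclusion_injective hk)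

namespace AbExt

variable {G P M : Type u} [Group G] [Group P] [AddCommGroup M] (E : AbExt G P M)

theorem vn_of_pow_sub_mem [Group.FG G] {m : ℕ} (ih : AbelianByTowerVN.{u} m) {w : P}
    (hw : CentralStep m w) (hno : NoAff G) {W : AddSubgroup M} {r : ℕ} (hr : 0 < r)
    (hWr : ∀ m, E.ρ (w ^ r) m - m ∈ W) {G' : Type u} [Group G'] (φ : G →* G')
    (hφ : Function.Surjective φ) (hφk : ∀ g, φ g = 1 ↔ g ∈ E.sub W) : VN G' := by
  obtain ⟨P', _, π, hπ, hπk, hP'⟩ := hw.exists_quotient hr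
  have hle : φ.ker ≤ (π.comp E.f).ker := fun g hg => by
    obtain ⟨m, -, rfl⟩ := (hφk g).1 hg
    change π (E.f (E.i m)) = 1
    rw [E.f_i, map_one]
  let f' : G' →* P' := φ.liftOfSurjective hφ ⟨π.comp E.f, hle⟩
  have hf' : ∀ g, f' (φ g) = π (E.f g) := fun g =>
    φ.liftOfRightInverse_comp_apply _ (Function.rightInverse_surjInv hφ) ⟨π.comp E.f, hle⟩ g
  have : Group.FG G' := Group.fg_of_surjective hφ
  refine ih G' P' f' ?_ hP' ?_ (hno.of_surjective φ hφ)
  · intro p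
    obtain ⟨p, rfl⟩ := hπ p
    obtain ⟨g, rfl⟩ := E.surj p
    exact ⟨φ g, hf' g⟩
  · obtain ⟨z, hz⟩ := E.surj w
    have hform : ∀ a ∈ f'.ker, ∃ (k : ℤ) (m : M), a = φ (z ^ r) ^ k * φ (E.i m) := by
      intro a ha
      obtain ⟨g, rfl⟩ := hφ a
      have h1 : E.f g ∈ π.ker := by
        rw [MonoidHom.mem_ker, ← hf']
        exact ha
      rw [hπk] at h1
      obtain ⟨k, hk⟩ := h1
      have h2 : E.f (((z ^ r) ^ k)⁻¹ * g) = 1 := by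
        rw [map_mul, map_inv, map_zpow, map_pow, hz, ← hk]
        exact inv_mul_cancel _
      obtain ⟨m, hm⟩ := (E.mem_ker _).1 h2
      refine ⟨k, m, ?_⟩
      rw [hm, ← map_zpow, ← map_mul, mul_inv_cancel_left]
    have hcm : ∀ m, Commute (φ (z ^ r)) (φ (E.i m)) := by
      intro m
      rw [commute_iff_eq, ← mul_inv_eq_one, ← map_mul, ← map_mul, ← map_inv, ← map_mul, hφk]
      refine ⟨E.ρ (w ^ r) m - m, hWr m, ?_⟩
      rw [E.i_sub, ← hz, ← map_pow, E.i_ρ]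
      group
    intro a ha b hb
    obtain ⟨k, m, rfl⟩ := hform a ha
    obtain ⟨l, n, rfl⟩ := hform b hb
    have h1 : Commute (φ (z ^ r) ^ k * φ (E.i m)) (φ (z ^ r) ^ l * φ (E.i n)) := by
      refine Commute.mul_left (Commute.mul_right ?_ ?_) (Commute.mul_right ?_ ?_)
      · exact (Commute.refl _).zpow_zpow _ _
      · exact (hcm n).zpow_left k
      · exact ((hcm m).zpow_left l).symm
      · rw [commute_iff_eq, ← map_mul, E.i_comm, map_mul]
    exact h1

end AbExt

end AbelianByTower

section AbelianKernel

namespace AbExt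

variable {G P M : Type u} [Group G] [Group P] [AddCommGroup M] (E : AbExt G P M)

theorem finite_quotient [Group.FG G] {W : AddSubgroup M} {G' : Type u} [Group G'] (φ : G →* G')
    (hφ : Function.Surjective φ) (hφk : ∀ g, φ g = 1 ↔ g ∈ E.sub W) (hG' : VN G') {N : ℕ}
    (hN : 0 < N) (hNW : ∀ m : M, N • m ∈ W) : Finite (M ⧸ W) := by
  have hfg : Group.FG G' := Group.fg_of_surjective hφ
  let j : Multiplicative M →* G' :=
    { toFun := fun m => φ (E.i m.toAdd)
      map_one' := by
        change φ (E.i 0) = 1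
        rw [E.i_zero, map_one]
      map_mul' := fun a b => by
        change φ (E.i (a.toAdd + b.toAdd)) = _
        rw [E.i_add, map_mul] }
  have hR : Group.FG j.range := hG'.fg_subgroup _
  let _ : CommGroup j.range := { (inferInstance : Group j.range) with
    mul_comm := by
      rintro ⟨_, a, rfl⟩ ⟨_, b, rfl⟩
      exact Subtype.ext (by
        change j a * j b = j b * j a
        rw [← map_mul, mul_comm, map_mul]) }
  have hfin : Finite j.range := by
    refine CommGroup.finite_of_fg_isMulTorsion _ ?_
    rintro ⟨_, m, rfl⟩
    rw [isOfFinOrder_iff_pow_eq_one]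
    refine ⟨N, hN, Subtype.ext ?_⟩
    change j m ^ N = 1
    rw [← map_pow]
    exact (hφk _).2 (E.i_mem_sub.2 (hNW m.toAdd))
  refine Finite.of_injective
    (fun x : M ⧸ W => (⟨j (Multiplicative.ofAdd x.out), _, rfl⟩ : j.range)) fun a b hab => ?_
  have h1 : φ (E.i a.out) = φ (E.i b.out) := congrArg Subtype.val hab
  rw [← Quotient.out_eq' a, ← Quotient.out_eq' b]
  refine QuotientAddGroup.eq.2 ?_
  rw [← E.i_mem_sub, ← hφk, E.i_add, E.i_neg, map_mul, map_inv, h1, inv_mul_cancel]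

/-- The subgroup generated by the commutators of `u ∈ U` with elements of `H`. -/
def comm (H : Subgroup G) (U : AddSubgroup M) : AddSubgroup M :=
  AddSubgroup.closure {x | ∃ h ∈ H, ∃ u ∈ U, x = E.ρ (E.f h) u - u}

theorem comm_mono (H : Subgroup G) {U V : AddSubgroup M} (h : U ≤ V) : E.comm H U ≤ E.comm H V :=
  AddSubgroup.closure_mono fun _ ⟨g, hg, u, hu, e⟩ => ⟨g, hg, u, h hu, e⟩

theorem iterate_comm_mono (H : Subgroup G) (n : ℕ) {U V : AddSubgroup M} (h : U ≤ V) :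
    (E.comm H)^[n] U ≤ (E.comm H)^[n] V := by
  induction n with
  | zero => exact h
  | succ n ih =>
    rw [Function.iterate_succ_apply', Function.iterate_succ_apply']
    exact E.comm_mono H ih

theorem comm_map_le (H : Subgroup G) (y : M →+ M) (hy : ∀ p m, y (E.ρ p m) = E.ρ p (y m))
    (U : AddSubgroup M) : E.comm H (U.map y) ≤ (E.comm H U).map y := by
  refine (AddSubgroup.closure_le _).2 ?_
  rintro _ ⟨h, hh, _, ⟨u, hu, rfl⟩, rfl⟩
  exact ⟨E.ρ (E.f h) u - u, AddSubgroup.subset_closure ⟨h, hh, u, hu, rfl⟩, by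
    rw [map_sub, hy]⟩

theorem iterate_comm_map_le (H : Subgroup G) (y : M →+ M)
    (hy : ∀ p m, y (E.ρ p m) = E.ρ p (y m)) (n : ℕ) (U : AddSubgroup M) :
    (E.comm H)^[n] (U.map y) ≤ ((E.comm H)^[n] U).map y := by
  induction n with
  | zero => exact le_rfl
  | succ n ih =>
    rw [Function.iterate_succ_apply', Function.iterate_succ_apply']
    exact (E.comm_mono H ih).trans (E.comm_map_le H y hy _)

theorem sub_iterate_comm_le (H : Subgroup G) [H.Normal] (n : ℕ) :
    E.sub ((E.comm H)^[n + 1] ⊤) ≤ H.lowerCentralSeries n := by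
  have key : ∀ (U : AddSubgroup M) (L : Subgroup G),
      (∀ h ∈ H, ∀ u ∈ U, E.i (E.ρ (E.f h) u - u) ∈ L) → E.sub (E.comm H U) ≤ L := by
    intro U L hL
    rintro _ ⟨m, hm, rfl⟩
    refine AddSubgroup.closure_induction (p := fun m _ => E.i m ∈ L) ?_ ?_ ?_ ?_ hm
    · rintro _ ⟨h, hh, u, hu, rfl⟩
      exact hL h hh u hu
    · rw [E.i_zero]
      exact one_mem L
    · intro a b _ _ ha hb
      rw [E.i_add]
      exact mul_mem ha hb
    · intro a _ ha
      rw [E.i_neg]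
      exact inv_mem ha
  induction n with
  | zero =>
    refine key _ _ fun h hh u _ => ?_
    rw [E.i_sub, E.i_ρ, mul_assoc, mul_assoc]
    refine mul_mem hh ?_
    rw [← mul_assoc]
    exact (inferInstance : H.Normal).conj_mem _ (inv_mem hh) _
  | succ n ih =>
    rw [Function.iterate_succ_apply']
    refine key _ _ fun h hh u hu => ?_
    have h1 : E.i u ∈ H.lowerCentralSeries n := ih (E.i_mem_sub.2 hu)
    rw [E.i_sub, E.i_ρ, Subgroup.lowerCentralSeries_succ, Subgroup.commutator_comm]
    exact Subgroup.commutator_mem_commutator hh h1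

theorem lowerCentralSeries_le (H : Subgroup G) {c : ℕ}
    (hc : H.lowerCentralSeries c ≤ E.sub ⊤) (n : ℕ) :
    H.lowerCentralSeries (c + n) ≤ E.sub ((E.comm H)^[n] ⊤) := by
  induction n with
  | zero => exact hc
  | succ n ih =>
    rw [← add_assoc, Subgroup.lowerCentralSeries_succ, Subgroup.commutator_le,
      Function.iterate_succ_apply']
    intro g hg h hh
    obtain ⟨u, hu, rfl⟩ := ih hg
    refine ⟨-(E.ρ (E.f h) u - u),
      neg_mem (AddSubgroup.subset_closure ⟨h, hh, u, hu, rfl⟩), ?_⟩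
    rw [neg_sub, E.i_sub, E.i_ρ, commutatorElement_def]
    group

theorem vn_of_nilpotent (y : M →+ M) (hy : ∀ p m, y (E.ρ p m) = E.ρ p (y m)) {k : ℕ}
    (hk : ∀ m, y^[k] m = 0) {G' : Type u} [Group G'] (φ : G →* G')
    (hφk : ∀ g, φ g = 1 ↔ g ∈ E.sub y.range) (hG' : VN G') : VN G := by
  obtain ⟨H₀, _, hn⟩ := hG'
  obtain ⟨c, hc⟩ := (Subgroup.isNilpotent_iff_lowerCentralSeries H₀).1 hn
  have hfi := finiteIndex_comap φ H₀.normalCore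
  have hnorm : (H₀.normalCore.comap φ).Normal := inferInstance
  set H := H₀.normalCore.comap φ with hH
  have hlcs : H.lowerCentralSeries c ≤ E.sub y.range := by
    intro g hg
    rw [← hφk, ← Subgroup.mem_bot, ← hc]
    have h1 : φ g ∈ (H.map φ).lowerCentralSeries c := by
      rw [← Subgroup.map_lowerCentralSeries]
      exact ⟨g, hg, rfl⟩
    exact Subgroup.lowerCentralSeries_mono c
      ((Subgroup.map_comap_le _ _).trans H₀.normalCore_le) h1
  have hΔ : (E.comm H)^[c + 1] ⊤ ≤ y.range := fun m hm =>
    E.i_mem_sub.1 (hlcs (E.sub_iterate_comm_le H c (E.i_mem_sub.2 hm)))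
  have hΔk : ∀ j, (E.comm H)^[(c + 1) * j] ⊤ ≤ (AddSubgroup.map y)^[j] ⊤ := by
    intro j
    induction j with
    | zero => exact le_rfl
    | succ j ih =>
      rw [mul_add, mul_one, add_comm, Function.iterate_add_apply]
      refine (E.iterate_comm_mono H _ ih).trans ?_
      clear ih
      have h2 : ∀ U : AddSubgroup M, (E.comm H)^[c + 1] U ≤ y.range := fun U =>
        (E.iterate_comm_mono H _ le_top).trans hΔ
      induction j with
      | zero =>
        rw [Function.iterate_zero_apply, Function.iterate_one, ← AddMonoidHom.range_eq_map]
        exact hΔ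
      | succ j ihj =>
        rw [Function.iterate_succ_apply' (AddSubgroup.map y) (j + 1),
          Function.iterate_succ_apply' (AddSubgroup.map y) j]
        rw [Function.iterate_succ_apply' (AddSubgroup.map y) j] at ihj
        exact (E.iterate_comm_map_le H y hy _ _).trans (AddSubgroup.map_mono ihj)
  have hbot : (AddSubgroup.map y)^[k] ⊤ = ⊥ := by
    have h1 : ∀ j, ∀ m ∈ (AddSubgroup.map y)^[j] ⊤, ∃ n, m = y^[j] n := by
      intro j
      induction j with
      | zero => exact fun m _ => ⟨m, rfl⟩
      | succ j ih =>
        intro m hm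
        rw [Function.iterate_succ_apply'] at hm
        obtain ⟨n, hn, rfl⟩ := hm
        obtain ⟨n', rfl⟩ := ih n hn
        exact ⟨n', (Function.iterate_succ_apply' y j n').symm⟩
    refine (AddSubgroup.eq_bot_iff_forall _).2 fun m hm => ?_
    obtain ⟨n, rfl⟩ := h1 k m hm
    exact hk n
  refine ⟨H, hfi, (Subgroup.isNilpotent_iff_lowerCentralSeries H).2
    ⟨c + (c + 1) * k, eq_bot_iff.2 ?_⟩⟩
  refine (E.lowerCentralSeries_le H (hlcs.trans (E.sub_mono le_top)) _).trans ?_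
  rintro _ ⟨m, hm, rfl⟩
  have h1 := hΔk k hm
  rw [hbot, AddSubgroup.mem_bot] at h1
  rw [h1, E.i_zero]
  exact one_mem _

end AbExt

end AbelianKernel

open Polynomial

section GenericFreeness

variable {D : Type} {M : Type u} [CommRing D] [AddCommGroup M] [Module D M]

theorem finite_index_of_finite_quotient {ι : Type u} {b : ι → M} {f π : D}
    (hb : ∀ l : ι →₀ D, Finsupp.linearCombination D b l = 0 → l = 0)
    (hf : ∀ m, ∃ k : ℕ, f ^ k • m ∈ Submodule.span D (Set.range b)) (hπ : Prime π)
    (hπf : ¬ π ∣ f) (W : AddSubgroup M) [Finite (M ⧸ W)] (hW : ∀ m ∈ W, ∃ m', m = π • m') :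
    Finite ι := by
  classical
  refine Finite.of_injective (fun i => (b i : M ⧸ W)) fun i j hij => ?_
  by_contra hne
  obtain ⟨m, hm⟩ := hW _ (QuotientAddGroup.eq.1 hij)
  obtain ⟨k, hk⟩ := hf m
  obtain ⟨l, hl⟩ := (Finsupp.mem_span_range_iff_exists_finsupp).1 hk
  have h1 := hb (π • l - (Finsupp.single j (f ^ k) - Finsupp.single i (f ^ k))) (by
    have h2 : Finsupp.linearCombination D b l = f ^ k • m := hl
    rw [map_sub, map_sub, map_smul, h2, Finsupp.linearCombination_single,
      Finsupp.linearCombination_single, ← smul_sub, sub_eq_zero, smul_comm, ← hm]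
    congr 1
    abel)
  have h3 : π * l j - f ^ k = 0 := by
    have h4 := DFunLike.congr_fun h1 j
    simpa [Finsupp.single_apply, hne] using h4
  exact hπf (hπ.dvd_of_dvd_pow ⟨l j, (sub_eq_zero.1 h3).symm⟩)

theorem finiteDimensional_functionals {L : Type} [Field L] [Algebra D L]
    (hL : Function.Injective (algebraMap D L)) {ι : Type u} [Finite ι] {b : ι → M} {f : D}
    (hf0 : f ≠ 0) (hf : ∀ m, ∃ k : ℕ, f ^ k • m ∈ Submodule.span D (Set.range b)) :
    FiniteDimensional L (M →ₗ[D] L) := by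
  let T : (M →ₗ[D] L) →ₗ[L] (ι → L) :=
    { toFun := fun φ i => φ (b i)
      map_add' := fun _ _ => rfl
      map_smul' := fun _ _ => rfl }
  refine Module.Finite.of_injective T ((injective_iff_map_eq_zero T).2 fun φ hφ => ?_)
  refine LinearMap.ext fun m => ?_
  obtain ⟨k, hk⟩ := hf m
  have h1 : Submodule.span D (Set.range b) ≤ LinearMap.ker φ := by
    rw [Submodule.span_le]
    rintro _ ⟨i, rfl⟩
    exact congrFun hφ i
  have h2 : φ (f ^ k • m) = 0 := h1 hk
  rw [map_smul, Algebra.smul_def, mul_eq_zero] at h2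
  refine h2.resolve_left fun h3 => hf0 ?_
  rw [map_pow] at h3
  exact hL ((eq_zero_of_pow_eq_zero h3).trans (map_zero _).symm)

theorem exists_functional_ne_zero [IsDomain D] {L : Type} [Field L] [Algebra D L]
    (hL : Function.Injective (algebraMap D L)) {m : M} (hm : ∀ d : D, d • m = 0 → d = 0) :
    ∃ φ : M →ₗ[D] L, φ m ≠ 0 := by
  let K := FractionRing D
  let N := LocalizedModule (nonZeroDivisors D) M
  let j : M →ₗ[D] N := LocalizedModule.mkLinearMap (nonZeroDivisors D) M
  have hj : j m ≠ 0 := fun h => by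
    obtain ⟨c, hc⟩ := (IsLocalizedModule.eq_zero_iff (nonZeroDivisors D) j).1 h
    exact nonZeroDivisors.coe_ne_zero c (hm c hc)
  have : ∃ ψ : N →ₗ[K] K, ψ (j m) ≠ 0 := by
    by_contra! h
    exact hj ((Module.forall_dual_apply_eq_zero_iff K (j m)).1 h)
  obtain ⟨ψ, hψ⟩ := this
  let e : K →ₐ[D] L := IsFractionRing.liftAlgHom (g := Algebra.ofId D L) hL
  refine ⟨e.toLinearMap ∘ₗ ψ.restrictScalars D ∘ₗ j, fun h => hψ ?_⟩
  exact e.toRingHom.injective (h.trans (map_zero _).symm)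

namespace AbExt

variable {G P : Type u} [Group G] [Group P] (E : AbExt G P M)

theorem exists_linear (h : ∀ (d : D) p m, E.ρ p (d • m) = d • E.ρ p m) :
    ∃ ρD : P →* Module.End D M, ∀ p m, ρD p m = E.ρ p m :=
  ⟨{  toFun := fun p =>
        { toFun := E.ρ p
          map_add' := map_add _
          map_smul' := fun d m => h d p m }
      map_one' := LinearMap.ext E.ρ_one
      map_mul' := fun p q => LinearMap.ext (E.ρ_mul p q) }, fun _ _ => rfl⟩

theorem exists_annihilator [Group.FG G] [IsDomain D] {k : ℕ} (hP : CentralTower k P)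
    (h : ∀ (d : D) p m, E.ρ p (d • m) = d • E.ρ p m) (y : M →+ M)
    (hy : ∀ p m, y (E.ρ p m) = E.ρ p (y m)) (ht : ∀ m : M, ∃ d : D, d ≠ 0 ∧ d • y m = 0) :
    ∃ d : D, d ≠ 0 ∧ ∀ m : M, d • y m = 0 := by
  obtain ⟨X, hX, hXW⟩ := E.exists_orbitSpan hP
  choose d hd0 hd using ht
  refine ⟨∏ x ∈ hX.toFinset, d x, Finset.prod_ne_zero_iff.2 fun x _ => hd0 x, fun m => ?_⟩
  have h1 := hXW
    ((DistribSMul.toAddMonoidHom M (∏ x ∈ hX.toFinset, d x)).comp y).ker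
    (fun x hx => ?_) (fun p m hm => ?_)
  · have h2 : m ∈ (⊤ : AddSubgroup M) := trivial
    rw [← h1] at h2
    exact h2
  · change (∏ x ∈ hX.toFinset, d x) • y x = 0
    obtain ⟨c, hc⟩ := Finset.dvd_prod_of_mem d (hX.mem_toFinset.2 hx)
    rw [hc, mul_comm, mul_smul, hd, smul_zero]
  · change (∏ x ∈ hX.toFinset, d x) • y (E.ρ p m) = 0
    have h3 : (∏ x ∈ hX.toFinset, d x) • y m = 0 := hm
    rw [hy, ← h, h3, map_zero]

end AbExt

end GenericFreeness

section PrimeExponent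

namespace AbExt

variable {G P M : Type u} [Group G] [Group P] [AddCommGroup M] (E : AbExt G P M)

theorem ρ_comm {w : P} (hw : ∀ p, w * p = p * w) (p : P) (m : M) :
    E.ρ p (E.ρ w m) = E.ρ w (E.ρ p m) := by
  rw [← E.ρ_mul, ← E.ρ_mul, hw]

theorem ρ_inv_apply (p : P) (m : M) : E.ρ p (E.ρ p⁻¹ m) = m := by
  rw [← E.ρ_mul, mul_inv_cancel, E.ρ_one]

theorem exists_polynomialModule {k : Type} [Field k] [Module k M] {w : P}
    (hw : ∀ q, w * q = q * w) (hk : ∀ q (c : k) (m : M), E.ρ q (c • m) = c • E.ρ q m) :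
    ∃ _ : Module k[X] M, (∀ m : M, (X : k[X]) • m = E.ρ w m) ∧
      ∀ (d : k[X]) q (m : M), E.ρ q (d • m) = d • E.ρ q m := by
  let R : P → Module.End k M := fun q =>
    { toFun := E.ρ q
      map_add' := map_add _
      map_smul' := hk q }
  have hR : ∀ q m, R q m = E.ρ q m := fun _ _ => rfl
  let I : Module k[X] M := Module.compHom M (aeval (R w)).toRingHom
  have hI : ∀ (d : k[X]) (m : M), d • m = aeval (R w) d m := fun _ _ => rfl
  refine ⟨I, fun m => ?_, fun d q m => ?_⟩
  · rw [hI, aeval_X, hR]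
  · rw [hI, hI]
    have h1 : Commute (R q) (R w) := LinearMap.ext fun m => E.ρ_comm hw q m
    have h2 : Commute (R q) (aeval (R w) d) := by
      induction d using Polynomial.induction_on' with
      | add a b ha hb =>
        rw [map_add]
        exact ha.add_right hb
      | monomial n a =>
        rw [aeval_monomial]
        exact Commute.mul_right (Algebra.commutes a (R q)).symm (h1.pow_right n)
    exact LinearMap.congr_fun h2 m

theorem exists_dvd_X_pow_sub_one {k : Type} [Field k] [Finite k] {h : k[X]} (h0 : h ≠ 0) :
    ∃ i r : ℕ, 0 < r ∧ h ∣ X ^ i * (X ^ r - 1) := by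
  have hfin : Finite (AdjoinRoot h) := by
    let pb := AdjoinRoot.powerBasis h0
    have := pb.finite
    exact Module.finite_of_finite k
  obtain ⟨i, j, hij, he⟩ := Finite.exists_ne_map_eq_of_infinite
    (fun n : ℕ => AdjoinRoot.root h ^ n)
  have key : ∀ i j : ℕ, i < j → AdjoinRoot.root h ^ i = AdjoinRoot.root h ^ j →
      ∃ i r : ℕ, 0 < r ∧ h ∣ X ^ i * (X ^ r - 1) := fun i j hlt he => by
    refine ⟨i, j - i, Nat.sub_pos_of_lt hlt, AdjoinRoot.mk_eq_zero.1 ?_⟩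
    rw [mul_sub, ← pow_add, Nat.add_sub_cancel' hlt.le, mul_one, map_sub, map_pow, map_pow,
      AdjoinRoot.mk_X, he, sub_self]
  rcases hij.lt_or_gt with h | h
  · exact key i j h he
  · exact key j i h he.symm

theorem vn_of_prime_exponent (E : AbExt G P M) [Group.FG G] {m : ℕ} (ih : AbelianByTowerVN.{u} m) {w : P}
    (hw : CentralStep m w) (hno : NoAff G) {p : ℕ} [hpp : Fact p.Prime]
    (hp : ∀ m : M, p • m = 0) : VN G := by
  obtain ⟨I, hX, hcomm⟩ : ∃ _ : Module (ZMod p)[X] M,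
      (∀ m : M, (X : (ZMod p)[X]) • m = E.ρ w m) ∧
      ∀ (d : (ZMod p)[X]) q (m : M), E.ρ q (d • m) = d • E.ρ q m := by
    let _ : Module (ZMod p) M := AddCommGroup.zmodModule hp
    exact E.exists_polynomialModule hw.comm fun q c m => ZMod.map_smul (E.ρ q) c m
  obtain ⟨ρD, hρD⟩ := E.exists_linear hcomm
  have hpow : ∀ (n : ℕ) (m : M), (X ^ n : (ZMod p)[X]) • m = E.ρ (w ^ n) m := fun n => by
    induction n with
    | zero => exact fun m => by rw [pow_zero, pow_zero, one_smul, E.ρ_one]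
    | succ n ih => exact fun m => by rw [pow_succ', mul_smul, ih, hX, pow_succ', E.ρ_mul]
  have hrange : ∀ h : (ZMod p)[X], h ≠ 0 →
      ∃ r : ℕ, 0 < r ∧ ∀ m : M, ∃ m', E.ρ (w ^ r) m - m = h • m' := by
    intro h h0
    obtain ⟨i, r, hr, c, hc⟩ := exists_dvd_X_pow_sub_one h0
    refine ⟨r, hr, fun m => ⟨c • E.ρ (w ^ i)⁻¹ m, ?_⟩⟩
    rw [← mul_smul, ← hc, mul_comm, mul_smul, hpow, E.ρ_inv_apply, sub_smul, one_smul, hpow]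
  by_cases ht : ∃ m₀ : M, ∀ d : (ZMod p)[X], d • m₀ = 0 → d = 0
  · exfalso
    obtain ⟨m₀, hm₀⟩ := ht
    obtain ⟨f, hf0, ι, b, -, hb, hf⟩ := E.exists_genFree ρD hρD hw.tower
    have hb' : ∀ l : ι →₀ (ZMod p)[X], Finsupp.linearCombination _ b l = 0 → l = 0 :=
      fun l hl => hb l ((Submodule.mem_bot _).2 hl)
    have hf' : ∀ m, ∃ k : ℕ, f ^ k • m ∈ Submodule.span (ZMod p)[X] (Set.range b) := fun m => by
      obtain ⟨k, hk⟩ := hf m trivial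
      rw [bot_sup_eq] at hk
      exact ⟨k, hk⟩
    have hdeg : (X * f + 1).natDegree ≠ 0 := by
      rw [← map_one C, natDegree_add_C, natDegree_X_mul hf0]
      exact Nat.succ_ne_zero _
    obtain ⟨π, hπ, hπf⟩ := WfDvdMonoid.exists_irreducible_factor
      (fun h => hdeg (natDegree_eq_zero_of_isUnit h)) (fun h => hdeg (by rw [h, natDegree_zero]))
    have hπf' : ¬ π ∣ f := fun h =>
      hπ.not_isUnit (isUnit_of_dvd_one ((dvd_add_right (h.mul_left X)).1 hπf))
    have hπp : Prime π := hπ.prime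
    let W : AddSubgroup M := (DistribSMul.toAddMonoidHom M π).range
    obtain ⟨r, hr, hrW⟩ := hrange π hπ.ne_zero
    have hWs : ∀ q, ∀ m ∈ W, E.ρ q m ∈ W := by
      rintro q _ ⟨m, rfl⟩
      exact ⟨E.ρ q m, (hcomm π q m).symm⟩
    have hN := E.normal_sub hWs
    have hk : ∀ g, QuotientGroup.mk' (E.sub W) g = 1 ↔ g ∈ E.sub W := QuotientGroup.eq_one_iff
    have hvn := E.vn_of_pow_sub_mem ih hw hno hr (W := W) (fun m => by
      obtain ⟨m', h⟩ := hrW m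
      exact ⟨m', h.symm⟩) _ (QuotientGroup.mk'_surjective _) hk
    have hfin := E.finite_quotient _ (QuotientGroup.mk'_surjective _) hk hvn hpp.out.pos
      (fun m => (hp m).symm ▸ zero_mem W)
    have hι := finite_index_of_finite_quotient hb' hf' hπp hπf' W (by
      rintro _ ⟨m, rfl⟩
      exact ⟨m, rfl⟩)
    let L := AlgebraicClosure (RatFunc (ZMod p))
    have hL : Function.Injective (algebraMap (ZMod p)[X] L) := by
      rw [IsScalarTower.algebraMap_eq (ZMod p)[X] (RatFunc (ZMod p)) L]
      exact (algebraMap (RatFunc (ZMod p)) L).injective.comp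
        (IsFractionRing.injective (ZMod p)[X] (RatFunc (ZMod p)))
    have := finiteDimensional_functionals hL hf0 hf'
    obtain ⟨φ, hφ⟩ := exists_functional_ne_zero hL hm₀
    have hx := hyperbolic_X.{u} (k := ZMod p) (K := RatFunc (ZMod p)) (L := L)
    rw [← IsScalarTower.algebraMap_apply] at hx
    refine E.not_noAff_of_functional (φ₀ := φ) ρD hρD hw.tower.vn hw.comm hx (fun n hn h => ?_)
      (fun h => hφ (by rw [h]; rfl)) (fun m => ?_) hno
    · rw [← map_pow, ← map_one (algebraMap (ZMod p)[X] L)] at h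
      have h1 := congrArg natDegree (hL h)
      rw [natDegree_X_pow, natDegree_one] at h1
      exact hn.ne' h1
    · rw [← hX, map_smul, Algebra.smul_def]
  · push Not at ht
    obtain ⟨d, hd0, hd⟩ := E.exists_annihilator hw.tower hcomm (AddMonoidHom.id M)
      (fun _ _ => rfl) (fun m => by
      obtain ⟨d, h1, h2⟩ := ht m
      exact ⟨d, h2, h1⟩)
    obtain ⟨r, hr, hrd⟩ := hrange d hd0
    refine E.vn_of_pow_sub_mem ih hw hno hr (W := ⊥) (fun m => ?_) (MonoidHom.id G)
      Function.surjective_id fun g => ⟨?_, ?_⟩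
    · obtain ⟨m', h⟩ := hrd m
      rw [h]
      have h2 : d • m' = 0 := hd m'
      rw [h2]
      exact zero_mem _
    · rintro rfl
      exact one_mem _
    · rintro ⟨m, hm, rfl⟩
      rw [AddSubgroup.mem_bot.1 hm]
      exact E.i_zero

end AbExt

end PrimeExponent

section AbelianStep

theorem exists_pow_sub_one_nilpotent {L V : Type*} [Field L] [IsAlgClosed L] [AddCommGroup V]
    [Module L V] [FiniteDimensional L V] (T : Module.End L V)
    (hT : ∀ x, T.HasEigenvalue x → ∃ n : ℕ, 0 < n ∧ x ^ n = 1) :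
    ∃ n d : ℕ, 0 < n ∧ (T ^ n - 1) ^ d = 0 := by
  classical
  have hroot : ∀ x : (minpoly L T).roots.toFinset, ∃ n : ℕ, 0 < n ∧ (x : L) ^ n = 1 := fun x =>
    hT x (Module.End.hasEigenvalue_of_isRoot
      (Polynomial.isRoot_of_mem_roots (Multiset.mem_toFinset.1 x.2)))
  choose e he0 he using hroot
  have key : ∀ (n : ℕ) (s : Multiset L), (∀ a ∈ s, a ^ n = 1) →
      (s.map fun a => X - C a).prod ∣ (X ^ n - 1 : L[X]) ^ Multiset.card s := by
    intro n s hs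
    induction s using Multiset.induction_on with
    | empty => simp
    | cons a s ih =>
      rw [Multiset.map_cons, Multiset.prod_cons, Multiset.card_cons, pow_succ']
      refine mul_dvd_mul ?_ (ih fun b hb => hs b (Multiset.mem_cons_of_mem hb))
      rw [Polynomial.dvd_iff_isRoot]
      simp [hs a (Multiset.mem_cons_self a s)]
  refine ⟨∏ x, e x, Multiset.card (minpoly L T).roots, Finset.prod_pos fun x _ => he0 x, ?_⟩
  have h1 := key (∏ x, e x) (minpoly L T).roots fun a ha => by
    obtain ⟨c, hc⟩ := Finset.dvd_prod_of_mem e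
      (Finset.mem_univ (⟨a, Multiset.mem_toFinset.2 ha⟩ : (minpoly L T).roots.toFinset))
    have h2 : a ^ e ⟨a, Multiset.mem_toFinset.2 ha⟩ = 1 := he _
    rw [hc, pow_mul, h2, one_pow]
  rw [← (IsAlgClosed.splits (minpoly L T)).eq_prod_roots_of_monic
    (minpoly.monic (Algebra.IsIntegral.isIntegral T))] at h1
  obtain ⟨c, hc⟩ := h1
  have h2 := congrArg (aeval T) hc
  rwa [map_mul, minpoly.aeval, zero_mul, map_pow, map_sub, map_pow, aeval_X, map_one] at h2

/-- Every element of `M` is congruent modulo `N` to one of finitely many elements. -/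
def FiniteMod (M : Type u) [AddCommGroup M] (N : ℕ) : Prop :=
  ∃ T : Set M, T.Finite ∧ ∀ m, ∃ t ∈ T, ∃ m', m = t + N • m'

theorem FiniteMod.mul {M : Type u} [AddCommGroup M] {a b : ℕ} (ha : FiniteMod M a)
    (hb : FiniteMod M b) : FiniteMod M (a * b) := by
  obtain ⟨S, hS, hS'⟩ := ha
  obtain ⟨T, hT, hT'⟩ := hb
  refine ⟨Set.image2 (fun s t => s + a • t) S T, hS.image2 _ hT, fun m => ?_⟩
  obtain ⟨s, hs, m', rfl⟩ := hS' m
  obtain ⟨t, ht, m'', rfl⟩ := hT' m'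
  exact ⟨_, ⟨s, hs, t, ht, rfl⟩, m'', by rw [smul_add, mul_smul, add_assoc]⟩

theorem FiniteMod.of_finite {M : Type u} [AddCommGroup M] {N : ℕ}
    (h : Finite (M ⧸ (nsmulAddMonoidHom (α := M) N).range)) : FiniteMod M N := by
  refine ⟨Set.range (Quotient.out : M ⧸ (nsmulAddMonoidHom (α := M) N).range → M),
    Set.finite_range _, fun m => ⟨_, ⟨(m : M ⧸ (nsmulAddMonoidHom (α := M) N).range), rfl⟩, ?_⟩⟩
  obtain ⟨⟨_, m', rfl⟩, h⟩ :=
    QuotientAddGroup.mk_out_eq_add (nsmulAddMonoidHom (α := M) N).range m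
  refine ⟨-m', ?_⟩
  rw [h, smul_neg]
  exact (add_neg_cancel_right m _).symm

theorem FiniteMod.of_prime {M : Type u} [AddCommGroup M]
    (h : ∀ p : ℕ, p.Prime → FiniteMod M p) {N : ℕ} (hN : N ≠ 0) : FiniteMod M N := by
  induction N using Nat.recOnMul with
  | zero => exact absurd rfl hN
  | one => exact ⟨{0}, Set.finite_singleton _, fun m => ⟨0, rfl, m, by simp⟩⟩
  | prime p hp => exact h p hp
  | mul a b ha hb => exact (ha (left_ne_zero_of_mul hN)).mul (hb (right_ne_zero_of_mul hN))

namespace AbExt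

variable {G P M : Type u} [Group G] [Group P] [AddCommGroup M] (E : AbExt G P M)

theorem i_nsmul (n : ℕ) (m : M) : E.i (n • m) = E.i m ^ n := by
  induction n with
  | zero => rw [zero_smul, E.i_zero, pow_zero]
  | succ n ih => rw [succ_nsmul, E.i_add, ih, pow_succ]

theorem exists_pow_of_finiteMod {N : ℕ} (h : FiniteMod M N) (w : P) :
    ∃ n : ℕ, 0 < n ∧ ∀ m, ∃ m', E.ρ (w ^ n) m - m = N • m' := by
  obtain ⟨T, hT, hTN⟩ := h
  have := hT.to_subtype
  choose F hF m' hm' using hTN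
  obtain ⟨i, j, hij, he⟩ := Finite.exists_ne_map_eq_of_infinite
    (fun (n : ℕ) (t : T) => (⟨F (E.ρ (w ^ n) t), hF _⟩ : T))
  have key : ∀ i j : ℕ, i < j → (∀ t : T, F (E.ρ (w ^ i) t) = F (E.ρ (w ^ j) t)) →
      ∃ n : ℕ, 0 < n ∧ ∀ m, ∃ m', E.ρ (w ^ n) m - m = N • m' := by
    intro i j hlt he
    refine ⟨j - i, Nat.sub_pos_of_lt hlt, fun m => ?_⟩
    have h1 : ∀ t ∈ T, ∃ a, E.ρ (w ^ j) t - E.ρ (w ^ i) t = N • a := fun t ht => by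
      refine ⟨m' (E.ρ (w ^ j) t) - m' (E.ρ (w ^ i) t), ?_⟩
      have h2 := congrArg₂ (· - ·) (hm' (E.ρ (w ^ j) t)) (hm' (E.ρ (w ^ i) t))
      have h3 : F (E.ρ (w ^ i) t) = F (E.ρ (w ^ j) t) := he ⟨t, ht⟩
      refine h2.trans ?_
      rw [h3, smul_sub, add_sub_add_left_eq_sub]
    obtain ⟨a, ha⟩ := h1 _ (hF m)
    have h2 : E.ρ (w ^ j) m - E.ρ (w ^ i) m =
        N • (a + E.ρ (w ^ j) (m' m) - E.ρ (w ^ i) (m' m)) := by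
      conv_lhs => rw [hm' m]
      rw [map_add, map_add, map_nsmul, map_nsmul, smul_sub, smul_add, ← ha]
      abel
    refine ⟨E.ρ (w ^ i)⁻¹ (a + E.ρ (w ^ j) (m' m) - E.ρ (w ^ i) (m' m)), ?_⟩
    rw [← map_nsmul, ← h2, map_sub, ← E.ρ_mul, ← E.ρ_mul, inv_mul_cancel, E.ρ_one,
      ← Nat.sub_add_cancel hlt.le, pow_add, Nat.add_sub_cancel, ← pow_add, add_comm, pow_add,
      inv_mul_cancel_left]
  rcases hij.lt_or_gt with h | h
  · exact key i j h fun t => congrArg Subtype.val (congrFun he t)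
  · exact key j i h fun t => (congrArg Subtype.val (congrFun he t)).symm

theorem finite_quotient_prime (E : AbExt G P M) [Group.FG G] {m : ℕ}
    (ih : AbelianByTowerVN.{u} m) {w : P}
    (hw : CentralStep m w) (hno : NoAff G) {p : ℕ} (hp : p.Prime) :
    Finite (M ⧸ (nsmulAddMonoidHom (α := M) p).range) := by
  have : Fact p.Prime := ⟨hp⟩
  set W := (nsmulAddMonoidHom (α := M) p).range
  have hWs : ∀ q, ∀ m ∈ W, E.ρ q m ∈ W := by
    rintro q _ ⟨m, rfl⟩
    exact ⟨E.ρ q m, (map_nsmul (E.ρ q) p m).symm⟩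
  have hN := E.normal_sub hWs
  have hk : ∀ g, QuotientGroup.mk' (E.sub W) g = 1 ↔ g ∈ E.sub W := QuotientGroup.eq_one_iff
  have hle : E.sub W ≤ E.f.ker := by
    rintro _ ⟨m, -, rfl⟩
    exact E.f_i m
  have hker : ∀ a ∈ (QuotientGroup.lift (E.sub W) E.f hle).ker,
      ∃ m, a = QuotientGroup.mk' (E.sub W) (E.i m) := by
    intro a ha
    obtain ⟨g, rfl⟩ := QuotientGroup.mk_surjective a
    obtain ⟨m, rfl⟩ := (E.mem_ker g).1 ha
    exact ⟨m, rfl⟩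
  obtain ⟨M', _, E', hE'⟩ := AbExt.exists_of_comm (QuotientGroup.lift (E.sub W) E.f hle)
    (fun q => by
      obtain ⟨g, rfl⟩ := E.surj q
      exact ⟨g, rfl⟩) (by
      intro a ha b hb
      obtain ⟨m, rfl⟩ := hker a ha
      obtain ⟨n, rfl⟩ := hker b hb
      rw [← map_mul, E.i_comm, map_mul])
  have hp' : ∀ m' : M', p • m' = 0 := fun m' => E'.inj (by
    obtain ⟨m, hm⟩ := hker (E'.i m') (hE' ▸ E'.f_i m')
    rw [E'.i_nsmul, hm, E'.i_zero, ← map_pow, ← E.i_nsmul, hk, E.i_mem_sub]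
    exact ⟨m, rfl⟩)
  have hvn := E'.vn_of_prime_exponent ih hw
    (hno.of_surjective (QuotientGroup.mk' (E.sub W)) (QuotientGroup.mk'_surjective _)) hp'
  exact E.finite_quotient _ (QuotientGroup.mk'_surjective _) hk hvn hp.pos fun m => ⟨m, rfl⟩

end AbExt

end AbelianStep

section AbelianStepFinal

namespace AbExt

variable {G P M : Type u} [Group G] [Group P] [AddCommGroup M]

/-- Restriction along iterates of `a` is given by powers of `A`. -/
theorem dual_pow_apply {L : Type} [Field L] [Algebra ℤ L] {A : Module.End L (M →ₗ[ℤ] L)}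
    {a : Module.End ℤ M} (h : ∀ φ m, A φ m = φ (a m)) (k : ℕ) (φ : M →ₗ[ℤ] L) (m : M) :
    (A ^ k) φ m = φ ((a ^ k) m) := by
  induction k generalizing m with
  | zero => rfl
  | succ k ih =>
    rw [pow_succ', pow_succ, Module.End.mul_apply, Module.End.mul_apply, h, ih]

theorem exists_pow_sub_one_torsion (E : AbExt G P M) [Group.FG G] {m : ℕ}
    (ih : AbelianByTowerVN.{u} m) {w : P} (hw : CentralStep m w) (hno : NoAff G)
    (ρD : P →* Module.End ℤ M) (hρD : ∀ p m, ρD p m = E.ρ p m) :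
    ∃ n d : ℕ, 0 < n ∧ ∀ m : M, ∃ c : ℤ, c ≠ 0 ∧ c • ((ρD w ^ n - 1) ^ d) m = 0 := by
  obtain ⟨f, hf0, ι, b, -, hb, hf⟩ := E.exists_genFree ρD hρD hw.tower
  have hb' : ∀ l : ι →₀ ℤ, Finsupp.linearCombination _ b l = 0 → l = 0 :=
    fun l hl => hb l ((Submodule.mem_bot _).2 hl)
  have hf' : ∀ m, ∃ k : ℕ, f ^ k • m ∈ Submodule.span ℤ (Set.range b) := fun m => by
    obtain ⟨k, hk⟩ := hf m trivial
    rw [bot_sup_eq] at hk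
    exact ⟨k, hk⟩
  obtain ⟨p, hpf, hp⟩ := Nat.exists_infinite_primes (f.natAbs + 1)
  have hpf' : ¬ (p : ℤ) ∣ f := fun h => by
    have h1 := Nat.le_of_dvd (Int.natAbs_pos.2 hf0) (Int.natCast_dvd.1 h)
    omega
  have hfin := E.finite_quotient_prime ih hw hno hp
  have hι := finite_index_of_finite_quotient hb' hf' (Nat.prime_iff_prime_int.1 hp) hpf'
    (nsmulAddMonoidHom (α := M) p).range (by
    rintro _ ⟨m, rfl⟩
    exact ⟨m, (natCast_zsmul m p).symm⟩)
  let L := AlgebraicClosure ℚ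
  have halg : Algebra.IsAlgebraic ℚ L := by
    have h : (AlgebraicClosure.instAlgebra ℚ : Algebra ℚ L) = DivisionRing.toRatAlgebra :=
      Subsingleton.elim _ _
    exact h ▸ AlgebraicClosure.isAlgebraic ℚ
  have hL : Function.Injective (algebraMap ℤ L) := (algebraMap ℤ L).injective_int
  have hfd := finiteDimensional_functionals hL hf0 hf'
  let T : Module.End L (M →ₗ[ℤ] L) :=
    { toFun := fun φ => φ ∘ₗ ρD w
      map_add' := fun _ _ => rfl
      map_smul' := fun _ _ => rfl }
  have hT : ∀ φ m, T φ m = φ (ρD w m) := fun _ _ => rfl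
  obtain ⟨n, d, hn, hnd⟩ := exists_pow_sub_one_nilpotent T (fun x hx => by
    by_contra! hx1
    obtain ⟨φ, hφ⟩ := hx.exists_hasEigenvector
    exact E.not_noAff_of_functional (φ₀ := φ) ρD hρD hw.tower.vn hw.comm
      (hyperbolic_of_rat.{u} hx1) hx1 hφ.2
      (fun m => by
        rw [← hρD, ← hT, hφ.apply_eq_smul]
        rfl) hno)
  refine ⟨n, d, hn, fun m => ?_⟩
  by_contra! hm
  obtain ⟨φ, hφ⟩ := exists_functional_ne_zero hL (m := ((ρD w ^ n - 1) ^ d) m)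
    fun c hc => by_contra fun h => hm c h hc
  refine hφ ?_
  rw [← dual_pow_apply (A := T ^ n - 1) (fun φ m => by
    rw [LinearMap.sub_apply, LinearMap.sub_apply, dual_pow_apply hT, LinearMap.sub_apply, map_sub]
    rfl), hnd]
  rfl

theorem vn_of_centralStep (E : AbExt G P M) [Group.FG G] {m : ℕ}
    (ih : AbelianByTowerVN.{u} m) {w : P} (hw : CentralStep m w) (hno : NoAff G) : VN G := by
  obtain ⟨ρD, hρD⟩ := E.exists_linear (D := ℤ) fun d p m => map_zsmul (E.ρ p) d m
  obtain ⟨n, d, hn, hnd⟩ := E.exists_pow_sub_one_torsion ih hw hno ρD hρD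
  have hcomm : ∀ p, Commute (ρD p) (ρD w) := fun p => by
    rw [commute_iff_eq, ← map_mul, ← map_mul, hw.comm]
  have hcommy : ∀ p (k : ℕ), Commute (ρD p) (ρD w ^ k - 1) := fun p k =>
    ((hcomm p).pow_right k).sub_right (Commute.one_right _)
  obtain ⟨c, hc0, hc⟩ := E.exists_annihilator (D := ℤ) hw.tower
    (fun d p m => map_zsmul (E.ρ p) d m) ((ρD w ^ n - 1) ^ d).toAddMonoidHom
    (fun p m => by
      rw [← hρD, ← hρD]
      exact (LinearMap.congr_fun ((hcommy p n).pow_right d) m).symm) hnd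
  obtain ⟨n', hn', hNn'⟩ := E.exists_pow_of_finiteMod (FiniteMod.of_prime (M := M)
    (fun p hp => FiniteMod.of_finite (E.finite_quotient_prime ih hw hno hp))
    (Int.natAbs_ne_zero.2 hc0)) w
  have hc' : ∀ m, c.natAbs • ((ρD w ^ n - 1) ^ d) m = 0 := fun m => by
    rcases Int.natAbs_eq c with h | h
    · rw [← natCast_zsmul, ← h]
      exact hc m
    · rw [← natCast_zsmul, ← neg_neg ((c.natAbs : ℤ)), ← h, neg_smul, neg_eq_zero]
      exact hc m
  set Y : Module.End ℤ M := ρD w ^ (n * n') - 1 with hY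
  have hY1 : Y = (ρD w ^ n - 1) * ∑ i ∈ Finset.range n', (ρD w ^ n) ^ i := by
    rw [mul_geom_sum, ← pow_mul]
  have hY2 : Y = (ρD w ^ n' - 1) * ∑ i ∈ Finset.range n, (ρD w ^ n') ^ i := by
    rw [mul_geom_sum, ← pow_mul, mul_comm n' n]
  have hS : Commute (ρD w ^ n - 1) (∑ i ∈ Finset.range n', (ρD w ^ n) ^ i) :=
    Commute.sum_right _ _ _ fun i _ =>
      (((Commute.refl _).sub_left (Commute.one_left _)).pow_right i)
  have hYapply : ∀ m, Y m = E.ρ (w ^ (n * n')) m - m := fun m => by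
    rw [hY, ← map_pow, LinearMap.sub_apply, hρD]
    rfl
  have hYc : ∀ p m, Y (E.ρ p m) = E.ρ p (Y m) := fun p m => by
    rw [← hρD, ← hρD]
    exact (LinearMap.congr_fun (hcommy p (n * n')) m).symm
  have hYN : ∀ m, ∃ m', Y m = c.natAbs • m' := fun m => by
    obtain ⟨m', hm'⟩ := hNn' ((∑ i ∈ Finset.range n, (ρD w ^ n') ^ i) m)
    refine ⟨m', ?_⟩
    rw [hY2, ← hm', Module.End.mul_apply, LinearMap.sub_apply, ← map_pow, hρD]
    rfl
  have hYnil : ∀ m, (Y ^ (d + 1)) m = 0 := fun m => by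
    obtain ⟨m', hm'⟩ := hYN m
    rw [pow_succ, Module.End.mul_apply, hm', map_nsmul, hY1, hS.mul_pow, (hS.pow_pow d d).eq,
      Module.End.mul_apply, ← map_nsmul, hc', map_zero]
  have hWs : ∀ q, ∀ m ∈ Y.toAddMonoidHom.range, E.ρ q m ∈ Y.toAddMonoidHom.range := by
    rintro q _ ⟨m, rfl⟩
    exact ⟨E.ρ q m, hYc q m⟩
  have hN := E.normal_sub hWs
  have hk : ∀ g, QuotientGroup.mk' (E.sub Y.toAddMonoidHom.range) g = 1 ↔
    g ∈ E.sub Y.toAddMonoidHom.range := QuotientGroup.eq_one_iff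
  have hvn := E.vn_of_pow_sub_mem ih hw hno (Nat.mul_pos hn hn') (W := Y.toAddMonoidHom.range)
    (fun m => ⟨m, hYapply m⟩) _ (QuotientGroup.mk'_surjective _) hk
  exact E.vn_of_nilpotent Y.toAddMonoidHom hYc (k := d + 1) (fun m => by
    rw [← hYnil m, Module.End.pow_apply]
    rfl) _ hk hvn

end AbExt

theorem abelianByTowerVN (m : ℕ) : AbelianByTowerVN.{u} m := by
  induction m with
  | zero =>
    intro G P _ _ _ f hf hP hc _
    have : Finite P := hP
    have : f.ker.FiniteIndex := inferInstance
    refine ⟨f.ker, inferInstance, ?_⟩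
    let _ : CommGroup f.ker := { (inferInstance : Group f.ker) with
      mul_comm := fun a b => Subtype.ext (hc a a.2 b b.2) }
    exact CommGroup.isNilpotent
  | succ m ih =>
    intro G P _ _ _ f hf hP hc hno
    obtain ⟨H, K, _, q, w, hH, hq, hw, hker, hK⟩ := hP
    have hfi := finiteIndex_comap f H
    have hfg : Group.FG (H.comap f) := inferInstance
    have hfH : Function.Surjective (f.subgroupComap H) := by
      rintro ⟨p, hp⟩
      obtain ⟨g, rfl⟩ := hf p
      exact ⟨⟨g, hp⟩, rfl⟩
    obtain ⟨M, _, E, -⟩ := AbExt.exists_of_comm (f.subgroupComap H) hfH (fun a ha b hb =>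
      Subtype.ext (hc a (congrArg Subtype.val ha) b (congrArg Subtype.val hb)))
    exact VN.of_finiteIndex (H.comap f)
      (E.vn_of_centralStep ih ⟨hw, K, _, q, hq, hker, hK⟩ (hno.subgroup _))

end AbelianStepFinal

theorem vn_of_derivedSeries_eq_bot (n : ℕ) (G : Type u) [Group G] [Group.FG G] (hno : NoAff G)
    (h : derivedSeries G n = ⊥) : VN G := by
  induction n generalizing G with
  | zero =>
    have : Subsingleton G := subsingleton_iff_bot_eq_top.1 (by simpa using h.symm) |>
      fun h => (Subgroup.subsingleton_iff).1 h
    exact VN.of_finite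
  | succ n ih =>
    let f := QuotientGroup.mk' (derivedSeries G n)
    have hf : Function.Surjective f := QuotientGroup.mk'_surjective _
    have hker : f.ker = derivedSeries G n := QuotientGroup.ker_mk' _
    have : Group.FG (G ⧸ derivedSeries G n) := Group.fg_of_surjective hf
    have hbot : derivedSeries (G ⧸ derivedSeries G n) n = ⊥ := by
      rw [← map_derivedSeries_eq hf, Subgroup.map_eq_bot_iff, hker]
    obtain ⟨m, hm⟩ := (ih _ (hno.of_surjective f hf) hbot).exists_centralTower
    refine abelianByTowerVN m G _ f hf hm ?_ hno
    rw [hker]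
    intro a ha b hb
    refine commutatorElement_eq_one_iff_mul_comm.1 ((Subgroup.mem_bot).1 ?_)
    rw [← h, derivedSeries_succ]
    exact Subgroup.commutator_mem_commutator ha hb

theorem vn_of_virtually_solvable {G : Type u} [Group G] [Group.FG G] (hno : NoAff G)
    (h : ∃ H : Subgroup G, H.FiniteIndex ∧ Group.IsSolvable H) : VN G := by
  obtain ⟨H, _, ⟨n, hn⟩⟩ := h
  exact VN.of_finiteIndex H (vn_of_derivedSeries_eq_bot n H (hno.subgroup H) hn)

theorem solvable_finite_dim_HFk_implies_virtually_nilpotent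
    {G : Type*} [Group G]
    (S : Finset G) (hSgen : Subgroup.closure (S : Set G) = ⊤)
    (hSsym : ∀ s ∈ S, s⁻¹ ∈ S)
    (hsolv : ∃ H : Subgroup G, H.FiniteIndex ∧ IsSolvable ↥H)
    (μ : G → ℝ) (hnonneg : ∀ x, 0 ≤ μ x) (hprob : HasSum μ 1)
    (hsym : ∀ x : G, μ x⁻¹ = μ x)
    (hadapted : Subgroup.closure {x : G | μ x ≠ 0} = ⊤)
    (hsmooth : ∃ ζ : ℝ, 0 < ζ ∧
      Summable (fun x : G => μ x * Real.exp (ζ * (wordLen (S : Set G) x))))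
    (k : ℕ) (hk : 1 ≤ k)
    (hfin : ∃ W : Submodule ℂ (G → ℂ), FiniteDimensional ℂ W ∧
      HFk (S : Set G) μ k ⊆ (W : Set (G → ℂ))) :
    ∃ H : Subgroup G, H.FiniteIndex ∧ Group.IsNilpotent ↥H := by
  obtain ⟨W, _, hW⟩ := hfin
  have : Group.FG G := Group.fg_iff.2 ⟨S, hSgen, S.finite_toSet⟩
  have hμ : Courteous S μ := ⟨hSgen, hSsym, hnonneg, hprob, hsym, hadapted, hsmooth⟩
  exact vn_of_virtually_solvable (hμ.noAff hk hW) hsolv
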